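/- Let p ∈ (0,1) and ε > 0 be fixed and m = ⌊N·p⌋. Let a = a(n) be an integer sequence with a = α_0(n) − O(1) and μ_a ≥ n^{1+ε}, and suppose additionally μ_a ≫ n^2/ln^2 n. Suppose k = k(n) is a tame a-bounded sequence of complete colouring profiles with ln E_m[X̄_k] ≫ ln n, and that for every fixed δ > 0, for all sufficiently large n and all colouring profiles λ ≤ κ with δ ≤ Σ_{1≤u≤a} λ_u ≤ 1−δ (writing ℓ_u = n·λ_u/u), one has E_p[X̄_λ] ≥ exp(ln^6 n) · Π_{1≤u≤a} C(k_u, ℓ_u)^2. Then with high probability G_{n,m} has a proper colouring with profile k. -/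

import Mathlib

open Filter
open scoped BigOperators Classical

noncomputable section

/-- The number of edges of a simple graph on `Fin n`. -/
def edgeCount {n : ℕ} (G : SimpleGraph (Fin n)) : ℕ := Nat.card G.edgeSet

/-- Probability of a graph property under the uniform random graph `G(n,m)`. -/
def Pm (n m : ℕ) (E : SimpleGraph (Fin n) → Prop) : ℝ :=
  (Nat.card {G : SimpleGraph (Fin n) // edgeCount G = m ∧ E G} : ℝ) /
    (Nat.card {G : SimpleGraph (Fin n) // edgeCount G = m} : ℝ)

/-- Expectation of a real functional under the uniform random graph `G(n,m)`. -/
def Em (n m : ℕ) (X : SimpleGraph (Fin n) → ℝ) : ℝ :=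
  (∑ᶠ G : {G : SimpleGraph (Fin n) // edgeCount G = m}, X G.1) /
    (Nat.card {G : SimpleGraph (Fin n) // edgeCount G = m} : ℝ)

/-- Probability of a graph property under the binomial random graph `G(n,p)`. -/
def Pp (n : ℕ) (p : ℝ) (E : SimpleGraph (Fin n) → Prop) : ℝ :=
  ∑ᶠ G : SimpleGraph (Fin n),
    (if E G then (1 : ℝ) else 0) * p ^ edgeCount G * (1 - p) ^ (n.choose 2 - edgeCount G)

/-- Expectation of a real functional under the binomial random graph `G(n,p)`. -/
def Ep (n : ℕ) (p : ℝ) (X : SimpleGraph (Fin n) → ℝ) : ℝ :=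
  ∑ᶠ G : SimpleGraph (Fin n),
    X G * p ^ edgeCount G * (1 - p) ^ (n.choose 2 - edgeCount G)

/-- `α₀(n) = 2 log_b n − 2 log_b log_b n + 2 log_b (e/2) + 1`. -/
def alpha0 (b : ℝ) (n : ℕ) : ℝ :=
  2 * Real.logb b n - 2 * Real.logb b (Real.logb b n) + 2 * Real.logb b (Real.exp 1 / 2) + 1

/-- `α(n) = ⌊α₀(n)⌋`. -/
def alphaNat (b : ℝ) (n : ℕ) : ℕ := ⌊alpha0 b n⌋₊

/-- `μ_t = C(n,t) q^{C(t,2)}`, the expected number of independent `t`-sets. -/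
def muExp (q : ℝ) (n t : ℕ) : ℝ := (n.choose t : ℝ) * q ^ t.choose 2

/-- A finset of vertices is independent in `G`. -/
def IndepFinset {n : ℕ} (G : SimpleGraph (Fin n)) (s : Finset (Fin n)) : Prop :=
  ∀ v ∈ s, ∀ w ∈ s, ¬ G.Adj v w

/-- `G` has a proper colouring with `k` colours, all colour classes of size at most `t`. -/
def HasBoundedColouring {n : ℕ} (G : SimpleGraph (Fin n)) (t k : ℕ) : Prop :=
  ∃ C : Fin n → Fin k, (∀ v w, G.Adj v w → C v ≠ C w) ∧
    ∀ c : Fin k, (Finset.univ.filter fun v => C v = c).card ≤ t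

/-- The `t`-bounded chromatic number `χ_t(G)`. -/
def chiBounded {n : ℕ} (G : SimpleGraph (Fin n)) (t : ℕ) : ℕ :=
  sInf {k | HasBoundedColouring G t k}

/-- `G` has an equitable proper colouring with `k` colours. -/
def HasEquitableColouring {n : ℕ} (G : SimpleGraph (Fin n)) (k : ℕ) : Prop :=
  ∃ C : Fin n → Fin k, (∀ v w, G.Adj v w → C v ≠ C w) ∧
    ∀ c c' : Fin k,
      (Finset.univ.filter fun v => C v = c).card ≤
        (Finset.univ.filter fun v => C v = c').card + 1

/-- The equitable chromatic number `χ₌(G)`. -/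
def chiEquitable {n : ℕ} (G : SimpleGraph (Fin n)) : ℕ :=
  sInf {k | HasEquitableColouring G k}

/-- The number of unordered `t`-bounded proper `k`-colourings of `G`, i.e. partitions of the
vertex set into exactly `k` nonempty independent sets, each of size at most `t`. -/
def numUnorderedColourings (n t k : ℕ) (G : SimpleGraph (Fin n)) : ℕ :=
  Set.ncard {Q : Finset (Finset (Fin n)) | Q.card = k ∧
    (∀ s ∈ Q, s.Nonempty ∧ s.card ≤ t ∧ IndepFinset G s) ∧
    (∀ v : Fin n, ∃ s ∈ Q, v ∈ s) ∧
    ∀ s ∈ Q, ∀ s' ∈ Q, s ≠ s' → Disjoint s s'}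

/-- `E_{n,k,t}`: the expected number of unordered `t`-bounded `k`-colourings of `G_{n,1/2}`. -/
def Enkt (n k t : ℕ) : ℝ := Ep n (1/2) fun G => (numUnorderedColourings n t k G : ℝ)

/-- The `t`-bounded first moment threshold `k_t(n)`. -/
def fmThreshold (n t : ℕ) : ℕ := sInf {k | 1 ≤ Enkt n k t}

/-- `P` is a (possibly partial) `k`-colouring profile on `n` vertices. -/
def IsProfile (n k : ℕ) (P : ℕ → ℕ) : Prop :=
  (∀ u, u ∉ Finset.Icc 1 n → P u = 0) ∧
    (∑ u ∈ Finset.Icc 1 n, P u = k) ∧ (∑ u ∈ Finset.Icc 1 n, u * P u ≤ n)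

/-- A colouring profile is complete if its classes use all `n` vertices. -/
def IsCompleteProfile (n : ℕ) (P : ℕ → ℕ) : Prop :=
  ∑ u ∈ Finset.Icc 1 n, u * P u = n

/-- A colouring profile is `t`-bounded if it has no classes of size larger than `t`. -/
def IsBoundedProfile (t : ℕ) (P : ℕ → ℕ) : Prop := ∀ u, t < u → P u = 0

/-- The number of parts of a profile on `n` vertices. -/
def profileParts (n : ℕ) (P : ℕ → ℕ) : ℕ := ∑ u ∈ Finset.Icc 1 n, P u

/-- `X_k`: the number of ordered (partial) proper colourings of `G` with profile `P`:
ordered tuples of pairwise disjoint independent sets, decreasing in size, with exactly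
`P u` parts of size `u` for every `u`. -/
def Xprofile {n : ℕ} (G : SimpleGraph (Fin n)) (P : ℕ → ℕ) : ℕ :=
  Set.ncard {V : Fin (profileParts n P) → Finset (Fin n) |
    (∀ i j, i ≠ j → Disjoint (V i) (V j)) ∧
    (∀ i j, i ≤ j → (V j).card ≤ (V i).card) ∧
    (∀ u : ℕ, (Finset.univ.filter fun i => (V i).card = u).card = P u) ∧
    ∀ i, IndepFinset G (V i)}

/-- `X̄_k = X_k / ∏_u k_u!`: the number of unordered colourings with profile `P`. -/
def Xbar {n : ℕ} (G : SimpleGraph (Fin n)) (P : ℕ → ℕ) : ℝ :=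
  (Xprofile G P : ℝ) / ∏ u ∈ Finset.Icc 1 n, ((P u).factorial : ℝ)

/-- `κ = Σ_u κ_u` where `κ_u = u k_u / n`. -/
def kappaTot (n : ℕ) (P : ℕ → ℕ) : ℝ := ∑ u ∈ Finset.Icc 1 n, (u : ℝ) * P u / n

/-- `m = ⌊p N⌋` with `N = C(n,2)`. -/
def mFloor (p : ℝ) (n : ℕ) : ℕ := ⌊p * (n.choose 2 : ℝ)⌋₊

/-- Definition 2.2: a sequence `P` of complete `a`-bounded colouring profiles is tame. -/
def IsTame (p : ℝ) (a : ℕ → ℕ) (P : ℕ → ℕ → ℕ) : Prop :=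
  (∃ C : ℝ, ∀ᶠ n in atTop, alpha0 (1/(1-p)) n - C ≤ (a n : ℝ)) ∧
  (∀ᶠ n in atTop, a n ≤ alphaNat (1/(1-p)) n) ∧
  (∀ n, IsProfile n (profileParts n (P n)) (P n) ∧ IsCompleteProfile n (P n) ∧
      IsBoundedProfile (a n) (P n)) ∧
  ∃ c : ℝ, c ∈ Set.Ioo (0:ℝ) 1 ∧ ∃ γ : ℕ → ℝ, Monotone γ ∧ Tendsto γ atTop atTop ∧
    (∀ᶠ n in atTop, ∀ u, 1 ≤ u → u ≤ a n →
      (u : ℝ) * P n u / n <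
        (1/(1-p)) ^ (-(((alphaNat (1/(1-p)) n - u : ℕ) : ℝ) *
          γ (alphaNat (1/(1-p)) n - u)))) ∧
    ∀ ε : ℝ, 0 < ε → ∀ᶠ n : ℕ in atTop,
      Real.exp (-ε * (n : ℝ) ^ ((1:ℝ) - c)) ≤ Em n (mFloor p n) fun G => Xbar G (P n)

/-- The function `φ(κ)` from Lemma 3.3. -/
def phiProfile (p : ℝ) (n : ℕ) (P : ℕ → ℕ) : ℝ :=
  -(1 - kappaTot n P) * Real.log (1 - kappaTot n P) +
    Real.log (1/(1-p)) / 2 * ∑ u ∈ Finset.Icc 1 n,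
      ((u : ℝ) * P u / n) * (alpha0 (1/(1-p)) n - 1 - 2 / Real.log (1/(1-p)) - (u : ℝ))

/-- The function `φ̃_δ(x)` from Lemma 3.5. -/
def phiTilde (p δ x : ℝ) : ℝ :=
  -(1 - x) * Real.log (1 - x) - (1 - Real.log (1/(1-p)) / 2 * δ) * x

/-- `d_u = 2^{C(u,2)} u!`. -/
def dcoef (u : ℕ) : ℝ := 2 ^ u.choose 2 * (u.factorial : ℝ)

/-- `L_0(n,k,t)`: the supremum of `L_k` over real-valued `t`-bounded complete profiles. -/
def L0 (n k t : ℕ) : ℝ :=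
  sSup {y : ℝ | ∃ f : ℕ → ℝ, (∀ u ∈ Finset.Icc 1 t, 0 ≤ f u) ∧
    (∑ u ∈ Finset.Icc 1 t, f u = (k : ℝ)) ∧ (∑ u ∈ Finset.Icc 1 t, (u : ℝ) * f u = (n : ℝ)) ∧
    y = (n : ℝ) * Real.log n - (n : ℝ) + (k : ℝ) -
      ∑ u ∈ Finset.Icc 1 t, f u * Real.log (f u * dcoef u)}

/-- Membership in `P_{n,k,t}`: a `t`-bounded complete `k`-colouring profile on `n` vertices. -/
def IsKTProfile (n k t : ℕ) (P : ℕ → ℕ) : Prop :=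
  (∀ u, u ∉ Finset.Icc 1 t → P u = 0) ∧
    (∑ u ∈ Finset.Icc 1 t, P u = k) ∧ (∑ u ∈ Finset.Icc 1 t, u * P u = n)

/-- `E_{n,k,t}` written as the sum over profiles of `E_{1/2}[X̄_k]`. -/
def EnktSum (n k t : ℕ) : ℝ :=
  ∑ᶠ P : ℕ → ℕ, if IsKTProfile n k t P then Ep n (1/2) fun G => Xbar G P else 0

section PartA

namespace TC
open Finset

variable {n k m : ℕ}

/-- colour classes -/
def fib (c : Fin n → Fin k) (i : Fin k) : Finset (Fin n) := univ.filter (fun x => c x = i)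

lemma mem_fib {c : Fin n → Fin k} {i : Fin k} {x : Fin n} : x ∈ fib c i ↔ c x = i := by
  simp [fib]

/-- pairs inside a vertex set -/
def prs (V : Finset (Fin n)) : Finset (Sym2 (Fin n)) := V.offDiag.image (fun p => s(p.1, p.2))

lemma mem_prs {V : Finset (Fin n)} {x y : Fin n} : s(x, y) ∈ prs V ↔ x ∈ V ∧ y ∈ V ∧ x ≠ y := by
  simp only [prs, mem_image, mem_offDiag, Prod.exists, Sym2.eq_iff]
  constructor
  · rintro ⟨a, b, h, (⟨rfl, rfl⟩ | ⟨rfl, rfl⟩)⟩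
    · exact h
    · exact ⟨h.2.1, h.1, h.2.2.symm⟩
  · intro h
    exact ⟨x, y, h, Or.inl ⟨rfl, rfl⟩⟩

lemma card_prs (V : Finset (Fin n)) : (prs V).card = V.card.choose 2 :=
  Sym2.card_image_offDiag V

def allE (n : ℕ) : Finset (Sym2 (Fin n)) := prs univ

lemma mem_allE {x y : Fin n} : s(x, y) ∈ allE n ↔ x ≠ y := by simp [allE, mem_prs]

lemma card_allE : (allE n).card = n.choose 2 := by simp [allE, card_prs]

lemma prs_mono {V W : Finset (Fin n)} (h : V ⊆ W) : prs V ⊆ prs W := by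
  intro e
  induction e with
  | _ x y => simp only [mem_prs]; exact fun hh => ⟨h hh.1, h hh.2.1, hh.2.2⟩

lemma prs_subset_allE (V : Finset (Fin n)) : prs V ⊆ allE n := prs_mono (subset_univ _)

lemma prs_inter (V W : Finset (Fin n)) : prs V ∩ prs W = prs (V ∩ W) := by
  ext e
  induction e with
  | _ x y => simp only [mem_inter, mem_prs]; tauto

def mono (c : Fin n → Fin k) : Finset (Sym2 (Fin n)) := univ.biUnion fun i => prs (fib c i)

lemma mem_mono {c : Fin n → Fin k} {x y : Fin n} : s(x, y) ∈ mono c ↔ c x = c y ∧ x ≠ y := by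
  simp only [mono, mem_biUnion, mem_univ, true_and, mem_prs, mem_fib]
  constructor
  · rintro ⟨i, h1, h2, h3⟩; exact ⟨h1.trans h2.symm, h3⟩
  · rintro ⟨h1, h2⟩; exact ⟨c y, h1, rfl, h2⟩

lemma mono_subset (c : Fin n → Fin k) : mono c ⊆ allE n :=
  biUnion_subset.2 fun _ _ => prs_subset_allE _

lemma fib_disj (c : Fin n → Fin k) {i j : Fin k} (h : i ≠ j) : Disjoint (fib c i) (fib c j) := by
  rw [Finset.disjoint_left]
  intro x hx hy
  rw [mem_fib] at hx hy
  exact h (hx.symm.trans hy)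

lemma prs_disj {V W : Finset (Fin n)} (h : Disjoint V W) : Disjoint (prs V) (prs W) := by
  rw [Finset.disjoint_left]
  intro e
  induction e with
  | _ x y =>
    simp only [mem_prs]
    intro h1 h2
    exact (Finset.disjoint_left.1 h) h1.1 h2.1

lemma card_mono (c : Fin n → Fin k) : (mono c).card = ∑ i, ((fib c i).card).choose 2 := by
  rw [mono, card_biUnion]
  · simp [card_prs]
  · intro i _ j _ hij
    exact prs_disj (fib_disj c hij)

/-- overlap number of two colourings. -/
def ov (c c' : Fin n → Fin k) : ℕ := ∑ i, ∑ j, ((fib c i ∩ fib c' j).card).choose 2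

lemma card_mono_inter (c c' : Fin n → Fin k) : (mono c ∩ mono c').card = ov c c' := by
  have h : mono c ∩ mono c' = univ.biUnion fun i => univ.biUnion fun j =>
      prs (fib c i ∩ fib c' j) := by
    ext e
    induction e with
    | _ x y =>
      simp only [mem_inter, mem_mono, mem_biUnion, mem_univ, true_and, mem_prs, mem_fib]
      constructor
      · rintro ⟨⟨h1, h2⟩, h3, _⟩
        exact ⟨c y, c' y, ⟨h1, h3⟩, ⟨rfl, rfl⟩, h2⟩
      · rintro ⟨i, j, ⟨h1, h2⟩, ⟨h3, h4⟩, h5⟩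
        exact ⟨⟨h1.trans h3.symm, h5⟩, h2.trans h4.symm, h5⟩
  rw [h, card_biUnion, ov]
  · refine sum_congr rfl fun i _ => ?_
    rw [card_biUnion]
    · simp [card_prs]
    · intro j _ j' _ hj
      exact prs_disj ((fib_disj c' hj).mono inter_subset_right inter_subset_right)
  · intro i _ i' _ hi
    simp only [Function.onFun]
    rw [Finset.disjoint_biUnion_left]
    intro j _
    rw [Finset.disjoint_biUnion_right]
    intro j' _
    exact prs_disj ((fib_disj c hi).mono inter_subset_left inter_subset_left)

lemma card_mono_union (c c' : Fin n → Fin k) :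
    (mono c ∪ mono c').card + ov c c' = (mono c).card + (mono c').card := by
  rw [← card_mono_inter, card_union_add_card_inter]

def Om (n m : ℕ) : Finset (Finset (Sym2 (Fin n))) := (allE n).powersetCard m

lemma card_Om : (Om n m).card = (n.choose 2).choose m := by
  simp [Om, card_powersetCard, card_allE]

lemma card_avoid {D : Finset (Sym2 (Fin n))} (hD : D ⊆ allE n) :
    ((Om n m).filter fun ω => Disjoint ω D).card = (n.choose 2 - D.card).choose m := by
  have : ((Om n m).filter fun ω => Disjoint ω D) = (allE n \ D).powersetCard m := by
    ext ω
    simp only [Om, mem_filter, mem_powersetCard]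
    constructor
    · rintro ⟨⟨h1, h2⟩, h3⟩
      exact ⟨fun e he => mem_sdiff.2 ⟨h1 he, fun h => (Finset.disjoint_left.1 h3) he h⟩, h2⟩
    · rintro ⟨h1, h2⟩
      exact ⟨⟨fun e he => (mem_sdiff.1 (h1 he)).1, h2⟩,
        Finset.disjoint_left.2 fun e he h => (mem_sdiff.1 (h1 he)).2 h⟩
  rw [this, card_powersetCard, card_sdiff_of_subset hD, card_allE]

/-! transfer -/

def toG (ω : Finset (Sym2 (Fin n))) : SimpleGraph (Fin n) := SimpleGraph.fromEdgeSet (ω : Set _)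

lemma toG_adj {ω : Finset (Sym2 (Fin n))} (x y : Fin n) :
    (toG ω).Adj x y ↔ s(x, y) ∈ ω ∧ x ≠ y := by simp [toG]

/-- graphs correspond to subsets of `allE`. -/
def gEquiv (n : ℕ) : SimpleGraph (Fin n) ≃ (allE n).powerset where
  toFun G := ⟨G.edgeFinset, by
    rw [mem_powerset]
    intro e
    induction e with
    | _ x y =>
      intro h
      rw [mem_allE]
      exact SimpleGraph.Adj.ne (G := G) (by simpa using h)⟩
  invFun ω := toG ω.1
  left_inv G := by
    ext x y
    simp only [toG_adj, SimpleGraph.mem_edgeFinset, SimpleGraph.mem_edgeSet]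
    exact ⟨fun h => h.1, fun h => ⟨h, h.ne⟩⟩
  right_inv ω := by
    apply Subtype.ext
    ext e
    have := mem_powerset.1 ω.2
    induction e with
    | _ x y =>
      simp only [SimpleGraph.mem_edgeFinset, SimpleGraph.mem_edgeSet, toG_adj]
      exact ⟨fun h => h.1, fun h => ⟨h, mem_allE.1 (this h)⟩⟩

lemma edgeCount_eq (G : SimpleGraph (Fin n)) : edgeCount G = (gEquiv n G).1.card := by
  have : (gEquiv n G).1 = G.edgeFinset := rfl
  rw [this, edgeCount, Nat.card_eq_fintype_card, SimpleGraph.edgeFinset_card]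

lemma edgeCount_toG {ω : Finset (Sym2 (Fin n))} (h : ω ⊆ allE n) : edgeCount (toG ω) = ω.card := by
  have : toG ω = (gEquiv n).symm ⟨ω, mem_powerset.2 h⟩ := rfl
  rw [edgeCount_eq, this]; simp

lemma sum_graphs (F : SimpleGraph (Fin n) → ℝ) :
    ∑ G : SimpleGraph (Fin n), F G = ∑ ω ∈ (allE n).powerset, F (toG ω) := by
  have h1 := Finset.sum_coe_sort (allE n).powerset (fun ω => F (toG ω))
  rw [← h1]
  have h2 := (gEquiv n).symm.sum_comp F
  rw [← h2]
  rfl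

lemma sum_graphs_m (F : SimpleGraph (Fin n) → ℝ) :
    ∑ G : SimpleGraph (Fin n), (if edgeCount G = m then F G else 0) =
      ∑ ω ∈ Om n m, F (toG ω) := by
  rw [sum_graphs]
  have : Om n m = (allE n).powerset.filter fun ω => ω.card = m := by
    ext ω; simp [Om, mem_powersetCard]
  rw [this, sum_filter]
  refine sum_congr rfl fun ω hω => ?_
  rw [edgeCount_toG (mem_powerset.1 hω)]

lemma natCard_graphs (E : SimpleGraph (Fin n) → Prop) :
    (Nat.card {G : SimpleGraph (Fin n) // edgeCount G = m ∧ E G} : ℝ) =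
      (((Om n m).filter fun ω => E (toG ω)).card : ℝ) := by
  rw [Nat.card_eq_fintype_card, Fintype.card_subtype, card_filter, card_filter]
  push_cast
  rw [← sum_graphs_m (m := m) (fun G => if E G then (1:ℝ) else 0)]
  refine sum_congr rfl fun G _ => ?_
  by_cases h : edgeCount G = m <;> simp [h]

lemma natCard_graphs' :
    (Nat.card {G : SimpleGraph (Fin n) // edgeCount G = m} : ℝ) = ((n.choose 2).choose m : ℝ) := by
  have := natCard_graphs (n := n) (m := m) (fun _ => True)
  simp only [and_true] at this
  rw [this]
  simp [card_Om]

lemma Pm_eq (E : SimpleGraph (Fin n) → Prop) :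
    Pm n m E = (((Om n m).filter fun ω => E (toG ω)).card : ℝ) / ((n.choose 2).choose m : ℝ) := by
  rw [Pm, natCard_graphs, natCard_graphs']

lemma Em_eq (X : SimpleGraph (Fin n) → ℝ) :
    Em n m X = (∑ ω ∈ Om n m, X (toG ω)) / ((n.choose 2).choose m : ℝ) := by
  rw [Em, natCard_graphs', finsum_eq_sum_of_fintype]
  congr 1
  rw [← sum_graphs_m, ← sum_filter]
  exact (Finset.sum_subtype _ (by simp) _).symm

lemma Ep_eq (p : ℝ) (X : SimpleGraph (Fin n) → ℝ) :
    Ep n p X = ∑ ω ∈ (allE n).powerset,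
      X (toG ω) * (p ^ ω.card * (1 - p) ^ (n.choose 2 - ω.card)) := by
  rw [Ep, finsum_eq_sum_of_fintype, sum_graphs]
  refine sum_congr rfl fun ω hω => ?_
  rw [edgeCount_toG (mem_powerset.1 hω), mul_assoc]

lemma Ep_avoid (p : ℝ) {D : Finset (Sym2 (Fin n))} (hD : D ⊆ allE n) :
    ∑ ω ∈ (allE n).powerset, (if Disjoint ω D then (1:ℝ) else 0) *
      (p ^ ω.card * (1 - p) ^ (n.choose 2 - ω.card)) = (1 - p) ^ D.card := by
  have h1 : ∑ ω ∈ (allE n).powerset, (if Disjoint ω D then (1:ℝ) else 0) *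
      (p ^ ω.card * (1 - p) ^ (n.choose 2 - ω.card)) =
      ∑ ω ∈ (allE n \ D).powerset, (p ^ ω.card * (1 - p) ^ (n.choose 2 - ω.card)) := by
    have : (allE n \ D).powerset = (allE n).powerset.filter fun ω => Disjoint ω D := by
      ext ω; simp [subset_sdiff]
    rw [this, sum_filter]
    refine sum_congr rfl fun ω _ => ?_
    split_ifs <;> simp
  rw [h1]
  have h2 := Finset.sum_pow_mul_eq_add_pow p (1 - p) (allE n \ D)
  have h3 : (allE n \ D).card = n.choose 2 - D.card := by
    rw [card_sdiff_of_subset hD, card_allE]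
  have h4 : D.card ≤ n.choose 2 := by rw [← card_allE]; exact card_le_card hD
  have h5 : ∀ ω ∈ (allE n \ D).powerset, (p ^ ω.card * (1 - p) ^ (n.choose 2 - ω.card)) =
      (p ^ ω.card * (1 - p) ^ ((allE n \ D).card - ω.card)) * (1 - p) ^ D.card := by
    intro ω hω
    have : ω.card ≤ (allE n \ D).card := card_le_card (mem_powerset.1 hω)
    rw [mul_assoc, ← pow_add]
    congr 2
    omega
  rw [sum_congr rfl h5, ← sum_mul, h2]
  simp

end TC

end PartA

section PartB

namespace TC
open Finset

variable {n k m : ℕ}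

/-- tuples of disjoint sets with prescribed sizes -/
def tup (ℓ : ℕ) (w : Fin ℓ → ℕ) (A : Finset (Fin n)) : Finset (Fin ℓ → Finset (Fin n)) :=
  univ.filter fun V => (∀ i j, i ≠ j → Disjoint (V i) (V j)) ∧ (∀ i, V i ⊆ A) ∧
    ∀ i, (V i).card = w i

lemma card_tup : ∀ (ℓ : ℕ) (w : Fin ℓ → ℕ) (A : Finset (Fin n)),
    (tup ℓ w A).card * ((∏ i, (w i).factorial) * (A.card - ∑ i, w i).factorial) ≤
      A.card.factorial := by
  intro ℓ
  induction ℓ with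
  | zero =>
    intro w A
    have : (tup 0 w A).card ≤ 1 := by
      refine (card_le_univ _).trans ?_
      simp
    simpa using Nat.mul_le_mul_right A.card.factorial this
  | succ ℓ ih =>
    intro w A
    have h1 : (tup (ℓ+1) w A).card ≤
        ∑ S ∈ A.powersetCard (w 0), (tup ℓ (fun i => w i.succ) (A \ S)).card := by
      rw [← card_sigma]
      refine card_le_card_of_injOn (fun V => ⟨V 0, fun i => V i.succ⟩) ?_ ?_
      · intro V hV
        simp only [tup, coe_filter, mem_univ, true_and, Set.mem_ofPred_eq] at hV
        obtain ⟨h1, h2, h3⟩ := hV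
        simp only [coe_sigma, Set.mem_sigma_iff, mem_coe, mem_powersetCard, tup, mem_filter,
          mem_univ, true_and]
        refine ⟨⟨h2 0, h3 0⟩, fun i j hij => h1 _ _ (fun h => hij (Fin.succ_injective _ h)),
          fun i => ?_, fun i => h3 _⟩
        rw [subset_sdiff]
        exact ⟨h2 _, h1 _ _ (Fin.succ_ne_zero i)⟩
      · intro V _ V' _ h
        simp only [Sigma.mk.injEq, heq_eq_eq] at h
        funext i
        refine Fin.cases h.1 (fun j => congrFun h.2 j) i
    have h2 : ∀ S ∈ A.powersetCard (w 0), (tup ℓ (fun i => w i.succ) (A \ S)).card *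
        ((∏ i, (w i).factorial) * (A.card - ∑ i, w i).factorial) ≤
        (w 0).factorial * (A.card - w 0).factorial := by
      intro S hS
      rw [mem_powersetCard] at hS
      have := ih (fun i => w i.succ) (A \ S)
      rw [card_sdiff_of_subset hS.1, hS.2] at this
      rw [Fin.prod_univ_succ, Fin.sum_univ_succ]
      rw [Nat.sub_sub] at this
      calc _ = (w 0).factorial * ((tup ℓ (fun i => w i.succ) (A \ S)).card *
        ((∏ i : Fin ℓ, (w i.succ).factorial) * (A.card - (w 0 + ∑ i : Fin ℓ, w i.succ)).factorial)) := by
            ring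
        _ ≤ _ := Nat.mul_le_mul_left _ this
    calc _ ≤ (∑ S ∈ A.powersetCard (w 0), (tup ℓ (fun i => w i.succ) (A \ S)).card) *
        ((∏ i, (w i).factorial) * (A.card - ∑ i, w i).factorial) := Nat.mul_le_mul_right _ h1
      _ = ∑ S ∈ A.powersetCard (w 0), (tup ℓ (fun i => w i.succ) (A \ S)).card *
        ((∏ i, (w i).factorial) * (A.card - ∑ i, w i).factorial) := sum_mul _ _ _
      _ ≤ ∑ S ∈ A.powersetCard (w 0), (w 0).factorial * (A.card - w 0).factorial := sum_le_sum h2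
      _ = A.card.choose (w 0) * ((w 0).factorial * (A.card - w 0).factorial) := by
          rw [sum_const, card_powersetCard, smul_eq_mul]
      _ ≤ A.card.factorial := by
          by_cases h : w 0 ≤ A.card
          · rw [← mul_assoc, Nat.choose_mul_factorial_mul_factorial h]
          · rw [Nat.choose_eq_zero_of_lt (not_le.1 h)]; simp

/-- antitone functions with the same fibre counts agree -/
lemma antitone_unique {ℓ : ℕ} {v w : Fin ℓ → ℕ} (hv : Antitone v) (hw : Antitone w)
    (h : ∀ u, (univ.filter fun i => v i = u).card = (univ.filter fun i => w i = u).card) :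
    v = w := by
  have e : ∀ u, Nonempty ({i // v i = u} ≃ {i // w i = u}) := by
    intro u
    refine ⟨Fintype.equivOfCardEq ?_⟩
    rw [Fintype.card_subtype, Fintype.card_subtype, h u]
  let f : Fin ℓ ≃ Fin ℓ := Equiv.ofFiberEquiv (fun u => (e u).some)
  have hf : ∀ i, w (f i) = v i := fun i => Equiv.ofFiberEquiv_map (fun u => (e u).some) i
  have hv' : Monotone ((OrderDual.toDual ∘ w) ∘ f) := by
    intro i j hij
    simp only [Function.comp, hf]
    exact hv hij
  have hw' : Monotone ((OrderDual.toDual ∘ w) ∘ (Equiv.refl (Fin ℓ))) := fun i j hij => hw hij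
  have := Tuple.unique_monotone hv' hw'
  funext i
  have h2 := congrFun this i
  simp only [Function.comp, hf, Equiv.refl_apply] at h2
  exact h2

lemma exists_sizes (P : ℕ → ℕ) (hP : ∀ u, u ∉ Icc 1 n → P u = 0) :
    ∃ v : Fin (profileParts n P) → ℕ, Antitone v ∧
      ∀ u, (univ.filter fun i => v i = u).card = P u := by
  have hc : Fintype.card (Fin (profileParts n P)) = Fintype.card (Σ u : Icc 1 n, Fin (P u.1)) := by
    rw [Fintype.card_sigma, Fintype.card_fin]
    simp only [Fintype.card_fin, profileParts]
    exact (Finset.sum_coe_sort (Icc 1 n) P).symm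
  let e := Fintype.equivOfCardEq hc
  let w : Fin (profileParts n P) → ℕ := fun i => ((e i).1 : ℕ)
  let wd : Fin (profileParts n P) → ℕᵒᵈ := fun i => OrderDual.toDual (w i)
  have hw : ∀ u, (univ.filter fun i => w i = u).card = P u := by
    intro u
    have h1 : (univ.filter fun i => w i = u).card =
        (univ.filter fun x : (Σ u : Icc 1 n, Fin (P u.1)) => (x.1 : ℕ) = u).card := by
      refine card_bij (fun i _ => e i) ?_ ?_ ?_
      · intro i hi; simpa [w] using hi
      · intro i _ j _ h; exact e.injective h
      · intro x hx; exact ⟨e.symm x, by simpa [w] using hx, by simp⟩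
    rw [h1]
    by_cases hu : u ∈ Icc 1 n
    · have : (univ.filter fun x : (Σ u : Icc 1 n, Fin (P u.1)) => (x.1 : ℕ) = u) =
          univ.map ⟨fun j : Fin (P u) => (⟨⟨u, hu⟩, j⟩ : Σ u : Icc 1 n, Fin (P u.1)),
            fun a b h => by simpa using h⟩ := by
        ext ⟨⟨u', hu'⟩, j⟩
        simp only [mem_filter, mem_univ, true_and, Finset.mem_map, Function.Embedding.coeFn_mk]
        constructor
        · intro h
          change u' = u at h
          subst h
          exact ⟨j, rfl⟩
        · rintro ⟨a, ha⟩
          have := congrArg (fun x : (Σ u : Icc 1 n, Fin (P u.1)) => (x.1 : ℕ)) ha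
          exact this.symm
      rw [this]; simp
    · rw [hP u hu, card_eq_zero, filter_eq_empty_iff]
      intro x _ h
      exact hu (h ▸ x.1.2)
  refine ⟨w ∘ (Tuple.sort wd), ?_, ?_⟩
  · intro i j hij
    exact Tuple.monotone_sort wd hij
  · intro u
    rw [← hw u]
    refine card_bij (fun i _ => Tuple.sort wd i) ?_ ?_ ?_
    · intro i hi; simpa using hi
    · intro i _ j _ h; exact (Tuple.sort wd).injective h
    · intro x hx; exact ⟨(Tuple.sort wd).symm x, by simpa using hx, by simp⟩

/-- the tuple set in the definition of `Xprofile`, for edge sets -/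
lemma Xprofile_le {P : ℕ → ℕ} (v : Fin (profileParts n P) → ℕ) (hv : Antitone v)
    (hvP : ∀ u, (univ.filter fun i => v i = u).card = P u) (ω : Finset (Sym2 (Fin n))) :
    (Xprofile (toG ω) P : ℝ) ≤ ∑ V ∈ tup (profileParts n P) v univ,
      if Disjoint ω (univ.biUnion fun i => prs (V i)) then (1:ℝ) else 0 := by
  rw [Xprofile, ← sum_filter, sum_const, nsmul_eq_mul, mul_one]
  norm_cast
  rw [← Set.ncard_coe_finset]
  refine Set.ncard_le_ncard ?_ (Finset.finite_toSet _)
  intro V hV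
  obtain ⟨h1, h2, h3, h4⟩ := hV
  have h5 : (fun i => (V i).card) = v :=
    antitone_unique (fun i j h => h2 i j h) hv (fun u => by rw [h3, hvP])
  rw [mem_coe, mem_filter, tup, mem_filter]
  refine ⟨⟨mem_univ _, h1, fun i => subset_univ _, fun i => congrFun h5 i⟩, ?_⟩
  rw [Finset.disjoint_left]
  intro e he hd
  simp only [mem_biUnion, mem_univ, true_and] at hd
  obtain ⟨i, hi⟩ := hd
  induction e with
  | _ x y =>
    rw [mem_prs] at hi
    exact h4 i x hi.1 y hi.2.1 ((toG_adj x y).2 ⟨he, hi.2.2⟩)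

lemma card_tupD {ℓ : ℕ} {w : Fin ℓ → ℕ} {A : Finset (Fin n)} {V : Fin ℓ → Finset (Fin n)}
    (hV : V ∈ tup ℓ w A) : (univ.biUnion fun i => prs (V i)).card = ∑ i, (w i).choose 2 := by
  rw [tup, mem_filter] at hV
  obtain ⟨_, h1, _, h3⟩ := hV
  rw [card_biUnion]
  · simp [card_prs, h3]
  · intro i _ j _ hij
    exact prs_disj (h1 i j hij)

lemma tupD_sub {ℓ : ℕ} (V : Fin ℓ → Finset (Fin n)) :
    (univ.biUnion fun i => prs (V i)) ⊆ allE n :=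
  biUnion_subset.2 fun _ _ => prs_subset_allE _

lemma card_tup_real (ℓ : ℕ) (w : Fin ℓ → ℕ) : ((tup ℓ w (univ : Finset (Fin n))).card : ℝ) ≤
    (n.factorial : ℝ) / ((∏ i, ((w i).factorial : ℝ)) * ((n - ∑ i, w i).factorial : ℝ)) := by
  rw [le_div_iff₀ (by positivity)]
  have := card_tup ℓ w (univ : Finset (Fin n))
  rw [card_univ, Fintype.card_fin] at this
  exact_mod_cast this

lemma Em_le {P : ℕ → ℕ} (v : Fin (profileParts n P) → ℕ) (hv : Antitone v)
    (hvP : ∀ u, (univ.filter fun i => v i = u).card = P u) :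
    Em n m (fun G => Xbar G P) ≤
      (n.factorial : ℝ) / ((∏ i, ((v i).factorial : ℝ)) * ((n - ∑ i, v i).factorial : ℝ)) *
      ((n.choose 2 - ∑ i, (v i).choose 2).choose m : ℝ) / ((n.choose 2).choose m : ℝ) /
        ∏ u ∈ Icc 1 n, ((P u).factorial : ℝ) := by
  rw [Em_eq]
  simp only [Xbar]
  rw [← sum_div, div_div, div_div, mul_comm (∏ u ∈ Icc 1 n, ((P u).factorial : ℝ))]
  refine div_le_div_of_nonneg_right ?_ (by positivity)
  calc ∑ ω ∈ Om n m, (Xprofile (toG ω) P : ℝ)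
      ≤ ∑ ω ∈ Om n m, ∑ V ∈ tup (profileParts n P) v univ,
      (if Disjoint ω (univ.biUnion fun i => prs (V i)) then (1:ℝ) else 0) :=
        sum_le_sum fun ω _ => Xprofile_le v hv hvP ω
    _ = ∑ V ∈ tup (profileParts n P) v univ, ∑ ω ∈ Om n m,
      (if Disjoint ω (univ.biUnion fun i => prs (V i)) then (1:ℝ) else 0) := sum_comm
    _ = ∑ V ∈ tup (profileParts n P) v univ,
      ((n.choose 2 - ∑ i, (v i).choose 2).choose m : ℝ) := by
        refine sum_congr rfl fun V hV => ?_
        rw [← sum_filter, sum_const, nsmul_eq_mul, mul_one, card_avoid (tupD_sub V), card_tupD hV]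
    _ ≤ _ := by
        rw [sum_const, nsmul_eq_mul]
        exact mul_le_mul_of_nonneg_right (card_tup_real _ _) (by positivity)

lemma Ep_le {p : ℝ} (hp0 : 0 ≤ p) (hp1 : p ≤ 1) {P : ℕ → ℕ} (v : Fin (profileParts n P) → ℕ)
    (hv : Antitone v) (hvP : ∀ u, (univ.filter fun i => v i = u).card = P u) :
    Ep n p (fun G => Xbar G P) ≤
      (n.factorial : ℝ) / ((∏ i, ((v i).factorial : ℝ)) * ((n - ∑ i, v i).factorial : ℝ)) *
      (1 - p) ^ (∑ i, (v i).choose 2) / ∏ u ∈ Icc 1 n, ((P u).factorial : ℝ) := by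
  have hq : 0 ≤ 1 - p := by linarith
  rw [Ep_eq]
  simp only [Xbar, div_mul_eq_mul_div]
  rw [← sum_div]
  refine div_le_div_of_nonneg_right ?_ (by positivity)
  rw [← div_mul_eq_mul_div]
  calc ∑ ω ∈ (allE n).powerset, (Xprofile (toG ω) P : ℝ) *
        (p ^ ω.card * (1 - p) ^ (n.choose 2 - ω.card))
      ≤ ∑ ω ∈ (allE n).powerset, (∑ V ∈ tup (profileParts n P) v univ,
      (if Disjoint ω (univ.biUnion fun i => prs (V i)) then (1:ℝ) else 0)) *
        (p ^ ω.card * (1 - p) ^ (n.choose 2 - ω.card)) :=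
        sum_le_sum fun ω _ => mul_le_mul_of_nonneg_right (Xprofile_le v hv hvP ω) (by positivity)
    _ = ∑ V ∈ tup (profileParts n P) v univ, ∑ ω ∈ (allE n).powerset,
      (if Disjoint ω (univ.biUnion fun i => prs (V i)) then (1:ℝ) else 0) *
        (p ^ ω.card * (1 - p) ^ (n.choose 2 - ω.card)) := by
        simp only [sum_mul]
        exact sum_comm
    _ = ∑ V ∈ tup (profileParts n P) v univ, (1 - p) ^ (∑ i, (v i).choose 2) := by
        refine sum_congr rfl fun V hV => ?_
        rw [Ep_avoid p (tupD_sub V), card_tupD hV]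
    _ ≤ _ := by
        rw [sum_const, nsmul_eq_mul]
        exact mul_le_mul_of_nonneg_right (card_tup_real _ _) (by positivity)

/-- product/sum over parts in terms of the profile -/
lemma sum_parts {P : ℕ → ℕ} (hP : ∀ u, u ∉ Icc 1 n → P u = 0) (v : Fin k → ℕ)
    (hvP : ∀ u, (univ.filter fun i => v i = u).card = P u) (F : ℕ → ℝ) :
    ∑ i, F (v i) = ∑ u ∈ Icc 1 n, (P u : ℝ) * F u := by
  have hmem : ∀ i, v i ∈ Icc 1 n := by
    intro i
    by_contra h
    have := hvP (v i)
    rw [hP _ h, card_eq_zero, filter_eq_empty_iff] at this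
    exact this (mem_univ i) rfl
  rw [← sum_fiberwise_of_maps_to (fun i _ => hmem i)]
  refine sum_congr rfl fun u _ => ?_
  rw [← hvP u, sum_congr rfl (g := fun _ => F u)]
  · rw [sum_const, nsmul_eq_mul]
  · intro i hi; rw [(mem_filter.1 hi).2]

lemma prod_parts {P : ℕ → ℕ} (hP : ∀ u, u ∉ Icc 1 n → P u = 0) (v : Fin k → ℕ)
    (hvP : ∀ u, (univ.filter fun i => v i = u).card = P u) (F : ℕ → ℝ) :
    ∏ i, F (v i) = ∏ u ∈ Icc 1 n, (F u) ^ (P u) := by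
  have hmem : ∀ i, v i ∈ Icc 1 n := by
    intro i
    by_contra h
    have := hvP (v i)
    rw [hP _ h, card_eq_zero, filter_eq_empty_iff] at this
    exact this (mem_univ i) rfl
  rw [← prod_fiberwise_of_maps_to (fun i _ => hmem i)]
  refine prod_congr rfl fun u _ => ?_
  rw [← hvP u, prod_congr rfl (g := fun _ => F u)]
  · rw [prod_const]
  · intro i hi; rw [(mem_filter.1 hi).2]

/-- a base colouring with prescribed class sizes -/
lemma exists_c0 (v : Fin k → ℕ) (hs : ∑ i, v i = n) :
    ∃ c0 : Fin n → Fin k, ∀ i, (fib c0 i).card = v i := by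
  have hc : Fintype.card (Fin n) = Fintype.card (Σ i : Fin k, Fin (v i)) := by
    rw [Fintype.card_sigma, Fintype.card_fin]
    simp [hs]
  let e := Fintype.equivOfCardEq hc
  refine ⟨fun x => (e x).1, fun i => ?_⟩
  rw [fib]
  have h1 : (univ.filter fun x => (e x).1 = i).card =
      (univ : Finset (Fin (v i))).card := by
    symm
    refine card_bij (fun j _ => e.symm ⟨i, j⟩) ?_ ?_ ?_
    · intro j _; simp
    · intro a _ b _ h
      have := e.symm.injective h
      simpa using this
    · intro x hx
      have h2 : (e x).1 = i := by simpa using hx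
      refine ⟨h2 ▸ (e x).2, mem_univ _, ?_⟩
      rw [Equiv.symm_apply_eq]
      subst h2
      rfl
  rw [h1]; simp

end TC

end PartB

section PartC

namespace TC
open Finset

variable {n k m : ℕ}

lemma perm_ext_card (S : Finset (Fin n)) (g : Fin n → Fin n) :
    (univ.filter fun τ : Equiv.Perm (Fin n) => ∀ x ∈ S, τ x = g x).card ≤
      (n - S.card).factorial := by
  by_cases hne : (univ.filter fun τ : Equiv.Perm (Fin n) => ∀ x ∈ S, τ x = g x).Nonempty
  · obtain ⟨τ0, h0⟩ := hne
    rw [mem_filter] at h0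
    have h1 : (univ.filter fun τ : Equiv.Perm (Fin n) => ∀ x ∈ S, τ x = g x).card ≤
        (univ.filter fun τ : Equiv.Perm (Fin n) => ∀ x, ¬ (x ∉ S) → τ x = x).card := by
      refine card_le_card_of_injOn (fun τ => τ0⁻¹ * τ) ?_ ?_
      · intro τ hτ
        simp only [coe_filter, mem_univ, true_and, Set.mem_ofPred_eq, not_not] at hτ ⊢
        intro x hx
        rw [Equiv.Perm.mul_apply, hτ x hx, ← h0.2 x hx]
        simp
      · intro a _ b _ h
        simpa using h
    refine h1.trans (le_of_eq ?_)
    rw [← Fintype.card_subtype, ← Fintype.card_congr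
      (Equiv.Perm.subtypeEquivSubtypePerm (fun x => x ∉ S)), Fintype.card_perm]
    congr 1
    rw [Fintype.card_subtype_compl]
    simp
  · rw [not_nonempty_iff_eq_empty.1 hne]; simp

lemma inj_card (S T : Finset (Fin n)) :
    (univ.filter fun g : S → Fin n => Function.Injective g ∧ ∀ x, g x ∈ T).card ≤
      T.card.descFactorial S.card := by
  have := Fintype.card_embedding_eq (α := S) (β := T)
  rw [Fintype.card_coe, Fintype.card_coe] at this
  rw [← this, ← Fintype.card_subtype]
  refine Fintype.card_le_of_injective
    (fun g => (⟨fun x => ⟨g.1 x, g.2.2 x⟩, fun a b h => g.2.1 (by simpa using h)⟩ : S ↪ T)) ?_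
  intro a b h
  apply Subtype.ext
  funext x
  have := congrArg (fun e : S ↪ T => ((e x : T) : Fin n)) h
  exact this

lemma perm_family_card {ι : Type} [Fintype ι] (S T : ι → Finset (Fin n))
    (hS : ∀ i j, i ≠ j → Disjoint (S i) (S j)) :
    (univ.filter fun τ : Equiv.Perm (Fin n) => ∀ i, ∀ x ∈ S i, τ x ∈ T i).card ≤
      (∏ i, (T i).card.descFactorial (S i).card) * (n - ∑ i, (S i).card).factorial := by
  let f : Equiv.Perm (Fin n) → (∀ i, S i → Fin n) := fun τ i x => τ x
  have hU : (univ.biUnion S).card = ∑ i, (S i).card :=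
    card_biUnion fun i _ j _ hij => hS i j hij
  set R := (univ.filter fun τ : Equiv.Perm (Fin n) => ∀ i, ∀ x ∈ S i, τ x ∈ T i) with hR
  have h1 : R.card ≤ (n - ∑ i, (S i).card).factorial * (R.image f).card := by
    refine card_le_mul_card_image R _ ?_
    intro b hb
    obtain ⟨τ0, _, rfl⟩ := mem_image.1 hb
    rw [← hU]
    refine le_trans (card_le_card ?_) (perm_ext_card (univ.biUnion S) τ0)
    intro τ hτ
    rw [mem_filter] at hτ ⊢
    refine ⟨mem_univ _, fun x hx => ?_⟩
    obtain ⟨i, _, hi⟩ := mem_biUnion.1 hx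
    exact congrFun (congrFun hτ.2 i) ⟨x, hi⟩
  have h2 : (R.image f).card ≤ ∏ i, (T i).card.descFactorial (S i).card := by
    calc (R.image f).card ≤ (Fintype.piFinset fun i =>
        (univ.filter fun g : S i → Fin n => Function.Injective g ∧ ∀ x, g x ∈ T i)).card := by
          refine card_le_card ?_
          intro b hb
          obtain ⟨τ, hτ, rfl⟩ := mem_image.1 hb
          rw [Fintype.mem_piFinset]
          intro i
          rw [mem_filter]
          refine ⟨mem_univ _, fun x y h => ?_, fun x => (mem_filter.1 hτ).2 i x x.2⟩
          exact Subtype.ext (τ.injective h)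
      _ = ∏ i, _ := Fintype.card_piFinset _
      _ ≤ _ := prod_le_prod' fun i _ => inj_card _ _
  calc R.card ≤ _ := h1
    _ ≤ _ := Nat.mul_le_mul_left _ h2
    _ = _ := mul_comm _ _

/-- the families of the expansion -/
def fam (c : Fin n → Fin k) : Finset (Fin k × Fin k → Finset (Fin n)) :=
  Fintype.piFinset fun ij => (fib c ij.1).powerset

lemma expansion (c c0 : Fin n → Fin k) (Reg : Finset (Equiv.Perm (Fin n)))
    (w : Fin k × Fin k → ℕ → ℝ) (hw : ∀ ij r, 0 ≤ w ij r)
    (Q : (Fin k × Fin k → Finset (Fin n)) → Prop)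
    (hQ : ∀ τ ∈ Reg, ∀ S : Fin k × Fin k → Finset (Fin n),
      (∀ ij, S ij ⊆ fib c ij.1 ∩ fib (c0 ∘ τ) ij.2) → Q S) :
    ∑ τ ∈ Reg, ∏ ij : Fin k × Fin k,
        ∑ S ∈ (fib c ij.1 ∩ fib (c0 ∘ τ) ij.2).powerset, w ij S.card ≤
      ∑ S ∈ (fam c).filter (fun S => (∀ x y, x ≠ y → Disjoint (S x) (S y)) ∧ Q S),
        (∏ ij, w ij (S ij).card * ((fib c0 ij.2).card.descFactorial (S ij).card : ℝ)) *
          ((n - ∑ ij, (S ij).card).factorial : ℝ) := by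
  set F := (fam c).filter (fun S => (∀ x y, x ≠ y → Disjoint (S x) (S y)) ∧ Q S) with hF
  have h1 : ∀ τ ∈ Reg, ∏ ij : Fin k × Fin k,
        ∑ S ∈ (fib c ij.1 ∩ fib (c0 ∘ τ) ij.2).powerset, w ij S.card ≤
      ∑ S ∈ F, (if ∀ ij, ∀ x ∈ S ij, τ x ∈ fib c0 ij.2 then (1:ℝ) else 0) *
        ∏ ij, w ij (S ij).card := by
    intro τ hτ
    rw [Finset.prod_univ_sum]
    simp only [ite_mul, one_mul, zero_mul]
    rw [← sum_filter]
    refine sum_le_sum_of_subset_of_nonneg ?_ (fun S _ _ => prod_nonneg fun ij _ => hw _ _)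
    intro S hS
    rw [Fintype.mem_piFinset] at hS
    have hS' : ∀ ij, S ij ⊆ fib c ij.1 ∩ fib (c0 ∘ τ) ij.2 := fun ij => mem_powerset.1 (hS ij)
    rw [mem_filter, hF, mem_filter, fam, Fintype.mem_piFinset]
    refine ⟨⟨fun ij => mem_powerset.2 ((hS' ij).trans inter_subset_left), ?_, hQ τ hτ S hS'⟩, ?_⟩
    · intro x y hxy
      rw [Finset.disjoint_left]
      intro z hz1 hz2
      have a1 := mem_inter.1 (hS' x hz1)
      have a2 := mem_inter.1 (hS' y hz2)
      rw [mem_fib, mem_fib] at a1 a2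
      exact hxy (Prod.ext (a1.1.symm.trans a2.1) (a1.2.symm.trans a2.2))
    · intro ij x hx
      have a1 := (mem_inter.1 (hS' ij hx)).2
      rw [mem_fib] at a1 ⊢
      exact a1
  refine (sum_le_sum h1).trans ?_
  rw [sum_comm]
  refine sum_le_sum fun S hS => ?_
  rw [← sum_mul, prod_mul_distrib, mul_comm, mul_assoc]
  refine mul_le_mul_of_nonneg_left ?_ (prod_nonneg fun ij _ => hw _ _)
  rw [← sum_filter, sum_const, nsmul_eq_mul, mul_one]
  have h2 := perm_family_card S (fun ij => fib c0 ij.2) (mem_filter.1 hS).2.1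
  have h3 : (Reg.filter fun τ => ∀ ij, ∀ x ∈ S ij, τ x ∈ fib c0 ij.2).card ≤
    (univ.filter fun τ : Equiv.Perm (Fin n) => ∀ ij, ∀ x ∈ S ij, τ x ∈ fib c0 ij.2).card :=
    card_le_card (filter_subset_filter _ (subset_univ _))
  exact_mod_cast h3.trans h2

lemma fam_sum (c : Fin n → Fin k) (F : Fin k × Fin k → ℕ → ℝ) :
    ∑ S ∈ fam c, ∏ ij, F ij (S ij).card =
      ∏ ij : Fin k × Fin k, ∑ r ∈ range ((fib c ij.1).card + 1),
        ((fib c ij.1).card.choose r : ℝ) * F ij r := by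
  rw [fam, ← Finset.prod_univ_sum (fun ij : Fin k × Fin k => (fib c ij.1).powerset)
    (fun ij S => F ij S.card)]
  refine prod_congr rfl fun ij _ => ?_
  rw [Finset.sum_powerset_apply_card (fun r => F ij r)]
  simp [nsmul_eq_mul]

/-- the main expansion bound -/
lemma expansion_bound (c c0 : Fin n → Fin k) (v : Fin k → ℕ) (hc : ∀ i, (fib c i).card = v i)
    (hc0 : ∀ i, (fib c0 i).card = v i) (Reg : Finset (Equiv.Perm (Fin n)))
    (w z z' : Fin k × Fin k → ℕ → ℝ) (hw : ∀ ij r, 0 ≤ w ij r) (hz : ∀ ij r, 0 ≤ z ij r)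
    (hz' : ∀ ij r, 0 ≤ z' ij r) (A A' : ℝ) (hA : 0 ≤ A) (hA' : 0 ≤ A')
    (Q : (Fin k × Fin k → Finset (Fin n)) → Prop)
    (hQ : ∀ τ ∈ Reg, ∀ S : Fin k × Fin k → Finset (Fin n),
      (∀ ij, S ij ⊆ fib c ij.1 ∩ fib (c0 ∘ τ) ij.2) → Q S)
    (hfac : ∀ S : Fin k × Fin k → Finset (Fin n), (∑ ij, (S ij).card ≤ n) → Q S →
      (∀ ij, w ij (S ij).card ≠ 0) →
      ((n - ∑ ij, (S ij).card).factorial : ℝ) ≤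
        A * ∏ ij, z ij (S ij).card + A' * ∏ ij, z' ij (S ij).card) :
    ∑ τ ∈ Reg, ∏ ij : Fin k × Fin k,
        ∑ S ∈ (fib c ij.1 ∩ fib (c0 ∘ τ) ij.2).powerset, w ij S.card ≤
      A * ∏ ij : Fin k × Fin k, ∑ r ∈ range (v ij.1 + 1),
        ((v ij.1).choose r : ℝ) * (w ij r * ((v ij.2).descFactorial r : ℝ) * z ij r) +
      A' * ∏ ij : Fin k × Fin k, ∑ r ∈ range (v ij.1 + 1),
        ((v ij.1).choose r : ℝ) * (w ij r * ((v ij.2).descFactorial r : ℝ) * z' ij r) := by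
  refine (expansion c c0 Reg w hw Q hQ).trans ?_
  have e1 := fam_sum c (fun ij r => w ij r * ((v ij.2).descFactorial r : ℝ) * z ij r)
  have e2 := fam_sum c (fun ij r => w ij r * ((v ij.2).descFactorial r : ℝ) * z' ij r)
  simp only [hc] at e1 e2
  rw [← e1, ← e2, mul_sum, mul_sum, ← sum_add_distrib]
  calc _ ≤ ∑ S ∈ (fam c).filter (fun S => (∀ x y, x ≠ y → Disjoint (S x) (S y)) ∧ Q S),
      (A * ∏ ij, (w ij (S ij).card * ((v ij.2).descFactorial (S ij).card : ℝ) * z ij (S ij).card) +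
      A' * ∏ ij, (w ij (S ij).card * ((v ij.2).descFactorial (S ij).card : ℝ) * z' ij (S ij).card)) := by
        refine sum_le_sum fun S hS => ?_
        simp only [hc0]
        rw [prod_mul_distrib (g := fun ij => z ij (S ij).card),
          prod_mul_distrib (g := fun ij => z' ij (S ij).card)]
        by_cases h0 : ∀ ij, w ij (S ij).card ≠ 0
        · rw [mem_filter] at hS
          have hle : ∑ ij, (S ij).card ≤ n := by
            rw [← card_biUnion fun i _ j _ hij => hS.2.1 i j hij]
            exact (card_le_univ _).trans (by simp)
          have := hfac S hle hS.2.2 h0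
          have hp : 0 ≤ ∏ ij : Fin k × Fin k,
              w ij (S ij).card * ((v ij.2).descFactorial (S ij).card : ℝ) :=
            prod_nonneg fun ij _ => mul_nonneg (hw _ _) (by positivity)
          calc _ ≤ _ := mul_le_mul_of_nonneg_left this hp
            _ = _ := by ring
        · push Not at h0
          obtain ⟨ij, hij⟩ := h0
          have : ∏ ij : Fin k × Fin k,
              w ij (S ij).card * ((v ij.2).descFactorial (S ij).card : ℝ) = 0 :=
            prod_eq_zero (mem_univ ij) (by rw [hij]; simp)
          rw [this]; simp
    _ ≤ _ := by
        refine sum_le_sum_of_subset_of_nonneg (filter_subset _ _) (fun S _ _ => ?_)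
        have p1 : 0 ≤ ∏ ij : Fin k × Fin k,
            (w ij (S ij).card * ((v ij.2).descFactorial (S ij).card : ℝ) * z ij (S ij).card) :=
          prod_nonneg fun ij _ => mul_nonneg (mul_nonneg (hw _ _) (by positivity)) (hz _ _)
        have p2 : 0 ≤ ∏ ij : Fin k × Fin k,
            (w ij (S ij).card * ((v ij.2).descFactorial (S ij).card : ℝ) * z' ij (S ij).card) :=
          prod_nonneg fun ij _ => mul_nonneg (mul_nonneg (hw _ _) (by positivity)) (hz' _ _)
        positivity

end TC

end PartC

section PartD

namespace TC
open Finset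

variable {n k m : ℕ}

lemma choose_down (N m : ℕ) (hN : 0 < N) (hmN : m ≤ N) : ∀ (d M : ℕ), M ≤ N → d ≤ M →
    ((M - d).choose m : ℝ) ≤ (M.choose m : ℝ) * (1 - (m:ℝ) / N) ^ d := by
  have hN' : (0:ℝ) < N := by exact_mod_cast hN
  have hq : 0 ≤ 1 - (m:ℝ) / N := by
    rw [sub_nonneg, div_le_one hN']; exact_mod_cast hmN
  intro d
  induction d with
  | zero => intro M _ _; simp
  | succ d ih =>
    intro M hM hd
    obtain ⟨M', rfl⟩ : ∃ M', M = M' + 1 := ⟨M - 1, by omega⟩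
    have h1 := ih M' (by omega) (by omega)
    have h2 : ((M' + 1 : ℕ) : ℝ) * (M'.choose m : ℝ) = ((M'+1).choose m : ℝ) * ((M' + 1 : ℕ) - m : ℝ) ∨
        (M'.choose m = 0) := by
      by_cases hm : m ≤ M'
      · left
        have := Nat.add_one_mul_choose_eq M' m
        have h3 := Nat.choose_mul_succ_eq M' m
        have h4 : ((M' + 1 - m : ℕ) : ℝ) = ((M' + 1 : ℕ) - m : ℝ) := by
          rw [Nat.cast_sub (by omega)]
        rw [← h4]
        rw [mul_comm]
        exact_mod_cast h3
      · right; exact Nat.choose_eq_zero_of_lt (not_le.1 hm)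
    have h3 : (M'.choose m : ℝ) ≤ ((M'+1).choose m : ℝ) * (1 - (m:ℝ)/N) := by
      rcases h2 with h2 | h2
      · have hM0 : (0:ℝ) < ((M' + 1 : ℕ) : ℝ) := by positivity
        have h5 : (M'.choose m : ℝ) = ((M'+1).choose m : ℝ) * (1 - (m:ℝ) / ((M'+1 : ℕ) : ℝ)) := by
          field_simp
          linarith
        rw [h5]
        refine mul_le_mul_of_nonneg_left ?_ (by positivity)
        have : (m:ℝ)/N ≤ (m:ℝ) / ((M'+1 : ℕ) : ℝ) :=
          div_le_div_of_nonneg_left (by positivity) hM0 (by exact_mod_cast hM)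
        linarith
      · rw [h2]; simp only [Nat.cast_zero]; positivity
    have e : M' + 1 - (d + 1) = M' - d := by omega
    rw [e]
    calc _ ≤ _ := h1
      _ ≤ (((M'+1).choose m : ℝ) * (1 - (m:ℝ)/N)) * (1 - (m:ℝ)/N)^d :=
        mul_le_mul_of_nonneg_right h3 (by positivity)
      _ = _ := by ring

lemma choose_up (M m : ℕ) (hm : m ≤ M) (g : ℕ) :
    ((M + g).choose m : ℝ) ≤ (M.choose m : ℝ) * (((M:ℝ) + 1) / ((M:ℝ) + 1 - m)) ^ g := by
  have hm' : (m:ℝ) ≤ M := by exact_mod_cast hm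
  induction g with
  | zero => simp
  | succ g ih =>
    have h3 := Nat.choose_mul_succ_eq (M + g) m
    have h4 : ((M + g + 1 - m : ℕ) : ℝ) = ((M:ℝ) + g + 1 - m : ℝ) := by
      rw [Nat.cast_sub (by omega)]; push_cast; ring
    have h5 : ((M + g).choose m : ℝ) * ((M:ℝ) + g + 1) = ((M + g + 1).choose m : ℝ) * ((M:ℝ) + g + 1 - m) := by
      rw [← h4]; exact_mod_cast h3
    have hg : (0:ℝ) ≤ g := by positivity
    have p1 : (0:ℝ) < (M:ℝ) + g + 1 - m := by linarith
    have p2 : (0:ℝ) < (M:ℝ) + 1 - m := by linarith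
    have h6 : ((M + g + 1).choose m : ℝ) = ((M + g).choose m : ℝ) * (((M:ℝ) + g + 1) / ((M:ℝ) + g + 1 - m)) := by
      field_simp
      linarith
    have h7 : (((M:ℝ) + g + 1) / ((M:ℝ) + g + 1 - m)) ≤ (((M:ℝ) + 1) / ((M:ℝ) + 1 - m)) := by
      rw [div_le_div_iff₀ p1 p2]
      have : (0:ℝ) ≤ m := by positivity
      nlinarith [mul_nonneg hg this]
    rw [← add_assoc, h6, pow_succ, ← mul_assoc]
    exact mul_le_mul ih h7 (by positivity) (by positivity)

lemma tele_sum (x : ℝ) : ∀ m : ℕ, (m : ℝ) < x + 1 →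
    (m:ℝ) / ((x - m + 1) * (x + 1)) ≤ ∑ t ∈ range m, 1 / (x - t) ^ 2 ∨ ∃ t < m, x - (t:ℝ) = 0 := by
  intro m
  induction m with
  | zero => intro h; left; simp
  | succ m ih =>
    intro h
    push_cast at h
    rcases ih (by linarith) with h1 | ⟨t, ht, h1⟩
    · have hx : 0 < x - m := by linarith
      have hm : (0:ℝ) ≤ m := by positivity
      left
      rw [sum_range_succ]
      have : (((m+1:ℕ):ℝ)) / ((x - ((m+1:ℕ):ℝ) + 1) * (x + 1)) =
          (m:ℝ) / ((x - m + 1) * (x + 1)) + 1 / ((x - m) * (x - m + 1)) := by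
        have a1 : x - m + 1 ≠ 0 := by linarith
        have a2 : x + 1 ≠ 0 := by linarith
        have a3 : x - m ≠ 0 := by linarith
        have a4 : x - ((m+1:ℕ):ℝ) + 1 = x - m := by push_cast; ring
        rw [a4]
        push_cast
        field_simp
        ring
      rw [this]
      refine add_le_add h1 ?_
      rw [div_le_div_iff_of_pos_left one_pos (by positivity) (by positivity)]
      nlinarith
    · right; exact ⟨t, by omega, h1⟩

lemma R0_bound (N f m : ℕ) (hm : m + 2 * f ≤ N) :
    ((N - 2 * f).choose m : ℝ) * (N.choose m : ℝ) ≤ ((N - f).choose m : ℝ) ^ 2 *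
      Real.exp (-((f:ℝ) ^ 2 * ((m:ℝ) / (((N:ℝ) - f - m + 1) * ((N:ℝ) - f + 1))))) := by
  have key : ∀ M : ℕ, m ≤ M → (M.choose m : ℝ) * (m.factorial : ℝ) = ∏ t ∈ range m, ((M:ℝ) - t) := by
    intro M hM
    have h1 := Nat.descFactorial_eq_factorial_mul_choose M m
    have h2 := Nat.descFactorial_eq_prod_range M m
    have h3 : ((∏ i ∈ range m, (M - i) : ℕ) : ℝ) = ∏ t ∈ range m, ((M:ℝ) - t) := by
      push_cast
      refine prod_congr rfl fun t ht => ?_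
      rw [Nat.cast_sub]
      have := mem_range.1 ht
      omega
    rw [← h3, ← h2, h1]; push_cast; ring
  have hf : (0:ℝ) < (m.factorial : ℝ) := by positivity
  have k1 := key (N - 2*f) (by omega)
  have k2 := key N (by omega)
  have k3 := key (N - f) (by omega)
  have c1 : ((N - 2*f : ℕ) : ℝ) = (N:ℝ) - 2 * f := by rw [Nat.cast_sub (by omega)]; push_cast; ring
  have c3 : ((N - f : ℕ) : ℝ) = (N:ℝ) - f := by rw [Nat.cast_sub (by omega)]
  rw [c1] at k1
  rw [c3] at k3
  set E := Real.exp (-((f:ℝ) ^ 2 * ((m:ℝ) / (((N:ℝ) - f - m + 1) * ((N:ℝ) - f + 1))))) with hE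
  have hNr : (m:ℝ) + 2 * f ≤ N := by exact_mod_cast hm
  have hf0 : (0:ℝ) ≤ f := by positivity
  have hpos : ∀ t ∈ range m, (0:ℝ) < (N:ℝ) - 2 * f - t := by
    intro t ht
    have : (t:ℝ) < m := by exact_mod_cast mem_range.1 ht
    linarith
  have main : (∏ t ∈ range m, ((N:ℝ) - 2 * f - t)) * (∏ t ∈ range m, ((N:ℝ) - t)) ≤
      (∏ t ∈ range m, ((N:ℝ) - f - t)) ^ 2 * E := by
    have h1 : ∀ t ∈ range m, ((N:ℝ) - 2 * f - t) * ((N:ℝ) - t) ≤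
        ((N:ℝ) - f - t) ^ 2 * Real.exp (-((f:ℝ)^2 * (1 / ((N:ℝ) - f - t) ^ 2))) := by
      intro t ht
      have hp := hpos t ht
      have hy : (0:ℝ) < (N:ℝ) - f - t := by linarith
      have h2 := Real.add_one_le_exp (-((f:ℝ)^2 * (1 / ((N:ℝ) - f - t) ^ 2)))
      calc ((N:ℝ) - 2 * f - t) * ((N:ℝ) - t) = ((N:ℝ) - f - t) ^ 2 *
          (-((f:ℝ)^2 * (1 / ((N:ℝ) - f - t) ^ 2)) + 1) := by field_simp; ring
        _ ≤ _ := mul_le_mul_of_nonneg_left h2 (by positivity)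
    rw [← prod_mul_distrib]
    calc _ ≤ ∏ t ∈ range m, (((N:ℝ) - f - t) ^ 2 * Real.exp (-((f:ℝ)^2 * (1 / ((N:ℝ) - f - t) ^ 2)))) := by
          refine prod_le_prod (fun t ht => ?_) h1
          have := hpos t ht
          have : (0:ℝ) < (N:ℝ) - t := by linarith
          positivity
      _ = (∏ t ∈ range m, ((N:ℝ) - f - t)) ^ 2 *
          Real.exp (-((f:ℝ)^2 * ∑ t ∈ range m, (1 / ((N:ℝ) - f - t) ^ 2))) := by
          rw [prod_mul_distrib, prod_pow, ← Real.exp_sum, mul_sum, sum_neg_distrib]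
      _ ≤ _ := by
          refine mul_le_mul_of_nonneg_left ?_ (by positivity)
          rw [hE, Real.exp_le_exp]
          have := tele_sum ((N:ℝ) - f) m (by linarith)
          rcases this with h | ⟨t, ht, h⟩
          · have := mul_le_mul_of_nonneg_left h (by positivity : 0 ≤ (f:ℝ)^2)
            linarith
          · exfalso
            have := hpos t (mem_range.2 ht)
            linarith
  rw [← k1, ← k2, ← k3] at main
  have : (((N - 2 * f).choose m : ℝ) * (N.choose m : ℝ)) * ((m.factorial:ℝ)^2) ≤
      (((N - f).choose m : ℝ) ^ 2 * E) * ((m.factorial:ℝ)^2) := by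
    linarith [main]
  exact le_of_mul_le_mul_right this (by positivity)

/-- truncated second moment -/
lemma second_moment (Pr : Finset (Sym2 (Fin n)) → Prop)
    (G : Equiv.Perm (Fin n) → Finset (Sym2 (Fin n)) → Prop)
    (hG : ∀ σ, ∀ ω ∈ Om n m, G σ ω → Pr ω) (M : ℝ) (hM : 0 < M)
    (hMN : 0 < (n.choose 2).choose m) (ε1 ε2 : ℝ) (hε1' : ε1 ≤ 1) (hε2 : 0 ≤ ε2)
    (h1 : ∀ σ, (1 - ε1) * M ≤ (((Om n m).filter fun ω => G σ ω).card : ℝ))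
    (h2 : ∀ σ, ∑ τ, (((Om n m).filter fun ω => G σ ω ∧ G τ ω).card : ℝ) ≤
      (1 + ε2) * (n.factorial : ℝ) * M ^ 2 / ((n.choose 2).choose m : ℝ)) :
    (1 - ε1) ^ 2 / (1 + ε2) ≤
      (((Om n m).filter fun ω => Pr ω).card : ℝ) / ((n.choose 2).choose m : ℝ) := by
  set C : ℝ := ((n.choose 2).choose m : ℝ) with hC
  have hCpos : 0 < C := by rw [hC]; exact_mod_cast hMN
  set Y : Finset (Sym2 (Fin n)) → ℝ := fun ω => ∑ σ : Equiv.Perm (Fin n), if G σ ω then 1 else 0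
  set Rg := (Om n m).filter fun ω => Pr ω
  have hn : (0:ℝ) < n.factorial := by positivity
  have hY0 : ∀ ω ∈ Om n m, ω ∉ Rg → Y ω = 0 := by
    intro ω hω hR
    refine sum_eq_zero fun σ _ => ?_
    rw [if_neg]
    intro h
    exact hR (mem_filter.2 ⟨hω, hG σ ω hω h⟩)
  have e1 : ∑ ω ∈ Rg, Y ω = ∑ σ, (((Om n m).filter fun ω => G σ ω).card : ℝ) := by
    rw [sum_subset (filter_subset _ _) hY0, sum_comm]
    refine sum_congr rfl fun σ _ => ?_
    simp
  have e2 : ∑ ω ∈ Rg, Y ω ^ 2 ≤ ∑ σ, ∑ τ, (((Om n m).filter fun ω => G σ ω ∧ G τ ω).card : ℝ) := by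
    calc ∑ ω ∈ Rg, Y ω ^ 2 ≤ ∑ ω ∈ Om n m, Y ω ^ 2 :=
          sum_le_sum_of_subset_of_nonneg (filter_subset _ _) fun _ _ _ => sq_nonneg _
      _ = ∑ ω ∈ Om n m, ∑ σ : Equiv.Perm (Fin n), ∑ τ : Equiv.Perm (Fin n),
          (if G σ ω ∧ G τ ω then (1:ℝ) else 0) := by
          refine sum_congr rfl fun ω _ => ?_
          rw [sq, sum_mul_sum]
          refine sum_congr rfl fun σ _ => sum_congr rfl fun τ _ => ?_
          by_cases a : G σ ω <;> by_cases b : G τ ω <;> simp [a, b]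
      _ = _ := by
          rw [sum_comm]
          refine sum_congr rfl fun σ _ => ?_
          rw [sum_comm]
          refine sum_congr rfl fun τ _ => ?_
          simp
      _ ≤ _ := le_refl _
  have l1 : (n.factorial : ℝ) * ((1 - ε1) * M) ≤ ∑ ω ∈ Rg, Y ω := by
    rw [e1]
    calc _ = ∑ σ : Equiv.Perm (Fin n), (1 - ε1) * M := by
          rw [sum_const, card_univ, Fintype.card_perm, Fintype.card_fin, nsmul_eq_mul]
      _ ≤ _ := sum_le_sum fun σ _ => h1 σ
  have l2 : ∑ ω ∈ Rg, Y ω ^ 2 ≤ (n.factorial : ℝ) * ((1 + ε2) * (n.factorial : ℝ) * M ^ 2 / C) := by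
    refine e2.trans ?_
    calc _ ≤ ∑ σ : Equiv.Perm (Fin n), ((1 + ε2) * (n.factorial : ℝ) * M ^ 2 / C) :=
          sum_le_sum fun σ _ => h2 σ
      _ = _ := by rw [sum_const, card_univ, Fintype.card_perm, Fintype.card_fin, nsmul_eq_mul]
  have cs := sq_sum_le_card_mul_sum_sq (s := Rg) (f := Y)
  have hnn : 0 ≤ (n.factorial : ℝ) * ((1 - ε1) * M) := by
    have : 0 ≤ 1 - ε1 := by linarith
    positivity
  have l3 : ((n.factorial : ℝ) * ((1 - ε1) * M)) ^ 2 ≤ (Rg.card : ℝ) *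
      ((n.factorial : ℝ) * ((1 + ε2) * (n.factorial : ℝ) * M ^ 2 / C)) :=
    calc _ ≤ (∑ ω ∈ Rg, Y ω) ^ 2 := pow_le_pow_left₀ hnn l1 2
      _ ≤ _ := cs
      _ ≤ _ := mul_le_mul_of_nonneg_left l2 (by positivity)
  rw [div_le_div_iff₀ (by positivity) hCpos]
  have l4 : ((n.factorial : ℝ)^2 * M^2 / C) * ((1 - ε1)^2 * C) ≤
      ((n.factorial : ℝ)^2 * M^2 / C) * ((Rg.card : ℝ) * (1 + ε2)) := by
    calc _ = ((n.factorial : ℝ) * ((1 - ε1) * M)) ^ 2 := by field_simp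
      _ ≤ _ := l3
      _ = _ := by ring
  exact le_of_mul_le_mul_left l4 (by positivity)

end TC

end PartD

section PartE

namespace TC
open Finset

variable {n k m : ℕ}

def star (x : Fin n) (S : Finset (Fin n)) : Finset (Sym2 (Fin n)) := S.image (fun y => s(x, y))

lemma star_sub_prs {x : Fin n} {S W : Finset (Fin n)} (hx : x ∈ W) (hS : S ⊆ W) (hxS : x ∉ S) :
    star x S ⊆ prs W := by
  intro e he
  obtain ⟨y, hy, rfl⟩ := mem_image.1 he
  rw [mem_prs]
  exact ⟨hx, hS hy, fun h => hxS (h ▸ hy)⟩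

/-- `x` can be added to class `i` after deleting `y` (or nothing when `y = x`). -/
def triple (c : Fin n → Fin k) (ω : Finset (Sym2 (Fin n))) (i : Fin k) (y x : Fin n) : Prop :=
  c x ≠ i ∧ (c y = i ∨ y = x) ∧ Disjoint ω (star x ((fib c i).erase y))

def gbList (c : Fin n → Fin k) (ω : Finset (Sym2 (Fin n))) : Finset (Fin k × Fin n × Fin n) :=
  univ.filter fun t => triple c ω t.1 t.2.1 t.2.2

def gcList (c : Fin n → Fin k) (ω : Finset (Sym2 (Fin n))) : Finset (Fin k × Fin n) :=
  univ.filter fun t => c t.2 ≠ t.1 ∧ Disjoint ω (star t.2 (fib c t.1))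

/-- bad extra structures -/
def badE (c : Fin n → Fin k) (ω : Finset (Sym2 (Fin n))) (h umin a t : ℕ)
    (I : Finset (Fin k)) (lab : Fin n → Option (Fin t)) : Prop :=
  I.card = t ∧ (∀ j, Disjoint ω (prs (univ.filter fun x => lab x = some j)) ∧
    umin ≤ (univ.filter fun x => lab x = some j).card ∧
    (univ.filter fun x => lab x = some j).card ≤ a ∧
    ∀ i, ((univ.filter fun x => lab x = some j) ∩ fib c i).card ≤ h) ∧
    (univ.filter fun x => lab x ≠ none ∧ c x ∉ I).card ≤ (a - umin + 1) * t

def linked (c : Fin n → Fin k) (ω : Finset (Sym2 (Fin n)))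
    (i1 : Fin k) (y1 x1 : Fin n) (i2 : Fin k) (y2 x2 : Fin n) : Prop :=
  triple c ω i1 y1 x1 ∧ triple c ω i2 y2 x2 ∧ i1 ≠ i2 ∧ x1 ≠ x2 ∧ (c x2 = i1 ∨ c x1 = c x2)

structure Good (h umin a s1 lam lam' : ℕ) (c : Fin n → Fin k) (ω : Finset (Sym2 (Fin n))) : Prop where
  proper : Disjoint ω (mono c)
  ga : ∀ (T : Finset (Fin n)) (i : Fin k), Disjoint ω (prs T) → umin ≤ T.card → T.card ≤ a →
    h < (T ∩ fib c i).card → (T \ fib c i).card ≤ 1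
  gb : (gbList c ω).card ≤ lam'
  gc : (gcList c ω).card ≤ lam
  gl : ∀ i1 y1 x1 i2 y2 x2, ¬ linked c ω i1 y1 x1 i2 y2 x2
  ge : ∀ t, 1 ≤ t → t ≤ s1 → ∀ (I : Finset (Fin k)) (lab : Fin n → Option (Fin t)),
    ¬ badE c ω h umin a t I lab

lemma indep_fib {c : Fin n → Fin k} {ω : Finset (Sym2 (Fin n))} (h : Disjoint ω (mono c))
    (i : Fin k) : Disjoint ω (prs (fib c i)) :=
  h.mono_right (subset_biUnion_of_mem (fun i => prs (fib c i)) (mem_univ i))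

/-- two good colourings in the same graph -/
structure Pair (h umin a s1 lam lam' : ℕ) (c c' : Fin n → Fin k) (ω : Finset (Sym2 (Fin n))) : Prop where
  g1 : Good h umin a s1 lam lam' c ω
  g2 : Good h umin a s1 lam lam' c' ω
  lo1 : ∀ i, umin ≤ (fib c i).card
  lo2 : ∀ i, umin ≤ (fib c' i).card
  hi1 : ∀ i, (fib c i).card ≤ a
  hi2 : ∀ i, (fib c' i).card ≤ a
  h1 : 1 ≤ h
  hu : h < umin

variable {h umin a s1 lam lam' : ℕ} {c c' : Fin n → Fin k} {ω : Finset (Sym2 (Fin n))}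

lemma Pair.symm (P : Pair h umin a s1 lam lam' c c' ω) : Pair h umin a s1 lam lam' c' c ω :=
  ⟨P.g2, P.g1, P.lo2, P.lo1, P.hi2, P.hi1, P.h1, P.hu⟩

def big (h : ℕ) (c c' : Fin n → Fin k) (i j : Fin k) : Prop := h < (fib c i ∩ fib c' j).card

lemma big_symm {i j : Fin k} (hb : big h c c' i j) : big h c' c j i := by
  rw [big, inter_comm]; exact hb

lemma Pair.near (P : Pair h umin a s1 lam lam' c c' ω) {i j : Fin k} (hb : big h c c' i j) :
    (fib c' j \ fib c i).card ≤ 1 :=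
  P.g1.ga (fib c' j) i (indep_fib P.g2.proper j) (P.lo2 j) (P.hi2 j) (by rw [inter_comm]; exact hb)

lemma Pair.near' (P : Pair h umin a s1 lam lam' c c' ω) {i j : Fin k} (hb : big h c c' i j) :
    (fib c i \ fib c' j).card ≤ 1 := P.symm.near (big_symm hb)

lemma Pair.uniq (P : Pair h umin a s1 lam lam' c c' ω) {i j j' : Fin k} (hb : big h c c' i j)
    (hb' : big h c c' i j') : j = j' := by
  by_contra hne
  have h1 := P.near' hb
  have h2 : fib c i ∩ fib c' j' ⊆ fib c i \ fib c' j := by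
    intro x hx
    rw [mem_inter] at hx
    rw [Finset.mem_sdiff]
    refine ⟨hx.1, fun hh => ?_⟩
    exact (Finset.disjoint_left.1 (fib_disj c' hne)) hh hx.2
  have h3 := card_le_card h2
  have := P.h1
  unfold big at hb'
  omega

lemma Pair.uniq' (P : Pair h umin a s1 lam lam' c c' ω) {i i' j : Fin k} (hb : big h c c' i j)
    (hb' : big h c c' i' j) : i = i' := P.symm.uniq (big_symm hb) (big_symm hb')

/-- a gained vertex yields a triple -/
lemma Pair.gain (P : Pair h umin a s1 lam lam' c c' ω) {i j : Fin k} (hb : big h c c' i j)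
    {x : Fin n} (hx : c' x = j) (hxi : c x ≠ i) :
    ∃ y, triple c ω i y x ∧ (∀ z, c z = i → c' z ≠ j → y = z) ∧ (y = x → fib c i ⊆ fib c' j) := by
  have hind := indep_fib P.g2.proper j
  by_cases hsub : fib c i ⊆ fib c' j
  · refine ⟨x, ⟨hxi, Or.inr rfl, ?_⟩, ?_, fun _ => hsub⟩
    · refine hind.mono_right (star_sub_prs (mem_fib.2 hx) ((erase_subset _ _).trans hsub) ?_)
      simp
    · intro z hz hz'
      exact absurd (mem_fib.1 (hsub (mem_fib.2 hz))) hz'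
  · obtain ⟨y, hy, hy'⟩ := not_subset.1 hsub
    have hall : ∀ z, c z = i → c' z ≠ j → y = z := by
      intro z hz hz'
      exact card_le_one.1 (P.near' hb) y (Finset.mem_sdiff.2 ⟨hy, hy'⟩) z
        (Finset.mem_sdiff.2 ⟨mem_fib.2 hz, fun hh => hz' (mem_fib.1 hh)⟩)
    refine ⟨y, ⟨hxi, Or.inl (mem_fib.1 hy), ?_⟩, hall, ?_⟩
    · refine hind.mono_right (star_sub_prs (mem_fib.2 hx) ?_ ?_)
      · intro z hz
        rw [mem_erase, mem_fib] at hz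
        rw [mem_fib]
        by_contra hz'
        exact hz.1 (hall z hz.2 hz').symm
      · rw [mem_erase, mem_fib]; exact fun hh => hxi hh.2
    · intro hyx
      exact absurd (mem_fib.1 hy) (hyx ▸ hxi)

/-- the number of inexact big pairs -/
lemma Pair.inexact (P : Pair h umin a s1 lam lam' c c' ω) :
    (univ.filter fun ij : Fin k × Fin k => big h c c' ij.1 ij.2 ∧ fib c ij.1 ≠ fib c' ij.2).card ≤
      2 * lam' := by
  have hsub : (univ.filter fun ij : Fin k × Fin k => big h c c' ij.1 ij.2 ∧
      fib c ij.1 ≠ fib c' ij.2) ⊆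
      (univ.filter fun ij : Fin k × Fin k => big h c c' ij.1 ij.2 ∧ ¬ fib c' ij.2 ⊆ fib c ij.1) ∪
      (univ.filter fun ij : Fin k × Fin k => big h c c' ij.1 ij.2 ∧ ¬ fib c ij.1 ⊆ fib c' ij.2) := by
    intro ij hij
    simp only [mem_union, mem_filter, mem_univ, true_and] at hij ⊢
    by_cases h1 : fib c' ij.2 ⊆ fib c ij.1
    · by_cases h2 : fib c ij.1 ⊆ fib c' ij.2
      · exact absurd (Subset.antisymm h2 h1) hij.2
      · exact Or.inr ⟨hij.1, h2⟩
    · exact Or.inl ⟨hij.1, h1⟩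
  have key : ∀ {d d' : Fin n → Fin k}, Pair h umin a s1 lam lam' d d' ω →
      (univ.filter fun ij : Fin k × Fin k => big h d d' ij.1 ij.2 ∧
        ¬ fib d' ij.2 ⊆ fib d ij.1).card ≤ lam' := by
    intro d d' P
    refine le_trans ?_ P.g1.gb
    have hinj : Set.InjOn Prod.fst ((univ.filter fun ij : Fin k × Fin k => big h d d' ij.1 ij.2 ∧
        ¬ fib d' ij.2 ⊆ fib d ij.1 : Finset (Fin k × Fin k)) : Set (Fin k × Fin k)) := by
      rintro ⟨i, j⟩ h1 ⟨i', j'⟩ h2 hh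
      simp only [coe_filter, mem_univ, true_and, Set.mem_ofPred_eq] at h1 h2 hh
      subst hh
      rw [P.uniq h1.1 h2.1]
    rw [← card_image_of_injOn hinj]
    refine le_trans (card_le_card ?_) (card_image_le (s := gbList d ω) (f := Prod.fst))
    intro i hi
    obtain ⟨⟨i', j⟩, h1, rfl⟩ := mem_image.1 hi
    obtain ⟨_, hb, hs⟩ := mem_filter.1 h1
    obtain ⟨x, hx, hx'⟩ := not_subset.1 hs
    obtain ⟨y, hy, _⟩ := P.gain hb (mem_fib.1 hx) (fun hh => hx' (mem_fib.2 hh))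
    exact mem_image.2 ⟨(i', y, x), mem_filter.2 ⟨mem_univ _, hy⟩, rfl⟩
  have hB : (univ.filter fun ij : Fin k × Fin k => big h c c' ij.1 ij.2 ∧
      ¬ fib c ij.1 ⊆ fib c' ij.2).card ≤ lam' := by
    refine le_trans (le_of_eq ?_) (key P.symm)
    refine card_bij (fun ij _ => (ij.2, ij.1)) ?_ ?_ ?_
    · intro ij hij
      simp only [mem_filter, mem_univ, true_and] at hij ⊢
      exact ⟨big_symm hij.1, hij.2⟩
    · rintro ⟨i, j⟩ _ ⟨i', j'⟩ _ hh
      simp only [Prod.mk.injEq] at hh ⊢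
      exact ⟨hh.2, hh.1⟩
    · rintro ⟨i, j⟩ hij
      simp only [mem_filter, mem_univ, true_and] at hij
      exact ⟨(j, i), by simp only [mem_filter, mem_univ, true_and]; exact ⟨big_symm hij.1, hij.2⟩, rfl⟩
  have := card_le_card hsub
  have h2 := card_union_le (univ.filter fun ij : Fin k × Fin k => big h c c' ij.1 ij.2 ∧ ¬ fib c' ij.2 ⊆ fib c ij.1)
      (univ.filter fun ij : Fin k × Fin k => big h c c' ij.1 ij.2 ∧ ¬ fib c ij.1 ⊆ fib c' ij.2)
  have h3 := key P
  omega

/-- unmatched classes -/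
def unm (h : ℕ) (c c' : Fin n → Fin k) : Finset (Fin k) := univ.filter fun i => ∀ j, ¬ big h c c' i j

lemma Pair.unm_card_le (P : Pair h umin a s1 lam lam' c c' ω) :
    (unm h c c').card ≤ (unm h c' c).card := by
  have hex : ∀ j : Fin k, j ∉ unm h c' c → ∃ i, big h c' c j i := by
    intro j hj
    simp only [unm, mem_filter, mem_univ, true_and, not_forall, not_not] at hj
    exact hj
  have : (unm h c' c)ᶜ.card ≤ (unm h c c')ᶜ.card := by
    refine card_le_card_of_forall_subsingleton (fun j i => big h c' c j i) ?_ ?_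
    · intro j hj
      obtain ⟨i, hi⟩ := hex j (mem_compl.1 hj)
      refine ⟨i, ?_, hi⟩
      rw [mem_compl]
      intro h1
      exact (mem_filter.1 h1).2 j (big_symm hi)
    · intro i _ j hj j' hj'
      exact P.uniq (big_symm hj.2) (big_symm hj'.2)
  rw [card_compl, card_compl] at this
  have h1 : (unm h c' c).card ≤ Fintype.card (Fin k) := card_le_univ _
  have h2 : (unm h c c').card ≤ Fintype.card (Fin k) := card_le_univ _
  omega

lemma Pair.unm_card (P : Pair h umin a s1 lam lam' c c' ω) :
    (unm h c c').card = (unm h c' c).card := le_antisymm P.unm_card_le P.symm.unm_card_le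

lemma card_fibU (c : Fin n → Fin k) (I : Finset (Fin k)) :
    (univ.filter fun x => c x ∈ I).card = ∑ i ∈ I, (fib c i).card := by
  have : (univ.filter fun x => c x ∈ I) = I.biUnion (fib c) := by
    ext x; simp [mem_fib]
  rw [this, card_biUnion]
  intro i _ j _ hij
  exact fib_disj c hij

/-- nothing is unmatched -/
lemma Pair.unm_empty (P : Pair h umin a s1 lam lam' c c' ω) (hs : (unm h c c').card ≤ s1) :
    unm h c c' = ∅ := by
  by_contra hne
  have hne' : (unm h c c').Nonempty := nonempty_iff_ne_empty.2 hne
  set I := unm h c c' with hI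
  set J := unm h c' c with hJ
  have hIJ : I.card = J.card := P.unm_card
  let e : J ≃ Fin I.card := Fintype.equivFinOfCardEq (by rw [Fintype.card_coe, hIJ])
  let lab : Fin n → Option (Fin I.card) := fun x =>
    if hx : c' x ∈ J then some (e ⟨c' x, hx⟩) else none
  have hclass : ∀ j : Fin I.card, (univ.filter fun x => lab x = some j) = fib c' (e.symm j).1 := by
    intro j
    ext x
    simp only [mem_filter, mem_univ, true_and, mem_fib, lab]
    constructor
    · intro hx
      split_ifs at hx with h1
      have := Option.some.inj hx
      rw [← this]; simp
    · intro hx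
      have h1 : c' x ∈ J := by rw [hx]; exact (e.symm j).2
      rw [dif_pos h1]
      congr 1
      rw [← Equiv.eq_symm_apply]
      exact Subtype.ext hx
  refine P.g1.ge I.card (card_pos.2 hne') hs I lab ⟨rfl, ?_, ?_⟩
  · intro j
    rw [hclass]
    refine ⟨indep_fib P.g2.proper _, P.lo2 _, P.hi2 _, fun i => ?_⟩
    have h1 : ((e.symm j).1) ∈ unm h c' c := (e.symm j).2
    have := (mem_filter.1 h1).2 i
    exact not_lt.1 this
  · have hlab : ∀ x, lab x ≠ none ↔ c' x ∈ J := by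
      intro x
      simp only [lab]
      split_ifs with h1 <;> simp [h1]
    have e1 : (univ.filter fun x => lab x ≠ none ∧ c x ∉ I) =
        (univ.filter fun x => c' x ∈ J) \ (univ.filter fun x => c x ∈ I) := by
      ext x
      simp only [mem_filter, mem_univ, true_and, Finset.mem_sdiff, hlab]
    rw [e1]
    set U := (univ.filter fun x => c' x ∈ J)
    set VI := (univ.filter fun x => c x ∈ I)
    have hU : U.card ≤ a * I.card := by
      rw [card_fibU, hIJ]
      calc _ ≤ ∑ j ∈ J, a := sum_le_sum fun j _ => P.hi2 j
        _ = _ := by simp [mul_comm]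
    have hV : umin * I.card ≤ VI.card := by
      rw [card_fibU]
      calc _ = ∑ j ∈ I, umin := by simp [mul_comm]
        _ ≤ _ := sum_le_sum fun j _ => P.lo1 j
    have hVU : (VI \ U).card ≤ I.card := by
      refine card_le_card_of_injOn c ?_ ?_
      · intro x hx
        rw [mem_coe, Finset.mem_sdiff] at hx
        exact (mem_filter.1 hx.1).2
      · intro x1 hx1 x2 hx2 hc
        by_contra hne12
        rw [mem_coe, Finset.mem_sdiff] at hx1 hx2
        have m1 : c x1 ∈ I := (mem_filter.1 hx1.1).2
        have n1 : c' x1 ∉ J := fun hh => hx1.2 (mem_filter.2 ⟨mem_univ _, hh⟩)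
        have n2 : c' x2 ∉ J := fun hh => hx2.2 (mem_filter.2 ⟨mem_univ _, hh⟩)
        have hex : ∀ x, c' x ∉ J → ∃ i, big h c c' i (c' x) := by
          intro x hj
          simp only [hJ, unm, mem_filter, mem_univ, true_and, not_forall, not_not] at hj
          obtain ⟨i, hi⟩ := hj
          exact ⟨i, big_symm hi⟩
        obtain ⟨i1, b1⟩ := hex x1 n1
        obtain ⟨i2, b2⟩ := hex x2 n2
        have nI : ∀ i j, big h c c' i j → i ∉ I := by
          intro i j hb hi
          exact (mem_filter.1 hi).2 j hb
        have d1 : c x1 ≠ i1 := fun hh => nI _ _ b1 (hh ▸ m1)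
        have d2 : c x2 ≠ i2 := fun hh => nI _ _ b2 (by rw [← hh, ← hc]; exact m1)
        have hii : i1 ≠ i2 := by
          intro hh
          subst hh
          have hj := P.uniq b1 b2
          have := P.near b1
          exact hne12 (card_le_one.1 this x1
            (Finset.mem_sdiff.2 ⟨mem_fib.2 rfl, fun hh => d1 (mem_fib.1 hh)⟩) x2
            (Finset.mem_sdiff.2 ⟨mem_fib.2 hj.symm, fun hh => d2 (mem_fib.1 hh)⟩))
        obtain ⟨y1, t1, _⟩ := P.gain b1 rfl d1
        obtain ⟨y2, t2, _⟩ := P.gain b2 rfl d2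
        exact P.g1.gl i1 y1 x1 i2 y2 x2 ⟨t1, t2, hii, hne12, Or.inr hc⟩
    have q1 := card_sdiff_add_card_inter U VI
    have q2 := card_sdiff_add_card_inter VI U
    rw [inter_comm] at q2
    have hau : umin ≤ a := by
      obtain ⟨i, _⟩ := hne'
      exact (P.lo1 i).trans (P.hi1 i)
    obtain ⟨d, rfl⟩ := Nat.exists_eq_add_of_le hau
    have : umin + d - umin + 1 = d + 1 := by omega
    rw [this]
    nlinarith

/-- the modified colouring -/
def tA (c : Fin n → Fin k) (A : Finset (Fin k × Fin n)) (x : Fin n) : Fin k :=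
  if hx : ∃ i, (i, x) ∈ A then hx.choose else c x

/-- regime III structure -/
lemma Pair.struct (P : Pair h umin a s1 lam lam' c c' ω) (hs : (unm h c c').card ≤ s1) :
    ∃ A ∈ (gcList c ω).powerset, ∃ φ : Equiv.Perm (Fin k), c' = φ ∘ tA c A := by
  have h0 := P.unm_empty hs
  have h0' : unm h c' c = ∅ := by
    rw [← card_eq_zero, ← P.unm_card, h0, card_empty]
  have hex : ∀ i, ∃ j, big h c c' i j := by
    intro i
    by_contra hh
    push Not at hh
    have : i ∈ unm h c c' := mem_filter.2 ⟨mem_univ _, hh⟩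
    rw [h0] at this
    exact absurd this (notMem_empty _)
  choose f hf using hex
  have finj : Function.Injective f := by
    intro i i' hh
    have := hf i'
    rw [← hh] at this
    exact P.uniq' (hf i) this
  let φ : Equiv.Perm (Fin k) := Equiv.ofBijective f (Finite.injective_iff_bijective.1 finj)
  have hφ : ∀ i, φ i = f i := fun i => rfl
  let A : Finset (Fin k × Fin n) := univ.filter fun t => c t.2 ≠ t.1 ∧ c' t.2 = f t.1
  refine ⟨A, ?_, φ, ?_⟩
  · rw [mem_powerset]
    rintro ⟨i, x⟩ hix
    obtain ⟨_, h1, h2⟩ := mem_filter.1 hix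
    simp only at h1 h2
    rw [gcList, mem_filter]
    refine ⟨mem_univ _, h1, ?_⟩
    simp only
    have hsub : fib c i ⊆ fib c' (f i) := by
      intro y hy
      by_contra hy'
      obtain ⟨y1, t1, u1, _⟩ := P.gain (hf i) h2 h1
      have hyi : c y = i := mem_fib.1 hy
      have hyj : c' y ≠ f i := fun hh => hy' (mem_fib.2 hh)
      have e1 := u1 y hyi hyj
      obtain ⟨i2, hi2⟩ := φ.surjective (c' y)
      rw [hφ] at hi2
      have hii : i ≠ i2 := by
        intro hh
        rw [hh] at hyj
        exact hyj hi2.symm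
      obtain ⟨y2, t2, _, _⟩ := P.gain (hf i2) hi2.symm (by rw [hyi]; exact hii)
      refine P.g1.gl i y1 x i2 y2 y ⟨t1, t2, hii, ?_, Or.inl hyi⟩
      intro hh
      rw [hh] at h1
      exact h1 hyi
    refine (indep_fib P.g2.proper (f i)).mono_right
      (star_sub_prs (mem_fib.2 h2) hsub fun hh => h1 (mem_fib.1 hh))
  · funext x
    simp only [Function.comp, hφ]
    by_cases hx : ∃ i, (i, x) ∈ A
    · rw [tA, dif_pos hx]
      exact (mem_filter.1 hx.choose_spec).2.2
    · rw [tA, dif_neg hx]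
      obtain ⟨i, hi⟩ := φ.surjective (c' x)
      rw [hφ] at hi
      by_contra hne
      refine hx ⟨i, mem_filter.2 ⟨mem_univ _, ?_, hi.symm⟩⟩
      intro hh
      simp only at hh
      rw [hh] at hne
      exact hne hi.symm

/-- permutations with prescribed pullback -/
lemma perm_pullback_card {α ι : Type} [Fintype α] [DecidableEq α] [DecidableEq ι] (f w : α → ι) :
    (univ.filter fun g : Equiv.Perm α => f ∘ g = w).card ≤
      ∏ i ∈ univ.image f, ((univ.filter fun x => f x = i).card).factorial := by
  by_cases hne : (univ.filter fun g : Equiv.Perm α => f ∘ g = w).Nonempty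
  · obtain ⟨g0, h0⟩ := hne
    rw [mem_filter] at h0
    have h1 : (univ.filter fun g : Equiv.Perm α => f ∘ g = w).card ≤
        (univ.filter fun g : Equiv.Perm α => f ∘ g = f).card := by
      refine card_le_card_of_injOn (fun g => g * g0⁻¹) ?_ ?_
      · intro g hg
        simp only [coe_filter, mem_univ, true_and, Set.mem_ofPred_eq] at hg ⊢
        funext x
        have e1 := congrFun hg (g0⁻¹ x)
        have e2 := congrFun h0.2 (g0⁻¹ x)
        simp only [Function.comp] at e1 e2
        simp only [Function.comp, Equiv.Perm.mul_apply]
        rw [e1, ← e2]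
        simp
      · intro g _ g' _ hh
        simpa using hh
    refine h1.trans (le_of_eq ?_)
    rw [← Fintype.card_subtype]
    have := DomMulAct.stabilizer_card' f
    convert this using 2
    rw [Fintype.card_subtype]
  · rw [not_nonempty_iff_eq_empty.1 hne]; simp

/-- number of good colourings in regime III -/
lemma regimeIII_card (c0 c : Fin n → Fin k) (v : Fin k → ℕ) (hc0 : ∀ i, (fib c0 i).card = v i)
    (R : Finset (Equiv.Perm (Fin n)))
    (hR : ∀ τ ∈ R, Pair h umin a s1 lam lam' c (c0 ∘ τ) ω ∧ (unm h c (c0 ∘ τ)).card ≤ s1)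
    (hgc : (gcList c ω).card ≤ lam) :
    R.card ≤ 2 ^ lam * (∏ u ∈ univ.image v, ((univ.filter fun i => v i = u).card).factorial) *
      ∏ i, (v i).factorial := by
  set B := ∏ u ∈ univ.image v, ((univ.filter fun i => v i = u).card).factorial
  have himg : (R.image fun τ : Equiv.Perm (Fin n) => (c0 ∘ τ : Fin n → Fin k)).card ≤ 2 ^ lam * B := by
    have hsub : (R.image fun τ : Equiv.Perm (Fin n) => (c0 ∘ τ : Fin n → Fin k)) ⊆ (gcList c ω).powerset.biUnion fun A =>
        (univ.filter fun φ : Equiv.Perm (Fin k) => v ∘ φ = fun i => (fib (tA c A) i).card).image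
          fun φ : Equiv.Perm (Fin k) => (φ ∘ tA c A : Fin n → Fin k) := by
      intro d hd
      obtain ⟨τ, hτ, rfl⟩ := mem_image.1 hd
      obtain ⟨hP, hs⟩ := hR τ hτ
      obtain ⟨A, hA, φ, hφ⟩ := hP.struct hs
      rw [mem_biUnion]
      refine ⟨A, hA, mem_image.2 ⟨φ, mem_filter.2 ⟨mem_univ _, ?_⟩, hφ.symm⟩⟩
      funext i
      have e1 : (fib (c0 ∘ τ) (φ i)).card = v (φ i) := by
        rw [← hc0 (φ i)]
        refine card_bij (fun x _ => τ x) ?_ ?_ ?_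
        · intro x hx; rw [mem_fib] at hx ⊢; exact hx
        · intro x _ y _ hh; exact τ.injective hh
        · intro y hy; exact ⟨τ.symm y, by rw [mem_fib] at hy ⊢; simpa using hy, by simp⟩
      rw [Function.comp, ← e1, hφ]
      congr 1
      ext x
      simp [mem_fib]
    calc _ ≤ _ := card_le_card hsub
      _ ≤ ∑ A ∈ (gcList c ω).powerset, _ := card_biUnion_le
      _ ≤ ∑ A ∈ (gcList c ω).powerset, B := by
          refine sum_le_sum fun A _ => card_image_le.trans ?_
          have hk := perm_pullback_card v (fun i => (fib (tA c A) i).card)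
          refine le_trans (le_of_eq ?_) hk
          congr
      _ = 2 ^ (gcList c ω).card * B := by rw [sum_const, card_powerset, smul_eq_mul]
      _ ≤ _ := Nat.mul_le_mul_right _ (Nat.pow_le_pow_right (by norm_num) hgc)
  have hfibre : R.card ≤ (∏ i, (v i).factorial) * (R.image fun τ : Equiv.Perm (Fin n) => (c0 ∘ τ : Fin n → Fin k)).card := by
    refine card_le_mul_card_image R _ ?_
    intro d _
    refine le_trans (card_le_card (t := univ.filter fun g : Equiv.Perm (Fin n) => c0 ∘ g = d) ?_) ?_
    · intro τ hτ
      rw [mem_filter] at hτ ⊢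
      exact ⟨mem_univ _, hτ.2⟩
    · have hk := perm_pullback_card c0 d
      refine le_trans (le_of_eq ?_) (hk.trans ?_)
      · congr!
      calc _ = ∏ i ∈ univ.image c0, (v i).factorial := by
            refine prod_congr rfl fun i _ => ?_
            rw [← hc0 i, fib]
        _ ≤ _ := prod_le_prod_of_subset_of_one_le' (subset_univ _)
            fun i _ _ => Nat.one_le_iff_ne_zero.2 (Nat.factorial_ne_zero _)
  calc R.card ≤ _ := hfibre
    _ ≤ (∏ i, (v i).factorial) * (2 ^ lam * B) := Nat.mul_le_mul_left _ himg
    _ = _ := by ring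

end TC

end PartE

section PartF

namespace TC
open Finset

variable {n k m : ℕ}

lemma card_small_subsets {α : Type} [DecidableEq α] (U : Finset α) (w : ℕ) :
    (U.powerset.filter fun S => S.card ≤ w).card ≤ (U.card + 1) ^ w := by
  have h1 : (U.powerset.filter fun S => S.card ≤ w) ⊆
      (univ : Finset (Fin w → Option U)).image
        (fun g => U.filter fun x => ∃ i, ∃ hx : x ∈ U, g i = some ⟨x, hx⟩) := by
    intro S hS
    rw [mem_filter, mem_powerset] at hS
    rw [mem_image]
    let e := S.equivFin
    refine ⟨fun i => if hi : i.1 < S.card then some ⟨(e.symm ⟨i.1, hi⟩).1, hS.1 (e.symm ⟨i.1, hi⟩).2⟩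
      else none, mem_univ _, ?_⟩
    ext x
    rw [mem_filter]
    constructor
    · rintro ⟨hx, i, hx', hi⟩
      simp only at hi
      split_ifs at hi with h2
      have := Option.some.inj hi
      have h3 := congrArg Subtype.val this
      simp only at h3
      rw [← h3]; exact (e.symm ⟨i.1, h2⟩).2
    · intro hx
      have h4 : (e ⟨x, hx⟩).1 < w := lt_of_lt_of_le (e ⟨x, hx⟩).2 hS.2
      refine ⟨hS.1 hx, ⟨(e ⟨x, hx⟩).1, h4⟩, hS.1 hx, ?_⟩
      simp only
      rw [dif_pos (e ⟨x, hx⟩).2]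
      simp
  refine (card_le_card h1).trans (card_image_le.trans ?_)
  rw [card_univ, Fintype.card_fun]
  simp

/-- number of edges with prescribed sets removed -/
lemma avoid_le (c : Fin n → Fin k) (hmN : m ≤ n.choose 2) (hN : 0 < n.choose 2)
    {D : Finset (Sym2 (Fin n))} (hD : D ⊆ allE n) :
    (((Om n m).filter fun ω => Disjoint ω (mono c) ∧ Disjoint ω D).card : ℝ) ≤
      ((n.choose 2 - (mono c).card).choose m : ℝ) *
        (1 - (m:ℝ) / (n.choose 2 : ℕ)) ^ (D \ mono c).card := by
  have h1 : ((Om n m).filter fun ω => Disjoint ω (mono c) ∧ Disjoint ω D) =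
      (Om n m).filter fun ω => Disjoint ω (mono c ∪ (D \ mono c)) := by
    refine filter_congr fun ω _ => ?_
    rw [← disjoint_union_right, union_sdiff_self_eq_union]
  have h2 : mono c ∪ (D \ mono c) ⊆ allE n :=
    union_subset (mono_subset c) (sdiff_subset.trans hD)
  have h3 : (mono c ∪ (D \ mono c)).card = (mono c).card + (D \ mono c).card :=
    card_union_of_disjoint disjoint_sdiff
  have h4 := card_le_card h2
  rw [card_allE] at h4
  rw [h1, card_avoid h2, h3, Nat.sub_add_eq]
  exact choose_down (n.choose 2) m hN hmN _ _ (Nat.sub_le _ _) (by omega)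

/-- union bound -/
lemma union_bound {ι : Type} (c : Fin n → Fin k) (hmN : m ≤ n.choose 2) (hN : 0 < n.choose 2)
    (S : Finset ι) (D : ι → Finset (Sym2 (Fin n))) (hD : ∀ i ∈ S, D i ⊆ allE n)
    (A : Finset (Finset (Sym2 (Fin n)))) (hA : ∀ ω ∈ A, ω ∈ Om n m ∧ Disjoint ω (mono c) ∧
      ∃ i ∈ S, Disjoint ω (D i)) :
    (A.card : ℝ) ≤
      ((n.choose 2 - (mono c).card).choose m : ℝ) *
        ∑ i ∈ S, (1 - (m:ℝ) / (n.choose 2 : ℕ)) ^ (D i \ mono c).card := by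
  have h1 : A ⊆
      S.biUnion fun i => (Om n m).filter fun ω => Disjoint ω (mono c) ∧ Disjoint ω (D i) := by
    intro ω hω
    obtain ⟨h3, h4, i, hi, h2⟩ := hA ω hω
    exact mem_biUnion.2 ⟨i, hi, mem_filter.2 ⟨h3, h4, h2⟩⟩
  have h2 := (card_le_card h1).trans card_biUnion_le
  calc _ ≤ ((∑ i ∈ S, ((Om n m).filter fun ω => Disjoint ω (mono c) ∧ Disjoint ω (D i)).card : ℕ) : ℝ) := by
        exact_mod_cast h2
    _ ≤ _ := by
        push_cast
        rw [mul_sum]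
        exact sum_le_sum fun i hi => avoid_le c hmN hN (hD i hi)

/-- Markov bound -/
lemma markov_bound {ι : Type} (c : Fin n → Fin k) (hmN : m ≤ n.choose 2) (hN : 0 < n.choose 2)
    (S : Finset ι) (D : ι → Finset (Sym2 (Fin n))) (hD : ∀ i ∈ S, D i ⊆ allE n) (T : ℕ) :
    (((Om n m).filter fun ω => Disjoint ω (mono c) ∧
        ¬ (S.filter fun i => Disjoint ω (D i)).card ≤ T).card : ℝ) ≤
      ((n.choose 2 - (mono c).card).choose m : ℝ) *
        ((∑ i ∈ S, (1 - (m:ℝ) / (n.choose 2 : ℕ)) ^ (D i \ mono c).card) / (T + 1)) := by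
  rw [← mul_div_assoc, le_div_iff₀ (by positivity)]
  set A := (Om n m).filter fun ω => Disjoint ω (mono c) ∧
        ¬ (S.filter fun i => Disjoint ω (D i)).card ≤ T
  have h1 : A.card * (T + 1) ≤ ∑ ω ∈ (Om n m).filter (fun ω => Disjoint ω (mono c)),
      (S.filter fun i => Disjoint ω (D i)).card := by
    have : A ⊆ (Om n m).filter (fun ω => Disjoint ω (mono c)) := by
      intro ω hω
      rw [mem_filter] at hω ⊢
      exact ⟨hω.1, hω.2.1⟩
    refine le_trans ?_ (sum_le_sum_of_subset this)
    rw [← smul_eq_mul]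
    refine card_nsmul_le_sum _ _ _ fun ω hω => ?_
    have := (mem_filter.1 hω).2.2
    omega
  have h2 : ∑ ω ∈ (Om n m).filter (fun ω => Disjoint ω (mono c)),
      (S.filter fun i => Disjoint ω (D i)).card =
      ∑ i ∈ S, ((Om n m).filter fun ω => Disjoint ω (mono c) ∧ Disjoint ω (D i)).card := by
    simp_rw [card_filter]
    rw [sum_comm]
    refine sum_congr rfl fun i _ => ?_
    rw [sum_filter]
    refine sum_congr rfl fun ω _ => ?_
    by_cases h1 : Disjoint ω (mono c) <;> simp [h1]
  rw [h2] at h1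
  calc (A.card : ℝ) * (T + 1) ≤ ((∑ i ∈ S, ((Om n m).filter fun ω =>
        Disjoint ω (mono c) ∧ Disjoint ω (D i)).card : ℕ) : ℝ) := by exact_mod_cast h1
    _ ≤ _ := by
        push_cast
        rw [mul_sum]
        exact sum_le_sum fun i hi => avoid_le c hmN hN (hD i hi)

lemma star_allE {x : Fin n} {S : Finset (Fin n)} (h : x ∉ S) : star x S ⊆ allE n := by
  intro e he
  obtain ⟨y, hy, rfl⟩ := mem_image.1 he
  rw [mem_allE]
  exact fun hh => h (hh ▸ hy)

lemma card_star (x : Fin n) (S : Finset (Fin n)) : (star x S).card = S.card := by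
  refine card_image_of_injective _ fun y z hh => ?_
  simp only [Sym2.eq_iff] at hh
  rcases hh with hh | hh
  · exact hh.2
  · exact hh.2.trans hh.1

lemma star_mono_disj {c : Fin n → Fin k} {x : Fin n} {i : Fin k} {S : Finset (Fin n)}
    (hx : c x ≠ i) (hS : S ⊆ fib c i) : Disjoint (star x S) (mono c) := by
  rw [Finset.disjoint_left]
  intro e he
  obtain ⟨y, hy, rfl⟩ := mem_image.1 he
  rw [mem_mono]
  intro hh
  exact hx (hh.1.trans (mem_fib.1 (hS hy)))

variable {c : Fin n → Fin k} {a umin h : ℕ}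

lemma qh_nonneg (hmN : m ≤ n.choose 2) (hN : 0 < n.choose 2) : 0 ≤ 1 - (m:ℝ) / (n.choose 2 : ℕ) := by
  rw [sub_nonneg, div_le_one (by exact_mod_cast hN)]; exact_mod_cast hmN

lemma qh_le_one : 1 - (m:ℝ) / (n.choose 2 : ℕ) ≤ 1 := by
  have : 0 ≤ (m:ℝ) / (n.choose 2 : ℕ) := by positivity
  linarith

lemma F_gc (hmN : m ≤ n.choose 2) (hN : 0 < n.choose 2) (T : ℕ) :
    (((Om n m).filter fun ω => Disjoint ω (mono c) ∧ ¬ (gcList c ω).card ≤ T).card : ℝ) ≤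
      ((n.choose 2 - (mono c).card).choose m : ℝ) *
        ((n * ∑ i, (1 - (m:ℝ) / (n.choose 2 : ℕ)) ^ (fib c i).card) / (T + 1)) := by
  have h1 := markov_bound c hmN hN ((univ : Finset (Fin k × Fin n)).filter fun t => c t.2 ≠ t.1)
    (fun t => star t.2 (fib c t.1)) (by
      intro t ht
      refine star_allE ?_
      rw [mem_fib]; exact (mem_filter.1 ht).2) T
  have h2 : ∀ ω, ((univ : Finset (Fin k × Fin n)).filter fun t => c t.2 ≠ t.1).filter
      (fun t => Disjoint ω (star t.2 (fib c t.1))) = gcList c ω := by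
    intro ω
    rw [filter_filter, gcList]
  simp only [h2] at h1
  refine h1.trans ?_
  have h3 : ∑ t ∈ (univ : Finset (Fin k × Fin n)).filter (fun t => c t.2 ≠ t.1),
      (1 - (m:ℝ) / (n.choose 2 : ℕ)) ^ (star t.2 (fib c t.1) \ mono c).card ≤
      n * ∑ i, (1 - (m:ℝ) / (n.choose 2 : ℕ)) ^ (fib c i).card := by
    calc _ = ∑ t ∈ (univ : Finset (Fin k × Fin n)).filter (fun t => c t.2 ≠ t.1),
          (1 - (m:ℝ) / (n.choose 2 : ℕ)) ^ (fib c t.1).card := by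
            refine sum_congr rfl fun t ht => ?_
            rw [sdiff_eq_self_of_disjoint (star_mono_disj (mem_filter.1 ht).2 (Subset.refl _)), card_star]
      _ ≤ ∑ t : Fin k × Fin n, (1 - (m:ℝ) / (n.choose 2 : ℕ)) ^ (fib c t.1).card :=
            sum_le_sum_of_subset_of_nonneg (filter_subset _ _)
              fun _ _ _ => pow_nonneg (qh_nonneg hmN hN) _
      _ = _ := by
            rw [Fintype.sum_prod_type, mul_sum]
            simp
  gcongr

lemma F_gb (hmN : m ≤ n.choose 2) (hN : 0 < n.choose 2) (hhi : ∀ i, (fib c i).card ≤ a) (T : ℕ) :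
    (((Om n m).filter fun ω => Disjoint ω (mono c) ∧ ¬ (gbList c ω).card ≤ T).card : ℝ) ≤
      ((n.choose 2 - (mono c).card).choose m : ℝ) *
        ((n * (a + 1) * ∑ i, (1 - (m:ℝ) / (n.choose 2 : ℕ)) ^ ((fib c i).card - 1)) / (T + 1)) := by
  set S := (univ : Finset (Fin k × Fin n × Fin n)).filter fun t =>
    c t.2.2 ≠ t.1 ∧ (c t.2.1 = t.1 ∨ t.2.1 = t.2.2)
  have h1 := markov_bound c hmN hN S
    (fun t => star t.2.2 ((fib c t.1).erase t.2.1)) (by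
      intro t ht
      refine star_allE ?_
      rw [mem_erase, mem_fib]; exact fun hh => (mem_filter.1 ht).2.1 hh.2) T
  have h2 : ∀ ω, S.filter
      (fun t => Disjoint ω (star t.2.2 ((fib c t.1).erase t.2.1))) = gbList c ω := by
    intro ω
    rw [filter_filter, gbList]
    refine filter_congr fun t _ => ?_
    rw [triple, and_assoc]
  simp only [h2] at h1
  refine h1.trans ?_
  have hq0 := qh_nonneg hmN hN
  have hq1 := qh_le_one (n := n) (m := m)
  have h3 : ∑ t ∈ S,
      (1 - (m:ℝ) / (n.choose 2 : ℕ)) ^ (star t.2.2 ((fib c t.1).erase t.2.1) \ mono c).card ≤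
      n * (a + 1) * ∑ i, (1 - (m:ℝ) / (n.choose 2 : ℕ)) ^ ((fib c i).card - 1) := by
    calc _ ≤ ∑ t ∈ S, (1 - (m:ℝ) / (n.choose 2 : ℕ)) ^ ((fib c t.1).card - 1) := by
            refine sum_le_sum fun t ht => ?_
            rw [sdiff_eq_self_of_disjoint (star_mono_disj (mem_filter.1 ht).2.1 (erase_subset _ _)), card_star]
            exact pow_le_pow_of_le_one hq0 hq1 (pred_card_le_card_erase)
      _ ≤ ∑ t ∈ (univ : Finset (Fin k)).biUnion (fun i => (univ : Finset (Fin n)).biUnion fun x =>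
            (insert x (fib c i)).image fun y => (i, y, x)),
            (1 - (m:ℝ) / (n.choose 2 : ℕ)) ^ ((fib c t.1).card - 1) := by
            refine sum_le_sum_of_subset_of_nonneg ?_ fun _ _ _ => pow_nonneg hq0 _
            rintro ⟨i, y, x⟩ ht
            have := (mem_filter.1 ht).2.2
            simp only [mem_biUnion, mem_univ, true_and, mem_image, mem_insert, mem_fib]
            exact ⟨i, x, y, this.symm, rfl⟩
      _ ≤ ∑ i : Fin k, ∑ t ∈ (univ : Finset (Fin n)).biUnion (fun x =>
            (insert x (fib c i)).image fun y => (i, y, x)),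
            (1 - (m:ℝ) / (n.choose 2 : ℕ)) ^ ((fib c t.1).card - 1) := by
            refine le_of_eq (sum_biUnion ?_)
            intro i _ j _ hij
            simp only [Function.onFun, Finset.disjoint_left, mem_biUnion, mem_univ, true_and, mem_image]
            rintro t ⟨x, y, _, rfl⟩ ⟨x', y', _, hh⟩
            exact hij (congrArg Prod.fst hh).symm
      _ ≤ ∑ i : Fin k, (n * (a + 1)) * (1 - (m:ℝ) / (n.choose 2 : ℕ)) ^ ((fib c i).card - 1) := by
            refine sum_le_sum fun i _ => ?_
            set Bq := (univ : Finset (Fin n)).biUnion (fun x =>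
              (insert x (fib c i)).image fun y => (i, y, x))
            have hB : Bq.card ≤ n * (a + 1) := by
              calc _ ≤ ∑ x : Fin n, ((insert x (fib c i)).image fun y => (i, y, x)).card := card_biUnion_le
                _ ≤ ∑ x : Fin n, (a + 1) := sum_le_sum fun x _ => card_image_le.trans
                    ((card_insert_le _ _).trans (Nat.succ_le_succ (hhi i)))
                _ = _ := by simp
            calc _ = ∑ t ∈ Bq, (1 - (m:ℝ) / (n.choose 2 : ℕ)) ^ ((fib c i).card - 1) := by
                  refine sum_congr rfl fun t ht => ?_
                  simp only [Bq, mem_biUnion, mem_univ, true_and, mem_image] at ht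
                  obtain ⟨x, y, _, rfl⟩ := ht
                  rfl
              _ = Bq.card * (1 - (m:ℝ) / (n.choose 2 : ℕ)) ^ ((fib c i).card - 1) := by simp
              _ ≤ _ := by
                  refine mul_le_mul_of_nonneg_right ?_ (pow_nonneg hq0 _)
                  exact_mod_cast hB
      _ = _ := by rw [mul_sum]
  gcongr

lemma F_linked (hmN : m ≤ n.choose 2) (hN : 0 < n.choose 2)
    (hlo : ∀ i, umin ≤ (fib c i).card) (hhi : ∀ i, (fib c i).card ≤ a) :
    (((Om n m).filter fun ω => Disjoint ω (mono c) ∧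
      ∃ i1 y1 x1 i2 y2 x2, linked c ω i1 y1 x1 i2 y2 x2).card : ℝ) ≤
      ((n.choose 2 - (mono c).card).choose m : ℝ) *
        (2 * k ^ 2 * n * a * (a + 1) ^ 2 * (1 - (m:ℝ) / (n.choose 2 : ℕ)) ^ (2 * umin - 3)) := by
  have hq0 := qh_nonneg hmN hN
  have hq1 := qh_le_one (n := n) (m := m)
  set U := (univ : Finset (Fin k × Fin k)).biUnion fun ij => (univ : Finset (Fin n)).biUnion fun x1 =>
    (fib c ij.1 ∪ fib c (c x1)).biUnion fun x2 =>
      ((insert x1 (fib c ij.1)) ×ˢ (insert x2 (fib c ij.2))).image fun y =>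
        ((ij.1, y.1, x1), (ij.2, y.2, x2)) with hU
  set S := U.filter fun t => c t.1.2.2 ≠ t.1.1 ∧ c t.2.2.2 ≠ t.2.1 ∧ t.1.1 ≠ t.2.1 ∧ t.1.2.2 ≠ t.2.2.2
  have h1 := union_bound (m := m) c hmN hN S
    (fun t => star t.1.2.2 ((fib c t.1.1).erase t.1.2.1) ∪ star t.2.2.2 ((fib c t.2.1).erase t.2.2.1)) (by
      intro t ht
      have ht := (mem_filter.1 ht).2
      refine union_subset (star_allE ?_) (star_allE ?_)
      · rw [mem_erase, mem_fib]; exact fun hh => ht.1 hh.2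
      · rw [mem_erase, mem_fib]; exact fun hh => ht.2.1 hh.2)
    ((Om n m).filter fun ω => Disjoint ω (mono c) ∧
      ∃ i1 y1 x1 i2 y2 x2, linked c ω i1 y1 x1 i2 y2 x2) (by
      intro ω hω
      obtain ⟨hO, hp, i1, y1, x1, i2, y2, x2, ⟨a1, a2, a3⟩, ⟨b1, b2, b3⟩, h3, h4, h5⟩ := mem_filter.1 hω
      refine ⟨hO, hp, ((i1, y1, x1), (i2, y2, x2)), mem_filter.2 ⟨?_, a1, b1, h3, h4⟩, ?_⟩
      · simp only [hU, mem_biUnion, mem_univ, true_and, mem_image, mem_union, mem_fib, mem_product, mem_insert]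
        exact ⟨(i1, i2), x1, x2, h5.imp id Eq.symm, (y1, y2), ⟨a2.symm, b2.symm⟩, rfl⟩
      · exact disjoint_union_right.2 ⟨a3, b3⟩)
  refine h1.trans ?_
  refine mul_le_mul_of_nonneg_left ?_ (by positivity)
  have hUc : S.card ≤ 2 * k ^ 2 * n * a * (a + 1) ^ 2 := by
    refine (card_filter_le _ _).trans ?_
    calc _ ≤ ∑ ij : Fin k × Fin k, ∑ x1 : Fin n, ∑ x2 ∈ fib c ij.1 ∪ fib c (c x1), (a + 1) * (a + 1) := by
          refine card_biUnion_le.trans (sum_le_sum fun ij _ => ?_)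
          refine card_biUnion_le.trans (sum_le_sum fun x1 _ => ?_)
          refine card_biUnion_le.trans (sum_le_sum fun x2 _ => ?_)
          refine card_image_le.trans ?_
          rw [card_product]
          exact Nat.mul_le_mul ((card_insert_le _ _).trans (Nat.succ_le_succ (hhi _)))
            ((card_insert_le _ _).trans (Nat.succ_le_succ (hhi _)))
      _ ≤ ∑ ij : Fin k × Fin k, ∑ x1 : Fin n, (2 * a) * ((a + 1) * (a + 1)) := by
          refine sum_le_sum fun ij _ => sum_le_sum fun x1 _ => ?_
          rw [sum_const, smul_eq_mul]
          refine Nat.mul_le_mul_right _ ((card_union_le _ _).trans ?_)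
          have := hhi ij.1
          have := hhi (c x1)
          omega
      _ = _ := by
          simp
          ring
  calc _ ≤ ∑ t ∈ S, (1 - (m:ℝ) / (n.choose 2 : ℕ)) ^ (2 * umin - 3) := by
        refine sum_le_sum ?_
        rintro ⟨⟨i1, y1, x1⟩, i2, y2, x2⟩ ht
        have ht := (mem_filter.1 ht).2
        simp only at ht ⊢
        obtain ⟨q1, q2, q3, q4⟩ := ht
        refine pow_le_pow_of_le_one hq0 hq1 ?_
        have d1 := star_mono_disj q1 (erase_subset y1 (fib c i1))
        have d2 := star_mono_disj q2 (erase_subset y2 (fib c i2))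
        rw [sdiff_eq_self_of_disjoint (disjoint_union_left.2 ⟨d1, d2⟩)]
        have e1 := card_union_add_card_inter (star x1 ((fib c i1).erase y1)) (star x2 ((fib c i2).erase y2))
        have e2 : (star x1 ((fib c i1).erase y1) ∩ star x2 ((fib c i2).erase y2)).card ≤ 1 := by
          refine le_trans (card_le_card (t := {s(x1, x2)}) ?_) (by simp)
          intro e he
          rw [mem_inter] at he
          obtain ⟨z1, hz1, rfl⟩ := mem_image.1 he.1
          obtain ⟨z2, hz2, hh⟩ := mem_image.1 he.2
          rw [mem_singleton]
          rw [Sym2.eq_iff] at hh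
          rcases hh with hh | hh
          · exact absurd hh.1.symm q4
          · rw [hh.1]
        rw [card_star, card_star] at e1
        have e3 : (fib c i1).card - 1 ≤ ((fib c i1).erase y1).card := pred_card_le_card_erase
        have e4 : (fib c i2).card - 1 ≤ ((fib c i2).erase y2).card := pred_card_le_card_erase
        have e5 := hlo i1
        have e6 := hlo i2
        omega
    _ = S.card * (1 - (m:ℝ) / (n.choose 2 : ℕ)) ^ (2 * umin - 3) := by simp
    _ ≤ _ := by
        refine mul_le_mul_of_nonneg_right ?_ (pow_nonneg hq0 _)
        exact_mod_cast hUc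

end TC

end PartF

section PartF2

namespace TC
open Finset

variable {n k m : ℕ} {c : Fin n → Fin k} {a umin h R s1 : ℕ}

lemma prs_inter_mono (c : Fin n → Fin k) (T : Finset (Fin n)) :
    (prs T ∩ mono c).card = ∑ l, ((T ∩ fib c l).card).choose 2 := by
  have h1 : prs T ∩ mono c = univ.biUnion fun l => prs (T ∩ fib c l) := by
    ext e
    rw [mem_inter, mem_biUnion]
    induction e using Sym2.ind with
    | _ x y =>
    simp only [mem_prs, mem_mono, mem_univ, true_and, mem_inter, mem_fib]
    constructor
    · rintro ⟨⟨h1, h2, h3⟩, h4, _⟩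
      exact ⟨c x, ⟨h1, rfl⟩, ⟨h2, h4.symm⟩, h3⟩
    · rintro ⟨l, ⟨h1, h2⟩, ⟨h3, h4⟩, h5⟩
      exact ⟨⟨h1, h3, h5⟩, h2.trans h4.symm, h5⟩
  rw [h1, card_biUnion]
  · exact sum_congr rfl fun l _ => card_prs _
  · intro i _ j _ hij
    exact prs_disj ((fib_disj c hij).mono inter_subset_right inter_subset_right)

lemma two_choose (t : ℕ) : 2 * t.choose 2 = t * (t - 1) := by
  rw [Nat.choose_two_right]
  exact Nat.mul_div_cancel' (Nat.even_mul_pred_self t).two_dvd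

lemma sum_inter (c : Fin n → Fin k) (T : Finset (Fin n)) : ∑ l, (T ∩ fib c l).card = T.card := by
  rw [card_eq_sum_card_fiberwise (f := c) (t := univ) (fun x _ => mem_univ _)]
  refine sum_congr rfl fun l _ => ?_
  congr 1
  ext x
  simp [mem_fib]

lemma edges_eq (c : Fin n → Fin k) (T : Finset (Fin n)) :
    T.card * (T.card - 1) = 2 * (prs T \ mono c).card +
      ∑ l, (T ∩ fib c l).card * ((T ∩ fib c l).card - 1) := by
  have h1 := card_sdiff_add_card_inter (prs T) (mono c)
  rw [card_prs, prs_inter_mono] at h1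
  rw [← two_choose, ← h1, mul_add, mul_sum]
  simp only [two_choose]

lemma edges_lb (T : Finset (Fin n)) (hR : ∀ l, (T ∩ fib c l).card ≤ R) :
    T.card * (T.card - 1) ≤ 2 * (prs T \ mono c).card +
      R * (T.card - (univ.filter fun l => (T ∩ fib c l).Nonempty).card) := by
  rw [edges_eq c T]
  refine Nat.add_le_add_left ?_ _
  set S := univ.filter fun l => (T ∩ fib c l).Nonempty
  have h2 : ∑ l, ((T ∩ fib c l).card - 1) = T.card - S.card := by
    have h3 : ∑ l, (((T ∩ fib c l).card - 1) + if (T ∩ fib c l).Nonempty then 1 else 0) = T.card := by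
      rw [← sum_inter c T]
      refine sum_congr rfl fun l _ => ?_
      by_cases hl : (T ∩ fib c l).Nonempty
      · rw [if_pos hl]
        have := card_pos.2 hl
        omega
      · rw [if_neg hl, not_nonempty_iff_eq_empty.1 hl]; simp
    rw [sum_add_distrib] at h3
    have h4 : S.card = ∑ l, if (T ∩ fib c l).Nonempty then 1 else 0 := card_filter _ _
    omega
  rw [← h2, mul_sum]
  exact sum_le_sum fun l _ => Nat.mul_le_mul_right _ (hR l)

lemma edges_lb2 (T : Finset (Fin n)) (hh : 1 ≤ h) (hR : ∀ l, (T ∩ fib c l).card ≤ h) :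
    T.card * (T.card - h) ≤ 2 * (prs T \ mono c).card := by
  have h1 := edges_eq c T
  have h2 : ∑ l, (T ∩ fib c l).card * ((T ∩ fib c l).card - 1) ≤ T.card * (h - 1) := by
    rw [← sum_inter c T, sum_mul]
    exact sum_le_sum fun l _ => Nat.mul_le_mul_left _ (by have := hR l; omega)
  have h3 : T.card * (T.card - h) + T.card * (h - 1) ≤ T.card * (T.card - 1) ∨ T.card < h := by
    by_cases hlt : T.card < h
    · exact Or.inr hlt
    · left
      rw [← mul_add]
      exact Nat.mul_le_mul_left _ (by omega)
  rcases h3 with h3 | h3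
  · omega
  · rw [Nat.sub_eq_zero_of_le h3.le]; simp

lemma edges_lb1 (T : Finset (Fin n)) (i : Fin k) :
    (T ∩ fib c i).card * (T \ fib c i).card ≤ (prs T \ mono c).card := by
  rw [← card_product]
  refine card_le_card_of_injOn (fun x => s(x.1, x.2)) ?_ ?_
  · rintro ⟨x, y⟩ hx
    simp only [coe_product, Set.mem_prod, mem_coe, mem_inter, Finset.mem_sdiff, mem_fib] at hx
    simp only [mem_coe, Finset.mem_sdiff, mem_prs, mem_mono]
    obtain ⟨⟨h1, h2⟩, h3, h4⟩ := hx
    have h5 : c x ≠ c y := fun hh => h4 (hh.symm.trans h2)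
    exact ⟨⟨h1, h3, fun hh => h5 (congrArg c hh)⟩, fun hh => h5 hh.1⟩
  · rintro ⟨x, y⟩ hx ⟨x', y'⟩ hx' hh
    simp only [coe_product, Set.mem_prod, mem_coe, mem_inter, Finset.mem_sdiff, mem_fib] at hx hx'
    simp only [Sym2.eq_iff] at hh
    rcases hh with hh | hh
    · rw [hh.1, hh.2]
    · exfalso
      exact hx'.2.2 (hh.1 ▸ hx.1.2)

def RD (a umin R : ℕ) : Finset (ℕ × ℕ) :=
  (range (a + 1) ×ˢ range (a + 1)).filter fun x => R < x.1 ∧ 2 ≤ x.2 ∧ umin ≤ x.1 + x.2 ∧ x.1 + x.2 ≤ a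

def US (a umin h : ℕ) : Finset (ℕ × ℕ) :=
  (range (a + 1) ×ˢ range (a + 1)).filter fun x => umin ≤ x.1 ∧ x.2 + h ≤ x.1

lemma count1 (hhi : ∀ i, (fib c i).card ≤ a) (i : Fin k) (r d : ℕ) :
    ((univ : Finset (Finset (Fin n))).filter fun T => (T ∩ fib c i).card = r ∧
      (T \ fib c i).card = d).card ≤ a.choose r * n ^ d := by
  have h1 : ((univ : Finset (Finset (Fin n))).filter fun T => (T ∩ fib c i).card = r ∧
      (T \ fib c i).card = d).card ≤ (powersetCard r (fib c i) ×ˢ powersetCard d (univ : Finset (Fin n))).card := by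
    refine card_le_card_of_injOn (fun T => (T ∩ fib c i, T \ fib c i)) ?_ ?_
    · intro T hT
      simp only [coe_filter, mem_univ, true_and, Set.mem_ofPred_eq] at hT
      simp only [mem_coe, mem_product, mem_powersetCard]
      exact ⟨⟨inter_subset_right, hT.1⟩, subset_univ _, hT.2⟩
    · intro T _ T' _ hh
      simp only [Prod.mk.injEq] at hh
      rw [← sdiff_union_inter T (fib c i), ← sdiff_union_inter T' (fib c i), hh.1, hh.2]
  refine h1.trans ?_
  rw [card_product, card_powersetCard, card_powersetCard, card_univ, Fintype.card_fin]
  exact Nat.mul_le_mul (Nat.choose_le_choose _ (hhi i)) (Nat.choose_le_pow _ _)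

lemma count2 (hhi : ∀ i, (fib c i).card ≤ a) (u s : ℕ) (hu : u ≤ a) (hs : s ≤ a) :
    ((univ : Finset (Finset (Fin n))).filter fun T => T.card = u ∧
      (univ.filter fun l => (T ∩ fib c l).Nonempty).card = s).card ≤ k ^ s * (a * a + 1) ^ a := by
  have h1 : ((univ : Finset (Finset (Fin n))).filter fun T => T.card = u ∧
      (univ.filter fun l => (T ∩ fib c l).Nonempty).card = s) ⊆
      (powersetCard s (univ : Finset (Fin k))).biUnion fun C =>
        (univ.filter fun x => c x ∈ C).powerset.filter fun S => S.card ≤ a := by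
    intro T hT
    rw [mem_filter] at hT
    rw [mem_biUnion]
    refine ⟨univ.filter fun l => (T ∩ fib c l).Nonempty, mem_powersetCard.2 ⟨subset_univ _, hT.2.2⟩, ?_⟩
    rw [mem_filter, mem_powerset]
    refine ⟨fun x hx => ?_, by omega⟩
    simp only [mem_filter, mem_univ, true_and]
    exact ⟨x, mem_inter.2 ⟨hx, mem_fib.2 rfl⟩⟩
  refine (card_le_card h1).trans (card_biUnion_le.trans ?_)
  calc _ ≤ ∑ C ∈ powersetCard s (univ : Finset (Fin k)), (a * a + 1) ^ a := by
        refine sum_le_sum fun C hC => (card_small_subsets _ _).trans ?_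
        refine Nat.pow_le_pow_left (Nat.succ_le_succ ?_) _
        rw [card_fibU]
        calc _ ≤ ∑ j ∈ C, a := sum_le_sum fun j _ => hhi j
          _ = C.card * a := by simp
          _ ≤ a * a := Nat.mul_le_mul_right _ (by rw [(mem_powersetCard.1 hC).2]; exact hs)
    _ = k.choose s * (a * a + 1) ^ a := by simp
    _ ≤ _ := Nat.mul_le_mul_right _ (Nat.choose_le_pow _ _)

lemma F_ga (hmN : m ≤ n.choose 2) (hN : 0 < n.choose 2) (h1h : 1 ≤ h)
    (hhi : ∀ i, (fib c i).card ≤ a) (R : ℕ) :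
    (((Om n m).filter fun ω => Disjoint ω (mono c) ∧
      ¬ ∀ (T : Finset (Fin n)) (i : Fin k), Disjoint ω (prs T) → umin ≤ T.card → T.card ≤ a →
        h < (T ∩ fib c i).card → (T \ fib c i).card ≤ 1).card : ℝ) ≤
      ((n.choose 2 - (mono c).card).choose m : ℝ) *
        ((∑ x ∈ RD a umin R, (k:ℝ) * ((a.choose x.1 * n ^ x.2 : ℕ) : ℝ) *
            (1 - (m:ℝ) / (n.choose 2 : ℕ)) ^ (x.1 * x.2)) +
          ∑ x ∈ US a umin h, ((k ^ x.2 * (a * a + 1) ^ a : ℕ) : ℝ) *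
            (1 - (m:ℝ) / (n.choose 2 : ℕ)) ^ ((x.1 * (x.1 - 1) - R * (x.1 - x.2)) / 2)) := by
  have hq0 := qh_nonneg hmN hN
  have hq1 := qh_le_one (n := n) (m := m)
  set q := 1 - (m:ℝ) / (n.choose 2 : ℕ)
  set S1 : Finset ((Fin k × ℕ × ℕ) × Finset (Fin n)) :=
    (((univ : Finset (Fin k)) ×ˢ RD a umin R) ×ˢ univ).filter fun t =>
      (t.2 ∩ fib c t.1.1).card = t.1.2.1 ∧ (t.2 \ fib c t.1.1).card = t.1.2.2
  set S2 : Finset ((ℕ × ℕ) × Finset (Fin n)) := ((US a umin h) ×ˢ univ).filter fun t =>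
      (t.2.card = t.1.1 ∧ (univ.filter fun l => (t.2 ∩ fib c l).Nonempty).card = t.1.2) ∧
        ∀ l, (t.2 ∩ fib c l).card ≤ R
  have hub := union_bound (m := m) c hmN hN (S1.disjSum S2)
    (fun t => t.elim (fun t => prs t.2) (fun t => prs t.2)) (by
      rintro (t | t) _ <;> exact prs_subset_allE _)
    ((Om n m).filter fun ω => Disjoint ω (mono c) ∧
      ¬ ∀ (T : Finset (Fin n)) (i : Fin k), Disjoint ω (prs T) → umin ≤ T.card → T.card ≤ a →
        h < (T ∩ fib c i).card → (T \ fib c i).card ≤ 1) (by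
      intro ω hω
      obtain ⟨hO, hp, hne⟩ := mem_filter.1 hω
      push Not at hne
      obtain ⟨T, i, hd, hlo, hup, hbig, hex⟩ := hne
      refine ⟨hO, hp, ?_⟩
      by_cases hall : ∀ l, (T ∩ fib c l).card ≤ R
      · refine ⟨Sum.inr ((T.card, (univ.filter fun l => (T ∩ fib c l).Nonempty).card), T), ?_, hd⟩
        rw [inr_mem_disjSum, mem_filter, mem_product]
        refine ⟨⟨?_, mem_univ _⟩, ⟨rfl, rfl⟩, hall⟩
        have hs : (univ.filter fun l => (T ∩ fib c l).Nonempty).card + h ≤ T.card := by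
          rw [card_filter, ← sum_inter c T, ← add_sum_erase _ _ (mem_univ i),
            ← add_sum_erase _ (fun l => (T ∩ fib c l).card) (mem_univ i)]
          have e1 : ∑ l ∈ univ.erase i, (if (T ∩ fib c l).Nonempty then 1 else 0) ≤
              ∑ l ∈ univ.erase i, (T ∩ fib c l).card := by
            refine sum_le_sum fun l _ => ?_
            split_ifs with hl
            · exact card_pos.2 hl
            · exact Nat.zero_le _
          have e2 : (if (T ∩ fib c i).Nonempty then 1 else 0) ≤ 1 := by split_ifs <;> omega
          omega
        rw [US, mem_filter, mem_product, mem_range, mem_range]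
        simp only
        omega
      · push Not at hall
        obtain ⟨l, hl⟩ := hall
        by_cases hmx : 2 ≤ (T \ fib c l).card
        · refine ⟨Sum.inl ((l, (T ∩ fib c l).card, (T \ fib c l).card), T), ?_, hd⟩
          rw [inl_mem_disjSum, mem_filter, mem_product, mem_product]
          refine ⟨⟨⟨mem_univ _, ?_⟩, mem_univ _⟩, rfl, rfl⟩
          have := card_inter_add_card_sdiff T (fib c l)
          rw [RD, mem_filter, mem_product, mem_range, mem_range]
          simp only
          omega
        · exfalso
          by_cases hil : i = l
          · subst hil; omega
          · have : T ∩ fib c i ⊆ T \ fib c l := by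
              intro x hx
              rw [mem_inter] at hx
              exact Finset.mem_sdiff.2 ⟨hx.1, fun hh => Finset.disjoint_left.1 (fib_disj c hil) hx.2 hh⟩
            have := card_le_card this
            omega)
  refine hub.trans (mul_le_mul_of_nonneg_left ?_ (by positivity))
  rw [sum_disjSum]
  refine add_le_add ?_ ?_
  · simp only [Sum.elim_inl]
    rw [sum_filter, sum_product, sum_product, sum_comm]
    refine sum_le_sum fun x hx => ?_
    have : ∀ i : Fin k, (∑ T : Finset (Fin n), if (T ∩ fib c i).card = x.1 ∧ (T \ fib c i).card = x.2 then
        q ^ (prs T \ mono c).card else 0) ≤ ((a.choose x.1 * n ^ x.2 : ℕ) : ℝ) * q ^ (x.1 * x.2) := by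
      intro i
      rw [← sum_filter]
      calc _ ≤ ∑ T ∈ (univ : Finset (Finset (Fin n))).filter (fun T => (T ∩ fib c i).card = x.1 ∧
            (T \ fib c i).card = x.2), q ^ (x.1 * x.2) := by
            refine sum_le_sum fun T hT => pow_le_pow_of_le_one hq0 hq1 ?_
            have h2 := (mem_filter.1 hT).2
            rw [← h2.1, ← h2.2]
            exact edges_lb1 T i
        _ ≤ _ := by
            rw [sum_const, nsmul_eq_mul]
            refine mul_le_mul_of_nonneg_right ?_ (pow_nonneg hq0 _)
            exact_mod_cast count1 hhi i x.1 x.2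
    calc _ ≤ ∑ i : Fin k, ((a.choose x.1 * n ^ x.2 : ℕ) : ℝ) * q ^ (x.1 * x.2) := sum_le_sum fun i _ => this i
      _ = _ := by rw [sum_const, card_univ, Fintype.card_fin, nsmul_eq_mul, mul_assoc]
  · simp only [Sum.elim_inr]
    rw [sum_filter, sum_product]
    refine sum_le_sum fun x hx => ?_
    rw [US, mem_filter, mem_product, mem_range, mem_range] at hx
    rw [← sum_filter]
    calc _ ≤ ∑ T ∈ (univ : Finset (Finset (Fin n))).filter (fun T => (T.card = x.1 ∧
            (univ.filter fun l => (T ∩ fib c l).Nonempty).card = x.2) ∧ ∀ l, (T ∩ fib c l).card ≤ R),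
            q ^ ((x.1 * (x.1 - 1) - R * (x.1 - x.2)) / 2) := by
            refine sum_le_sum fun T hT => pow_le_pow_of_le_one hq0 hq1 ?_
            have h2 := (mem_filter.1 hT).2
            rw [← h2.1.1, ← h2.1.2]
            have := edges_lb T h2.2
            simp only
            omega
      _ ≤ _ := by
            rw [sum_const, nsmul_eq_mul]
            refine mul_le_mul_of_nonneg_right ?_ (pow_nonneg hq0 _)
            have h3 := count2 hhi x.1 x.2 (by omega) (by omega)
            have h4 : ((univ : Finset (Finset (Fin n))).filter (fun T => (T.card = x.1 ∧
              (univ.filter fun l => (T ∩ fib c l).Nonempty).card = x.2) ∧ ∀ l, (T ∩ fib c l).card ≤ R)).card ≤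
              k ^ x.2 * (a * a + 1) ^ a := by
              refine le_trans (card_le_card ?_) h3
              intro T hT
              rw [mem_filter] at hT ⊢
              exact ⟨hT.1, hT.2.1⟩
            exact_mod_cast h4

lemma count3 (hhi : ∀ i, (fib c i).card ≤ a) (t w : ℕ) (I : Finset (Fin k)) (hI : I.card = t) :
    ((univ : Finset (Fin n → Option (Fin t))).filter fun lab =>
      (univ.filter fun x => lab x ≠ none ∧ c x ∉ I).card ≤ w).card ≤
      (t + 1) ^ (a * t) * (n * t + 1) ^ w := by
  set U : Finset (Fin n) := univ.filter fun x => c x ∈ I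
  have h1 : ((univ : Finset (Fin n → Option (Fin t))).filter fun lab =>
      (univ.filter fun x => lab x ≠ none ∧ c x ∉ I).card ≤ w).card ≤
      ((univ : Finset (U → Option (Fin t))) ×ˢ
        ((univ : Finset (Fin n × Fin t)).powerset.filter fun S => S.card ≤ w)).card := by
    refine card_le_card_of_injOn (fun lab => (fun x => lab x.1,
      univ.filter fun y : Fin n × Fin t => c y.1 ∉ I ∧ lab y.1 = some y.2)) ?_ ?_
    · intro lab hl
      simp only [coe_filter, mem_univ, true_and, Set.mem_ofPred_eq] at hl
      simp only [mem_coe, mem_product, mem_univ, true_and, mem_filter, mem_powerset, subset_univ]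
      refine le_trans (card_le_card_of_injOn Prod.fst ?_ ?_) hl
      · intro y hy
        simp only [coe_filter, mem_univ, true_and, Set.mem_ofPred_eq] at hy ⊢
        exact ⟨by rw [hy.2]; simp, hy.1⟩
      · rintro ⟨x, j⟩ hy ⟨x', j'⟩ hy' hh
        simp only [coe_filter, mem_univ, true_and, Set.mem_ofPred_eq] at hy hy' hh
        subst hh
        have := Option.some.inj (hy.2.symm.trans hy'.2)
        rw [this]
    · intro lab _ lab' _ hh
      simp only [Prod.mk.injEq] at hh
      funext x
      by_cases hx : c x ∈ I
      · exact congrFun hh.1 ⟨x, mem_filter.2 ⟨mem_univ _, hx⟩⟩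
      · have h3 : ∀ j, lab x = some j ↔ lab' x = some j := by
          intro j
          have := Finset.ext_iff.1 hh.2 (x, j)
          simpa [hx] using this
        exact Option.ext h3
  refine h1.trans ?_
  rw [card_product, card_univ, Fintype.card_fun, Fintype.card_option, Fintype.card_fin, Fintype.card_coe]
  refine Nat.mul_le_mul (Nat.pow_le_pow_right (by omega) ?_) ((card_small_subsets _ _).trans (le_of_eq ?_))
  · rw [card_fibU, ← hI]
    calc _ ≤ ∑ j ∈ I, a := sum_le_sum fun j _ => hhi j
      _ = _ := by simp [mul_comm]
  · simp

/-- no bad extra structures -/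
def geOK (c : Fin n → Fin k) (ω : Finset (Sym2 (Fin n))) (h umin a s1 : ℕ) : Prop :=
  ∀ t, 1 ≤ t → t ≤ s1 → ∀ (I : Finset (Fin k)) (lab : Fin n → Option (Fin t)),
    ¬ badE c ω h umin a t I lab

lemma F_ge (hmN : m ≤ n.choose 2) (hN : 0 < n.choose 2) (h1h : 1 ≤ h)
    (hhi : ∀ i, (fib c i).card ≤ a) (s1 : ℕ) :
    (((Om n m).filter fun ω => Disjoint ω (mono c) ∧
      ¬ geOK c ω h umin a s1).card : ℝ) ≤
      ((n.choose 2 - (mono c).card).choose m : ℝ) *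
        ∑ t ∈ Icc 1 s1, ((k ^ t * ((t + 1) ^ (a * t) * (n * t + 1) ^ ((a - umin + 1) * t)) : ℕ) : ℝ) *
            (1 - (m:ℝ) / (n.choose 2 : ℕ)) ^ (t * (umin * (umin - h) / 2)) := by
  have hq0 := qh_nonneg hmN hN
  have hq1 := qh_le_one (n := n) (m := m)
  set q := 1 - (m:ℝ) / (n.choose 2 : ℕ)
  set S : Finset (Σ t : ℕ, Finset (Fin k) × (Fin n → Option (Fin t))) :=
    (Icc 1 s1).sigma fun t => ((powersetCard t univ) ×ˢ univ).filter fun x =>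
      (univ.filter fun y => x.2 y ≠ none ∧ c y ∉ x.1).card ≤ (a - umin + 1) * t ∧
      ∀ j, umin ≤ (univ.filter fun y => x.2 y = some j).card ∧
        ∀ i, ((univ.filter fun y => x.2 y = some j) ∩ fib c i).card ≤ h
  have hub := union_bound (m := m) c hmN hN S
    (fun t => univ.biUnion fun j => prs (univ.filter fun y => t.2.2 y = some j)) (by
      rintro t _
      exact biUnion_subset.2 fun j _ => prs_subset_allE _)
    ((Om n m).filter fun ω => Disjoint ω (mono c) ∧
      ¬ geOK c ω h umin a s1) (by
      intro ω hω
      obtain ⟨hO, hp, hne⟩ := mem_filter.1 hω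
      unfold geOK at hne
      push Not at hne
      obtain ⟨t, h1, h2, I, lab, h3, h4, h5⟩ := hne
      refine ⟨hO, hp, ⟨t, I, lab⟩, ?_, ?_⟩
      · simp only [S, mem_sigma, mem_Icc, mem_filter, mem_product, mem_powersetCard, mem_univ, subset_univ,
          true_and, and_true]
        exact ⟨⟨h1, h2⟩, h3, by simpa using h5, fun j => ⟨(h4 j).2.1, (h4 j).2.2.2⟩⟩
      · rw [disjoint_biUnion_right]
        exact fun j _ => (h4 j).1)
  refine hub.trans (mul_le_mul_of_nonneg_left ?_ (by positivity))
  rw [sum_sigma]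
  refine sum_le_sum fun t ht => ?_
  set e := t * (umin * (umin - h) / 2)
  have hpt : ∀ x ∈ ((powersetCard t (univ : Finset (Fin k))) ×ˢ (univ : Finset (Fin n → Option (Fin t)))).filter
      (fun x => (univ.filter fun y => x.2 y ≠ none ∧ c y ∉ x.1).card ≤ (a - umin + 1) * t ∧
      ∀ j, umin ≤ (univ.filter fun y => x.2 y = some j).card ∧
        ∀ i, ((univ.filter fun y => x.2 y = some j) ∩ fib c i).card ≤ h),
      q ^ ((univ.biUnion fun j => prs (univ.filter fun y => x.2 y = some j)) \ mono c).card ≤ q ^ e := by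
    intro x hx
    have hx := (mem_filter.1 hx).2.2
    refine pow_le_pow_of_le_one hq0 hq1 ?_
    have h1 : (univ.biUnion fun j => prs (univ.filter fun y => x.2 y = some j)) \ mono c =
        univ.biUnion fun j => (prs (univ.filter fun y => x.2 y = some j) \ mono c) := by
      ext z; simp only [Finset.mem_sdiff, mem_biUnion, mem_univ, true_and]; tauto
    rw [h1, card_biUnion]
    · calc e = ∑ j : Fin t, (umin * (umin - h) / 2) := by simp [e]
        _ ≤ _ := by
          refine sum_le_sum fun j _ => ?_
          have h2 := edges_lb2 (c := c) _ h1h (hx j).2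
          have h3 := (hx j).1
          have h4 : umin * (umin - h) ≤ (univ.filter fun y => x.2 y = some j).card *
            ((univ.filter fun y => x.2 y = some j).card - h) := Nat.mul_le_mul h3 (by omega)
          omega
    · intro i _ j _ hij
      refine Disjoint.mono sdiff_subset sdiff_subset (prs_disj ?_)
      rw [Finset.disjoint_left]
      intro y hy hy'
      simp only [mem_filter, mem_univ, true_and] at hy hy'
      exact hij (Option.some.inj (hy.symm.trans hy'))
  refine (sum_le_sum hpt).trans ?_
  rw [sum_const, nsmul_eq_mul]
  refine mul_le_mul_of_nonneg_right ?_ (pow_nonneg hq0 _)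
  have hcard : (((powersetCard t (univ : Finset (Fin k))) ×ˢ (univ : Finset (Fin n → Option (Fin t)))).filter
      (fun x => (univ.filter fun y => x.2 y ≠ none ∧ c y ∉ x.1).card ≤ (a - umin + 1) * t ∧
      ∀ j, umin ≤ (univ.filter fun y => x.2 y = some j).card ∧
        ∀ i, ((univ.filter fun y => x.2 y = some j) ∩ fib c i).card ≤ h)).card ≤
      k ^ t * ((t + 1) ^ (a * t) * (n * t + 1) ^ ((a - umin + 1) * t)) := by
    refine le_trans (card_le_card (t := (powersetCard t (univ : Finset (Fin k))).biUnion fun I =>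
      ((univ : Finset (Fin n → Option (Fin t))).filter fun lab =>
      (univ.filter fun x => lab x ≠ none ∧ c x ∉ I).card ≤ (a - umin + 1) * t).image fun lab => (I, lab)) ?_) ?_
    · rintro ⟨I, lab⟩ hx
      rw [mem_filter, mem_product] at hx
      rw [mem_biUnion]
      exact ⟨I, hx.1.1, mem_image.2 ⟨lab, mem_filter.2 ⟨mem_univ _, hx.2.1⟩, rfl⟩⟩
    · refine card_biUnion_le.trans ?_
      calc _ ≤ ∑ I ∈ powersetCard t (univ : Finset (Fin k)),
            ((t + 1) ^ (a * t) * (n * t + 1) ^ ((a - umin + 1) * t)) := by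
            refine sum_le_sum fun I hI => card_image_le.trans ?_
            exact count3 hhi t _ I (mem_powersetCard.1 hI).2
        _ = k.choose t * ((t + 1) ^ (a * t) * (n * t + 1) ^ ((a - umin + 1) * t)) := by simp
        _ ≤ _ := Nat.mul_le_mul_right _ (Nat.choose_le_pow _ _)
  exact_mod_cast hcard

/-- the first moment estimate -/
lemma F_good (hmN : m ≤ n.choose 2) (hN : 0 < n.choose 2) (h1h : 1 ≤ h)
    (hlo : ∀ i, umin ≤ (fib c i).card) (hhi : ∀ i, (fib c i).card ≤ a) (R s1 lam lam' : ℕ)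
    (e1 e2 e3 e4 e5 e6 : ℝ) (q : ℝ) (hq : q = 1 - (m:ℝ) / (n.choose 2 : ℕ))
    (h1 : ∑ x ∈ RD a umin R, (k:ℝ) * ((a.choose x.1 * n ^ x.2 : ℕ) : ℝ) * q ^ (x.1 * x.2) ≤ e1)
    (h2 : ∑ x ∈ US a umin h, ((k ^ x.2 * (a * a + 1) ^ a : ℕ) : ℝ) *
            q ^ ((x.1 * (x.1 - 1) - R * (x.1 - x.2)) / 2) ≤ e2)
    (h3 : (n * (a + 1) * ∑ i, q ^ ((fib c i).card - 1)) / (lam' + 1) ≤ e3)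
    (h4 : (n * ∑ i, q ^ (fib c i).card) / (lam + 1) ≤ e4)
    (h5 : 2 * k ^ 2 * n * a * (a + 1) ^ 2 * q ^ (2 * umin - 3) ≤ e5)
    (h6 : ∑ t ∈ Icc 1 s1, ((k ^ t * ((t + 1) ^ (a * t) * (n * t + 1) ^ ((a - umin + 1) * t)) : ℕ) : ℝ) *
            q ^ (t * (umin * (umin - h) / 2)) ≤ e6) :
    (1 - (e1 + e2 + e3 + e4 + e5 + e6)) * ((n.choose 2 - (mono c).card).choose m : ℝ) ≤
      (((Om n m).filter fun ω => Good h umin a s1 lam lam' c ω).card : ℝ) := by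
  subst hq
  set M := ((n.choose 2 - (mono c).card).choose m : ℝ) with hM
  have hM0 : 0 ≤ M := by positivity
  have g1 := F_ga (umin := umin) hmN hN h1h hhi R
  have g2 := F_gb hmN hN hhi lam'
  have g3 := F_gc (c := c) hmN hN lam
  have g4 := F_linked hmN hN hlo hhi
  have g5 := F_ge (umin := umin) hmN hN h1h hhi s1
  have hall : (((Om n m).filter fun ω => Disjoint ω (mono c)).card : ℝ) = M := by
    rw [card_avoid (mono_subset c)]
  have hsub : ((Om n m).filter fun ω => Disjoint ω (mono c)) ⊆
      ((Om n m).filter fun ω => Good h umin a s1 lam lam' c ω) ∪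
      (((Om n m).filter fun ω => Disjoint ω (mono c) ∧
      ¬ ∀ (T : Finset (Fin n)) (i : Fin k), Disjoint ω (prs T) → umin ≤ T.card → T.card ≤ a →
        h < (T ∩ fib c i).card → (T \ fib c i).card ≤ 1) ∪
      (((Om n m).filter fun ω => Disjoint ω (mono c) ∧ ¬ (gbList c ω).card ≤ lam') ∪
      (((Om n m).filter fun ω => Disjoint ω (mono c) ∧ ¬ (gcList c ω).card ≤ lam) ∪
      (((Om n m).filter fun ω => Disjoint ω (mono c) ∧
      ∃ i1 y1 x1 i2 y2 x2, linked c ω i1 y1 x1 i2 y2 x2) ∪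
      ((Om n m).filter fun ω => Disjoint ω (mono c) ∧
      ¬ geOK c ω h umin a s1))))) := by
    intro ω hω
    obtain ⟨hO, hp⟩ := mem_filter.1 hω
    simp only [mem_union, mem_filter, hO, hp, true_and]
    by_contra hcon
    simp only [not_or, not_not] at hcon
    obtain ⟨w0, w1, w2, w3, w4, w5⟩ := hcon
    exact w0 ⟨hp, w1, w2, w3, fun i1 y1 x1 i2 y2 x2 hl => w4 ⟨i1, y1, x1, i2, y2, x2, hl⟩, w5⟩
  have hc := card_le_card hsub
  have hc2 := fun (A B : Finset (Finset (Sym2 (Fin n)))) => card_union_le A B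
  have hfin : (((Om n m).filter fun ω => Disjoint ω (mono c)).card : ℝ) ≤ _ :=
    Nat.cast_le.2 (hc.trans ((hc2 _ _).trans (Nat.add_le_add_left ((hc2 _ _).trans (Nat.add_le_add_left
      ((hc2 _ _).trans (Nat.add_le_add_left ((hc2 _ _).trans (Nat.add_le_add_left (hc2 _ _) _)) _)) _)) _)))
  rw [hall] at hfin
  push_cast at hfin
  have k1 := g1.trans (mul_le_mul_of_nonneg_left (add_le_add h1 h2) hM0)
  have k2 := g2.trans (mul_le_mul_of_nonneg_left h3 hM0)
  have k3 := g3.trans (mul_le_mul_of_nonneg_left h4 hM0)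
  have k4 := g4.trans (mul_le_mul_of_nonneg_left h5 hM0)
  have k5 := g5.trans (mul_le_mul_of_nonneg_left h6 hM0)
  nlinarith [k1, k2, k3, k4, k5, hfin]

end TC

end PartF2

section PartG

namespace TC
open Finset

variable {n k m : ℕ}

/-- the truncated weights of the cluster expansion -/
def ht (B : ℝ) (s : ℕ) : ℝ :=
  if s = 0 then 1 else if s = 1 then 0 else if s = 2 then B - 1 else B ^ (s.choose 2)

lemma ht_nonneg {B : ℝ} (hB : 1 ≤ B) (s : ℕ) : 0 ≤ ht B s := by
  unfold ht
  split_ifs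
  · norm_num
  · norm_num
  · linarith
  · positivity

lemma ht_le {B : ℝ} (hB : 1 ≤ B) (s : ℕ) : ht B s ≤ B ^ (s.choose 2) := by
  unfold ht
  split_ifs with h1 h2 h3
  · subst h1; simp
  · positivity
  · subst h3; simp
  · exact le_rfl

lemma ht_expand {α : Type} [DecidableEq α] {B : ℝ} (hB : 1 ≤ B) (X : Finset α) (F : ℕ → ℝ)
    (hF : ∀ r, r ≤ X.card → F r = ht B r) :
    B ^ (X.card.choose 2) ≤ ∑ S ∈ X.powerset, F S.card := by
  have h0 : ∑ S ∈ X.powerset, F S.card = ∑ S ∈ X.powerset, ht B S.card :=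
    sum_congr rfl fun S hS => hF _ (card_le_card (mem_powerset.1 hS))
  rw [h0]
  have hnn : ∀ S ∈ X.powerset, 0 ≤ ht B S.card := fun S _ => ht_nonneg hB _
  by_cases h3 : 3 ≤ X.card
  · have := single_le_sum hnn (mem_powerset_self X)
    refine le_trans (le_of_eq ?_) this
    unfold ht
    rw [if_neg (by omega), if_neg (by omega), if_neg (by omega)]
  · rw [Finset.sum_powerset_apply_card (fun r => ht B r)]
    have : X.card = 0 ∨ X.card = 1 ∨ X.card = 2 := by omega
    rcases this with h | h | h <;> rw [h] <;> simp [sum_range_succ, ht]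

lemma pow_ov_le {B : ℝ} (hB : 1 ≤ B) (c c' : Fin n → Fin k) :
    B ^ (ov c c') ≤ ∏ ij : Fin k × Fin k, ∑ S ∈ (fib c ij.1 ∩ fib c' ij.2).powerset, ht B S.card := by
  have h1 : B ^ (ov c c') = ∏ ij : Fin k × Fin k, B ^ ((fib c ij.1 ∩ fib c' ij.2).card.choose 2) := by
    rw [prod_pow_eq_pow_sum, ov, Fintype.sum_prod_type]
  rw [h1]
  exact prod_le_prod (fun _ _ => by positivity) fun ij _ => ht_expand hB _ _ fun _ _ => rfl

lemma fac_e : ∀ (N s : ℕ), s ≤ N → (N:ℝ) ^ s * ((N - s).factorial : ℝ) ≤ Real.exp 1 ^ s * (N.factorial : ℝ) := by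
  intro N
  induction N with
  | zero => intro s hs; interval_cases s; simp
  | succ N ih =>
    intro s hs
    cases s with
    | zero => simp
    | succ s =>
      have h1 := ih s (by omega)
      have h2 : N + 1 - (s + 1) = N - s := by omega
      rw [h2, Nat.factorial_succ, pow_succ, pow_succ]
      have h3 : ((N:ℝ) + 1) ^ s ≤ (N:ℝ) ^ s * Real.exp 1 := by
        rcases Nat.eq_zero_or_pos N with h0 | h0
        · have : s = 0 := by omega
          subst this; simp
        · have hN : (0:ℝ) < N := by exact_mod_cast h0
          have h4 : (N:ℝ) + 1 ≤ N * Real.exp (1 / N) := by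
            have := Real.add_one_le_exp (1 / (N:ℝ))
            calc (N:ℝ) + 1 = N * (1 / N + 1) := by field_simp; ring
              _ ≤ _ := by gcongr
          calc ((N:ℝ) + 1) ^ s ≤ (N * Real.exp (1 / N)) ^ s := by gcongr
            _ = (N:ℝ) ^ s * Real.exp (s * (1 / N)) := by rw [mul_pow, ← Real.exp_nat_mul]
            _ ≤ _ := by
                gcongr
                rw [mul_one_div, div_le_one hN]
                have : s ≤ N := by omega
                exact_mod_cast this
      push_cast
      calc ((N:ℝ) + 1) ^ s * ((N:ℝ) + 1) * ((N - s).factorial : ℝ)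
          ≤ ((N:ℝ) ^ s * Real.exp 1) * ((N:ℝ) + 1) * ((N - s).factorial : ℝ) := by gcongr
        _ = Real.exp 1 * ((N:ℝ) + 1) * ((N:ℝ) ^ s * ((N - s).factorial : ℝ)) := by ring
        _ ≤ Real.exp 1 * ((N:ℝ) + 1) * (Real.exp 1 ^ s * (N.factorial : ℝ)) := by gcongr
        _ = _ := by ring

lemma fac_small {n s s0 : ℕ} (hs : s ≤ s0) (hn : s0 < n) (ε0 : ℝ)
    (h0 : ((n:ℝ) / (n - s0)) ^ s0 ≤ 1 + ε0) :
    ((n - s).factorial : ℝ) ≤ (n.factorial : ℝ) * (1 + ε0) * ((n:ℝ)⁻¹) ^ s := by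
  have hn0 : (0:ℝ) < n := by exact_mod_cast (by omega : 0 < n)
  have hns : (0:ℝ) < (n:ℝ) - s0 := by
    have : (s0:ℝ) < n := by exact_mod_cast hn
    linarith
  have h1 := Nat.factorial_mul_descFactorial (by omega : s ≤ n)
  have h2 := Nat.pow_sub_le_descFactorial n s
  have h3 : ((n:ℝ) - s0) ^ s ≤ (n.descFactorial s : ℝ) := by
    refine le_trans ?_ (Nat.cast_le.2 h2)
    push_cast
    gcongr
    rw [Nat.cast_sub (by omega)]
    push_cast
    have : (s:ℝ) ≤ s0 := by exact_mod_cast hs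
    linarith
  have h4 : ((n - s).factorial : ℝ) * (n.descFactorial s : ℝ) = n.factorial := by exact_mod_cast h1
  have h5 : ((n:ℝ) / (n - s0)) ^ s ≤ 1 + ε0 := by
    refine le_trans (pow_le_pow_right₀ ?_ hs) h0
    rw [one_le_div hns]
    have : (0:ℝ) ≤ s0 := by positivity
    linarith
  rw [div_pow, div_le_iff₀ (by positivity)] at h5
  have h6 : (n:ℝ) ^ s ≤ (1 + ε0) * (n.descFactorial s : ℝ) := by
    refine h5.trans (mul_le_mul_of_nonneg_left h3 ?_)
    refine le_trans ?_ h0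
    positivity
  rw [inv_pow, ← div_eq_mul_inv, le_div_iff₀ (by positivity), ← h4]
  have h7 : (0:ℝ) ≤ ((n - s).factorial : ℝ) := by positivity
  nlinarith

lemma fac_large {n sL sS : ℕ} (dl : ℝ) (hd0 : 0 ≤ dl) (hd1 : dl < 1) (hn : 0 < n) (hs : sL + sS ≤ n)
    (hL : (sL:ℝ) ≤ dl * n) :
    ((n - (sL + sS)).factorial : ℝ) ≤ (n.factorial : ℝ) * ((1 / (1 - dl)) / n) ^ sL *
      ((Real.exp 1 / (1 - dl)) / n) ^ sS := by
  have hn0 : (0:ℝ) < n := by exact_mod_cast hn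
  have hd : 0 < 1 - dl := by linarith
  have h1 := Nat.factorial_mul_descFactorial (by omega : sL ≤ n)
  have h2 := Nat.pow_sub_le_descFactorial n sL
  have hnl : (1 - dl) * n ≤ ((n - sL : ℕ) : ℝ) := by
    rw [Nat.cast_sub (by omega)]; linarith
  have h3 : ((1 - dl) * n) ^ sL ≤ (n.descFactorial sL : ℝ) := by
    refine le_trans ?_ (Nat.cast_le.2 h2)
    push_cast
    refine pow_le_pow_left₀ (by positivity) (hnl.trans ?_) _
    exact_mod_cast (by omega : n - sL ≤ n + 1 - sL)
  have h4 : ((n - sL).factorial : ℝ) * (n.descFactorial sL : ℝ) = n.factorial := by exact_mod_cast h1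
  have h5 := fac_e (n - sL) sS (by omega)
  have h6 : ((1 - dl) * n) ^ sS * ((n - sL - sS).factorial : ℝ) ≤ Real.exp 1 ^ sS * ((n - sL).factorial : ℝ) := by
    refine le_trans ?_ h5
    gcongr
  rw [Nat.sub_add_eq]
  have h7 : ((n - sL - sS).factorial : ℝ) * (((1 - dl) * n) ^ sL * ((1 - dl) * n) ^ sS) ≤
      Real.exp 1 ^ sS * n.factorial := by
    rw [← h4]
    calc _ = ((1 - dl) * n) ^ sL * (((1 - dl) * n) ^ sS * ((n - sL - sS).factorial : ℝ)) := by ring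
      _ ≤ (n.descFactorial sL : ℝ) * (Real.exp 1 ^ sS * ((n - sL).factorial : ℝ)) := by gcongr
      _ = _ := by ring
  have e1 : (n.factorial : ℝ) * ((1 / (1 - dl)) / n) ^ sL * ((Real.exp 1 / (1 - dl)) / n) ^ sS =
      (Real.exp 1 ^ sS * n.factorial) / (((1 - dl) * n) ^ sL * ((1 - dl) * n) ^ sS) := by
    rw [div_div, div_div, div_pow, div_pow, one_pow]
    field_simp
  rw [e1, le_div_iff₀ (by positivity)]
  exact h7

lemma prod_le_exp {ι : Type} (s : Finset ι) (f g : ι → ℝ) (h0 : ∀ i ∈ s, 0 ≤ f i)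
    (h : ∀ i ∈ s, f i ≤ 1 + g i) : ∏ i ∈ s, f i ≤ Real.exp (∑ i ∈ s, g i) := by
  rw [Real.exp_sum]
  exact prod_le_prod h0 fun i hi => (h i hi).trans (by rw [add_comm]; exact Real.add_one_le_exp _)

/-- evaluation of the factorised expansion -/
lemma prod_ht_le {B : ℝ} (hB : 1 ≤ B) (v : Fin k → ℕ) (a f : ℕ) (hva : ∀ i, v i ≤ a)
    (hf : ∑ i, (v i).choose 2 = f) (y : ℕ → ℝ) (hy : ∀ r, 0 ≤ y r) (hy0 : y 0 = 1) :
    ∏ ij : Fin k × Fin k, ∑ r ∈ range (v ij.1 + 1),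
        ((v ij.1).choose r : ℝ) * (ht B r * ((v ij.2).descFactorial r : ℝ) * y r) ≤
      Real.exp ((B - 1) * (2 * (f:ℝ) ^ 2) * y 2 +
        k ^ 2 * ∑ r ∈ Icc 3 a, (a.choose r : ℝ) * (a.descFactorial r : ℝ) * B ^ (r.choose 2) * y r) := by
  have hB0 : 0 ≤ B - 1 := by linarith
  refine (prod_le_exp univ _ (fun ij => ((v ij.1).choose 2 : ℝ) * ((B - 1) * (2 * ((v ij.2).choose 2 : ℝ)) * y 2) +
    ∑ r ∈ Icc 3 a, (a.choose r : ℝ) * (a.descFactorial r : ℝ) * B ^ (r.choose 2) * y r) ?_ ?_).trans ?_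
  · intro ij _
    exact sum_nonneg fun r _ => mul_nonneg (by positivity)
      (mul_nonneg (mul_nonneg (ht_nonneg hB r) (by positivity)) (hy r))
  · intro ij _
    have h1 : ∑ r ∈ range (v ij.1 + 1), ((v ij.1).choose r : ℝ) * (ht B r * ((v ij.2).descFactorial r : ℝ) * y r)
        ≤ ∑ r ∈ {0, 1, 2} ∪ Icc 3 a, ((v ij.1).choose r : ℝ) * (ht B r * ((v ij.2).descFactorial r : ℝ) * y r) := by
      refine sum_le_sum_of_subset_of_nonneg ?_ fun r _ _ => mul_nonneg (by positivity)
        (mul_nonneg (mul_nonneg (ht_nonneg hB r) (by positivity)) (hy r))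
      intro r hr
      rw [mem_range] at hr
      have := hva ij.1
      simp only [mem_union, mem_insert, mem_singleton, mem_Icc]
      omega
    refine h1.trans ?_
    rw [sum_union (by
      rw [Finset.disjoint_left]
      intro r hr
      simp only [mem_insert, mem_singleton] at hr
      rw [mem_Icc]; omega)]
    rw [← add_assoc]
    refine add_le_add (le_of_eq ?_) ?_
    · rw [sum_insert (by simp), sum_insert (by simp), sum_singleton]
      have e2 : ((v ij.2).descFactorial 2 : ℝ) = 2 * ((v ij.2).choose 2 : ℝ) := by
        rw [Nat.descFactorial_eq_factorial_mul_choose]; push_cast; norm_num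
      rw [e2]
      generalize ((v ij.2).choose 2 : ℝ) = X
      simp [ht, hy0]
    · refine sum_le_sum fun r hr => ?_
      calc ((v ij.1).choose r : ℝ) * (ht B r * ((v ij.2).descFactorial r : ℝ) * y r)
          ≤ (a.choose r : ℝ) * (B ^ (r.choose 2) * (a.descFactorial r : ℝ) * y r) := by
            have e1 : ((v ij.1).choose r : ℝ) ≤ (a.choose r : ℝ) := by
              exact_mod_cast Nat.choose_le_choose r (hva ij.1)
            have e2 : ((v ij.2).descFactorial r : ℝ) ≤ (a.descFactorial r : ℝ) := by
              exact_mod_cast Nat.descFactorial_le r (hva ij.2)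
            have e3 := ht_le hB r
            have e4 := ht_nonneg hB r
            have e5 := hy r
            gcongr
        _ = _ := by ring
  · refine Real.exp_le_exp.2 (le_of_eq ?_)
    rw [sum_add_distrib]
    congr 1
    · rw [Fintype.sum_prod_type]
      have hf2 : (f:ℝ) = ∑ i, ((v i).choose 2 : ℝ) := by rw [← hf]; push_cast; rfl
      rw [hf2, sq, sum_mul_sum, mul_sum, mul_sum, sum_mul]
      refine sum_congr rfl fun i _ => ?_
      rw [mul_sum, mul_sum, sum_mul]
      refine sum_congr rfl fun j _ => ?_
      ring
    · rw [sum_const, card_univ, Fintype.card_prod, Fintype.card_fin, nsmul_eq_mul]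
      push_cast; ring

/-- contribution of regime I -/
lemma regimeI (c c0 : Fin n → Fin k) (v : Fin k → ℕ) (hc : ∀ i, (fib c i).card = v i)
    (hc0 : ∀ i, (fib c0 i).card = v i) (a f h s0 : ℕ) (hva : ∀ i, v i ≤ a)
    (hf : ∑ i, (v i).choose 2 = f) {B : ℝ} (hB : 1 ≤ B) (dl ε0 ζ : ℝ) (hd0 : 0 ≤ dl) (hd1 : dl < 1)
    (hs0 : s0 < n) (hε0 : ((n:ℝ) / (n - s0)) ^ s0 ≤ 1 + ε0) (hζ : 1 ≤ ζ)
    (Reg : Finset (Equiv.Perm (Fin n)))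
    (hReg : ∀ τ ∈ Reg, ((∑ ij : Fin k × Fin k, if h < (fib c ij.1 ∩ fib (c0 ∘ τ) ij.2).card then
      (fib c ij.1 ∩ fib (c0 ∘ τ) ij.2).card else 0 : ℕ) : ℝ) ≤ dl * n)
    (y : ℕ → ℝ) (hy : y = fun r => if h < r then ((ζ / (1 - dl)) / n) ^ r else
      ((ζ * Real.exp 1 / (1 - dl)) / n) ^ r) :
    ∑ τ ∈ Reg, B ^ (ov c (c0 ∘ τ)) ≤ (n.factorial : ℝ) * ((1 + ε0) *
      Real.exp ((B - 1) * (2 * (f:ℝ) ^ 2) * ((n:ℝ)⁻¹) ^ 2 +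
        k ^ 2 * ∑ r ∈ Icc 3 a, (a.choose r : ℝ) * (a.descFactorial r : ℝ) * B ^ (r.choose 2) * ((n:ℝ)⁻¹) ^ r) +
      (ζ ^ s0)⁻¹ * Real.exp ((B - 1) * (2 * (f:ℝ) ^ 2) * y 2 +
        k ^ 2 * ∑ r ∈ Icc 3 a, (a.choose r : ℝ) * (a.descFactorial r : ℝ) * B ^ (r.choose 2) * y r)) := by
  have hd : 0 < 1 - dl := by linarith
  have hn : 0 < n := by omega
  have hn0 : (0:ℝ) < n := by exact_mod_cast hn
  have hy0 : ∀ r, 0 ≤ y r := by intro r; rw [hy]; simp only; split_ifs <;> positivity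
  have hε : 0 ≤ 1 + ε0 := by
    refine le_trans ?_ hε0
    have : (s0:ℝ) < n := by exact_mod_cast hs0
    have : 0 < (n:ℝ) - s0 := by linarith
    positivity
  have h1 : ∑ τ ∈ Reg, B ^ (ov c (c0 ∘ τ)) ≤ ∑ τ ∈ Reg, ∏ ij : Fin k × Fin k,
        ∑ S ∈ (fib c ij.1 ∩ fib (c0 ∘ τ) ij.2).powerset, (fun _ r => ht B r) ij S.card :=
    sum_le_sum fun τ _ => pow_ov_le hB c (c0 ∘ τ)
  refine h1.trans ?_
  have h2 := expansion_bound c c0 v hc hc0 Reg (fun _ r => ht B r) (fun _ r => ((n:ℝ)⁻¹) ^ r) (fun _ r => y r)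
    (fun _ r => ht_nonneg hB r) (fun _ r => by positivity) (fun _ r => hy0 r)
    ((n.factorial : ℝ) * (1 + ε0)) ((n.factorial : ℝ) * (ζ ^ s0)⁻¹) (by positivity) (by positivity)
    (fun S => ((∑ ij : Fin k × Fin k, if h < (S ij).card then (S ij).card else 0 : ℕ) : ℝ) ≤ dl * n)
    (by
      intro τ hτ S hS
      refine le_trans (Nat.cast_le.2 (sum_le_sum fun ij _ => ?_)) (hReg τ hτ)
      have := card_le_card (hS ij)
      split_ifs <;> omega)
    (by
      intro S hsn hQ _
      by_cases hs : ∑ ij, (S ij).card ≤ s0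
      · have := fac_small hs hs0 ε0 hε0
        rw [← prod_pow_eq_pow_sum] at this
        refine this.trans (le_add_of_nonneg_right ?_)
        have : 0 ≤ ∏ ij, y (S ij).card := prod_nonneg fun ij _ => hy0 _
        positivity
      · set sL := ∑ ij, if h < (S ij).card then (S ij).card else 0 with hsL
        set sS := ∑ ij, if h < (S ij).card then 0 else (S ij).card with hsS
        have hadd : ∑ ij, (S ij).card = sL + sS := by
          rw [hsL, hsS, ← sum_add_distrib]
          refine sum_congr rfl fun ij _ => ?_
          split_ifs <;> simp
        have h3 := fac_large dl hd0 hd1 hn (by rw [← hadd]; exact hsn) hQ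
        rw [← hadd] at h3
        have hprod : ∏ ij, y (S ij).card = ((ζ / (1 - dl)) / n) ^ sL * ((ζ * Real.exp 1 / (1 - dl)) / n) ^ sS := by
          rw [hsL, hsS, ← prod_pow_eq_pow_sum, ← prod_pow_eq_pow_sum, ← prod_mul_distrib]
          refine prod_congr rfl fun ij _ => ?_
          rw [hy]
          simp only
          split_ifs <;> simp
        rw [hprod]
        refine h3.trans ?_
        refine le_trans ?_ (le_add_of_nonneg_left ?_)
        · have e1 : ((ζ / (1 - dl)) / n) ^ sL * ((ζ * Real.exp 1 / (1 - dl)) / n) ^ sS =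
              ζ ^ (sL + sS) * (((1 / (1 - dl)) / n) ^ sL * ((Real.exp 1 / (1 - dl)) / n) ^ sS) := by
            rw [pow_add]
            have : (ζ / (1 - dl)) / n = ζ * ((1 / (1 - dl)) / n) := by ring
            rw [this, mul_pow]
            have : (ζ * Real.exp 1 / (1 - dl)) / n = ζ * ((Real.exp 1 / (1 - dl)) / n) := by ring
            rw [this, mul_pow]
            ring
          rw [e1]
          have e2 : 1 ≤ (ζ ^ s0)⁻¹ * ζ ^ (sL + sS) := by
            rw [inv_mul_eq_div, one_le_div (by positivity)]
            exact pow_le_pow_right₀ hζ (by omega)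
          have e3 : 0 ≤ (n.factorial : ℝ) * (((1 / (1 - dl)) / n) ^ sL * ((Real.exp 1 / (1 - dl)) / n) ^ sS) := by
            positivity
          nlinarith
        · have : 0 ≤ ∏ ij, ((n:ℝ)⁻¹) ^ (S ij).card := prod_nonneg fun ij _ => by positivity
          positivity)
  refine h2.trans ?_
  have h3 := prod_ht_le hB v a f hva hf (fun r => ((n:ℝ)⁻¹) ^ r) (fun r => by positivity) (by simp)
  have h4 := prod_ht_le hB v a f hva hf y hy0 (by rw [hy]; simp)
  refine (add_le_add (mul_le_mul_of_nonneg_left h3 (by positivity))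
    (mul_le_mul_of_nonneg_left h4 (by positivity))).trans (le_of_eq ?_)
  generalize Real.exp (_ + _ * ∑ r ∈ Icc 3 a, (a.choose r : ℝ) * (a.descFactorial r : ℝ) * B ^ (r.choose 2) * y r) = Y
  generalize Real.exp _ = X
  ring

end TC

end PartG

section PartH

namespace TC
open Finset
variable {n k m : ℕ}

/-- exactly matched pairs -/
def exE (c c' : Fin n → Fin k) : Finset (Fin k × Fin k) :=
  univ.filter fun ij => fib c ij.1 = fib c' ij.2

/-- partial matching between equal sizes -/
structure Mt (v : Fin k → ℕ) (E : Finset (Fin k × Fin k)) : Prop where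
  eqv : ∀ x ∈ E, v x.1 = v x.2
  inj1 : ∀ x ∈ E, ∀ y ∈ E, x.1 = y.1 → x = y
  inj2 : ∀ x ∈ E, ∀ y ∈ E, x.2 = y.2 → x = y

/-- free index pairs -/
def fr (E : Finset (Fin k × Fin k)) (x : Fin k × Fin k) : Prop :=
  (∀ y ∈ E, y.1 ≠ x.1) ∧ (∀ y ∈ E, y.2 ≠ x.2)

lemma Mt_exE {c c' : Fin n → Fin k} {v : Fin k → ℕ} (hc : ∀ i, (fib c i).card = v i)
    (hc' : ∀ i, (fib c' i).card = v i) (hv : ∀ i, 1 ≤ v i) : Mt v (exE c c') := by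
  have key : ∀ (d : Fin n → Fin k) (i j : Fin k), (fib d i).Nonempty → fib d i = fib d j → i = j := by
    intro d i j ⟨x, hx⟩ h
    have h2 := hx
    rw [h] at h2
    rw [mem_fib] at hx h2
    rw [← hx, h2]
  refine ⟨?_, ?_, ?_⟩
  · intro x hx
    simp only [exE, mem_filter, mem_univ, true_and] at hx
    rw [← hc, ← hc', hx]
  · intro x hx y hy h
    simp only [exE, mem_filter, mem_univ, true_and] at hx hy
    refine Prod.ext h (key c' _ _ ?_ ?_)
    · rw [← card_pos, hc']; exact hv _
    · rw [← hx, ← hy, h]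
  · intro x hx y hy h
    simp only [exE, mem_filter, mem_univ, true_and] at hx hy
    refine Prod.ext (key c _ _ ?_ ?_) h
    · rw [← card_pos, hc]; exact hv _
    · rw [hx, hy, h]

lemma inter_eq_empty_of_blocked {c c' : Fin n → Fin k} {x : Fin k × Fin k} (hx : x ∉ exE c c')
    (hf : ¬ fr (exE c c') x) : fib c x.1 ∩ fib c' x.2 = ∅ := by
  by_contra hne
  obtain ⟨z, hz⟩ := nonempty_iff_ne_empty.2 hne
  rw [mem_inter, mem_fib, mem_fib] at hz
  refine hf ⟨?_, ?_⟩
  · intro y hy h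
    have hy2 := hy
    simp only [exE, mem_filter, mem_univ, true_and] at hy2
    have : z ∈ fib c' y.2 := by rw [← hy2, mem_fib, h]; exact hz.1
    rw [mem_fib] at this
    exact hx (by have : y = x := Prod.ext h (by rw [← this, hz.2]); rwa [this] at hy)
  · intro y hy h
    have hy2 := hy
    simp only [exE, mem_filter, mem_univ, true_and] at hy2
    have : z ∈ fib c y.1 := by rw [hy2, mem_fib, h]; exact hz.2
    rw [mem_fib] at this
    exact hx (by have : y = x := Prod.ext (by rw [← this, hz.1]) h; rwa [this] at hy)

/-- weights for regime II -/
def wE (B : ℝ) (h : ℕ) (v : Fin k → ℕ) (E : Finset (Fin k × Fin k)) (x : Fin k × Fin k) (r : ℕ) : ℝ :=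
  if x ∈ E then (if r = v x.1 then B ^ (r.choose 2) else 0)
  else if fr E x then (if r ≤ h then ht B r else 0) else (if r = 0 then 1 else 0)

lemma wE_nonneg {B : ℝ} (hB : 1 ≤ B) (h : ℕ) (v : Fin k → ℕ) (E : Finset (Fin k × Fin k)) (x : Fin k × Fin k) (r : ℕ) :
    0 ≤ wE B h v E x r := by
  have := ht_nonneg hB r
  unfold wE
  split_ifs <;> positivity

lemma pow_ov_le_II {B : ℝ} (hB : 1 ≤ B) (h a Λ : ℕ) (c c' : Fin n → Fin k) (v : Fin k → ℕ)
    (hc : ∀ i, (fib c i).card = v i) (hva : ∀ i, v i ≤ a)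
    (hin : (univ.filter fun ij : Fin k × Fin k => big h c c' ij.1 ij.2 ∧ fib c ij.1 ≠ fib c' ij.2).card ≤ Λ) :
    B ^ (ov c c') ≤ B ^ (a * a * Λ) * ∏ ij : Fin k × Fin k,
      ∑ S ∈ (fib c ij.1 ∩ fib c' ij.2).powerset, wE B h v (exE c c') ij S.card := by
  have h1 : B ^ (ov c c') = ∏ ij : Fin k × Fin k, B ^ ((fib c ij.1 ∩ fib c' ij.2).card.choose 2) := by
    rw [prod_pow_eq_pow_sum, ov, Fintype.sum_prod_type]
  rw [h1]
  set J := univ.filter fun ij : Fin k × Fin k => big h c c' ij.1 ij.2 ∧ fib c ij.1 ≠ fib c' ij.2 with hJ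
  have hB0 : 0 < B := by linarith
  have h2 : ∏ ij : Fin k × Fin k, (if ij ∈ J then B ^ (a * a) else 1) ≤ B ^ (a * a * Λ) := by
    rw [prod_ite_mem, univ_inter, prod_const, ← pow_mul]
    exact pow_le_pow_right₀ hB (Nat.mul_le_mul_left _ hin)
  have hnn : ∀ ij : Fin k × Fin k, 0 ≤ ∑ S ∈ (fib c ij.1 ∩ fib c' ij.2).powerset, wE B h v (exE c c') ij S.card :=
    fun ij => sum_nonneg fun S _ => wE_nonneg hB _ _ _ _ _
  refine le_trans ?_ (mul_le_mul_of_nonneg_right h2 (prod_nonneg fun ij _ => hnn ij))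
  rw [← prod_mul_distrib]
  refine prod_le_prod (fun _ _ => by positivity) fun ij _ => ?_
  by_cases hE : ij ∈ exE c c'
  · have hEq : fib c ij.1 = fib c' ij.2 := by simpa [exE] using hE
    have hnJ : ij ∉ J := by simp [hJ, hEq]
    rw [if_neg hnJ, one_mul]
    have hcard : (fib c ij.1 ∩ fib c' ij.2).card = v ij.1 := by rw [← hEq, inter_self, hc]
    refine le_trans (le_of_eq ?_) (single_le_sum (f := fun S : Finset (Fin n) => wE B h v (exE c c') ij S.card)
      (fun S _ => wE_nonneg hB _ _ _ _ _) (mem_powerset_self _))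
    simp only [wE, if_pos hE, hcard, if_true]
  · by_cases hf : fr (exE c c') ij
    · by_cases hb : big h c c' ij.1 ij.2
      · have hin : ij ∈ J := by
          simp only [hJ, mem_filter, mem_univ, true_and]
          exact ⟨hb, fun hh => hE (by simp [exE, hh])⟩
        rw [if_pos hin]
        have e1 : 1 ≤ ∑ S ∈ (fib c ij.1 ∩ fib c' ij.2).powerset, wE B h v (exE c c') ij S.card := by
          refine le_trans (le_of_eq ?_) (single_le_sum (f := fun S : Finset (Fin n) => wE B h v (exE c c') ij S.card)
            (fun S _ => wE_nonneg hB _ _ _ _ _) (empty_mem_powerset _))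
          simp [wE, hE, hf, ht]
        have e2 : B ^ ((fib c ij.1 ∩ fib c' ij.2).card.choose 2) ≤ B ^ (a * a) := by
          refine pow_le_pow_right₀ hB ?_
          have e3 : (fib c ij.1 ∩ fib c' ij.2).card ≤ a :=
            (card_le_card inter_subset_left).trans (by rw [hc]; exact hva _)
          refine (Nat.choose_le_pow _ 2).trans ?_
          rw [sq]
          exact Nat.mul_le_mul e3 e3
        nlinarith [pow_pos hB0 (a * a)]
      · have hin : ij ∉ J := by simp [hJ, hb]
        rw [if_neg hin, one_mul]
        refine ht_expand hB _ _ ?_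
        intro r hr
        have : r ≤ h := hr.trans (not_lt.1 hb)
        simp [wE, hE, hf, this]
    · have hemp := inter_eq_empty_of_blocked hE hf
      have hin : ij ∉ J := by rw [hJ, mem_filter]; simp [big, hemp]
      rw [if_neg hin, one_mul, hemp]
      simp [wE, hE, hf]

lemma free_sum {B : ℝ} (hB : 1 ≤ B) (h a M vi vj : ℕ) (hi : vi ≤ a) (hj : vj ≤ a)
    (hM : 0 < M) (hx : (a:ℝ) ^ 2 * Real.exp 1 * B ^ h ≤ M / 2) (h1 : 1 ≤ h) :
    ∑ r ∈ range (vi + 1), (vi.choose r : ℝ) * ((if r ≤ h then ht B r else 0) * (vj.descFactorial r : ℝ) *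
      (Real.exp 1 / M) ^ r) ≤ 1 + 2 * ((a:ℝ) ^ 2 * Real.exp 1) ^ 2 * B / (M:ℝ) ^ 2 := by
  have hM0 : (0:ℝ) < M := by exact_mod_cast hM
  have he := Real.exp_pos 1
  have hB0 : 0 < B := by linarith
  set A := (a:ℝ) ^ 2 * Real.exp 1 with hA
  have hA0 : 0 ≤ A := by positivity
  have hterm : ∀ r ∈ range (vi + 1), (vi.choose r : ℝ) * ((if r ≤ h then ht B r else 0) * (vj.descFactorial r : ℝ) *
      (Real.exp 1 / M) ^ r) ≤ (if r = 0 then 1 else 0) + (if 2 ≤ r then A ^ 2 * B / (M:ℝ) ^ 2 * (1/2) ^ (r - 2) else 0) := by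
    intro r _
    by_cases h0 : r = 0
    · subst h0; simp [ht]
    by_cases h01 : r = 1
    · subst h01; simp [ht]
    have h2 : 2 ≤ r := by omega
    rw [if_neg h0, if_pos h2, zero_add]
    by_cases hr : r ≤ h
    · rw [if_pos hr]
      obtain ⟨s, rfl⟩ : ∃ s, r = s + 2 := ⟨r - 2, by omega⟩
      rw [Nat.add_sub_cancel]
      have e1 : (vi.choose (s+2) : ℝ) ≤ (a:ℝ) ^ (s+2) := by
        exact_mod_cast (Nat.choose_le_pow _ _).trans (Nat.pow_le_pow_left hi _)
      have e2 : (vj.descFactorial (s+2) : ℝ) ≤ (a:ℝ) ^ (s+2) := by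
        exact_mod_cast (Nat.descFactorial_le_pow _ _).trans (Nat.pow_le_pow_left hj _)
      have e3 : ht B (s+2) ≤ B * (B ^ h) ^ s := by
        refine (ht_le hB _).trans ?_
        rw [← pow_mul, ← pow_succ']
        refine pow_le_pow_right₀ hB ?_
        have : (s+2).choose 2 * 2 = (s + 2) * (s + 1) := by
          rw [Nat.choose_two_right]
          exact Nat.div_mul_cancel (even_iff_two_dvd.1 (by
            rw [mul_comm]; exact Nat.even_mul_succ_self (s+1)))
        nlinarith
      have e4 := ht_nonneg hB (s+2)
      calc (vi.choose (s+2) : ℝ) * (ht B (s+2) * (vj.descFactorial (s+2) : ℝ) * (Real.exp 1 / M) ^ (s+2))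
          ≤ (a:ℝ) ^ (s+2) * ((B * (B ^ h) ^ s) * (a:ℝ) ^ (s+2) * (Real.exp 1 / M) ^ (s+2)) := by gcongr
        _ = A ^ 2 * B / (M:ℝ) ^ 2 * (A * B ^ h / M) ^ s := by
            rw [hA, div_pow, div_pow]
            field_simp
            ring
        _ ≤ _ := by
            have : A * B ^ h / M ≤ 1 / 2 := by
              rw [div_le_iff₀ hM0]; linarith
            gcongr
    · rw [if_neg hr]
      simp only [zero_mul, mul_zero]
      positivity
  refine (sum_le_sum hterm).trans ?_
  rw [sum_add_distrib, ← sum_filter, ← sum_filter]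
  refine add_le_add ?_ ?_
  · rw [sum_const, nsmul_eq_mul, mul_one]
    have : ((range (vi+1)).filter fun r => r = 0).card ≤ 1 := card_le_one.2 (by
      intro x hx y hy
      rw [(mem_filter.1 hx).2, (mem_filter.1 hy).2])
    exact_mod_cast this
  · rw [← mul_sum]
    have hs : ∑ r ∈ (range (vi+1)).filter (fun r => 2 ≤ r), ((1:ℝ)/2) ^ (r - 2) ≤ 2 := by
      have := sum_image (s := (range (vi+1)).filter (fun r => 2 ≤ r)) (g := fun r => r - 2)
        (f := fun s : ℕ => ((1:ℝ)/2) ^ s) (by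
          intro x hx y hy hxy
          have h1 := (mem_filter.1 hx).2
          have h2 := (mem_filter.1 hy).2
          simp only at hxy
          omega)
      rw [← this]
      exact (Summable.sum_le_tsum _ (fun _ _ => by positivity) summable_geometric_two).trans tsum_geometric_two.le
    have : 0 ≤ A ^ 2 * B / (M:ℝ) ^ 2 := by positivity
    calc _ ≤ A ^ 2 * B / (M:ℝ) ^ 2 * 2 := mul_le_mul_of_nonneg_left hs this
      _ = _ := by ring

def sE (v : Fin k → ℕ) (E : Finset (Fin k × Fin k)) : ℕ := ∑ x ∈ E, v x.1

lemma Mt.card_free1 {v : Fin k → ℕ} {E : Finset (Fin k × Fin k)} (hE : Mt v E) (hv : ∀ i, 1 ≤ v i)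
    (hs : ∑ i, v i = n) : (univ.filter fun i : Fin k => ∀ y ∈ E, y.1 ≠ i).card + sE v E ≤ n := by
  have h1 : sE v E = ∑ i ∈ E.image Prod.fst, v i := by
    rw [sE, sum_image]
    intro x hx y hy h
    exact hE.inj1 x hx y hy h
  have h2 : (univ.filter fun i : Fin k => ∀ y ∈ E, y.1 ≠ i).card ≤ ∑ i ∈ univ.filter (fun i : Fin k => ∀ y ∈ E, y.1 ≠ i), v i := by
    rw [card_eq_sum_ones]
    exact sum_le_sum fun i _ => hv i
  have h3 : Disjoint (univ.filter fun i : Fin k => ∀ y ∈ E, y.1 ≠ i) (E.image Prod.fst) := by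
    rw [Finset.disjoint_left]
    intro i hi hi2
    obtain ⟨y, hy, hyi⟩ := mem_image.1 hi2
    exact (mem_filter.1 hi).2 y hy hyi
  have h4 := sum_union h3 (f := v)
  have h5 : ∑ i ∈ (univ.filter fun i : Fin k => ∀ y ∈ E, y.1 ≠ i) ∪ (E.image Prod.fst), v i ≤ ∑ i, v i :=
    sum_le_sum_of_subset (subset_univ _)
  omega

lemma Mt.symm {v : Fin k → ℕ} {E : Finset (Fin k × Fin k)} (hE : Mt v E) : Mt v (E.map (Equiv.prodComm _ _).toEmbedding) := by
  refine ⟨?_, ?_, ?_⟩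
  · intro x hx
    obtain ⟨y, hy, rfl⟩ := Finset.mem_map.1 hx
    exact (hE.eqv y hy).symm
  · intro x hx x' hx' h
    obtain ⟨y, hy, rfl⟩ := Finset.mem_map.1 hx
    obtain ⟨y', hy', rfl⟩ := Finset.mem_map.1 hx'
    rw [hE.inj2 y hy y' hy' h]
  · intro x hx x' hx' h
    obtain ⟨y, hy, rfl⟩ := Finset.mem_map.1 hx
    obtain ⟨y', hy', rfl⟩ := Finset.mem_map.1 hx'
    rw [hE.inj1 y hy y' hy' h]

lemma Mt.card_free {v : Fin k → ℕ} {E : Finset (Fin k × Fin k)} (hE : Mt v E) (hv : ∀ i, 1 ≤ v i)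
    (hs : ∑ i, v i = n) : (univ.filter fun x : Fin k × Fin k => fr E x).card ≤ (n - sE v E) * (n - sE v E) := by
  have h1 := hE.card_free1 hv hs
  have h2 := hE.symm.card_free1 hv hs
  have h3 : sE v (E.map (Equiv.prodComm _ _).toEmbedding) = sE v E := by
    rw [sE, sum_map, sE]
    exact sum_congr rfl fun x hx => (hE.eqv x hx).symm
  rw [h3] at h2
  have h4 : (univ.filter fun x : Fin k × Fin k => fr E x) ⊆ (univ.filter fun i : Fin k => ∀ y ∈ E, y.1 ≠ i) ×ˢ
      (univ.filter fun i : Fin k => ∀ y ∈ (E.map (Equiv.prodComm _ _).toEmbedding), y.1 ≠ i) := by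
    intro x hx
    have := (mem_filter.1 hx).2
    rw [mem_product, mem_filter, mem_filter]
    refine ⟨⟨mem_univ _, this.1⟩, mem_univ _, ?_⟩
    intro y hy
    obtain ⟨z, hz, rfl⟩ := Finset.mem_map.1 hy
    exact this.2 z hz
  refine (card_le_card h4).trans ?_
  rw [card_product]
  exact Nat.mul_le_mul (by omega) (by omega)

lemma regimeII_E {B : ℝ} (hB : 1 ≤ B) (h a Λ : ℕ) (c c0 : Fin n → Fin k) (v : Fin k → ℕ)
    (hc : ∀ i, (fib c i).card = v i) (hc0 : ∀ i, (fib c0 i).card = v i) (hva : ∀ i, v i ≤ a)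
    (hv : ∀ i, 1 ≤ v i) (hs : ∑ i, v i = n) (h1 : 1 ≤ h)
    (E : Finset (Fin k × Fin k)) (hE : Mt v E) (hM : sE v E < n)
    (hx : (a:ℝ) ^ 2 * Real.exp 1 * B ^ h ≤ ((n - sE v E : ℕ):ℝ) / 2)
    (Reg : Finset (Equiv.Perm (Fin n))) (hReg : ∀ τ ∈ Reg, exE c (c0 ∘ τ) = E ∧
      (univ.filter fun ij : Fin k × Fin k => big h c (c0 ∘ τ) ij.1 ij.2 ∧ fib c ij.1 ≠ fib (c0 ∘ τ) ij.2).card ≤ Λ) :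
    ∑ τ ∈ Reg, B ^ (ov c (c0 ∘ τ)) ≤ B ^ (a * a * Λ) * (Real.exp (2 * ((a:ℝ) ^ 2 * Real.exp 1) ^ 2 * B) *
      (((n - sE v E).factorial : ℝ) * ∏ x ∈ E, (B ^ ((v x.1).choose 2) * ((v x.1).factorial : ℝ)))) := by
  set M := n - sE v E with hMdef
  have hMpos : 0 < M := by omega
  have hM0 : (0:ℝ) < M := by exact_mod_cast hMpos
  have he := Real.exp_pos 1
  have hB0 : 0 < B := by linarith
  have hs1 : ∑ τ ∈ Reg, B ^ (ov c (c0 ∘ τ)) ≤ B ^ (a * a * Λ) * ∑ τ ∈ Reg, ∏ ij : Fin k × Fin k,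
      ∑ S ∈ (fib c ij.1 ∩ fib (c0 ∘ τ) ij.2).powerset, wE B h v E ij S.card := by
    rw [mul_sum]
    refine sum_le_sum fun τ hτ => ?_
    obtain ⟨r1, r2⟩ := hReg τ hτ
    rw [← r1]
    exact pow_ov_le_II hB h a Λ c (c0 ∘ τ) v hc hva r2
  refine hs1.trans (mul_le_mul_of_nonneg_left ?_ (by positivity))
  set z : Fin k × Fin k → ℕ → ℝ := fun x r => if x ∈ E then 1 else (Real.exp 1 / M) ^ r with hz
  have hz0 : ∀ x r, 0 ≤ z x r := by intro x r; rw [hz]; simp only; split_ifs <;> positivity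
  have h2 := expansion_bound c c0 v hc hc0 Reg (wE B h v E) z z (wE_nonneg hB h v E) hz0 hz0
    (M.factorial : ℝ) 0 (by positivity) le_rfl (fun _ => True) (fun _ _ _ _ => trivial) (by
      intro S hSn _ hw
      rw [zero_mul, add_zero]
      have hsum : ∑ ij, (S ij).card = sE v E + ∑ ij ∈ univ \ E, (S ij).card := by
        rw [← sum_sdiff (subset_univ E), add_comm]
        congr 1
        rw [sE]
        refine sum_congr rfl fun x hx => ?_
        have := hw x
        rw [wE, if_pos hx] at this
        by_contra hne
        rw [if_neg hne] at this
        exact this rfl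
      set s := ∑ ij ∈ univ \ E, (S ij).card with hsdef
      have e1 : ∏ ij, z ij (S ij).card = (Real.exp 1 / M) ^ s := by
        rw [← prod_sdiff (subset_univ E), hsdef, ← prod_pow_eq_pow_sum]
        have : ∏ x ∈ E, z x (S x).card = 1 := prod_eq_one fun x hx => by rw [hz]; simp only [if_pos hx]
        rw [this, mul_one]
        refine prod_congr rfl fun x hx => ?_
        rw [hz]; simp only [if_neg (Finset.mem_sdiff.1 hx).2]
      rw [e1]
      have e2 := fac_e M s (by omega)
      have e3 : n - ∑ ij, (S ij).card = M - s := by omega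
      rw [e3, div_pow, ← mul_div_assoc, le_div_iff₀ (by positivity)]
      linarith)
  rw [zero_mul, add_zero] at h2
  refine h2.trans ?_
  set T := 2 * ((a:ℝ) ^ 2 * Real.exp 1) ^ 2 * B / (M:ℝ) ^ 2 with hT
  have hT0 : 0 ≤ T := by positivity
  have h3 : ∏ ij : Fin k × Fin k, ∑ r ∈ range (v ij.1 + 1),
        ((v ij.1).choose r : ℝ) * (wE B h v E ij r * ((v ij.2).descFactorial r : ℝ) * z ij r) ≤
      ∏ ij : Fin k × Fin k, ((if ij ∈ E then (B ^ ((v ij.1).choose 2) * ((v ij.1).factorial : ℝ)) else 1) *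
        (if fr E ij then 1 + T else 1)) := by
    refine prod_le_prod (fun ij _ => sum_nonneg fun r _ => mul_nonneg (by positivity)
      (mul_nonneg (mul_nonneg (wE_nonneg hB h v E ij r) (by positivity)) (hz0 ij r))) fun ij _ => ?_
    by_cases hij : ij ∈ E
    · have hnf : ¬ fr E ij := fun hh => hh.1 ij hij rfl
      rw [if_pos hij, if_neg hnf, mul_one]
      refine le_of_eq ?_
      rw [sum_eq_single (v ij.1)]
      · simp only [wE, if_pos hij, hz, if_true]
        rw [← hE.eqv ij hij, Nat.descFactorial_self]
        simp
      · intro r _ hne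
        simp [wE, if_pos hij, hne]
      · intro hh; simp at hh
    · rw [if_neg hij, one_mul]
      by_cases hf : fr E ij
      · rw [if_pos hf]
        refine le_trans (le_of_eq ?_) (free_sum hB h a M (v ij.1) (v ij.2) (hva _) (hva _) hMpos hx h1)
        refine sum_congr rfl fun r _ => ?_
        simp [wE, hij, hf, hz]
      · rw [if_neg hf]
        refine le_of_eq ?_
        rw [sum_eq_single 0]
        · simp [wE, hij, hf, hz]
        · intro r _ hne
          simp [wE, hij, hf, hne]
        · intro hh; simp at hh
  have h4 : ∏ ij : Fin k × Fin k, (if fr E ij then 1 + T else 1) ≤ Real.exp (2 * ((a:ℝ) ^ 2 * Real.exp 1) ^ 2 * B) := by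
    rw [prod_ite, prod_const_one, mul_one, prod_const]
    have e1 : (1 + T) ^ (univ.filter fun x : Fin k × Fin k => fr E x).card ≤ (1 + T) ^ (M * M) :=
      pow_le_pow_right₀ (by linarith) (hE.card_free hv hs)
    refine e1.trans ?_
    have e2 : 1 + T ≤ Real.exp T := by rw [add_comm]; exact Real.add_one_le_exp T
    refine (pow_le_pow_left₀ (by linarith) e2 _).trans ?_
    rw [← Real.exp_nat_mul]
    refine Real.exp_le_exp.2 (le_of_eq ?_)
    rw [hT]; push_cast; field_simp
  rw [prod_mul_distrib, prod_ite_mem, univ_inter] at h3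
  have h5 : 0 ≤ ∏ x ∈ E, (B ^ ((v x.1).choose 2) * ((v x.1).factorial : ℝ)) := prod_nonneg fun _ _ => by positivity
  calc _ ≤ (M.factorial : ℝ) * ((∏ x ∈ E, (B ^ ((v x.1).choose 2) * ((v x.1).factorial : ℝ))) *
          Real.exp (2 * ((a:ℝ) ^ 2 * Real.exp 1) ^ 2 * B)) :=
        mul_le_mul_of_nonneg_left (h3.trans (mul_le_mul_of_nonneg_left h4 h5)) (by positivity)
    _ = _ := by ring

end TC

end PartH

section PartH2

namespace TC
open Finset
variable {n k m : ℕ}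

/-- matchings of size `l` inside `T × T` -/
def pmS {α : Type} [DecidableEq α] (T : Finset α) (l : ℕ) : Finset (Finset (α × α)) :=
  (T ×ˢ T).powerset.filter fun F => F.card = l ∧ (∀ x ∈ F, ∀ y ∈ F, x.1 = y.1 → x = y) ∧
    (∀ x ∈ F, ∀ y ∈ F, x.2 = y.2 → x = y)

lemma card_pmS {α : Type} [DecidableEq α] (T : Finset α) (l : ℕ) :
    (pmS T l).card ≤ (T.card.choose l) ^ 2 * l.factorial := by
  have hsub : pmS T l ⊆ (T.powersetCard l).biUnion fun I =>
      (univ : Finset (I ↪ T)).image fun f : I ↪ T => I.attach.image fun i : {x // x ∈ I} => ((i : α), (f i : α)) := by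
    intro F hF
    simp only [pmS, mem_filter, mem_powerset] at hF
    obtain ⟨hFT, hFc, hi1, hi2⟩ := hF
    have hex : ∀ i : (F.image Prod.fst : Finset α), ∃ y, ((i:α), y) ∈ F := by
      intro ⟨i, hi⟩
      obtain ⟨x, hx, rfl⟩ := mem_image.1 hi
      exact ⟨x.2, hx⟩
    choose g hg using hex
    rw [mem_biUnion]
    refine ⟨F.image Prod.fst, ?_, ?_⟩
    · rw [mem_powersetCard]
      refine ⟨?_, ?_⟩
      · intro i hi
        obtain ⟨x, hx, rfl⟩ := mem_image.1 hi
        exact (mem_product.1 (hFT hx)).1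
      · rw [card_image_of_injOn, hFc]
        intro x hx y hy h
        exact hi1 x hx y hy h
    · rw [mem_image]
      refine ⟨⟨fun i => ⟨g i, (mem_product.1 (hFT (hg i))).2⟩, ?_⟩, mem_univ _, ?_⟩
      · intro i j hij
        have h1 : g i = g j := by simpa using hij
        have h2 := hi2 _ (hg i) _ (hg j) h1
        exact Subtype.ext (congrArg Prod.fst h2)
      · ext x
        rw [mem_image]
        constructor
        · rintro ⟨i, _, rfl⟩
          exact hg i
        · intro hx
          refine ⟨⟨x.1, mem_image_of_mem _ hx⟩, mem_attach _ _, ?_⟩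
          exact hi1 _ (hg ⟨x.1, mem_image_of_mem _ hx⟩) x hx rfl
  refine (card_le_card hsub).trans (card_biUnion_le.trans ?_)
  calc ∑ I ∈ T.powersetCard l, ((univ : Finset (I ↪ T)).image fun f =>
        I.attach.image fun i : {x // x ∈ I} => ((i : α), (f i : α))).card
      ≤ ∑ I ∈ T.powersetCard l, T.card.descFactorial l := by
        refine sum_le_sum fun I hI => card_image_le.trans ?_
        rw [card_univ, Fintype.card_embedding_eq, Fintype.card_coe, Fintype.card_coe, (mem_powersetCard.1 hI).2]
    _ = _ := by
        rw [sum_const, card_powersetCard, Nat.descFactorial_eq_factorial_mul_choose, smul_eq_mul]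
        ring

def ell (v : Fin k → ℕ) (E : Finset (Fin k × Fin k)) (u : ℕ) : ℕ := (E.filter fun x => v x.1 = u).card

lemma Mt.ell_le {v : Fin k → ℕ} {E : Finset (Fin k × Fin k)} (hE : Mt v E) (u : ℕ) :
    ell v E u ≤ (univ.filter fun i => v i = u).card := by
  refine card_le_card_of_injOn Prod.fst ?_ ?_
  · intro x hx
    rw [mem_coe, mem_filter] at hx
    simp [hx.2]
  · intro x hx y hy h
    exact hE.inj1 x (mem_filter.1 hx).1 y (mem_filter.1 hy).1 h

lemma card_matchings {P : ℕ → ℕ} (v : Fin k → ℕ) (hvn : ∀ i, v i ∈ Icc 1 n)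
    (hvP : ∀ u, (univ.filter fun i => v i = u).card = P u)
    (l : ℕ → ℕ) (A : Finset (Finset (Fin k × Fin k))) (hA : ∀ E ∈ A, Mt v E ∧ ∀ u ∈ Icc 1 n, ell v E u = l u) :
    A.card ≤ ∏ u ∈ Icc 1 n, ((P u).choose (l u)) ^ 2 * (l u).factorial := by
  have h1 : A.card ≤ ((Icc 1 n).pi fun u => pmS (univ.filter fun i => v i = u) (l u)).card := by
    refine card_le_card_of_injOn (fun E => fun u _ => E.filter fun x => v x.1 = u) ?_ ?_
    · intro E hE
      obtain ⟨hM, hl⟩ := hA E hE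
      rw [mem_coe, Finset.mem_pi]
      intro u hu
      simp only [pmS, mem_filter, mem_powerset]
      refine ⟨?_, hl u hu, fun x hx y hy => hM.inj1 x hx.1 y hy.1, fun x hx y hy => hM.inj2 x hx.1 y hy.1⟩
      intro x hx
      rw [mem_filter] at hx
      rw [mem_product, mem_filter, mem_filter]
      exact ⟨⟨mem_univ _, hx.2⟩, mem_univ _, by rw [← hM.eqv x hx.1]; exact hx.2⟩
    · intro E _ E' _ h
      have h2 : ∀ x, x ∈ E ↔ x ∈ E' := by
        intro x
        have := congrFun (congrFun h (v x.1)) (hvn _)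
        have h3 : x ∈ E.filter (fun y => v y.1 = v x.1) ↔ x ∈ E'.filter (fun y => v y.1 = v x.1) := by
          exact iff_of_eq (congrArg (fun s => x ∈ s) this)
        simpa [mem_filter] using h3
      exact Finset.ext h2
  refine h1.trans ?_
  rw [card_pi]
  refine prod_le_prod' fun u _ => ?_
  have := card_pmS (univ.filter fun i => v i = u) (l u)
  rwa [hvP] at this

lemma sum_matchings {P : ℕ → ℕ} (v : Fin k → ℕ) (hvn : ∀ i, v i ∈ Icc 1 n)
    (hvP : ∀ u, (univ.filter fun i => v i = u).card = P u)
    (A : Finset (Finset (Fin k × Fin k))) (hA : ∀ E ∈ A, Mt v E) (W : Finset (Fin k × Fin k) → ℝ)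
    (K : ℝ) (hK : 0 ≤ K) (hW : ∀ E ∈ A, (∏ u ∈ Icc 1 n, (((P u).choose (ell v E u) : ℝ)) ^ 2 * ((ell v E u).factorial : ℝ)) * W E ≤ K) :
    ∑ E ∈ A, W E ≤ (∏ u ∈ Icc 1 n, ((P u : ℝ) + 1)) * K := by
  let key : Finset (Fin k × Fin k) → ((u : ℕ) → u ∈ Icc 1 n → ℕ) := fun E u _ => ell v E u
  have hmaps : ∀ E ∈ A, key E ∈ (Icc 1 n).pi fun u => range (P u + 1) := by
    intro E hE
    rw [Finset.mem_pi]
    intro u _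
    rw [mem_range]
    have := (hA E hE).ell_le u
    rw [hvP] at this
    simp only [key]
    omega
  rw [← sum_fiberwise_of_maps_to hmaps]
  have hcard : (((Icc 1 n).pi fun u => range (P u + 1)).card : ℝ) = ∏ u ∈ Icc 1 n, ((P u : ℝ) + 1) := by
    rw [card_pi]; push_cast; simp
  rw [← hcard, ← nsmul_eq_mul, ← sum_const]
  refine sum_le_sum fun y _ => ?_
  by_cases hne : (A.filter fun E => key E = y).Nonempty
  · obtain ⟨E0, hE0⟩ := hne
    rw [mem_filter] at hE0
    have hsame : ∀ E ∈ A.filter (fun E => key E = y), ∀ u ∈ Icc 1 n, ell v E u = ell v E0 u := by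
      intro E hE u hu
      have h1 := (mem_filter.1 hE).2
      rw [← hE0.2] at h1
      exact congrFun (congrFun h1 u) hu
    set Dn := ∏ u ∈ Icc 1 n, (((P u).choose (ell v E0 u) : ℝ)) ^ 2 * ((ell v E0 u).factorial : ℝ) with hDn
    have hcnt : ((A.filter fun E => key E = y).card : ℝ) ≤ Dn := by
      have := card_matchings v hvn hvP (ell v E0) (A.filter fun E => key E = y)
        (fun E hE => ⟨hA E (mem_filter.1 hE).1, hsame E hE⟩)
      rw [hDn]
      exact_mod_cast this
    have hDpos : 0 < Dn := by
      have : 0 < ((A.filter fun E => key E = y).card : ℝ) := by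
        exact_mod_cast card_pos.2 ⟨E0, mem_filter.2 hE0⟩
      linarith
    calc ∑ E ∈ A.filter (fun E => key E = y), W E ≤ ∑ E ∈ A.filter (fun E => key E = y), K / Dn := by
          refine sum_le_sum fun E hE => ?_
          rw [le_div_iff₀ hDpos, mul_comm]
          have h1 := hW E (mem_filter.1 hE).1
          have h2 : ∏ u ∈ Icc 1 n, (((P u).choose (ell v E u) : ℝ)) ^ 2 * ((ell v E u).factorial : ℝ) = Dn :=
            prod_congr rfl fun u hu => by rw [hsame E hE u hu]
          rwa [h2] at h1
      _ = (A.filter fun E => key E = y).card * (K / Dn) := by rw [sum_const, nsmul_eq_mul]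
      _ ≤ Dn * (K / Dn) := mul_le_mul_of_nonneg_right hcnt (by positivity)
      _ = K := by field_simp
  · rw [not_nonempty_iff_eq_empty.1 hne, sum_empty]
    exact hK

lemma prod_E {v : Fin k → ℕ} (hvn : ∀ i, v i ∈ Icc 1 n) (E : Finset (Fin k × Fin k)) (F : ℕ → ℝ) :
    ∏ x ∈ E, F (v x.1) = ∏ u ∈ Icc 1 n, F u ^ (ell v E u) := by
  rw [← prod_fiberwise_of_maps_to (fun x _ => hvn x.1)]
  refine prod_congr rfl fun u _ => ?_
  rw [prod_congr rfl (g := fun _ => F u)]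
  · rw [prod_const, ell]
  · intro x hx; rw [(mem_filter.1 hx).2]

lemma sE_eq {v : Fin k → ℕ} (hvn : ∀ i, v i ∈ Icc 1 n) (E : Finset (Fin k × Fin k)) :
    sE v E = ∑ u ∈ Icc 1 n, u * ell v E u := by
  rw [sE, ← sum_fiberwise_of_maps_to (fun x _ => hvn x.1)]
  refine sum_congr rfl fun u _ => ?_
  rw [sum_congr rfl (g := fun _ => u)]
  · rw [sum_const, ell, smul_eq_mul, mul_comm]
  · intro x hx; rw [(mem_filter.1 hx).2]

/-- the quantity controlling overlaps with profile `l` -/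
def Qp (n : ℕ) (B : ℝ) (P l : ℕ → ℕ) : ℝ :=
  (∏ u ∈ Icc 1 n, (((P u).choose (l u) : ℝ)) ^ 2 * ((l u).factorial : ℝ)) *
    (((n - ∑ u ∈ Icc 1 n, u * l u).factorial : ℝ) *
      ∏ u ∈ Icc 1 n, (B ^ (u.choose 2) * (u.factorial : ℝ)) ^ (l u))

/-- contribution of regime II -/
lemma regimeII {B : ℝ} (hB : 1 ≤ B) (h a Λ : ℕ) {P : ℕ → ℕ} (c c0 : Fin n → Fin k) (v : Fin k → ℕ)
    (hc : ∀ i, (fib c i).card = v i) (hc0 : ∀ i, (fib c0 i).card = v i) (hva : ∀ i, v i ≤ a)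
    (hvn : ∀ i, v i ∈ Icc 1 n) (hvP : ∀ u, (univ.filter fun i => v i = u).card = P u)
    (hs : ∑ i, v i = n) (h1 : 1 ≤ h) (M0 : ℕ) (hM0 : 0 < M0) (d0 : ℝ)
    (hx : (a:ℝ) ^ 2 * Real.exp 1 * B ^ h ≤ (M0:ℝ) / 2) (K : ℝ) (hK : 0 ≤ K)
    (hQ : ∀ l : ℕ → ℕ, (∀ u, l u ≤ P u) → d0 ≤ (∑ u ∈ Icc 1 n, u * l u : ℕ) →
      ∑ u ∈ Icc 1 n, u * l u + M0 ≤ n → Qp n B P l ≤ K)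
    (Reg : Finset (Equiv.Perm (Fin n))) (hReg : ∀ τ ∈ Reg, d0 ≤ (sE v (exE c (c0 ∘ τ)) : ℝ) ∧
      sE v (exE c (c0 ∘ τ)) + M0 ≤ n ∧
      (univ.filter fun ij : Fin k × Fin k => big h c (c0 ∘ τ) ij.1 ij.2 ∧ fib c ij.1 ≠ fib (c0 ∘ τ) ij.2).card ≤ Λ) :
    ∑ τ ∈ Reg, B ^ (ov c (c0 ∘ τ)) ≤ B ^ (a * a * Λ) * (Real.exp (2 * ((a:ℝ) ^ 2 * Real.exp 1) ^ 2 * B) *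
      ((∏ u ∈ Icc 1 n, ((P u : ℝ) + 1)) * K)) := by
  have hv1 : ∀ i, 1 ≤ v i := fun i => (mem_Icc.1 (hvn i)).1
  have hB0 : 0 < B := by linarith
  have hcτ : ∀ τ : Equiv.Perm (Fin n), ∀ i, (fib (c0 ∘ τ) i).card = v i := by
    intro τ i
    rw [← hc0 i]
    refine card_bij (fun x _ => τ x) ?_ ?_ ?_
    · intro x hx; rw [mem_fib] at hx ⊢; exact hx
    · intro x _ y _ h; exact τ.injective h
    · intro y hy; rw [mem_fib] at hy; exact ⟨τ.symm y, by rw [mem_fib]; simpa using hy, by simp⟩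
  set A := Reg.image fun τ : Equiv.Perm (Fin n) => exE c (c0 ∘ τ) with hA
  have hAM : ∀ E ∈ A, Mt v E := by
    intro E hE
    obtain ⟨τ, _, rfl⟩ := mem_image.1 hE
    exact Mt_exE hc (hcτ τ) hv1
  rw [← sum_fiberwise_of_maps_to (t := A) (g := fun τ : Equiv.Perm (Fin n) => exE c (c0 ∘ τ))
    (fun τ hτ => mem_image_of_mem _ hτ)]
  have h3 := sum_matchings v hvn hvP A hAM (fun E => ((n - sE v E).factorial : ℝ) *
    ∏ x ∈ E, (B ^ ((v x.1).choose 2) * ((v x.1).factorial : ℝ))) K hK (by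
      intro E hE
      have hM := hAM E hE
      obtain ⟨τ, hτ, rfl⟩ := mem_image.1 hE
      obtain ⟨r1, r2, r3⟩ := hReg τ hτ
      rw [prod_E hvn _ (fun u => B ^ (u.choose 2) * (u.factorial : ℝ)), sE_eq hvn]
      rw [sE_eq hvn] at r1 r2
      exact hQ _ (fun u => by rw [← hvP]; exact hM.ell_le u) r1 r2)
  refine le_trans ?_ (mul_le_mul_of_nonneg_left (mul_le_mul_of_nonneg_left h3 (Real.exp_nonneg _)) (by positivity))
  rw [mul_sum, mul_sum]
  refine sum_le_sum fun E hE => ?_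
  have hM := hAM E hE
  have hlt : sE v E + M0 ≤ n := by
    obtain ⟨τ, hτ, rfl⟩ := mem_image.1 hE
    exact (hReg τ hτ).2.1
  refine regimeII_E hB h a Λ c c0 v hc hc0 hva hv1 hs h1 E hM (by omega) ?_ _ ?_
  · refine hx.trans ?_
    have : (M0:ℝ) ≤ ((n - sE v E : ℕ) : ℝ) := by exact_mod_cast (by omega : M0 ≤ n - sE v E)
    linarith
  · intro τ hτ
    rw [mem_filter] at hτ
    exact ⟨hτ.2, (hReg τ hτ.1).2.2⟩

end TC

end PartH2

section PartH3

namespace TC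
open Finset
variable {n k m : ℕ}

/-- number of vertices in large overlaps -/
def bsum (h : ℕ) (c c' : Fin n → Fin k) : ℕ :=
  ∑ ij : Fin k × Fin k, if h < (fib c ij.1 ∩ fib c' ij.2).card then (fib c ij.1 ∩ fib c' ij.2).card else 0

lemma fib_comp_card {c0 : Fin n → Fin k} {v : Fin k → ℕ} (hc0 : ∀ i, (fib c0 i).card = v i)
    (τ : Equiv.Perm (Fin n)) (i : Fin k) : (fib (c0 ∘ τ) i).card = v i := by
  rw [← hc0 i]
  refine card_bij (fun x _ => τ x) ?_ ?_ ?_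
  · intro x hx; rw [mem_fib] at hx ⊢; exact hx
  · intro x _ y _ h; exact τ.injective h
  · intro y hy; rw [mem_fib] at hy; exact ⟨τ.symm y, by rw [mem_fib]; simpa using hy, by simp⟩

def inx (h : ℕ) (c c' : Fin n → Fin k) : Finset (Fin k × Fin k) :=
  univ.filter fun ij : Fin k × Fin k => big h c c' ij.1 ij.2 ∧ fib c ij.1 ≠ fib c' ij.2

lemma bsum_le {h a : ℕ} {c c' : Fin n → Fin k} {v : Fin k → ℕ} (hc : ∀ i, (fib c i).card = v i)
    (hva : ∀ i, v i ≤ a) : bsum h c c' ≤ sE v (exE c c') + a * (inx h c c').card := by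
  have h1 : bsum h c c' ≤ ∑ ij : Fin k × Fin k, ((if ij ∈ exE c c' then v ij.1 else 0) +
      (if ij ∈ inx h c c' then a else 0)) := by
    refine sum_le_sum fun ij _ => ?_
    have hcard : (fib c ij.1 ∩ fib c' ij.2).card ≤ v ij.1 := by
      rw [← hc]; exact card_le_card inter_subset_left
    have hva' := hva ij.1
    by_cases hb : h < (fib c ij.1 ∩ fib c' ij.2).card
    · rw [if_pos hb]
      by_cases he : fib c ij.1 = fib c' ij.2
      · have : ij ∈ exE c c' := by simp [exE, he]
        rw [if_pos this]; omega
      · have : ij ∈ inx h c c' := by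
          rw [inx, mem_filter]; exact ⟨mem_univ _, hb, he⟩
        rw [if_pos this]; omega
    · rw [if_neg hb]; omega
  refine h1.trans ?_
  rw [sum_add_distrib, sum_ite_mem, sum_ite_mem, univ_inter, univ_inter, sum_const, smul_eq_mul, sE, mul_comm a]

lemma combine {P : ℕ → ℕ} (c0 : Fin n → Fin k) (v : Fin k → ℕ) (hc0 : ∀ i, (fib c0 i).card = v i)
    (hvn : ∀ i, v i ∈ Icc 1 n) (hvP : ∀ u, (univ.filter fun i => v i = u).card = P u)
    (hs : ∑ i, v i = n) (h umin a s1 lam lam' f : ℕ) (h1 : 1 ≤ h) (hu : h < umin)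
    (hlo : ∀ i, umin ≤ v i) (hva : ∀ i, v i ≤ a) (hf : ∑ i, (v i).choose 2 = f)
    (hmf : m + 2 * f ≤ n.choose 2) (B : ℝ)
    (hBdef : B = (((n.choose 2 - 2 * f : ℕ) : ℝ) + 1) / (((n.choose 2 - 2 * f : ℕ) : ℝ) + 1 - m))
    (dl SI SII : ℝ) (hdl : (a:ℝ) * (2 * lam') ≤ dl / 2 * n) (σ : Equiv.Perm (Fin n))
    (hSI : ∀ Reg : Finset (Equiv.Perm (Fin n)), (∀ τ ∈ Reg, (bsum h (c0 ∘ σ) (c0 ∘ τ) : ℝ) ≤ dl * n) →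
      ∑ τ ∈ Reg, B ^ (ov (c0 ∘ σ) (c0 ∘ τ)) ≤ SI)
    (hSII : ∀ Reg : Finset (Equiv.Perm (Fin n)), (∀ τ ∈ Reg, dl / 2 * n ≤ (sE v (exE (c0 ∘ σ) (c0 ∘ τ)) : ℝ) ∧
      sE v (exE (c0 ∘ σ) (c0 ∘ τ)) + s1 ≤ n ∧ (inx h (c0 ∘ σ) (c0 ∘ τ)).card ≤ 2 * lam') →
      ∑ τ ∈ Reg, B ^ (ov (c0 ∘ σ) (c0 ∘ τ)) ≤ SII) :
    ∑ τ : Equiv.Perm (Fin n), (((Om n m).filter fun ω => Good h umin a s1 lam lam' (c0 ∘ σ) ω ∧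
        Good h umin a s1 lam lam' (c0 ∘ τ) ω).card : ℝ) ≤
      ((n.choose 2 - 2 * f).choose m : ℝ) * (SI + SII) +
      ((n.choose 2 - f).choose m : ℝ) * (2 ^ lam * (∏ u ∈ Icc 1 n, ((P u).factorial : ℝ)) * ∏ i, ((v i).factorial : ℝ)) := by
  set N := n.choose 2 with hN
  set c := c0 ∘ σ with hcdef
  have hc : ∀ i, (fib c i).card = v i := fib_comp_card hc0 σ
  set F : Equiv.Perm (Fin n) → ℝ := fun τ => (((Om n m).filter fun ω => Good h umin a s1 lam lam' c ω ∧
        Good h umin a s1 lam lam' (c0 ∘ τ) ω).card : ℝ) with hF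
  have hpair : ∀ (τ : Equiv.Perm (Fin n)) ω, Good h umin a s1 lam lam' c ω → Good h umin a s1 lam lam' (c0 ∘ τ) ω →
      Pair h umin a s1 lam lam' c (c0 ∘ τ) ω := fun τ ω g1 g2 =>
    ⟨g1, g2, fun i => by rw [hc]; exact hlo i, fun i => by rw [fib_comp_card hc0]; exact hlo i,
      fun i => by rw [hc]; exact hva i, fun i => by rw [fib_comp_card hc0]; exact hva i, h1, hu⟩
  have hmono : ∀ τ : Equiv.Perm (Fin n), (mono (c0 ∘ τ)).card = f := by
    intro τ
    rw [card_mono, ← hf]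
    exact sum_congr rfl fun i _ => by rw [fib_comp_card hc0]
  -- generic bound
  have hgen : ∀ τ, F τ ≤ ((N - 2 * f).choose m : ℝ) * B ^ (ov c (c0 ∘ τ)) := by
    intro τ
    have e1 : F τ ≤ (((Om n m).filter fun ω => Disjoint ω (mono c ∪ mono (c0 ∘ τ))).card : ℝ) := by
      rw [hF]
      refine Nat.cast_le.2 (card_le_card ?_)
      intro ω hω
      rw [mem_filter] at hω ⊢
      exact ⟨hω.1, disjoint_union_right.2 ⟨hω.2.1.proper, hω.2.2.proper⟩⟩
    rw [card_avoid (union_subset (mono_subset _) (mono_subset _))] at e1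
    have e2 := card_mono_union c (c0 ∘ τ)
    rw [hmono, hcdef, hmono] at e2
    have e3 : n.choose 2 - (mono c ∪ mono (c0 ∘ τ)).card = (N - 2 * f) + ov c (c0 ∘ τ) := by
      rw [hcdef]; omega
    rw [e3] at e1
    have e4 := choose_up (N - 2 * f) m (by omega) (ov c (c0 ∘ τ))
    rw [← hBdef] at e4
    exact e1.trans e4
  set RI := univ.filter fun τ : Equiv.Perm (Fin n) => (bsum h c (c0 ∘ τ) : ℝ) ≤ dl * n with hRI
  set RII := univ.filter fun τ : Equiv.Perm (Fin n) => ¬ ((bsum h c (c0 ∘ τ) : ℝ) ≤ dl * n) ∧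
    sE v (exE c (c0 ∘ τ)) + s1 ≤ n ∧ (inx h c (c0 ∘ τ)).card ≤ 2 * lam' with hRII
  set RIII := univ \ (RI ∪ RII) with hRIII
  have hsplit : ∑ τ, F τ ≤ ∑ τ ∈ RI, F τ + ∑ τ ∈ RII, F τ + ∑ τ ∈ RIII, F τ := by
    rw [← sum_sdiff (subset_univ (RI ∪ RII)), add_comm]
    refine add_le_add ?_ le_rfl
    rw [← sum_union_inter]
    refine le_add_of_nonneg_right (sum_nonneg fun τ _ => by rw [hF]; positivity)
  have hI : ∑ τ ∈ RI, F τ ≤ ((N - 2 * f).choose m : ℝ) * SI := by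
    refine (sum_le_sum fun τ _ => hgen τ).trans ?_
    rw [← mul_sum]
    exact mul_le_mul_of_nonneg_left (hSI RI fun τ hτ => (mem_filter.1 hτ).2) (by positivity)
  have hII : ∑ τ ∈ RII, F τ ≤ ((N - 2 * f).choose m : ℝ) * SII := by
    refine (sum_le_sum fun τ _ => hgen τ).trans ?_
    rw [← mul_sum]
    refine mul_le_mul_of_nonneg_left (hSII RII fun τ hτ => ?_) (by positivity)
    obtain ⟨r1, r2, r3⟩ := (mem_filter.1 hτ).2
    refine ⟨?_, r2, r3⟩
    have e1 := bsum_le (h := h) (c' := c0 ∘ τ) hc hva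
    have e2 : (bsum h c (c0 ∘ τ) : ℝ) ≤ (sE v (exE c (c0 ∘ τ)) : ℝ) + a * (2 * lam') := by
      have : bsum h c (c0 ∘ τ) ≤ sE v (exE c (c0 ∘ τ)) + a * (2 * lam') :=
        e1.trans (Nat.add_le_add_left (Nat.mul_le_mul_left _ r3) _)
      exact_mod_cast this
    push Not at r1
    linarith
  have hIII : ∑ τ ∈ RIII, F τ ≤ ((N - f).choose m : ℝ) * (2 ^ lam * (∏ u ∈ Icc 1 n, ((P u).factorial : ℝ)) * ∏ i, ((v i).factorial : ℝ)) := by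
    have e1 : ∑ τ ∈ RIII, F τ = ∑ ω ∈ Om n m, ((RIII.filter fun τ : Equiv.Perm (Fin n) => Good h umin a s1 lam lam' c ω ∧
        Good h umin a s1 lam lam' (c0 ∘ τ) ω).card : ℝ) := by
      simp only [hF, card_filter, Nat.cast_sum]
      exact sum_comm
    have e2 : ∀ ω ∈ Om n m, ((RIII.filter fun τ : Equiv.Perm (Fin n) => Good h umin a s1 lam lam' c ω ∧
        Good h umin a s1 lam lam' (c0 ∘ τ) ω).card : ℝ) ≤ (if Disjoint ω (mono c) then
          (2 ^ lam * (∏ u ∈ Icc 1 n, ((P u).factorial : ℝ)) * ∏ i, ((v i).factorial : ℝ)) else 0) := by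
      intro ω _
      by_cases hg : Good h umin a s1 lam lam' c ω
      · rw [if_pos hg.proper]
        have e3 := regimeIII_card (h := h) (umin := umin) (a := a) (s1 := s1) (lam := lam) (lam' := lam') (ω := ω) c0 c v hc0
          (RIII.filter fun τ : Equiv.Perm (Fin n) => Good h umin a s1 lam lam' c ω ∧
            Good h umin a s1 lam lam' (c0 ∘ τ) ω) (by
            intro τ hτ
            obtain ⟨t1, t2, t3⟩ := mem_filter.1 hτ
            have hP := hpair τ ω t2 t3
            refine ⟨hP, ?_⟩
            have hin : (inx h c (c0 ∘ τ)).card ≤ 2 * lam' := hP.inexact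
            have hlt : n < sE v (exE c (c0 ∘ τ)) + s1 := by
              by_contra hle
              rw [hRIII, Finset.mem_sdiff, mem_union, not_or] at t1
              obtain ⟨_, t4, t5⟩ := t1
              apply t5
              rw [hRII, mem_filter]
              refine ⟨mem_univ _, fun hh => t4 ?_, by omega, hin⟩
              rw [hRI, mem_filter]
              exact ⟨mem_univ _, hh⟩
            have hM := Mt_exE hc (fib_comp_card hc0 τ) (fun i => (mem_Icc.1 (hvn i)).1)
            have h5 := hM.card_free1 (fun i => (mem_Icc.1 (hvn i)).1) hs
            have h6 : unm h c (c0 ∘ τ) ⊆ univ.filter fun i : Fin k => ∀ y ∈ exE c (c0 ∘ τ), y.1 ≠ i := by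
              intro i hi
              rw [mem_filter]
              refine ⟨mem_univ _, fun y hy hyi => ?_⟩
              rw [unm, mem_filter] at hi
              refine hi.2 y.2 ?_
              have hy2 : fib c y.1 = fib (c0 ∘ τ) y.2 := by simpa [exE] using hy
              rw [big, ← hyi, ← hy2, inter_self, hc]
              exact hu.trans_le (hlo _)
            have h7 := card_le_card h6
            omega) hg.gc
        have e4 : ∏ u ∈ univ.image v, ((univ.filter fun i => v i = u).card).factorial ≤ ∏ u ∈ Icc 1 n, (P u).factorial := by
          rw [prod_congr rfl (fun u _ => by rw [hvP])]
          refine prod_le_prod_of_subset_of_one_le' ?_ fun u _ _ => Nat.factorial_pos _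
          intro u hu
          obtain ⟨i, _, rfl⟩ := mem_image.1 hu
          exact hvn i
        have e5 := e3.trans (Nat.mul_le_mul_right _ (Nat.mul_le_mul_left _ e4))
        exact_mod_cast e5
      · have : (RIII.filter fun τ : Equiv.Perm (Fin n) => Good h umin a s1 lam lam' c ω ∧
            Good h umin a s1 lam lam' (c0 ∘ τ) ω) = ∅ := by
          rw [filter_eq_empty_iff]; intro τ _ hh; exact hg hh.1
        rw [this, card_empty, Nat.cast_zero]
        split_ifs <;> positivity
    rw [e1]
    refine (sum_le_sum e2).trans (le_of_eq ?_)
    rw [← sum_filter, sum_const, nsmul_eq_mul, card_avoid (mono_subset c), hcdef, hmono]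
  calc ∑ τ, F τ ≤ _ := hsplit
    _ ≤ _ := add_le_add (add_le_add hI hII) hIII
    _ = _ := by ring

end TC

end PartH3

section PartI1

namespace TC
open Finset
variable {n k m : ℕ}

lemma ev_poly (j : ℕ) (C : ℝ) {c : ℝ} (hc : 0 < c) :
    ∀ᶠ x : ℝ in atTop, C * (2 * x + 2) ^ j ≤ Real.exp (c * x) := by
  have h1 := Real.tendsto_pow_mul_exp_neg_atTop_nhds_zero j
  have h2 : Tendsto (fun x : ℝ => c * x) atTop atTop := tendsto_id.const_mul_atTop hc
  have h3 := (h1.comp h2).const_mul (|C| * (4 / c) ^ j)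
  rw [mul_zero] at h3
  filter_upwards [h3.eventually (gt_mem_nhds (zero_lt_one)), eventually_ge_atTop 1] with x hx hx1
  simp only [Function.comp] at hx
  have e1 : |C| * (4 / c) ^ j * ((c * x) ^ j * Real.exp (-(c * x))) = |C| * (4 * x) ^ j * Real.exp (-(c * x)) := by
    have : (4 / c) ^ j * (c * x) ^ j = (4 * x) ^ j := by
      rw [← mul_pow]; congr 1; field_simp
    rw [← this]; ring
  rw [e1, Real.exp_neg, ← div_eq_mul_inv, div_lt_one (Real.exp_pos _)] at hx
  refine le_trans ?_ hx.le
  calc C * (2 * x + 2) ^ j ≤ |C| * (2 * x + 2) ^ j :=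
        mul_le_mul_of_nonneg_right (le_abs_self C) (by positivity)
    _ ≤ |C| * (4 * x) ^ j := by gcongr; linarith

lemma choose_le_weight (a r : ℕ) (hr : r ≤ a) {Y : ℝ} (hY : 0 < Y) :
    (a.choose r : ℝ) ≤ Real.exp (a / Y) * Y ^ (a - r) := by
  have h1 : (a.choose r : ℝ) * (Y⁻¹) ^ (a - r) ≤ (Y⁻¹ + 1) ^ a := by
    rw [add_pow]
    have := Finset.single_le_sum (f := fun t => Y⁻¹ ^ t * 1 ^ (a - t) * (a.choose t : ℝ))
      (s := range (a + 1)) (fun t _ => by positivity) (mem_range.2 (show a - r < a + 1 by omega))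
    simp only [one_pow, mul_one, Nat.choose_symm hr] at this
    simp only [one_pow, mul_one]
    linarith
  have h2 : (Y⁻¹ + 1) ^ a ≤ Real.exp (a / Y) := by
    rw [div_eq_mul_inv, Real.exp_nat_mul]
    exact pow_le_pow_left₀ (by positivity) (Real.add_one_le_exp _) _
  have h3 := h1.trans h2
  rw [inv_pow, ← div_eq_mul_inv, div_le_iff₀ (by positivity)] at h3
  exact h3

lemma pow_exp_le {q x : ℝ} (hq0 : 0 ≤ q) (hq : q ≤ Real.exp (-x)) (t : ℕ) {E : ℝ} (hx : 0 ≤ x) (hE : E ≤ t) :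
    q ^ t ≤ Real.exp (-(x * E)) := by
  calc q ^ t ≤ (Real.exp (-x)) ^ t := pow_le_pow_left₀ hq0 hq t
    _ = Real.exp (-(x * t)) := by rw [← Real.exp_nat_mul]; congr 1; ring
    _ ≤ _ := Real.exp_le_exp.2 (by nlinarith)

lemma sum_square_le (A : Finset (ℕ × ℕ)) (a : ℕ) (hA : A ⊆ range (a + 1) ×ˢ range (a + 1)) (F : ℕ × ℕ → ℝ)
    {M L : ℝ} (hM : 0 ≤ M) (ha : (a:ℝ) ≤ 2 * L) (hF : ∀ x ∈ A, F x ≤ M) :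
    ∑ x ∈ A, F x ≤ (2 * L + 2) ^ 2 * M := by
  have h1 := Finset.sum_le_card_nsmul A F M hF
  rw [nsmul_eq_mul] at h1
  refine h1.trans (mul_le_mul_of_nonneg_right ?_ hM)
  have h2 := card_le_card hA
  rw [card_product, card_range] at h2
  have h3 : (A.card : ℝ) ≤ ((a:ℝ) + 1) * (a + 1) := by exact_mod_cast h2
  have : (0:ℝ) ≤ a := by positivity
  nlinarith

lemma num1 {L r d : ℝ} (hL : 22 ≤ L) (hd : 2 ≤ d) (hr : 1.4 * L ≤ r) (hrd : 1.995 * L ≤ r + d) :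
    L + 0.04 * L + 0.01 * L * d + L * d - 0.995 * (r * d) ≤ -(0.4 * L) := by
  by_cases h : d ≤ 0.2 * L
  · have h1 : 1.795 * L * d ≤ r * d := mul_le_mul_of_nonneg_right (by linarith) (by linarith)
    have h2 : L * 2 ≤ L * d := mul_le_mul_of_nonneg_left hd (by linarith)
    linarith
  · push Not at h
    have h1 : 1.4 * L * d ≤ r * d := mul_le_mul_of_nonneg_right hr (by linarith)
    have h2 : L * 4.4 ≤ L * d := mul_le_mul_of_nonneg_left (by linarith) (by linarith)
    linarith

lemma num2 {L u s h : ℝ} (hL : 400 ≤ L) (hu : 1.995 * L ≤ u) (hu2 : u ≤ 2 * L) (h2 : s + h ≤ u) (hh : L / 8 ≤ h + 1) :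
    L * s + 0.002 * L ^ 2 - 0.995 * ((u * (u - 1) - 1.4 * L * (u - s)) / 2 - 1 / 2) ≤ -L := by
  have h1 : L * (L / 8 - 1) ≤ L * (u - s) := mul_le_mul_of_nonneg_left (by linarith) (by linarith)
  have h3 : 1.995 * L * u ≤ u * u := mul_le_mul_of_nonneg_right hu (by linarith)
  have h4 : L * u ≤ L * (2 * L) := mul_le_mul_of_nonneg_left hu2 (by linarith)
  have h5 : L * 400 ≤ L * L := mul_le_mul_of_nonneg_left hL (by linarith)
  rw [pow_two]
  linarith

lemma num6 {L : ℝ} (hL : 22 ≤ L) :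
    L + 1.02 * L ^ 2 + 2 * L * (0.005 * L + 1) - 0.995 * (1.8 * L ^ 2) ≤ -(2 * L) := by nlinarith

lemma e1_ev {β : ℝ} (hβ : 0 < β) {ξ : ℝ} (hξ0 : 0 ≤ ξ) (hξ : ξ ≤ 1/200)
    (hξ2 : ξ * Real.log (100 / β + 1) ≤ 0.02 * β) {η : ℝ} (hη : 0 < η) :
    ∀ᶠ L : ℝ in atTop, ∀ (n a umin k R : ℕ) (q : ℝ), (n:ℝ) = Real.exp (β * L) → 0 ≤ q →
      q ≤ Real.exp (-(0.995 * β)) → (2 - ξ) * L ≤ umin → (a:ℝ) ≤ 2 * L → k ≤ n → 1.4 * L ≤ R + 1 →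
      ∑ x ∈ RD a umin R, (k:ℝ) * ((a.choose x.1 * n ^ x.2 : ℕ) : ℝ) * q ^ (x.1 * x.2) ≤ η := by
  set Y := 100 / β + 1 with hYdef
  have hY1 : 1 ≤ Y := by rw [hYdef]; linarith [show (0:ℝ) ≤ 100 / β by positivity]
  have hY0 : 0 < Y := by linarith
  have hlY : 0 ≤ Real.log Y := Real.log_nonneg hY1
  have hYβ : 1 / Y ≤ β / 100 := by
    rw [div_le_div_iff₀ hY0 (by norm_num)]
    rw [hYdef]
    have : β * (100 / β + 1) = 100 + β := by field_simp
    linarith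
  filter_upwards [ev_poly 2 η⁻¹ (show 0 < 0.4 * β by positivity), eventually_ge_atTop 22,
    eventually_ge_atTop (Real.log Y / (0.01 * β))] with L hL1 hL22 hLY n a umin k R q hn hq0 hq hu ha hk hR
  have hLY' : Real.log Y ≤ 0.01 * β * L := by
    rw [div_le_iff₀ (by positivity)] at hLY; linarith
  have hterm : ∀ x ∈ RD a umin R, (k:ℝ) * ((a.choose x.1 * n ^ x.2 : ℕ) : ℝ) * q ^ (x.1 * x.2) ≤
      Real.exp (-(0.4 * β * L)) := by
    rintro ⟨r, d⟩ hx
    obtain ⟨_, h1, h2, h3, h4⟩ := mem_filter.1 hx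
    simp only at h1 h2 h3 h4 ⊢
    have h1' : 1.4 * L ≤ r := by
      have : (R:ℝ) + 1 ≤ r := by exact_mod_cast h1
      linarith
    have h2' : (2:ℝ) ≤ d := by exact_mod_cast h2
    have h3' : (umin:ℝ) ≤ r + d := by exact_mod_cast h3
    have h4' : (r:ℝ) + d ≤ a := by exact_mod_cast h4
    have hkn : (k:ℝ) ≤ Real.exp (β * L) := by rw [← hn]; exact_mod_cast hk
    have hch : (a.choose r : ℝ) ≤ Real.exp (0.04 * β * L + 0.01 * β * L * d) := by
      refine (choose_le_weight a r (by omega) hY0).trans ?_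
      have e1 : Y ^ (a - r) = Real.exp (Real.log Y * ((a:ℝ) - r)) := by
        rw [mul_comm, ← Nat.cast_sub (by omega), Real.exp_nat_mul, Real.exp_log hY0]
      rw [e1, ← Real.exp_add]
      refine Real.exp_le_exp.2 ?_
      have e2 : (a:ℝ) / Y ≤ 0.02 * β * L := by
        rw [div_eq_mul_one_div]
        have : (a:ℝ) * (1/Y) ≤ 2 * L * (β / 100) := by
          apply mul_le_mul ha hYβ (by positivity) (by positivity)
        linarith
      have e3 : Real.log Y * ((a:ℝ) - r) ≤ Real.log Y * (ξ * L + d) :=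
        mul_le_mul_of_nonneg_left (by linarith) hlY
      have e4 : Real.log Y * (ξ * L) ≤ 0.02 * β * L := by nlinarith
      have e5 : Real.log Y * d ≤ 0.01 * β * L * d := mul_le_mul_of_nonneg_right hLY' (by positivity)
      linarith
    have hqq : q ^ (r * d) ≤ Real.exp (-(0.995 * β * (r * d))) :=
      pow_exp_le hq0 hq _ (by positivity) (by push_cast; exact le_rfl)
    have hnd : ((n:ℝ)) ^ d = Real.exp (β * L * d) := by
      rw [hn, ← Real.exp_nat_mul]; congr 1; ring
    push_cast
    rw [hnd]
    calc (k:ℝ) * ((a.choose r : ℝ) * Real.exp (β * L * d)) * q ^ (r * d)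
        ≤ Real.exp (β * L) * (Real.exp (0.04 * β * L + 0.01 * β * L * d) * Real.exp (β * L * d)) *
          Real.exp (-(0.995 * β * (r * d))) := by gcongr
      _ = Real.exp (β * (L + 0.04 * L + 0.01 * L * d + L * d - 0.995 * (r * d))) := by
          rw [← Real.exp_add, ← Real.exp_add, ← Real.exp_add]; congr 1; ring
      _ ≤ _ := by
          refine Real.exp_le_exp.2 ?_
          have : L + 0.04 * L + 0.01 * L * d + L * d - 0.995 * (r * d) ≤ -(0.4 * L) := by
            exact num1 hL22 h2' h1' (by nlinarith)
          have := mul_le_mul_of_nonneg_left this hβ.le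
          linarith
  refine (sum_square_le _ a (filter_subset _ _) _ (Real.exp_pos _).le ha hterm).trans ?_
  rw [Real.exp_neg, ← div_eq_mul_inv, div_le_iff₀ (Real.exp_pos _)]
  rw [inv_mul_le_iff₀ hη] at hL1
  exact hL1

lemma e2_ev {β : ℝ} (hβ : 0 < β) {ξ : ℝ} (hξ0 : 0 ≤ ξ) (hξ : ξ ≤ 1/200) {η : ℝ} (hη : 0 < η) :
    ∀ᶠ L : ℝ in atTop, ∀ (n a umin k R h : ℕ) (q : ℝ), (n:ℝ) = Real.exp (β * L) → 0 ≤ q →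
      q ≤ Real.exp (-(0.995 * β)) → (2 - ξ) * L ≤ umin → (a:ℝ) ≤ 2 * L → k ≤ n → (R:ℝ) ≤ 1.4 * L →
      L / 8 ≤ h + 1 →
      ∑ x ∈ US a umin h, ((k ^ x.2 * (a * a + 1) ^ a : ℕ) : ℝ) *
            q ^ ((x.1 * (x.1 - 1) - R * (x.1 - x.2)) / 2) ≤ η := by
  filter_upwards [ev_poly 2 η⁻¹ (show 0 < β by positivity), eventually_ge_atTop 400,
    ev_poly 2 1 (show 0 < 0.001 * β by positivity)] with L hL1 hL22 hL2 n a umin k R h q hn hq0 hq hu ha hk hR hh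
  have hterm : ∀ x ∈ US a umin h, ((k ^ x.2 * (a * a + 1) ^ a : ℕ) : ℝ) *
            q ^ ((x.1 * (x.1 - 1) - R * (x.1 - x.2)) / 2) ≤ Real.exp (-(β * L)) := by
    rintro ⟨u, s⟩ hx
    obtain ⟨hx0, h1, h2⟩ := mem_filter.1 hx
    simp only at h1 h2 ⊢
    have hua : u ≤ a := by
      have := (mem_range.1 (mem_product.1 hx0).1); simp only at this; omega
    have h1' : (umin:ℝ) ≤ u := by exact_mod_cast h1
    have h2' : (s:ℝ) + h ≤ u := by exact_mod_cast h2
    have hua' : (u:ℝ) ≤ a := by exact_mod_cast hua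
    have hkn : (k:ℝ) ≤ Real.exp (β * L) := by rw [← hn]; exact_mod_cast hk
    have hu1 : 1 ≤ u := by
      have : (1:ℝ) ≤ u := by nlinarith
      exact_mod_cast this
    have hks : (k:ℝ) ^ s ≤ Real.exp (β * L * s) := by
      calc (k:ℝ) ^ s ≤ (Real.exp (β * L)) ^ s := pow_le_pow_left₀ (by positivity) hkn _
        _ = _ := by rw [← Real.exp_nat_mul]; congr 1; ring
    have haa : ((a:ℝ) * a + 1) ^ a ≤ Real.exp (0.002 * β * L ^ 2) := by
      calc ((a:ℝ) * a + 1) ^ a ≤ (Real.exp (0.001 * β * L)) ^ a := by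
            refine pow_le_pow_left₀ (by positivity) (le_trans ?_ hL2) _
            have : (0:ℝ) ≤ a := by positivity
            nlinarith
        _ = Real.exp (a * (0.001 * β * L)) := by rw [← Real.exp_nat_mul]
        _ ≤ _ := Real.exp_le_exp.2 (by
            have : 0 ≤ 0.001 * β * L := by positivity
            nlinarith)
    set T := (u * (u - 1) - R * (u - s)) / 2 with hT
    have hTlow : ((u:ℝ) * (u - 1) - R * (u - s)) / 2 - 1 / 2 ≤ T := by
      have e1 : u * (u - 1) ≤ 2 * T + 1 + R * (u - s) := by omega
      have e2 : ((u * (u - 1) : ℕ) : ℝ) ≤ ((2 * T + 1 + R * (u - s) : ℕ) : ℝ) := by exact_mod_cast e1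
      push_cast [Nat.cast_sub hu1, Nat.cast_sub (show s ≤ u by omega)] at e2
      linarith
    have hRus : (R:ℝ) * (u - s) ≤ 1.4 * L * (u - s) := mul_le_mul_of_nonneg_right hR (by
      have : (0:ℝ) ≤ h := by positivity
      linarith)
    have hqq : q ^ T ≤ Real.exp (-(0.995 * β * (((u:ℝ) * (u - 1) - 1.4 * L * (u - s)) / 2 - 1 / 2))) :=
      pow_exp_le hq0 hq _ (by positivity) (by linarith)
    push_cast
    calc (k:ℝ) ^ s * ((a:ℝ) * a + 1) ^ a * q ^ T
        ≤ Real.exp (β * L * s) * Real.exp (0.002 * β * L ^ 2) *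
          Real.exp (-(0.995 * β * (((u:ℝ) * (u - 1) - 1.4 * L * (u - s)) / 2 - 1 / 2))) := by gcongr
      _ = Real.exp (β * (L * s + 0.002 * L ^ 2 - 0.995 * (((u:ℝ) * (u - 1) - 1.4 * L * (u - s)) / 2 - 1 / 2))) := by
          rw [← Real.exp_add, ← Real.exp_add]; congr 1; ring
      _ ≤ _ := by
          refine Real.exp_le_exp.2 ?_
          have : L * s + 0.002 * L ^ 2 - 0.995 * (((u:ℝ) * (u - 1) - 1.4 * L * (u - s)) / 2 - 1 / 2) ≤ -L := by
            exact num2 hL22 (by nlinarith) (by linarith) h2' hh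
          have := mul_le_mul_of_nonneg_left this hβ.le
          linarith
  refine (sum_square_le _ a (filter_subset _ _) _ (Real.exp_pos _).le ha hterm).trans ?_
  rw [Real.exp_neg, ← div_eq_mul_inv, div_le_iff₀ (Real.exp_pos _)]
  rw [inv_mul_le_iff₀ hη] at hL1
  exact hL1

lemma e5_ev {β : ℝ} (hβ : 0 < β) {ξ : ℝ} (hξ0 : 0 ≤ ξ) (hξ : ξ ≤ 1/200) {η : ℝ} (hη : 0 < η) :
    ∀ᶠ L : ℝ in atTop, ∀ (n a umin k : ℕ) (q : ℝ), (n:ℝ) = Real.exp (β * L) → 0 ≤ q →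
      q ≤ Real.exp (-(0.995 * β)) → (2 - ξ) * L ≤ umin → (a:ℝ) ≤ 2 * L → k ≤ n →
      2 * (k:ℝ) ^ 2 * n * a * ((a:ℝ) + 1) ^ 2 * q ^ (2 * umin - 3) ≤ η := by
  filter_upwards [ev_poly 3 (2 * η⁻¹) (show 0 < 0.5 * β by positivity), eventually_ge_atTop 22] with
    L hL1 hL22 n a umin k q hn hq0 hq hu ha hk
  have hkn : (k:ℝ) ≤ Real.exp (β * L) := by rw [← hn]; exact_mod_cast hk
  have hu2 : (2 - 1/200) * L ≤ umin := by nlinarith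
  have h3 : 3 ≤ 2 * umin := by
    have : (3:ℝ) ≤ umin := by nlinarith
    have : 3 ≤ umin := by exact_mod_cast this
    omega
  have hqq : q ^ (2 * umin - 3) ≤ Real.exp (-(0.995 * β * (3.99 * L - 3))) :=
    pow_exp_le hq0 hq _ (by positivity) (by
      rw [Nat.cast_sub h3]; push_cast; linarith)
  have ha' : 2 * ((a:ℝ) * ((a:ℝ) + 1) ^ 2) ≤ 2 * (2 * L + 2) ^ 3 := by
    have : (0:ℝ) ≤ a := by positivity
    have e : (a:ℝ) * (a + 1) ^ 2 ≤ (2 * L + 2) * (2 * L + 2) ^ 2 := by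
      apply mul_le_mul (by linarith) _ (by positivity) (by linarith)
      exact pow_le_pow_left₀ (by linarith) (by linarith) 2
    nlinarith
  have hL1' : 2 * (2 * L + 2) ^ 3 ≤ η * Real.exp (0.5 * β * L) := by
    rw [mul_comm 2 η⁻¹, mul_assoc, inv_mul_le_iff₀ hη] at hL1
    exact hL1
  calc 2 * (k:ℝ) ^ 2 * n * a * ((a:ℝ) + 1) ^ 2 * q ^ (2 * umin - 3)
      = (2 * ((a:ℝ) * ((a:ℝ) + 1) ^ 2)) * ((k:ℝ) ^ 2 * n * q ^ (2 * umin - 3)) := by ring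
    _ ≤ (η * Real.exp (0.5 * β * L)) * ((Real.exp (β * L)) ^ 2 * Real.exp (β * L) *
        Real.exp (-(0.995 * β * (3.99 * L - 3)))) := by
        apply mul_le_mul (ha'.trans hL1') _ (by positivity) (by positivity)
        rw [hn]; gcongr
    _ = η * Real.exp (β * (3.5 * L - 0.995 * (3.99 * L - 3))) := by
        rw [← Real.exp_nat_mul, mul_assoc, ← Real.exp_add, ← Real.exp_add, ← Real.exp_add]
        congr 2; push_cast; ring
    _ ≤ η * 1 := by
        refine mul_le_mul_of_nonneg_left (Real.exp_le_one_iff.2 ?_) hη.le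
        nlinarith
    _ = η := mul_one _

lemma e6_ev {β : ℝ} (hβ : 0 < β) {ξ : ℝ} (hξ0 : 0 ≤ ξ) (hξ : ξ ≤ 1/200) {η : ℝ} (hη : 0 < η) :
    ∀ᶠ L : ℝ in atTop, ∀ (n a umin k h s1 : ℕ) (q : ℝ), (n:ℝ) = Real.exp (β * L) → 0 ≤ q →
      q ≤ Real.exp (-(0.995 * β)) → (2 - ξ) * L ≤ umin → (a:ℝ) ≤ 2 * L → umin ≤ a → k ≤ n →
      (h:ℝ) ≤ L / 8 → (s1:ℝ) ≤ Real.exp (β * L / 2) →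
      ∑ t ∈ Icc 1 s1, ((k ^ t * ((t + 1) ^ (a * t) * (n * t + 1) ^ ((a - umin + 1) * t)) : ℕ) : ℝ) *
            q ^ (t * (umin * (umin - h) / 2)) ≤ η := by
  filter_upwards [ev_poly 0 η⁻¹ (show 0 < β by positivity), eventually_ge_atTop 22,
    ev_poly 0 2 (show 0 < 0.01 * β by positivity)] with
    L hL1 hL22 hL2 n a umin k h s1 q hn hq0 hq hu ha hua hk hh hs1
  have hkn : (k:ℝ) ≤ Real.exp (β * L) := by rw [← hn]; exact_mod_cast hk
  have hu2 : (2 - 1/200) * L ≤ umin := by nlinarith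
  have hhu : h ≤ umin := by
    have : (h:ℝ) ≤ umin := by nlinarith
    exact_mod_cast this
  rw [pow_zero, mul_one] at hL1 hL2
  have hnpos : (1:ℝ) ≤ n := by rw [hn]; exact Real.one_le_exp (by positivity)
  set T := umin * (umin - h) / 2 with hT
  have hTlow : 1.8 * L ^ 2 ≤ T := by
    have e1 : umin * (umin - h) ≤ 2 * T + 1 := by omega
    have e2 : ((umin * (umin - h) : ℕ) : ℝ) ≤ ((2 * T + 1 : ℕ) : ℝ) := by exact_mod_cast e1
    push_cast [Nat.cast_sub hhu] at e2
    have e3 : 1.995 * L * (1.87 * L) ≤ umin * (umin - h) :=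
      mul_le_mul (by linarith) (by linarith) (by positivity) (by positivity)
    nlinarith
  have hterm : ∀ t ∈ Icc 1 s1, ((k ^ t * ((t + 1) ^ (a * t) * (n * t + 1) ^ ((a - umin + 1) * t)) : ℕ) : ℝ) *
            q ^ (t * T) ≤ Real.exp (-(2 * β * L)) := by
    intro t ht
    obtain ⟨ht1, ht2⟩ := mem_Icc.1 ht
    have ht2' : (t:ℝ) ≤ Real.exp (β * L / 2) := le_trans (by exact_mod_cast ht2) hs1
    have ht1' : (1:ℝ) ≤ t := by exact_mod_cast ht1
    have hbase : (k:ℝ) * ((t + 1) ^ a * ((n:ℝ) * t + 1) ^ (a - umin + 1)) * q ^ T ≤ Real.exp (-(2 * β * L)) := by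
      have b1 : ((t:ℝ) + 1) ^ a ≤ Real.exp (0.51 * β * L * (2 * L)) := by
        calc ((t:ℝ) + 1) ^ a ≤ (Real.exp (0.51 * β * L)) ^ a := by
              refine pow_le_pow_left₀ (by positivity) ?_ _
              calc (t:ℝ) + 1 ≤ 2 * t := by linarith
                _ ≤ Real.exp (0.01 * β * L) * Real.exp (β * L / 2) := by gcongr
                _ = _ := by rw [← Real.exp_add]; congr 1; ring
          _ = Real.exp (a * (0.51 * β * L)) := by rw [← Real.exp_nat_mul]
          _ ≤ _ := Real.exp_le_exp.2 (by
              have : 0 ≤ 0.51 * β * L := by positivity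
              nlinarith)
      have b2 : ((n:ℝ) * t + 1) ^ (a - umin + 1) ≤ Real.exp (2 * β * L * (0.005 * L + 1)) := by
        calc ((n:ℝ) * t + 1) ^ (a - umin + 1) ≤ (Real.exp (2 * β * L)) ^ (a - umin + 1) := by
              refine pow_le_pow_left₀ (by positivity) ?_ _
              calc (n:ℝ) * t + 1 ≤ (n * t) * 2 := by nlinarith
                _ ≤ (Real.exp (β * L) * Real.exp (β * L / 2)) * Real.exp (0.01 * β * L) := by rw [hn]; gcongr
                _ = Real.exp (1.51 * β * L) := by rw [← Real.exp_add, ← Real.exp_add]; congr 1; ring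
                _ ≤ _ := Real.exp_le_exp.2 (by linarith [mul_pos hβ (show 0 < L by linarith)])
          _ = Real.exp (((a - umin + 1 : ℕ):ℝ) * (2 * β * L)) := by rw [← Real.exp_nat_mul]
          _ ≤ _ := Real.exp_le_exp.2 (by
              push_cast [Nat.cast_sub hua]
              have : 0 ≤ 2 * β * L := by positivity
              nlinarith)
      have b3 : q ^ T ≤ Real.exp (-(0.995 * β * (1.8 * L ^ 2))) := pow_exp_le hq0 hq _ (by positivity) hTlow
      calc (k:ℝ) * ((t + 1) ^ a * ((n:ℝ) * t + 1) ^ (a - umin + 1)) * q ^ T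
          ≤ Real.exp (β * L) * (Real.exp (0.51 * β * L * (2 * L)) * Real.exp (2 * β * L * (0.005 * L + 1))) *
            Real.exp (-(0.995 * β * (1.8 * L ^ 2))) := by gcongr
        _ = Real.exp (β * (L + 1.02 * L ^ 2 + 2 * L * (0.005 * L + 1) - 0.995 * (1.8 * L ^ 2))) := by
            rw [← Real.exp_add, ← Real.exp_add, ← Real.exp_add]; congr 1; ring
        _ ≤ _ := by
            refine Real.exp_le_exp.2 ?_
            have : L + 1.02 * L ^ 2 + 2 * L * (0.005 * L + 1) - 0.995 * (1.8 * L ^ 2) ≤ -(2 * L) := num6 hL22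
            have := mul_le_mul_of_nonneg_left this hβ.le
            linarith
    have e : ((k ^ t * ((t + 1) ^ (a * t) * (n * t + 1) ^ ((a - umin + 1) * t)) : ℕ) : ℝ) *
            q ^ (t * T) = ((k:ℝ) * ((t + 1) ^ a * ((n:ℝ) * t + 1) ^ (a - umin + 1)) * q ^ T) ^ t := by
      push_cast
      rw [pow_mul, pow_mul, mul_comm t T, pow_mul]
      simp only [mul_pow]
    rw [e]
    calc _ ≤ (Real.exp (-(2 * β * L))) ^ t := pow_le_pow_left₀ (by positivity) hbase _
      _ ≤ (Real.exp (-(2 * β * L))) ^ 1 := by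
          apply pow_le_pow_of_le_one (Real.exp_pos _).le _ ht1
          exact Real.exp_le_one_iff.2 (by linarith [mul_pos hβ (show 0 < L by linarith)])
      _ = _ := pow_one _
  have h1 := Finset.sum_le_card_nsmul _ _ _ hterm
  rw [nsmul_eq_mul, Nat.card_Icc, Nat.add_sub_cancel] at h1
  refine h1.trans ?_
  calc (s1:ℝ) * Real.exp (-(2 * β * L)) ≤ Real.exp (β * L / 2) * Real.exp (-(2 * β * L)) := by gcongr
    _ = Real.exp (-(1.5 * β * L)) := by rw [← Real.exp_add]; congr 1; ring
    _ ≤ Real.exp (-(β * L)) := Real.exp_le_exp.2 (by linarith [mul_pos hβ (show 0 < L by linarith)])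
    _ ≤ η := by
        rw [Real.exp_neg]
        exact inv_le_of_inv_le₀ hη hL1

end TC

end PartI1

section PartI2

namespace TC
open Finset
variable {n k m : ℕ}

lemma mFloor_le {p : ℝ} (hp : 0 < p) (n : ℕ) : (mFloor p n : ℝ) ≤ p * (n.choose 2 : ℝ) :=
  Nat.floor_le (by positivity)

lemma lt_mFloor (p : ℝ) (n : ℕ) : p * (n.choose 2 : ℝ) < (mFloor p n : ℝ) + 1 := Nat.lt_floor_add_one _

lemma qhat_le {p : ℝ} {n : ℕ} (hN : 0 < n.choose 2) :
    1 - (mFloor p n : ℝ) / (n.choose 2 : ℕ) ≤ (1 - p) + 1 / (n.choose 2 : ℕ) := by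
  have hN' : (0:ℝ) < (n.choose 2 : ℕ) := by exact_mod_cast hN
  have h := lt_mFloor p n
  have : p - 1 / ((n.choose 2 : ℕ):ℝ) ≤ (mFloor p n : ℝ) / (n.choose 2 : ℕ) := by
    rw [le_div_iff₀ hN', sub_mul, div_mul_cancel₀ _ hN'.ne']
    linarith
  linarith

lemma qhat_nonneg {p : ℝ} (hp : 0 < p) (hp1 : p < 1) {n : ℕ} (hN : 0 < n.choose 2) :
    0 ≤ 1 - (mFloor p n : ℝ) / (n.choose 2 : ℕ) := by
  have hN' : (0:ℝ) < (n.choose 2 : ℕ) := by exact_mod_cast hN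
  have h := mFloor_le hp n
  have : (mFloor p n : ℝ) / (n.choose 2 : ℕ) ≤ 1 := by
    rw [div_le_one hN']; nlinarith
  linarith

lemma qhat_pow {p : ℝ} (hp : 0 < p) (hp1 : p < 1) {n : ℕ} (hN : 0 < n.choose 2) (t : ℕ)
    (ht : (t:ℝ) ≤ (1 - p) * (n.choose 2 : ℕ) / 2) :
    (1 - (mFloor p n : ℝ) / (n.choose 2 : ℕ)) ^ t ≤ 2 * (1 - p) ^ t := by
  have hN' : (0:ℝ) < (n.choose 2 : ℕ) := by exact_mod_cast hN
  have hq : 0 < 1 - p := by linarith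
  calc (1 - (mFloor p n : ℝ) / (n.choose 2 : ℕ)) ^ t ≤ ((1 - p) + 1 / (n.choose 2 : ℕ)) ^ t :=
        pow_le_pow_left₀ (qhat_nonneg hp hp1 hN) (qhat_le hN) t
    _ = (1 - p) ^ t * (1 / ((1 - p) * (n.choose 2 : ℕ)) + 1) ^ t := by
        rw [← mul_pow]; congr 1; field_simp; ring
    _ ≤ (1 - p) ^ t * (Real.exp (1 / ((1 - p) * (n.choose 2 : ℕ)))) ^ t := by
        gcongr; exact Real.add_one_le_exp _
    _ = (1 - p) ^ t * Real.exp (t / ((1 - p) * (n.choose 2 : ℕ))) := by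
        rw [← Real.exp_nat_mul]; congr 2; ring
    _ ≤ (1 - p) ^ t * Real.exp (1 / 2) := by
        refine mul_le_mul_of_nonneg_left (Real.exp_le_exp.2 ?_) (by positivity)
        rw [div_le_div_iff₀ (by positivity) (by norm_num)]; linarith
    _ ≤ (1 - p) ^ t * 2 := by
        gcongr
        have h1 := Real.exp_one_lt_d9
        have h2 : Real.exp (1/2) * Real.exp (1/2) = Real.exp 1 := by rw [← Real.exp_add]; norm_num
        nlinarith [Real.exp_pos (1/2)]
    _ = _ := mul_comm _ _

lemma choose_two_cast (n : ℕ) : ((n.choose 2 : ℕ) : ℝ) = n * (n - 1) / 2 := Nat.cast_choose_two ℝ n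

/-- elementary facts about the base `B` -/
lemma B_facts {p : ℝ} (hp : 0 < p) (hp1 : p < 1) {n f : ℕ} (hN : 0 < n.choose 2)
    (hf : 4 * (f:ℝ) ≤ (1 - p) * (n.choose 2 : ℕ)) {B : ℝ}
    (hB : B = (((n.choose 2 - 2 * f : ℕ) : ℝ) + 1) / (((n.choose 2 - 2 * f : ℕ) : ℝ) + 1 - mFloor p n)) :
    mFloor p n + 2 * f ≤ n.choose 2 ∧ 1 ≤ B ∧
      B ≤ (1 - p)⁻¹ * Real.exp (4 * f / ((1 - p) * (n.choose 2 : ℕ))) ∧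
      B - 1 = (mFloor p n : ℝ) / (((n.choose 2 : ℕ):ℝ) - 2 * f + 1 - mFloor p n) := by
  have hN' : (0:ℝ) < (n.choose 2 : ℕ) := by exact_mod_cast hN
  set N := n.choose 2
  set mm := mFloor p n
  have hm : (mm:ℝ) ≤ p * N := mFloor_le hp n
  have hq : 0 < 1 - p := by linarith
  have h1 : mm + 2 * f ≤ N := by
    have : (mm:ℝ) + 2 * f ≤ N := by
      have : 0 ≤ (1 - p) * N := by positivity
      linarith
    exact_mod_cast this
  have e1 : ((N - 2 * f : ℕ) : ℝ) = N - 2 * f := by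
    rw [Nat.cast_sub (by omega)]; push_cast; ring
  rw [e1] at hB
  have hD : (1 - p) * N / 2 < (N:ℝ) - 2 * f + 1 - mm := by linarith
  have hD0 : 0 < (N:ℝ) - 2 * f + 1 - mm := lt_trans (by positivity) hD
  have hm0 : (0:ℝ) ≤ mm := by positivity
  have hf0 : (0:ℝ) ≤ f := by positivity
  have hB1 : B - 1 = (mm:ℝ) / ((N:ℝ) - 2 * f + 1 - mm) := by
    rw [hB]; field_simp; ring
  refine ⟨h1, ?_, ?_, hB1⟩
  · have : 0 ≤ B - 1 := by rw [hB1]; positivity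
    linarith
  · have h2 : B ≤ (1 - p)⁻¹ * (4 * f / ((1 - p) * N) + 1) := by
      rw [hB, div_le_iff₀ hD0]
      have h3 : (1 - p)⁻¹ * (4 * f / ((1 - p) * N) + 1) * ((1 - p) * N - 2 * f + 1) ≤
          (1 - p)⁻¹ * (4 * f / ((1 - p) * N) + 1) * ((N:ℝ) - 2 * f + 1 - mm) := by
        gcongr; linarith
      refine le_trans ?_ h3
      have h4 : (1 - p) * ((N:ℝ) - 2 * f + 1) ≤ (4 * f / ((1 - p) * N) + 1) * ((1 - p) * N - 2 * f + 1) := by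
        have h5 : 4 * f / ((1 - p) * N) * ((1 - p) * N / 2) = 2 * f := by field_simp; ring
        have h6 : 4 * f / ((1 - p) * N) * ((1 - p) * N / 2) ≤ 4 * f / ((1 - p) * N) * ((1 - p) * N - 2 * f + 1) := by
          gcongr; linarith
        nlinarith
      rw [mul_assoc, ← div_eq_inv_mul, le_div_iff₀ hq]
      linarith
    refine h2.trans ?_
    gcongr
    exact Real.add_one_le_exp _

/-- the second-order term is cancelled by the correction `R0` -/
lemma T2_bound {p : ℝ} (hp : 0 < p) (hp1 : p < 1) {n f : ℕ} (hN : 0 < n.choose 2)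
    (hf : 4 * (f:ℝ) ≤ (1 - p) * (n.choose 2 : ℕ)) {B : ℝ}
    (hB : B = (((n.choose 2 - 2 * f : ℕ) : ℝ) + 1) / (((n.choose 2 - 2 * f : ℕ) : ℝ) + 1 - mFloor p n)) :
    (B - 1) * (2 * (f:ℝ) ^ 2) * ((n:ℝ)⁻¹) ^ 2 ≤
      (f:ℝ) ^ 2 * ((mFloor p n:ℝ) / ((((n.choose 2 : ℕ):ℝ) - f - mFloor p n + 1) * (((n.choose 2 : ℕ):ℝ) - f + 1)))
      + 24 * (f:ℝ) ^ 2 * (f + 1) / ((1 - p) ^ 2 * ((n.choose 2 : ℕ):ℝ) ^ 2) := by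
  obtain ⟨h1, hB1, _, hBm⟩ := B_facts hp hp1 hN hf hB
  have hN' : (1:ℝ) ≤ (n.choose 2 : ℕ) := by exact_mod_cast hN
  have hn2 : ((n.choose 2 : ℕ):ℝ) ≤ (n:ℝ) ^ 2 / 2 := by
    rw [choose_two_cast]; nlinarith [show (0:ℝ) ≤ n by positivity]
  have hm : (mFloor p n:ℝ) ≤ p * (n.choose 2 : ℕ) := mFloor_le hp n
  rw [hBm]
  generalize ((n.choose 2 : ℕ):ℝ) = N at *
  generalize (mFloor p n:ℝ) = mm at *
  have hm0 : 0 ≤ mm / (N - 2 * f + 1 - mm) := by linarith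
  have hq : 0 < 1 - p := by linarith
  have hqN : 0 < (1 - p) * N := by positivity
  have hD : (1 - p) * N / 2 ≤ N - 2 * f + 1 - mm := by linarith
  have hD0 : 0 < N - 2 * f + 1 - mm := by linarith
  have hmm : 0 ≤ mm := by
    by_contra hc; push Not at hc
    have := div_neg_of_neg_of_pos hc hD0
    linarith
  have hf0 : (0:ℝ) ≤ f := by positivity
  have hE1 : (1 - p) * N / 2 ≤ N - f - mm + 1 := by linarith
  have hE2 : N / 2 ≤ N - f + 1 := by nlinarith
  have hmN : mm ≤ N := by nlinarith
  have hfN : (f:ℝ) ≤ N := by nlinarith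
  have hnn : 0 < (n:ℝ) ^ 2 := by linarith
  have s1 : mm / (N - 2 * f + 1 - mm) * (2 * (f:ℝ) ^ 2) * ((n:ℝ)⁻¹) ^ 2 ≤ f ^ 2 * (mm / (N * (N - 2 * f + 1 - mm))) := by
    have e : ((n:ℝ)⁻¹) ^ 2 ≤ (2 * N)⁻¹ := by
      rw [inv_pow]; exact inv_anti₀ (by linarith) (by linarith)
    calc _ ≤ mm / (N - 2 * f + 1 - mm) * (2 * (f:ℝ) ^ 2) * (2 * N)⁻¹ := by gcongr
      _ = _ := by field_simp
  refine s1.trans ?_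
  have s2 : mm / (N * (N - 2 * f + 1 - mm)) - mm / ((N - f - mm + 1) * (N - f + 1)) ≤
      24 * (f + 1) / ((1 - p) ^ 2 * N ^ 2) := by
    have p1 : 0 < N - f - mm + 1 := by linarith
    have p2 : 0 < N - f + 1 := by linarith
    have p3 : (0:ℝ) < N := by linarith
    rw [div_sub_div _ _ (by positivity) (by positivity)]
    have num : mm * ((N - f - mm + 1) * (N - f + 1)) - N * (N - 2 * f + 1 - mm) * mm ≤ N * (3 * N * (f + 1)) := by
      have : (N - f - mm + 1) * (N - f + 1) - N * (N - 2 * f + 1 - mm) ≤ 3 * N * (f + 1) := by nlinarith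
      calc _ = mm * ((N - f - mm + 1) * (N - f + 1) - N * (N - 2 * f + 1 - mm)) := by ring
        _ ≤ mm * (3 * N * (f + 1)) := mul_le_mul_of_nonneg_left this hmm
        _ ≤ _ := by gcongr
    have den : (1 - p) ^ 2 * N ^ 2 * (N ^ 2 / 8) ≤ N * (N - 2 * f + 1 - mm) * ((N - f - mm + 1) * (N - f + 1)) := by
      calc (1 - p) ^ 2 * N ^ 2 * (N ^ 2 / 8) = N * ((1 - p) * N / 2) * (((1 - p) * N / 2) * (N / 2)) := by ring
        _ ≤ _ := by gcongr
    calc _ ≤ N * (3 * N * (f + 1)) / ((1 - p) ^ 2 * N ^ 2 * (N ^ 2 / 8)) := by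
          apply div_le_div₀ (by positivity) num (by positivity) den
      _ = _ := by field_simp; ring
  have := mul_le_mul_of_nonneg_left s2 (sq_nonneg (f:ℝ))
  have e3 : (f:ℝ) ^ 2 * (24 * (f + 1) / ((1 - p) ^ 2 * N ^ 2)) = 24 * (f:ℝ) ^ 2 * (f + 1) / ((1 - p) ^ 2 * N ^ 2) := by ring
  linarith

end TC

end PartI2

section PartI3

namespace TC
open Finset
variable {n k m : ℕ}

lemma num3 {L r : ℝ} (hL : 100 ≤ L) (hr : 3 ≤ r) (hr2 : r ≤ 1.5 * L) :
    2 * L + 0.02 * L * r + r * r / 2 - L * r ≤ -(0.5 * L) := by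
  by_cases h : r ≤ L / 8
  · have h1 : r * r ≤ L / 8 * r := mul_le_mul_of_nonneg_right h (by linarith)
    have h2 : L * 3 ≤ L * r := mul_le_mul_of_nonneg_left hr (by linarith)
    linarith
  · push Not at h
    have h1 : r * r ≤ 1.5 * L * r := mul_le_mul_of_nonneg_right hr2 (by linarith)
    have h2 : L * 12.5 ≤ L * r := mul_le_mul_of_nonneg_left (by linarith) (by linarith)
    linarith

lemma choose_two_split (r d : ℕ) : (r + d).choose 2 = r.choose 2 + r * d + d.choose 2 := by
  induction d with
  | zero => simp
  | succ d ih =>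
    rw [← add_assoc, Nat.choose_succ_succ' (r + d) 1, Nat.choose_succ_succ' d 1, ih]
    simp only [Nat.choose_one_right]
    ring

lemma bracket_le {β L : ℝ} (hβ : 0 < β) {n a r : ℕ} (hn : (n:ℝ) = Real.exp (β * L)) (hra : r ≤ a) (han : a ≤ n)
    (hr : 1.5 * L ≤ r) {μ : ℝ} (hμ : μ = (n.choose a : ℝ) * Real.exp (-(β * (a.choose 2 : ℕ)))) :
    (a.choose r : ℝ) * (a.descFactorial r : ℝ) * Real.exp (β * (r.choose 2 : ℕ)) * ((n:ℝ)⁻¹) ^ r ≤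
      μ⁻¹ * ((a:ℝ) * Real.exp (-(0.5 * β * L))) ^ (a - r) := by
  obtain ⟨d, rfl⟩ := Nat.exists_eq_add_of_le hra
  rw [Nat.add_sub_cancel_left]
  have hn0 : (0:ℝ) < n := by rw [hn]; exact Real.exp_pos _
  have h1 : ((r + d).choose r : ℝ) ≤ ((r + d : ℕ):ℝ) ^ d := by
    rw [Nat.choose_symm_add]; exact_mod_cast Nat.choose_le_pow _ _
  have h2 : ((r + d).descFactorial r : ℝ) ≤ ((r + d).factorial : ℝ) := by
    exact_mod_cast Nat.le_of_dvd (Nat.factorial_pos _) (Dvd.intro_left _ (Nat.factorial_mul_descFactorial (show r ≤ r + d by omega)))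
  have h3 : Real.exp (β * (r.choose 2 : ℕ)) ≤ Real.exp (β * ((r + d).choose 2 : ℕ)) * Real.exp (-(β * (1.5 * L * d))) := by
    rw [← Real.exp_add]
    refine Real.exp_le_exp.2 ?_
    rw [choose_two_split]
    push_cast
    have : 1.5 * L * d ≤ r * d := mul_le_mul_of_nonneg_right hr (by positivity)
    have h4 : (0:ℝ) ≤ (d.choose 2 : ℕ) := by positivity
    nlinarith
  have h4 : ((n:ℝ)⁻¹) ^ r = ((n:ℝ)⁻¹) ^ (r + d) * Real.exp (β * L * d) := by
    rw [pow_add, mul_assoc]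
    have : ((n:ℝ)⁻¹) ^ d * Real.exp (β * L * d) = 1 := by
      rw [inv_pow, hn, ← Real.exp_nat_mul, ← Real.exp_neg, ← Real.exp_add]
      rw [Real.exp_eq_one_iff]; ring
    rw [this, mul_one]
  have h5 : ((r + d).factorial : ℝ) * Real.exp (β * ((r + d).choose 2 : ℕ)) * ((n:ℝ)⁻¹) ^ (r + d) ≤ μ⁻¹ := by
    have hc : (0:ℝ) < (n.choose (r + d) : ℝ) := by exact_mod_cast Nat.choose_pos han
    rw [hμ, mul_inv, ← Real.exp_neg, neg_neg]
    have h6 : ((r + d).factorial : ℝ) * (n.choose (r + d) : ℝ) ≤ (n:ℝ) ^ (r + d) := by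
      rw [← Nat.cast_mul, ← Nat.descFactorial_eq_factorial_mul_choose]
      exact_mod_cast Nat.descFactorial_le_pow _ _
    rw [inv_pow, mul_right_comm]
    gcongr
    rw [← div_eq_mul_inv, div_le_iff₀ (by positivity), ← div_eq_inv_mul, le_div_iff₀ hc]
    exact h6
  calc _ ≤ ((r + d : ℕ):ℝ) ^ d * ((r + d).factorial : ℝ) * (Real.exp (β * ((r + d).choose 2 : ℕ)) * Real.exp (-(β * (1.5 * L * d)))) *
        (((n:ℝ)⁻¹) ^ (r + d) * Real.exp (β * L * d)) := by
        rw [h4]; gcongr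
    _ = (((r + d).factorial : ℝ) * Real.exp (β * ((r + d).choose 2 : ℕ)) * ((n:ℝ)⁻¹) ^ (r + d)) *
        (((r + d : ℕ):ℝ) ^ d * (Real.exp (-(β * (1.5 * L * d))) * Real.exp (β * L * d))) := by ring
    _ ≤ μ⁻¹ * (((r + d : ℕ):ℝ) ^ d * (Real.exp (-(β * (1.5 * L * d))) * Real.exp (β * L * d))) := by gcongr
    _ = _ := by
        rw [mul_pow, ← Real.exp_add, ← Real.exp_nat_mul]
        congr 3; ring

lemma high_ev {β : ℝ} (hβ : 0 < β) {D : ℝ} (hD : 1 ≤ D) {η : ℝ} (hη : 0 < η) :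
    ∀ᶠ L : ℝ in atTop, ∀ (n a k : ℕ) (B X μ : ℝ) (w : ℕ → ℝ), (n:ℝ) = Real.exp (β * L) → (a:ℝ) ≤ 2 * L →
      a ≤ n → k ≤ n → 0 ≤ B → (∀ t : ℕ, (t:ℝ) ≤ 4 * L ^ 2 → B ^ t ≤ 2 * Real.exp (β * t)) →
      (∀ r, 0 ≤ w r) → (∀ r, w r ≤ D ^ r) → (∀ r, r ≤ a → 1.5 * L < r → w r ≤ X) → 0 ≤ X →
      μ = (n.choose a : ℝ) * Real.exp (-(β * (a.choose 2 : ℕ))) →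
      (k:ℝ) ^ 2 * ∑ r ∈ Icc 3 a, (a.choose r : ℝ) * (a.descFactorial r : ℝ) * B ^ (r.choose 2) *
        (w r * ((n:ℝ)⁻¹) ^ r) ≤ η + 4 * X * ((k:ℝ) ^ 2 / μ) := by
  filter_upwards [eventually_ge_atTop 100, ev_poly 1 (2 * η⁻¹) (show 0 < 0.5 * β by positivity),
    ev_poly 2 D (show 0 < 0.02 * β by positivity), ev_poly 1 2 (show 0 < 0.5 * β by positivity)] with
    L hL hL1 hL2 hL3 n a k B X μ w hn ha han hk hB0 hB hw0 hwD hwX hX hμ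
  have hn0 : (0:ℝ) < n := by rw [hn]; exact Real.exp_pos _
  have hkn : (k:ℝ) ≤ Real.exp (β * L) := by rw [← hn]; exact_mod_cast hk
  have hc : (0:ℝ) < (n.choose a : ℝ) := by exact_mod_cast Nat.choose_pos han
  have hμ0 : 0 < μ := by rw [hμ]; positivity
  have hBr : ∀ r ≤ a, B ^ (r.choose 2) ≤ 2 * Real.exp (β * (r.choose 2 : ℕ)) := by
    intro r hr
    refine hB _ ?_
    rw [Nat.cast_choose_two]
    have hr' : (r:ℝ) ≤ 2 * L := le_trans (by exact_mod_cast hr) ha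
    have : (0:ℝ) ≤ r := by positivity
    nlinarith
  set F : ℕ → ℝ := fun r => (a.choose r : ℝ) * (a.descFactorial r : ℝ) * B ^ (r.choose 2) *
        (w r * ((n:ℝ)⁻¹) ^ r) with hF
  have hterm : ∀ r ∈ Icc 3 a, (k:ℝ) ^ 2 * F r ≤ 2 * Real.exp (-(0.5 * β * L)) +
      2 * X * ((k:ℝ) ^ 2 / μ) * (1/2) ^ (a - r) := by
    intro r hr
    obtain ⟨hr3, hra⟩ := mem_Icc.1 hr
    have hr3' : (3:ℝ) ≤ r := by exact_mod_cast hr3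
    by_cases hc : (r:ℝ) ≤ 1.5 * L
    · refine le_trans ?_ (le_add_of_nonneg_right (by positivity))
      have c1 : (a.choose r : ℝ) ≤ (a:ℝ) ^ r := by exact_mod_cast Nat.choose_le_pow _ _
      have c2 : (a.descFactorial r : ℝ) ≤ (a:ℝ) ^ r := by exact_mod_cast Nat.descFactorial_le_pow _ _
      have c3 : (a:ℝ) ^ r * (a:ℝ) ^ r * D ^ r ≤ Real.exp (0.02 * β * L * r) := by
        rw [← mul_pow, ← mul_pow]
        calc ((a:ℝ) * a * D) ^ r ≤ (Real.exp (0.02 * β * L)) ^ r := by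
              refine pow_le_pow_left₀ (by positivity) (le_trans ?_ hL2) _
              have : (0:ℝ) ≤ a := by positivity
              have e : (a:ℝ) * a ≤ (2 * L + 2) ^ 2 := by nlinarith
              calc (a:ℝ) * a * D ≤ (2 * L + 2) ^ 2 * D := by gcongr
                _ = _ := by ring
          _ = _ := by rw [← Real.exp_nat_mul]; congr 1; ring
      have c4 : Real.exp (β * (r.choose 2 : ℕ)) ≤ Real.exp (β * (r * r / 2)) := by
        refine Real.exp_le_exp.2 (mul_le_mul_of_nonneg_left ?_ hβ.le)
        rw [Nat.cast_choose_two]; nlinarith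
      have c5 : ((n:ℝ)⁻¹) ^ r = Real.exp (-(β * L * r)) := by
        rw [inv_pow, hn, ← Real.exp_nat_mul, ← Real.exp_neg]; congr 1; ring
      calc (k:ℝ) ^ 2 * F r ≤ (Real.exp (β * L)) ^ 2 * ((a:ℝ) ^ r * (a:ℝ) ^ r * (2 * Real.exp (β * (r * r / 2))) *
            (D ^ r * Real.exp (-(β * L * r)))) := by
            simp only [hF]
            rw [c5]
            have := (hBr r hra).trans (mul_le_mul_of_nonneg_left c4 (by norm_num : (0:ℝ) ≤ 2))
            have := hwD r
            have := hw0 r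
            gcongr
        _ = 2 * ((Real.exp (β * L)) ^ 2 * ((a:ℝ) ^ r * (a:ℝ) ^ r * D ^ r) * (Real.exp (β * (r * r / 2)) *
            Real.exp (-(β * L * r)))) := by ring
        _ ≤ 2 * ((Real.exp (β * L)) ^ 2 * Real.exp (0.02 * β * L * r) * (Real.exp (β * (r * r / 2)) *
            Real.exp (-(β * L * r)))) := by gcongr
        _ = 2 * Real.exp (β * (2 * L + 0.02 * L * r + r * r / 2 - L * r)) := by
            rw [← Real.exp_nat_mul, ← Real.exp_add, ← Real.exp_add, ← Real.exp_add]
            congr 2; push_cast; ring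
        _ ≤ _ := by
            have := mul_le_mul_of_nonneg_left (num3 hL hr3' hc) hβ.le
            gcongr
            linarith
    · push Not at hc
      refine le_trans ?_ (le_add_of_nonneg_left (by positivity))
      have hb := bracket_le hβ hn hra han hc.le hμ
      have hw := hwX r hra hc
      have c6 : (a:ℝ) * Real.exp (-(0.5 * β * L)) ≤ 1 / 2 := by
        rw [Real.exp_neg, ← div_eq_mul_inv, div_le_div_iff₀ (Real.exp_pos _) (by norm_num)]
        rw [pow_one] at hL3
        linarith
      calc (k:ℝ) ^ 2 * F r ≤ (k:ℝ) ^ 2 * ((a.choose r : ℝ) * (a.descFactorial r : ℝ) * (2 * Real.exp (β * (r.choose 2 : ℕ))) *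
            (X * ((n:ℝ)⁻¹) ^ r)) := by
            simp only [hF]
            have := hBr r hra
            have := hw0 r
            gcongr
        _ = (k:ℝ) ^ 2 * (2 * X) * ((a.choose r : ℝ) * (a.descFactorial r : ℝ) * Real.exp (β * (r.choose 2 : ℕ)) *
            ((n:ℝ)⁻¹) ^ r) := by ring
        _ ≤ (k:ℝ) ^ 2 * (2 * X) * (μ⁻¹ * ((a:ℝ) * Real.exp (-(0.5 * β * L))) ^ (a - r)) := by gcongr
        _ ≤ (k:ℝ) ^ 2 * (2 * X) * (μ⁻¹ * (1 / 2) ^ (a - r)) := by gcongr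
        _ = _ := by ring
  rw [mul_sum]
  refine (sum_le_sum hterm).trans ?_
  rw [sum_add_distrib, sum_const, nsmul_eq_mul, ← mul_sum]
  have g1 : ((Icc 3 a).card : ℝ) * (2 * Real.exp (-(0.5 * β * L))) ≤ η := by
    rw [Nat.card_Icc, Real.exp_neg, ← mul_assoc, ← div_eq_mul_inv, div_le_iff₀ (Real.exp_pos _)]
    rw [pow_one, mul_comm 2 η⁻¹, mul_assoc, inv_mul_le_iff₀ hη] at hL1
    refine le_trans ?_ hL1
    have : ((a + 1 - 3 : ℕ):ℝ) ≤ a := by exact_mod_cast (by omega)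
    linarith
  have g2 : ∑ r ∈ Icc 3 a, (1/2:ℝ) ^ (a - r) ≤ 2 := by
    calc ∑ r ∈ Icc 3 a, (1/2:ℝ) ^ (a - r) ≤ ∑ r ∈ range (a + 1), (1/2:ℝ) ^ (a - r) := by
          refine sum_le_sum_of_subset_of_nonneg ?_ fun _ _ _ => by positivity
          intro r hr; rw [mem_Icc] at hr; rw [mem_range]; omega
      _ = ∑ r ∈ range (a + 1), (1/2:ℝ) ^ r := by
          rw [← Finset.sum_range_reflect]
          refine sum_congr rfl fun r hr => ?_
          rw [mem_range] at hr; congr 1; omega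
      _ ≤ 2 := sum_geometric_two_le _
  have g3 : 2 * X * ((k:ℝ) ^ 2 / μ) * ∑ r ∈ Icc 3 a, (1/2:ℝ) ^ (a - r) ≤ 2 * X * ((k:ℝ) ^ 2 / μ) * 2 := by
    gcongr
  linarith

end TC

end PartI3

section PartI4

namespace TC
open Finset
variable {n k m : ℕ}

/-- size facts at a fixed `n` -/
structure SZ (β ξ C L : ℝ) (n a : ℕ) (P : ℕ → ℕ) (j : ℕ → ℕ) (w : ℕ → ℝ) : Prop where
  hn : (n:ℝ) = Real.exp (β * L)
  ha : (a:ℝ) ≤ 2 * L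
  han : a ≤ n
  lo : ∀ u, 0 < P u → (2 - ξ) * L ≤ u
  hi : ∀ u, 0 < P u → 1 ≤ u ∧ u ≤ a
  hq : ∀ u, 0 < P u → Real.exp (-(β * u)) ≤ (L / n) ^ 2 * Real.exp (β * j u)
  hP : ∀ u, 0 < P u → (u:ℝ) * P u * (j u + 1) ≤ n * Real.exp (-(β * j u)) * w u
  w0 : ∀ u, 0 ≤ w u
  hw : ∑ u ∈ Icc 1 n, w u ≤ C
  hPz : ∀ u, u ∉ Icc 1 n → P u = 0
  hsum : ∑ u ∈ Icc 1 n, u * P u = n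

lemma tendsto_L {b : ℝ} (hb : 1 < b) : Tendsto (fun n : ℕ => Real.logb b n) atTop atTop :=
  (Real.tendsto_logb_atTop hb).comp tendsto_natCast_atTop_atTop

lemma summable_w {β : ℝ} (hβ : 0 < β) {γ : ℕ → ℝ} (hγ : Tendsto γ atTop atTop) :
    Summable fun j : ℕ => ((j:ℝ) + 1) * Real.exp (-(β * j * (γ j - 1))) := by
  have h1 : Summable fun j : ℕ => ((j:ℝ) + 1) * Real.exp (-β) ^ j := by
    have hr : ‖Real.exp (-β)‖ < 1 := by
      rw [Real.norm_of_nonneg (Real.exp_pos _).le]; rw [← Real.exp_zero]; exact Real.exp_lt_exp.2 (by linarith)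
    have e1 := summable_pow_mul_geometric_of_norm_lt_one 1 hr
    have e2 := summable_geometric_of_norm_lt_one hr
    refine (e1.add e2).congr fun j => ?_
    simp only [pow_one]; ring
  refine summable_of_isBigO_nat h1 ?_
  refine Asymptotics.IsBigO.of_bound 1 ?_
  filter_upwards [hγ.eventually_ge_atTop 2] with j hj
  rw [Real.norm_of_nonneg (by positivity), Real.norm_of_nonneg (by positivity), one_mul]
  gcongr
  rw [← Real.exp_nat_mul]
  refine Real.exp_le_exp.2 ?_
  have : 0 ≤ β * j * (γ j - 2) := by
    have : 0 ≤ γ j - 2 := by linarith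
    positivity
  linarith

lemma alpha_ev {b : ℝ} (hb : 1 < b) {ξ : ℝ} (hξ : 0 < ξ) : ∀ᶠ n : ℕ in atTop,
    0 ≤ alpha0 b n ∧ alpha0 b n ≤ 2 * Real.logb b n ∧ (2 - ξ) * Real.logb b n ≤ alpha0 b n - 1 ∧
    Real.exp (-(Real.log b * (alpha0 b n - 1))) ≤ (Real.logb b n / n) ^ 2 ∧
    (n:ℝ) = Real.exp (Real.log b * Real.logb b n) := by
  have hβ : 0 < Real.log b := Real.log_pos hb
  set C := Real.logb b (Real.exp 1 / 2) with hC
  have hC0 : 0 ≤ C := by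
    apply Real.logb_nonneg hb
    have := Real.exp_one_gt_d9
    linarith
  have hL := tendsto_L hb
  have h1 : ∀ᶠ x : ℝ in atTop, Real.logb b x ≤ (ξ / 2) * x := by
    have := (Real.isLittleO_log_id_atTop.bound (show 0 < ξ / 2 * Real.log b by positivity))
    filter_upwards [this, eventually_ge_atTop 1] with x hx hx1
    rw [Real.logb, div_le_iff₀ hβ]
    have e1 := le_abs_self (Real.log x)
    rw [Real.norm_eq_abs, Real.norm_eq_abs, id, abs_of_nonneg (by linarith : (0:ℝ) ≤ x)] at hx
    linarith
  have h1' : ∀ᶠ x : ℝ in atTop, Real.logb b x ≤ (1 / 2) * x := by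
    have := (Real.isLittleO_log_id_atTop.bound (show 0 < 1 / 2 * Real.log b by positivity))
    filter_upwards [this, eventually_ge_atTop 1] with x hx hx1
    rw [Real.logb, div_le_iff₀ hβ]
    have e1 := le_abs_self (Real.log x)
    rw [Real.norm_eq_abs, Real.norm_eq_abs, id, abs_of_nonneg (by linarith : (0:ℝ) ≤ x)] at hx
    linarith
  have h2 := (Real.tendsto_logb_atTop hb).eventually_ge_atTop (C + 1)
  filter_upwards [hL.eventually h1, hL.eventually h1', hL.eventually h2, hL.eventually (eventually_ge_atTop 1),
    eventually_ge_atTop 2] with n g1 g1' g2 g3 g4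
  set L := Real.logb b n with hLdef
  have hn0 : (0:ℝ) < n := by exact_mod_cast (by omega : 0 < n)
  have hnL : (n:ℝ) = Real.exp (Real.log b * L) := by
    rw [hLdef, Real.logb, mul_div_cancel₀ _ hβ.ne', Real.exp_log hn0]
  have hα : alpha0 b n = 2 * L - 2 * Real.logb b L + 2 * C + 1 := rfl
  rw [hα]
  refine ⟨by linarith, by linarith, by linarith, ?_, hnL⟩
  have e1 : Real.exp (-(Real.log b * (2 * L - 2 * Real.logb b L + 2 * C + 1 - 1))) =
      (L / n) ^ 2 * Real.exp (-(Real.log b * (2 * C))) := by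
    have : (L / n) ^ 2 = Real.exp (2 * (Real.log b * Real.logb b L) - 2 * (Real.log b * L)) := by
      rw [Real.exp_sub, two_mul, two_mul, Real.exp_add, Real.exp_add, ← hnL]
      have : Real.exp (Real.log b * Real.logb b L) = L := by
        rw [Real.logb, mul_div_cancel₀ _ hβ.ne', Real.exp_log (by linarith)]
      rw [this, div_pow, pow_two, pow_two]
    rw [this, ← Real.exp_add]; congr 1; ring
  rw [e1]
  refine mul_le_of_le_one_right (by positivity) (Real.exp_le_one_iff.2 ?_)
  have : 0 ≤ Real.log b * (2 * C) := by positivity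
  linarith

lemma size_ev {p : ℝ} (hp : 0 < p) (hp1 : p < 1) {a : ℕ → ℕ} {P : ℕ → ℕ → ℕ} (htame : IsTame p a P) :
    ∃ C : ℝ, 0 ≤ C ∧ ∀ ξ : ℝ, 0 < ξ → ∀ᶠ n : ℕ in atTop, ∃ j w,
      SZ (Real.log (1/(1-p))) ξ C (Real.logb (1/(1-p)) n) n (a n) (P n) j w := by
  obtain ⟨_, haα, hprof, c, hc, γ, hγm, hγ, hκ, _⟩ := htame
  set b := 1/(1-p) with hb
  have hb1 : 1 < b := by rw [hb, one_lt_div (by linarith)]; linarith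
  have hβ : 0 < Real.log b := Real.log_pos hb1
  have hsm := summable_w hβ hγ
  set W : ℕ → ℝ := fun j : ℕ => ((j:ℝ) + 1) * Real.exp (-(Real.log b * j * (γ j - 1))) with hW
  have hW0 : ∀ j, 0 ≤ W j := fun j => by rw [hW]; positivity
  refine ⟨∑' j, W j, tsum_nonneg hW0, fun ξ hξ => ?_⟩
  obtain ⟨j0, hj0⟩ := (hγ.eventually_ge_atTop (2 / ξ)).exists_forall_of_atTop
  have hL := tendsto_L hb1
  have hLn : ∀ᶠ n : ℕ in atTop, 2 * Real.logb b n ≤ n := by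
    have := (Real.isLittleO_log_id_atTop.bound (show 0 < 1 / 2 * Real.log b by positivity))
    filter_upwards [tendsto_natCast_atTop_atTop.eventually this, eventually_ge_atTop 1] with n hx hx1
    rw [Real.logb, mul_div_assoc', div_le_iff₀ hβ]
    have e1 := le_abs_self (Real.log n)
    rw [Real.norm_eq_abs, Real.norm_eq_abs, id, abs_of_nonneg (by positivity : (0:ℝ) ≤ n)] at hx
    linarith
  filter_upwards [haα, hκ, alpha_ev hb1 (half_pos hξ), hL.eventually (eventually_ge_atTop 1),
    hL.eventually (eventually_ge_atTop (2 * (j0 + 1) / ξ)), eventually_ge_atTop 2, hLn] with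
    n h1 h2 h3 h4 h5 h6 h7
  obtain ⟨g0, g1, g2, g3, g4⟩ := h3
  set L := Real.logb b n with hLdef
  have hn0 : (0:ℝ) < n := by exact_mod_cast (by omega : 0 < n)
  obtain ⟨⟨q1, q2, q3⟩, q4, q5⟩ := hprof n
  set α := alphaNat b n with hα
  have hα1 : (α:ℝ) ≤ alpha0 b n := Nat.floor_le g0
  have hα2 : alpha0 b n < α + 1 := Nat.lt_floor_add_one _
  have haα' : ((a n : ℕ):ℝ) ≤ α := by exact_mod_cast h1
  have ha : ((a n : ℕ):ℝ) ≤ 2 * L := by linarith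
  have hhi : ∀ u, 0 < P n u → 1 ≤ u ∧ u ≤ a n := by
    intro u hu
    constructor
    · by_contra hh
      have := q1 u (by rw [mem_Icc]; omega)
      omega
    · by_contra hh
      have := q5 u (by omega)
      omega
  have hκ' : ∀ u, 0 < P n u → (u:ℝ) * P n u < n * Real.exp (-(Real.log b * ((α - u : ℕ):ℝ) * γ (α - u))) := by
    intro u hu
    have := h2 u (hhi u hu).1 (hhi u hu).2
    rw [div_lt_iff₀ hn0, Real.rpow_def_of_pos (by linarith)] at this
    have e : -(Real.log b * ((α - u : ℕ):ℝ) * γ (α - u)) =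
        Real.log b * -(((α - u : ℕ):ℝ) * γ (α - u)) := by ring
    rw [e, mul_comm (n:ℝ)]
    exact this
  refine ⟨fun u => α - u, fun u => if u ≤ a n then W (α - u) else 0, g4, ha, ?_, ?_, hhi, ?_, ?_, ?_, ?_, q1, q4⟩
  · have : ((a n : ℕ):ℝ) ≤ n := by linarith
    exact_mod_cast this
  · intro u hu
    have hk := hκ' u hu
    obtain ⟨hu1, hua⟩ := hhi u hu
    have hge : (1:ℝ) ≤ (u:ℝ) * P n u := by
      have : 1 ≤ u * P n u := Nat.mul_pos hu1 hu
      exact_mod_cast this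
    have hlt : (1:ℝ) < Real.exp (Real.log b * L - Real.log b * ((α - u : ℕ):ℝ) * γ (α - u)) := by
      rw [sub_eq_add_neg, Real.exp_add, ← g4]; linarith
    rw [Real.one_lt_exp_iff] at hlt
    have hlt2 : ((α - u : ℕ):ℝ) * γ (α - u) < L := by
      have : Real.log b * (((α - u : ℕ):ℝ) * γ (α - u)) < Real.log b * L := by linarith
      exact lt_of_mul_lt_mul_left this hβ.le
    have hjle : ((α - u : ℕ):ℝ) ≤ ξ / 2 * L := by
      by_contra hcon
      push Not at hcon
      have e1 : (j0:ℝ) + 1 ≤ ξ / 2 * L := by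
        rw [div_le_iff₀ hξ] at h5; linarith
      have e2 : j0 ≤ α - u := by
        have : (j0:ℝ) ≤ ((α - u : ℕ):ℝ) := by linarith
        exact_mod_cast this
      have e3 := hj0 _ e2
      have e4 : ξ / 2 * L * (2 / ξ) ≤ ((α - u : ℕ):ℝ) * γ (α - u) :=
        mul_le_mul hcon.le e3 (by positivity) (by positivity)
      have e5 : ξ / 2 * L * (2 / ξ) = L := by field_simp
      linarith
    rw [Nat.cast_sub (by omega)] at hjle
    linarith
  · intro u hu
    obtain ⟨hu1, hua⟩ := hhi u hu
    refine le_trans ?_ (mul_le_mul_of_nonneg_right g3 (Real.exp_pos _).le)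
    rw [← Real.exp_add]
    refine Real.exp_le_exp.2 ?_
    rw [Nat.cast_sub (by omega)]
    have : Real.log b * (alpha0 b n - 1) ≤ Real.log b * α := mul_le_mul_of_nonneg_left (by linarith) hβ.le
    linarith
  · intro u hu
    have hk := hκ' u hu
    obtain ⟨hu1, hua⟩ := hhi u hu
    simp only [if_pos hua, hW]
    have e : n * Real.exp (-(Real.log b * ((α - u : ℕ):ℝ))) * ((((α - u : ℕ):ℝ) + 1) *
        Real.exp (-(Real.log b * ((α - u : ℕ):ℝ) * (γ (α - u) - 1)))) =
        n * Real.exp (-(Real.log b * ((α - u : ℕ):ℝ) * γ (α - u))) * (((α - u : ℕ):ℝ) + 1) := by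
      have : Real.exp (-(Real.log b * ((α - u : ℕ):ℝ) * γ (α - u))) =
          Real.exp (-(Real.log b * ((α - u : ℕ):ℝ))) * Real.exp (-(Real.log b * ((α - u : ℕ):ℝ) * (γ (α - u) - 1))) := by
        rw [← Real.exp_add]; congr 1; ring
      rw [this]; ring
    rw [e]
    gcongr
  · intro u; split_ifs
    · exact hW0 _
    · exact le_rfl
  · rw [← sum_filter]
    have hinj : Set.InjOn (fun u => α - u) ((Icc 1 n).filter fun u => u ≤ a n : Finset ℕ) := by
      intro x hx y hy hxy
      rw [Finset.mem_coe, mem_filter] at hx hy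
      simp only at hxy
      omega
    have e1 : ∑ u ∈ (Icc 1 n).filter (fun u => u ≤ a n), W (α - u) =
        ∑ j ∈ ((Icc 1 n).filter (fun u => u ≤ a n)).image (fun u => α - u), W j :=
      (sum_image hinj).symm
    rw [e1]
    exact hsm.sum_le_tsum _ fun j _ => hW0 j

end TC

end PartI4

section PartI5

namespace TC
open Finset
variable {n k m : ℕ}

lemma sum_tau {P l : ℕ → ℕ} (hl : ∀ u, l u ≤ P u) (hsum : ∑ u ∈ Icc 1 n, u * P u = n) :
    n - ∑ u ∈ Icc 1 n, u * l u = ∑ u ∈ Icc 1 n, u * (P u - l u) := by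
  have : ∑ u ∈ Icc 1 n, u * l u + ∑ u ∈ Icc 1 n, u * (P u - l u) = n := by
    rw [← sum_add_distrib]
    conv_rhs => rw [← hsum]
    refine sum_congr rfl fun u _ => ?_
    rw [← mul_add]
    congr 1
    have := hl u
    omega
  omega

/-- rewriting of `Qp` in terms of the complement -/
lemma Qp_eq {b : ℝ} (hb : 0 < b) {P l : ℕ → ℕ} (hl : ∀ u, l u ≤ P u) :
    Qp n b P l = (∏ u ∈ Icc 1 n, (((P u).factorial : ℝ) * (b ^ (u.choose 2) * (u.factorial : ℝ)) ^ (P u))) *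
      (((n - ∑ u ∈ Icc 1 n, u * l u).factorial : ℝ) *
      ∏ u ∈ Icc 1 n, (((P u).choose (P u - l u) : ℝ) / (((P u - l u).factorial : ℝ) *
        (b ^ (u.choose 2) * (u.factorial : ℝ)) ^ (P u - l u)))) := by
  rw [Qp, mul_left_comm, mul_left_comm (∏ u ∈ Icc 1 n, (((P u).factorial : ℝ) * _))]
  congr 1
  rw [← prod_mul_distrib, ← prod_mul_distrib]
  refine prod_congr rfl fun u _ => ?_
  set D : ℝ := b ^ (u.choose 2) * (u.factorial : ℝ) with hD
  have hD0 : 0 < D := by positivity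
  rw [Nat.choose_symm (hl u)]
  have h1 : ((P u).choose (l u) : ℝ) * ((l u).factorial : ℝ) * ((P u - l u).factorial : ℝ) = ((P u).factorial : ℝ) := by
    exact_mod_cast Nat.choose_mul_factorial_mul_factorial (hl u)
  have h2 : D ^ (P u) = D ^ (l u) * D ^ (P u - l u) := by
    rw [← pow_add]; congr 1; have := hl u; omega
  have h3 : (0:ℝ) < ((P u - l u).factorial : ℝ) := by positivity
  have h4 : 0 < D ^ (P u - l u) := by positivity
  rw [← h1, h2]
  field_simp

lemma fac_lower (u : ℕ) : (u:ℝ) ^ u ≤ Real.exp 1 ^ u * (u.factorial : ℝ) := by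
  have := fac_e u u le_rfl
  simpa using this

/-- one colour size in the near-complete regime -/
lemma near_term {β L : ℝ} (hβ : 0 < β) (hL : 0 < L) {u P t j : ℕ} (hn : (n:ℝ) = Real.exp (β * L))
    (hu : L ≤ u) (hPn : P ≤ n) (hq : Real.exp (-(β * u)) ≤ (L / n) ^ 2 * Real.exp (β * j)) :
    ((P.choose t : ℕ):ℝ) / ((t.factorial : ℝ) * (Real.exp β ^ (u.choose 2) * (u.factorial : ℝ)) ^ t) ≤
      Real.exp ((u:ℝ) * t * (1 + 3/2 * β + β * j / 2 - β * L)) := by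
  have hu0 : (0:ℝ) < u := by linarith
  have hn0 : (0:ℝ) < n := by rw [hn]; positivity
  have hC : ((P.choose t : ℕ):ℝ) ≤ Real.exp (β * u * t) := by
    calc ((P.choose t : ℕ):ℝ) ≤ ((P ^ t : ℕ) : ℝ) := by exact_mod_cast Nat.choose_le_pow P t
      _ = (P:ℝ) ^ t := by push_cast; ring
      _ ≤ (Real.exp (β * u)) ^ t := by
          refine pow_le_pow_left₀ (by positivity) ?_ t
          have : (P:ℝ) ≤ n := by exact_mod_cast hPn
          refine this.trans ?_
          rw [hn]; exact Real.exp_le_exp.2 (mul_le_mul_of_nonneg_left hu hβ.le)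
      _ = Real.exp (β * u * t) := by rw [← Real.exp_nat_mul]; congr 1; ring
  -- half power
  have hhalf : Real.exp (-(β * u) / 2) ≤ L / n * Real.exp (β * j / 2) := by
    have e : Real.exp (-(β * u)) = Real.exp (-(β * u) / 2) ^ 2 := by
      rw [← Real.exp_nat_mul]; congr 1; push_cast; ring
    have e' : Real.exp (β * j) = Real.exp (β * j / 2) ^ 2 := by
      rw [← Real.exp_nat_mul]; congr 1; push_cast; ring
    rw [e, e', ← mul_pow] at hq
    exact (pow_le_pow_iff_left₀ (by positivity) (by positivity) two_ne_zero).1 hq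
  have hD : Real.exp (-((u:ℝ) * (1 + β / 2 + β * j / 2 - β * L))) ≤ Real.exp β ^ (u.choose 2) * (u.factorial : ℝ) := by
    have f1 : ((u:ℝ) * Real.exp (-1)) ^ u ≤ (u.factorial : ℝ) := by
      have := fac_lower u
      have e : Real.exp (-1) ^ u * Real.exp 1 ^ u = 1 := by
        rw [← mul_pow, ← Real.exp_add]; simp
      calc ((u:ℝ) * Real.exp (-1)) ^ u = Real.exp (-1) ^ u * (u:ℝ) ^ u := by rw [mul_pow]; ring
        _ ≤ Real.exp (-1) ^ u * (Real.exp 1 ^ u * (u.factorial : ℝ)) := by gcongr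
        _ = _ := by rw [← mul_assoc, e, one_mul]
    have f2 : Real.exp β ^ (u.choose 2) = (Real.exp (β * (u - 1) / 2)) ^ u := by
      rw [← Real.exp_nat_mul, ← Real.exp_nat_mul, choose_two_cast]; congr 1; ring
    have f3 : Real.exp (-(1 + β / 2 + β * j / 2 - β * L)) ≤ Real.exp (β * (u - 1) / 2) * ((u:ℝ) * Real.exp (-1)) := by
      -- n e^{-βj/2} ≤ L e^{βu/2}
      have g : n * Real.exp (-(β * j / 2)) ≤ u * Real.exp (β * u / 2) := by
        have g1 : 1 ≤ L / n * Real.exp (β * j / 2) * Real.exp (β * u / 2) := by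
          have := mul_le_mul_of_nonneg_right hhalf (Real.exp_pos (β * u / 2)).le
          refine le_trans (le_of_eq ?_) this
          rw [← Real.exp_add]; symm; rw [Real.exp_eq_one_iff]; ring
        have g2 : n * Real.exp (-(β * j / 2)) * (L / n * Real.exp (β * j / 2) * Real.exp (β * u / 2)) = L * Real.exp (β * u / 2) := by
          rw [Real.exp_neg]; field_simp
        calc n * Real.exp (-(β * j / 2)) ≤ n * Real.exp (-(β * j / 2)) * (L / n * Real.exp (β * j / 2) * Real.exp (β * u / 2)) :=
              le_mul_of_one_le_right (by positivity) g1
          _ = L * Real.exp (β * u / 2) := g2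
          _ ≤ _ := by gcongr
      have e1 : Real.exp (-(1 + β / 2 + β * j / 2 - β * L)) = Real.exp (-(1 + β/2)) * (n * Real.exp (-(β * j / 2))) := by
        rw [hn, ← Real.exp_add, ← Real.exp_add]; congr 1; ring
      have e2 : Real.exp (β * (u - 1) / 2) * ((u:ℝ) * Real.exp (-1)) = Real.exp (-(1 + β/2)) * (u * Real.exp (β * u / 2)) := by
        rw [mul_left_comm, mul_left_comm (Real.exp (-(1 + β/2))), ← Real.exp_add, ← Real.exp_add]; congr 2; ring
      rw [e1, e2]
      gcongr
    calc Real.exp (-((u:ℝ) * (1 + β / 2 + β * j / 2 - β * L))) = (Real.exp (-(1 + β / 2 + β * j / 2 - β * L))) ^ u := by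
          rw [← Real.exp_nat_mul]; congr 1; ring
      _ ≤ (Real.exp (β * (u - 1) / 2) * ((u:ℝ) * Real.exp (-1))) ^ u := pow_le_pow_left₀ (Real.exp_pos _).le f3 u
      _ = (Real.exp (β * (u - 1) / 2)) ^ u * ((u:ℝ) * Real.exp (-1)) ^ u := mul_pow _ _ _
      _ ≤ _ := by rw [f2]; gcongr
  have ht1 : (1:ℝ) ≤ (t.factorial : ℝ) := by exact_mod_cast Nat.one_le_iff_ne_zero.2 (Nat.factorial_ne_zero t)
  have hDt : Real.exp (-((u:ℝ) * t * (1 + β / 2 + β * j / 2 - β * L))) ≤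
      (t.factorial : ℝ) * (Real.exp β ^ (u.choose 2) * (u.factorial : ℝ)) ^ t := by
    calc Real.exp (-((u:ℝ) * t * (1 + β / 2 + β * j / 2 - β * L))) =
        (Real.exp (-((u:ℝ) * (1 + β / 2 + β * j / 2 - β * L)))) ^ t := by
          rw [← Real.exp_nat_mul]; congr 1; ring
      _ ≤ (Real.exp β ^ (u.choose 2) * (u.factorial : ℝ)) ^ t := pow_le_pow_left₀ (Real.exp_pos _).le hD t
      _ ≤ _ := le_mul_of_one_le_left (by positivity) ht1
  calc _ ≤ Real.exp (β * u * t) / Real.exp (-((u:ℝ) * t * (1 + β / 2 + β * j / 2 - β * L))) := by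
        gcongr
    _ = _ := by rw [← Real.exp_sub]; congr 1; ring

lemma Qp_near {β ξ C L δ : ℝ} (hβ : 0 < β) (hξ : ξ ≤ 1) (hL : 0 < L) {a : ℕ} {P j : ℕ → ℕ} {w : ℕ → ℝ}
    (hSZ : SZ β ξ C L n a P j w) {l : ℕ → ℕ} (hl : ∀ u, l u ≤ P u)
    (hZ : ∏ u ∈ Icc 1 n, (((P u).factorial : ℝ) * (Real.exp β ^ (u.choose 2) * (u.factorial : ℝ)) ^ (P u)) ≤
      2 * (n.factorial : ℝ)) {M0 : ℕ} (hM0 : 0 < M0) (hM : ∑ u ∈ Icc 1 n, u * l u + M0 ≤ n)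
    (hδ0 : 0 < δ) (hδ : 2 * (2 + 3/2 * β + β * C / 2) ≤ Real.log (1/δ))
    (hs : (1 - δ) * n ≤ (∑ u ∈ Icc 1 n, u * l u : ℕ)) :
    Qp n (Real.exp β) P l ≤ 2 * (n.factorial : ℝ) * Real.exp (-(M0:ℝ)) := by
  have hn0 : (0:ℝ) < n := by rw [hSZ.hn]; positivity
  rw [Qp_eq (Real.exp_pos β) hl]
  set N2 := n - ∑ u ∈ Icc 1 n, u * l u with hN2
  have hτ := sum_tau hl hSZ.hsum
  rw [← hN2] at hτ
  have hN2M : M0 ≤ N2 := by omega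
  have hN2c : (N2:ℝ) + (∑ u ∈ Icc 1 n, u * l u : ℕ) = n := by
    have : N2 + ∑ u ∈ Icc 1 n, u * l u = n := by omega
    exact_mod_cast this
  have hN2δ : (N2:ℝ) ≤ δ * n := by linarith
  have hN2p : (0:ℝ) < N2 := by exact_mod_cast (by omega : 0 < N2)
  have hN2n : (N2:ℝ) ≤ n := by
    have : N2 ≤ n := by omega
    exact_mod_cast this
  set J : ℝ := (β * L - Real.log N2) / β with hJ
  have hβJ : β * J = β * L - Real.log N2 := by rw [hJ]; field_simp
  have hlogn : Real.log n = β * L := by rw [hSZ.hn, Real.log_exp]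
  have hJ1 : Real.log (1/δ) ≤ β * J := by
    rw [hβJ, ← hlogn, ← Real.log_div hn0.ne' hN2p.ne']
    refine Real.log_le_log (by positivity) ?_
    rw [div_le_div_iff₀ hδ0 hN2p]; linarith
  have hJ0 : 0 ≤ J := by
    rw [hJ]
    refine div_nonneg ?_ hβ.le
    rw [← hlogn]
    have := Real.log_le_log hN2p hN2n
    linarith
  have hnJ : n * Real.exp (-(β * J)) = N2 := by
    rw [hβJ, hSZ.hn, ← Real.exp_add]
    have : β * L + -(β * L - Real.log N2) = Real.log N2 := by ring
    rw [this, Real.exp_log hN2p]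
  have hPn : ∀ u ∈ Icc 1 n, P u ≤ n := by
    intro u hu
    have h1 : u * P u ≤ n := by
      conv_rhs => rw [← hSZ.hsum]
      exact single_le_sum (f := fun u => u * P u) (fun _ _ => Nat.zero_le _) hu
    exact (Nat.le_mul_of_pos_left _ (mem_Icc.1 hu).1).trans h1
  have hprod : ∏ u ∈ Icc 1 n, (((P u).choose (P u - l u) : ℝ) / (((P u - l u).factorial : ℝ) *
        (Real.exp β ^ (u.choose 2) * (u.factorial : ℝ)) ^ (P u - l u))) ≤
      Real.exp (∑ u ∈ Icc 1 n, (u:ℝ) * ((P u - l u : ℕ):ℝ) * (1 + 3/2 * β + β * j u / 2 - β * L)) := by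
    rw [Real.exp_sum]
    refine prod_le_prod (fun u _ => by positivity) fun u hu => ?_
    by_cases hP0 : P u = 0
    · simp [hP0]
    · have hPp : 0 < P u := Nat.pos_of_ne_zero hP0
      refine near_term hβ hL hSZ.hn ?_ (hPn u hu) (hSZ.hq u hPp)
      have := hSZ.lo u hPp
      nlinarith
  have hτc : (N2:ℝ) = ∑ u ∈ Icc 1 n, (u:ℝ) * ((P u - l u : ℕ):ℝ) := by
    rw [hτ]; push_cast; rfl
  have hjs : ∑ u ∈ Icc 1 n, (u:ℝ) * ((P u - l u : ℕ):ℝ) * j u ≤ N2 * (J + C) := by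
    have : ∀ u ∈ Icc 1 n, (u:ℝ) * ((P u - l u : ℕ):ℝ) * j u ≤ (u:ℝ) * ((P u - l u : ℕ):ℝ) * J + N2 * w u := by
      intro u hu
      have hw0 := hSZ.w0 u
      by_cases hP0 : P u = 0
      · simp [hP0]; positivity
      have hPp : 0 < P u := Nat.pos_of_ne_zero hP0
      rcases le_or_gt (j u : ℝ) J with hj | hj
      · have : (u:ℝ) * ((P u - l u : ℕ):ℝ) * j u ≤ (u:ℝ) * ((P u - l u : ℕ):ℝ) * J := by gcongr
        have : 0 ≤ N2 * w u := by positivity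
        linarith
      · have h1 : (u:ℝ) * ((P u - l u : ℕ):ℝ) * j u ≤ (u:ℝ) * P u * (j u + 1) := by
          have : ((P u - l u : ℕ):ℝ) ≤ P u := by exact_mod_cast Nat.sub_le _ _
          gcongr
          linarith
        have h2 := hSZ.hP u hPp
        have h3 : n * Real.exp (-(β * j u)) * w u ≤ N2 * w u := by
          rw [← hnJ]
          gcongr
        have : 0 ≤ (u:ℝ) * ((P u - l u : ℕ):ℝ) * J := by positivity
        linarith
    calc _ ≤ ∑ u ∈ Icc 1 n, ((u:ℝ) * ((P u - l u : ℕ):ℝ) * J + N2 * w u) := sum_le_sum this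
      _ = N2 * J + N2 * ∑ u ∈ Icc 1 n, w u := by
          rw [sum_add_distrib, ← sum_mul, ← hτc, ← mul_sum]
      _ ≤ _ := by
          rw [mul_add]
          have := mul_le_mul_of_nonneg_left hSZ.hw hN2p.le
          linarith
  have hfac : ((N2.factorial : ℕ):ℝ) ≤ Real.exp (N2 * Real.log N2) := by
    calc ((N2.factorial : ℕ):ℝ) ≤ ((N2 ^ N2 : ℕ) : ℝ) := by exact_mod_cast Nat.factorial_le_pow N2
      _ = (N2:ℝ) ^ N2 := by push_cast; rfl
      _ = _ := by rw [Real.exp_nat_mul, Real.exp_log hN2p]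
  have hex : N2 * Real.log N2 + ∑ u ∈ Icc 1 n, (u:ℝ) * ((P u - l u : ℕ):ℝ) * (1 + 3/2 * β + β * j u / 2 - β * L) ≤ -(M0:ℝ) := by
    have e : ∑ u ∈ Icc 1 n, (u:ℝ) * ((P u - l u : ℕ):ℝ) * (1 + 3/2 * β + β * j u / 2 - β * L) =
        N2 * (1 + 3/2 * β - β * L) + β / 2 * ∑ u ∈ Icc 1 n, (u:ℝ) * ((P u - l u : ℕ):ℝ) * j u := by
      rw [hτc, sum_mul, mul_sum, ← sum_add_distrib]
      refine sum_congr rfl fun u _ => ?_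
      ring
    rw [e]
    have h1 := mul_le_mul_of_nonneg_left hjs (by positivity : 0 ≤ β / 2)
    have h2 : β / 2 * (N2 * (J + C)) = N2 * ((β * J) / 2 + β * C / 2) := by ring
    have h3 : N2 * Real.log N2 + N2 * (1 + 3/2 * β - β * L) + N2 * ((β * J) / 2 + β * C / 2) =
        N2 * ((1 + 3/2 * β + β * C / 2) - (β * J) / 2) := by rw [hβJ]; ring
    have h4 : N2 * ((1 + 3/2 * β + β * C / 2) - (β * J) / 2) ≤ N2 * (-1) :=
      mul_le_mul_of_nonneg_left (by linarith) hN2p.le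
    have h5 : (M0:ℝ) ≤ N2 := by exact_mod_cast hN2M
    linarith
  refine mul_le_mul hZ ?_ (by positivity) (by positivity)
  calc _ ≤ Real.exp (N2 * Real.log N2) * Real.exp (∑ u ∈ Icc 1 n, (u:ℝ) * ((P u - l u : ℕ):ℝ) * (1 + 3/2 * β + β * j u / 2 - β * L)) :=
        mul_le_mul hfac hprod (by positivity) (Real.exp_pos _).le
    _ = _ := (Real.exp_add _ _).symm
    _ ≤ _ := Real.exp_le_exp.2 hex

/-- middle range, from the first-moment assumption on subprofiles -/
lemma Qp_mid {p : ℝ} (hp : 0 < p) (hp1 : p < 1) {a : ℕ} (han : a ≤ n) {P l : ℕ → ℕ} (hl : ∀ u, l u ≤ P u)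
    (hPz : ∀ u, u ∉ Icc 1 n → P u = 0) (hPa : ∀ u, a < u → P u = 0) {T : ℝ}
    (h : Real.exp T * ∏ u ∈ Icc 1 a, ((P u).choose (l u) : ℝ) ^ 2 ≤ Ep n p fun G => Xbar G l) :
    Qp n (1/(1-p)) P l ≤ (n.factorial : ℝ) * Real.exp (-T) := by
  have hq : 0 < 1 - p := by linarith
  have hlz : ∀ u, u ∉ Icc 1 n → l u = 0 := fun u hu => by
    have := hl u; rw [hPz u hu] at this; omega
  obtain ⟨v, hv, hvl⟩ := exists_sizes l hlz
  have h1 := Ep_le hp.le hp1.le v hv hvl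
  have hsum : ∑ i, v i = ∑ u ∈ Icc 1 n, u * l u := by
    have := sum_parts hlz v hvl (fun u => (u:ℝ))
    have e : ((∑ i, v i : ℕ):ℝ) = ((∑ u ∈ Icc 1 n, u * l u : ℕ) : ℝ) := by
      push_cast; rw [this]; exact sum_congr rfl fun u _ => mul_comm _ _
    exact_mod_cast e
  have hch : (1 - p) ^ (∑ i, (v i).choose 2) = ∏ u ∈ Icc 1 n, ((1-p) ^ (u.choose 2)) ^ (l u) := by
    rw [← prod_parts hlz v hvl (fun u => (1-p) ^ (u.choose 2)), prod_pow_eq_pow_sum]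
  rw [hsum, hch, prod_parts hlz v hvl (fun u => (u.factorial : ℝ))] at h1
  have hprod : ∏ u ∈ Icc 1 a, ((P u).choose (l u) : ℝ) ^ 2 = ∏ u ∈ Icc 1 n, ((P u).choose (l u) : ℝ) ^ 2 := by
    refine prod_subset (Icc_subset_Icc_right han) fun u hu hu' => ?_
    have hu2 : a < u := by
      rw [mem_Icc] at hu hu'; omega
    have hl0 := hl u
    rw [hPa u hu2] at hl0
    simp [hPa u hu2, Nat.le_zero.1 hl0]
  rw [hprod] at h
  have h2 := h.trans h1
  rw [Qp]
  set S : ℝ := ((n - ∑ u ∈ Icc 1 n, u * l u).factorial : ℝ) with hS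
  have hS0 : 0 < S := by rw [hS]; positivity
  set X1 : ℝ := ∏ u ∈ Icc 1 n, ((P u).choose (l u) : ℝ) ^ 2 with hX1
  set X2 : ℝ := ∏ u ∈ Icc 1 n, ((l u).factorial : ℝ) with hX2
  set X3 : ℝ := ∏ u ∈ Icc 1 n, ((u.factorial : ℝ)) ^ (l u) with hX3
  set X4 : ℝ := ∏ u ∈ Icc 1 n, ((1-p) ^ (u.choose 2)) ^ (l u) with hX4
  have p2 : 0 < X2 := prod_pos fun u _ => by positivity
  have p3 : 0 < X3 := prod_pos fun u _ => by positivity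
  have p4 : 0 < X4 := prod_pos fun u _ => by positivity
  have e1 : ∏ u ∈ Icc 1 n, ((P u).choose (l u) : ℝ) ^ 2 * ((l u).factorial : ℝ) = X1 * X2 := prod_mul_distrib
  have e2 : ∏ u ∈ Icc 1 n, ((1/(1-p)) ^ (u.choose 2) * (u.factorial : ℝ)) ^ (l u) = X4⁻¹ * X3 := by
    rw [hX4, hX3, ← prod_inv_distrib, ← prod_mul_distrib]
    refine prod_congr rfl fun u _ => ?_
    rw [mul_pow, one_div, inv_pow, inv_pow]
  rw [e1, e2]
  have e3 : X1 ≤ Real.exp (-T) * ((n.factorial : ℝ) / (X3 * S) * X4 / X2) := by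
    have := mul_le_mul_of_nonneg_left h2 (Real.exp_pos (-T)).le
    rwa [← mul_assoc, ← Real.exp_add, neg_add_cancel, Real.exp_zero, one_mul] at this
  calc X1 * X2 * (S * (X4⁻¹ * X3)) ≤ (Real.exp (-T) * ((n.factorial : ℝ) / (X3 * S) * X4 / X2)) * X2 * (S * (X4⁻¹ * X3)) := by
        gcongr
    _ = _ := by field_simp

lemma Qp_change {B b θ : ℝ} (hb : 0 < b) (hB0 : 0 ≤ B) (hθ : 0 ≤ θ) (hB : B ≤ b * Real.exp θ) {P l : ℕ → ℕ} (hl : ∀ u, l u ≤ P u)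
    {f : ℕ} (hf : ∑ u ∈ Icc 1 n, P u * u.choose 2 = f) :
    Qp n B P l ≤ Real.exp (θ * f) * Qp n b P l := by
  rw [Qp, Qp, mul_left_comm (Real.exp (θ * f)), mul_left_comm (Real.exp (θ * f))]
  refine mul_le_mul_of_nonneg_left ?_ (prod_nonneg fun u _ => by positivity)
  refine mul_le_mul_of_nonneg_left ?_ (by positivity)
  have : ∀ u ∈ Icc 1 n, (B ^ (u.choose 2) * (u.factorial : ℝ)) ^ (l u) ≤
      Real.exp (θ * (P u * u.choose 2 : ℕ)) * (b ^ (u.choose 2) * (u.factorial : ℝ)) ^ (l u) := by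
    intro u _
    have h1 : B ^ (u.choose 2) ≤ b ^ (u.choose 2) * Real.exp (θ * (u.choose 2 : ℕ)) := by
      calc B ^ (u.choose 2) ≤ (b * Real.exp θ) ^ (u.choose 2) := pow_le_pow_left₀ hB0 hB _
        _ = _ := by rw [mul_pow, ← Real.exp_nat_mul]; congr 2; ring
    calc (B ^ (u.choose 2) * (u.factorial : ℝ)) ^ (l u) ≤
          (b ^ (u.choose 2) * Real.exp (θ * (u.choose 2 : ℕ)) * (u.factorial : ℝ)) ^ (l u) := by gcongr
      _ = Real.exp (θ * (u.choose 2 : ℕ)) ^ (l u) * (b ^ (u.choose 2) * (u.factorial : ℝ)) ^ (l u) := by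
          rw [← mul_pow]; congr 1; ring
      _ ≤ _ := by
          gcongr
          rw [← Real.exp_nat_mul]
          refine Real.exp_le_exp.2 ?_
          have : (l u : ℝ) ≤ P u := by exact_mod_cast hl u
          push_cast
          have e : (l u : ℝ) * (θ * (u.choose 2 : ℕ)) ≤ P u * (θ * (u.choose 2 : ℕ)) := by gcongr
          linarith
  calc _ ≤ ∏ u ∈ Icc 1 n, (Real.exp (θ * (P u * u.choose 2 : ℕ)) * (b ^ (u.choose 2) * (u.factorial : ℝ)) ^ (l u)) :=
        prod_le_prod (fun u _ => by positivity) this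
    _ = _ := by
        rw [prod_mul_distrib, ← Real.exp_sum, ← mul_sum, ← hf]; push_cast; rfl

end TC

end PartI5

section PartI6

namespace TC
open Finset
variable {n k m : ℕ}

/-- deterministic consequences for the list of sizes -/
lemma sizes_det {β ξ C L : ℝ} (hξ : ξ ≤ 1) (hL : 1 ≤ L) {a : ℕ} {P j : ℕ → ℕ} {w : ℕ → ℝ}
    (hSZ : SZ β ξ C L n a P j w) (v : Fin k → ℕ) (hvP : ∀ u, (univ.filter fun i => v i = u).card = P u)
    {f : ℕ} (hf : ∑ i, (v i).choose 2 = f) :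
    (∀ i, v i ∈ Icc 1 n) ∧ (∀ i, v i ≤ a) ∧ (∀ i, (2 - ξ) * L ≤ v i) ∧ (∑ i, v i = n) ∧
    ((f:ℝ) ≤ n * L) ∧ ((k:ℝ) * L ≤ n) ∧ (k ≤ n) ∧ (∑ u ∈ Icc 1 n, P u * u.choose 2 = f) ∧
    (∑ i, Real.exp (-(β * v i)) ≤ C * L / n) := by
  have hpos : ∀ i, 0 < P (v i) := by
    intro i
    rw [← hvP (v i)]
    exact card_pos.2 ⟨i, mem_filter.2 ⟨mem_univ _, rfl⟩⟩
  have hn0 : (0:ℝ) < n := by rw [hSZ.hn]; positivity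
  have hva : ∀ i, v i ≤ a := fun i => (hSZ.hi _ (hpos i)).2
  have hvn : ∀ i, v i ∈ Icc 1 n := fun i => mem_Icc.2 ⟨(hSZ.hi _ (hpos i)).1, (hva i).trans hSZ.han⟩
  have hlo : ∀ i, (2 - ξ) * L ≤ v i := fun i => hSZ.lo _ (hpos i)
  have hs : ∑ i, v i = n := by
    have h1 := sum_parts hSZ.hPz v hvP (fun u => (u:ℝ))
    have e : ((∑ i, v i : ℕ):ℝ) = ((∑ u ∈ Icc 1 n, u * P u : ℕ) : ℝ) := by
      push_cast; rw [h1]; exact sum_congr rfl fun u _ => mul_comm _ _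
    rw [hSZ.hsum] at e
    exact_mod_cast e
  have hsR : ∑ i, (v i : ℝ) = n := by exact_mod_cast hs
  have hLv : ∀ i, L ≤ v i := fun i => by have := hlo i; nlinarith
  have hf2 : ∑ u ∈ Icc 1 n, P u * u.choose 2 = f := by
    have h1 := sum_parts hSZ.hPz v hvP (fun u => ((u.choose 2 : ℕ):ℝ))
    have e : ((∑ u ∈ Icc 1 n, P u * u.choose 2 : ℕ) : ℝ) = ((∑ i, (v i).choose 2 : ℕ):ℝ) := by
      push_cast; rw [h1]
    rw [hf] at e
    exact_mod_cast e
  have hkL : (k:ℝ) * L ≤ n := by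
    rw [← hsR]
    calc (k:ℝ) * L = ∑ _i : Fin k, L := by simp
      _ ≤ _ := sum_le_sum fun i _ => hLv i
  refine ⟨hvn, hva, hlo, hs, ?_, hkL, ?_, hf2, ?_⟩
  · rw [← hf, ← hsR]
    push_cast
    rw [sum_mul]
    refine sum_le_sum fun i _ => ?_
    rw [choose_two_cast]
    have h1 : (v i : ℝ) ≤ 2 * L := by
      have : (v i : ℝ) ≤ a := by exact_mod_cast hva i
      linarith [hSZ.ha]
    have h2 : (0:ℝ) ≤ v i := by positivity
    nlinarith
  · have : (k:ℝ) ≤ n := by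
      have : (k:ℝ) * 1 ≤ k * L := by gcongr
      linarith
    exact_mod_cast this
  · rw [sum_parts hSZ.hPz v hvP (fun u => Real.exp (-(β * u)))]
    have hterm : ∀ u ∈ Icc 1 n, (P u : ℝ) * Real.exp (-(β * u)) ≤ L / n * w u := by
      intro u _
      have hw0 := hSZ.w0 u
      by_cases hP0 : P u = 0
      · simp [hP0]; positivity
      have hPp : 0 < P u := Nat.pos_of_ne_zero hP0
      have h1 := hSZ.hq u hPp
      have h2 := hSZ.hP u hPp
      have h3 : L ≤ u := by have := hSZ.lo u hPp; nlinarith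
      have h4 : L * (P u : ℝ) ≤ n * Real.exp (-(β * j u)) * w u := by
        refine le_trans ?_ h2
        have : (u:ℝ) * P u ≤ (u:ℝ) * P u * (j u + 1) := le_mul_of_one_le_right (by positivity) (by linarith [Nat.cast_nonneg (α := ℝ) (j u)])
        refine le_trans ?_ this
        gcongr
      calc (P u : ℝ) * Real.exp (-(β * u)) ≤ P u * ((L / n) ^ 2 * Real.exp (β * j u)) := by gcongr
        _ = (L * (P u : ℝ)) * (L / n ^ 2 * Real.exp (β * j u)) := by ring
        _ ≤ (n * Real.exp (-(β * j u)) * w u) * (L / n ^ 2 * Real.exp (β * j u)) := by gcongr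
        _ = L / n * w u := by
            rw [Real.exp_neg]; field_simp
    calc _ ≤ ∑ u ∈ Icc 1 n, L / n * w u := sum_le_sum hterm
      _ = L / n * ∑ u ∈ Icc 1 n, w u := by rw [mul_sum]
      _ ≤ L / n * C := by have := hSZ.hw; gcongr
      _ = _ := by ring

lemma ev_lin {β : ℝ} (hβ : 0 < β) (C : ℝ) (j : ℕ) : ∀ᶠ L : ℝ in atTop, C * L ^ j ≤ Real.exp (β * L) := by
  filter_upwards [ev_poly j |C| hβ, eventually_ge_atTop 0] with L h1 h2
  refine le_trans ?_ h1
  have : L ^ j ≤ (2 * L + 2) ^ j := pow_le_pow_left₀ h2 (by linarith) _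
  calc C * L ^ j ≤ |C| * L ^ j := by gcongr; exact le_abs_self C
    _ ≤ _ := by gcongr

/-- numerical facts about `N`, `f`, `B` -/
lemma basic_ev {p : ℝ} (hp : 0 < p) (hp1 : p < 1) {η : ℝ} (hη : 0 < η) :
    ∀ᶠ L : ℝ in atTop, ∀ (n f : ℕ), (n:ℝ) = Real.exp (Real.log (1/(1-p)) * L) → (f:ℝ) ≤ n * L →
      0 < n.choose 2 ∧ 4 * (f:ℝ) ≤ (1 - p) * (n.choose 2 : ℕ) ∧
      4 * (f:ℝ) / ((1 - p) * (n.choose 2 : ℕ)) ≤ 16 / (1 - p) * L / n ∧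
      4 * (f:ℝ) / ((1 - p) * (n.choose 2 : ℕ)) * (4 * L ^ 2) ≤ 1 / 2 ∧
      4 * (f:ℝ) / ((1 - p) * (n.choose 2 : ℕ)) * f ≤ 16 / (1 - p) * L ^ 2 ∧
      24 * (f:ℝ) ^ 2 * (f + 1) / ((1 - p) ^ 2 * ((n.choose 2 : ℕ):ℝ) ^ 2) ≤ η ∧
      1 - (mFloor p n : ℝ) / (n.choose 2 : ℕ) ≤ Real.exp (-(0.995 * Real.log (1/(1-p)))) := by
  have hq : 0 < 1 - p := by linarith
  set β := Real.log (1/(1-p)) with hβd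
  have hβ : 0 < β := Real.log_pos (by rw [one_lt_div hq]; linarith)
  have hexpβ : Real.exp (-β) = 1 - p := by
    rw [hβd, one_div, Real.log_inv, neg_neg, Real.exp_log hq]
  have hgap : 0 < Real.exp (-(0.995 * β)) - (1 - p) := by
    rw [← hexpβ, sub_pos]; exact Real.exp_lt_exp.2 (by linarith)
  set g := Real.exp (-(0.995 * β)) - (1 - p) with hg
  filter_upwards [ev_lin hβ 4 0, ev_lin hβ (16 / (1-p)) 1, ev_lin hβ (128/(1-p)) 3,
    ev_lin hβ (768 / ((1-p)^2 * η)) 3, ev_lin hβ (4 / g) 0, eventually_ge_atTop 1] with L h1 h2 h3 h4 h5 hL n f hn hf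
  rw [← hn] at h1 h2 h3 h4 h5
  rw [pow_zero, mul_one] at h1 h5
  have hn0 : (0:ℝ) < n := by linarith
  set N : ℝ := ((n.choose 2 : ℕ) : ℝ) with hN
  have hNn : (n:ℝ)^2 / 4 ≤ N := by
    rw [hN, choose_two_cast]; nlinarith
  have hN0 : 0 < N := lt_of_lt_of_le (by positivity) hNn
  have hθ : 4 * (f:ℝ) / ((1 - p) * N) ≤ 16 / (1 - p) * L / n := by
    rw [div_le_div_iff₀ (by positivity) hn0]
    have e : 16 / (1 - p) * L * ((1 - p) * N) = 16 * L * N := by field_simp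
    rw [e]
    have : 4 * (f:ℝ) * n ≤ 4 * (n * L) * n := by gcongr
    nlinarith
  have hL2 : 0 ≤ L := by linarith
  refine ⟨by rw [hN] at hN0; exact_mod_cast hN0, ?_, hθ, ?_, ?_, ?_, ?_⟩
  · have e1 : 16 * L ≤ (1 - p) * n := by
      have : 16 / (1-p) * L ^ 1 = 16 * L / (1 - p) := by ring
      rw [this, div_le_iff₀ hq] at h2; linarith
    calc 4 * (f:ℝ) ≤ 4 * (n * L) := by gcongr
      _ = n * (16 * L) / 4 := by ring
      _ ≤ n * ((1 - p) * n) / 4 := by gcongr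
      _ = (1 - p) * (n ^ 2 / 4) := by ring
      _ ≤ _ := by gcongr
  · calc 4 * (f:ℝ) / ((1 - p) * N) * (4 * L ^ 2) ≤ 16 / (1 - p) * L / n * (4 * L ^ 2) := by gcongr
      _ = (128 / (1 - p) * L ^ 3) / n / 2 := by ring
      _ ≤ n / n / 2 := by gcongr
      _ = 1 / 2 := by rw [div_self hn0.ne']
  · calc 4 * (f:ℝ) / ((1 - p) * N) * f ≤ 16 / (1 - p) * L / n * (n * L) := by gcongr
      _ = _ := by field_simp
  · have hnL : (1:ℝ) ≤ n * L := by nlinarith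
    calc 24 * (f:ℝ) ^ 2 * (f + 1) / ((1 - p) ^ 2 * N ^ 2) ≤ 24 * (n * L) ^ 2 * (n * L + n * L) / ((1 - p) ^ 2 * (n ^ 2 / 4) ^ 2) := by
          gcongr
      _ = (768 / ((1-p)^2 * η) * L ^ 3) * η / n := by field_simp; ring
      _ ≤ n * η / n := by gcongr
      _ = η := by field_simp
  · refine (qhat_le (by rw [hN] at hN0; exact_mod_cast hN0)).trans ?_
    have : 1 / N ≤ g := by
      rw [div_le_iff₀ hgap] at h5
      rw [div_le_iff₀ hN0]
      have : (n:ℝ) / 4 ≤ N := by nlinarith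
      nlinarith
    rw [← hN]
    linarith

/-- powers of `B` -/
lemma B_pow {b θ B T : ℝ} (hb : 0 < b) (hθ : 0 ≤ θ) (hB0 : 0 ≤ B) (hB : B ≤ b * Real.exp θ) (hT : θ * T ≤ 1/2) (t : ℕ)
    (ht : (t:ℝ) ≤ T) : B ^ t ≤ 2 * b ^ t := by
  calc B ^ t ≤ (b * Real.exp θ) ^ t := pow_le_pow_left₀ hB0 hB t
    _ = Real.exp (θ * t) * b ^ t := by rw [mul_pow, ← Real.exp_nat_mul, mul_comm]; congr 2; ring
    _ ≤ 2 * b ^ t := by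
        gcongr
        have h1 : θ * t ≤ 1/2 := (mul_le_mul_of_nonneg_left ht hθ).trans hT
        have h2 : Real.exp (θ * t) ≤ Real.exp (1/2) := Real.exp_le_exp.2 h1
        have h3 : Real.exp (1/2) ≤ 2 := by
          have e : Real.exp (1/2) ^ 2 = Real.exp 1 := by rw [← Real.exp_nat_mul]; norm_num
          have := Real.exp_one_lt_d9
          have h0 := Real.exp_pos (1/2)
          nlinarith
        linarith

end TC

end PartI6

section PartI7

namespace TC
open Finset
variable {n k m : ℕ}

lemma mu_eq {p : ℝ} (hp1 : p < 1) (n a : ℕ) : muExp (1-p) n a =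
    (n.choose a : ℝ) * Real.exp (-(Real.log (1/(1-p)) * (a.choose 2 : ℕ))) := by
  have hq : 0 < 1 - p := by linarith
  rw [muExp]; congr 1
  rw [one_div, Real.log_inv, neg_mul, neg_neg, mul_comm, Real.exp_nat_mul, Real.exp_log hq]

lemma second_ev {β : ℝ} (hβ : 0 < β) (A : ℝ) {ε : ℝ} (hε : 0 < ε) :
    ∀ᶠ L : ℝ in atTop, ∀ s0 : ℕ, Real.exp (0.3 * β * L) ≤ (s0:ℝ) + 1 →
      Real.exp (-(β / 40 * s0)) * Real.exp (A * L ^ 2 + (1 + 4 * Real.exp (β * L / 10))) ≤ ε := by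
  have hc : 0 < β / 10 := by positivity
  filter_upwards [ev_lin hc A 2, ev_lin hc 1 0, ev_lin hc (320 / β) 0, ev_lin hc (β / 40) 0,
    ev_lin hc (-Real.log ε) 0] with L h1 h2 h3 h4 h5 s0 hs
  have e : β / 10 * L = β * L / 10 := by ring
  rw [e] at h1 h2 h3 h4 h5
  rw [pow_zero, mul_one] at h2 h3 h4 h5
  have e3 : Real.exp (0.3 * β * L) = Real.exp (β * L / 10) ^ 3 := by
    rw [← Real.exp_nat_mul]; congr 1; push_cast; ring
  rw [e3] at hs
  set x := Real.exp (β * L / 10) with hx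
  rw [← Real.exp_add, ← Real.le_log_iff_exp_le hε]
  have g1 : 8 * x ≤ β / 40 * x ^ 3 := by
    have : 320 ≤ β * x := by rw [div_le_iff₀ hβ] at h3; linarith
    have h8 : 320 ≤ β * x * x := by nlinarith
    have : 320 * x ≤ β * x * x * x := mul_le_mul_of_nonneg_right h8 (by linarith)
    nlinarith
  have g2 : β / 40 * (x ^ 3 - 1) ≤ β / 40 * s0 := by
    refine mul_le_mul_of_nonneg_left ?_ (by positivity); linarith
  linarith

lemma s0_ev {β : ℝ} (hβ : 0 < β) {ε : ℝ} (hε : 0 < ε) :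
    ∀ᶠ L : ℝ in atTop, ∀ n s0 : ℕ, (n:ℝ) = Real.exp (β * L) → (s0:ℝ) ≤ Real.exp (0.3 * β * L) →
      s0 < n ∧ ((n:ℝ) / (n - s0)) ^ s0 ≤ 1 + ε := by
  have hc : 0 < 0.3 * β := by positivity
  have hc' : 0 < 0.4 * β := by positivity
  filter_upwards [ev_lin hc 2 0, ev_lin hc' (4 / ε) 0, ev_lin hc' 4 0, eventually_gt_atTop 0] with L h1 h2 h3 hL n s0 hn hs
  rw [pow_zero, mul_one] at h1 h2 h3
  have e1 : (n:ℝ) = Real.exp (0.3 * β * L) * Real.exp (0.3 * β * L) * Real.exp (0.4 * β * L) := by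
    rw [hn, ← Real.exp_add, ← Real.exp_add]; congr 1; ring
  set x := Real.exp (0.3 * β * L)
  set y := Real.exp (0.4 * β * L)
  have hx0 : 0 < x := Real.exp_pos _
  have hy0 : 0 < y := Real.exp_pos _
  have hn0 : (0:ℝ) < n := by rw [e1]; positivity
  have hsn : 2 * (s0:ℝ) ≤ n := by
    have : 2 * x * 1 ≤ x * x * y := by nlinarith
    linarith
  have hlt : (s0:ℝ) < n := by linarith
  refine ⟨by exact_mod_cast hlt, ?_⟩
  have hd : (0:ℝ) < n - s0 := by linarith
  have e2 : (n:ℝ) / (n - s0) = 1 + s0 / (n - s0) := by field_simp; ring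
  have h4 : (s0:ℝ) * (s0 / (n - s0)) ≤ 2 / y := by
    rw [mul_div_assoc', div_le_div_iff₀ hd hy0]
    have : (s0:ℝ) * s0 ≤ x * x := by gcongr
    have : (s0:ℝ) * s0 * y ≤ x * x * y := by gcongr
    nlinarith
  have h5 : 2 / y ≤ min (ε / 2) (1/2) := by
    rw [le_min_iff]
    constructor
    · rw [div_le_iff₀ hε] at h2
      rw [div_le_iff₀ hy0]; nlinarith
    · rw [div_le_iff₀ hy0]; linarith
  rw [le_min_iff] at h5
  calc ((n:ℝ) / (n - s0)) ^ s0 ≤ Real.exp (s0 / (n - s0)) ^ s0 := by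
        refine pow_le_pow_left₀ (by positivity) ?_ _
        rw [e2, add_comm]; exact Real.add_one_le_exp _
    _ = Real.exp (s0 * (s0 / (n - s0))) := by rw [← Real.exp_nat_mul]
    _ ≤ Real.exp (2 / y) := Real.exp_le_exp.2 h4
    _ ≤ 1 + ε := by
        have h0 : 0 ≤ 2 / y := by positivity
        have := Real.abs_exp_sub_one_le (x := 2 / y) (by rw [abs_of_nonneg h0]; linarith)
        rw [abs_of_nonneg h0] at this
        have := le_abs_self (Real.exp (2/y) - 1)
        linarith

lemma first_num {ε x : ℝ} (hε : 0 < ε) (hε1 : ε ≤ 1) (hx : x ≤ 3 * ε / 50) : (1 + ε / 50) * Real.exp x ≤ 1 + ε / 2 := by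
  have h0 : 0 ≤ 3 * ε / 50 := by positivity
  have := Real.abs_exp_sub_one_le (x := 3 * ε / 50) (by rw [abs_of_nonneg h0]; linarith)
  rw [abs_of_nonneg h0] at this
  have h1 := le_abs_self (Real.exp (3 * ε / 50) - 1)
  have h2 : Real.exp x ≤ 1 + 6 * ε / 50 := by
    have := Real.exp_le_exp.2 hx
    linarith
  have : (1 + ε / 50) * Real.exp x ≤ (1 + ε / 50) * (1 + 6 * ε / 50) := by gcongr
  nlinarith

lemma y2_num {c x L D : ℝ} (hx : x ≠ 0) : (2 * c) * (2 * (x * L) ^ 2) * (D ^ 2 * (x⁻¹) ^ 2) = 4 * c * D ^ 2 * L ^ 2 := by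
  field_simp; ring

set_option maxHeartbeats 1000000 in
/-- regime I sum -/
lemma SI_ev {p : ℝ} (hp : 0 < p) (hp1 : p < 1) {dl : ℝ} (hd0 : 0 ≤ dl) (hd1 : dl < 1)
    (hdl : 1 / (1 - dl) ≤ Real.exp (Real.log (1/(1-p)) / 40)) {ε : ℝ} (hε : 0 < ε) (hε1 : ε ≤ 1) :
    ∀ᶠ L : ℝ in atTop, ∀ (n a k h f : ℕ) (B : ℝ) (c c0 : Fin n → Fin k) (v : Fin k → ℕ),
      (n:ℝ) = Real.exp (Real.log (1/(1-p)) * L) → (a:ℝ) ≤ 2 * L → a ≤ n → k ≤ n → 2 ≤ h → (h:ℝ) ≤ 1.5 * L →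
      (f:ℝ) ≤ n * L → (k:ℝ) ^ 2 / muExp (1-p) n a ≤ ε / 200 →
      B = (((n.choose 2 - 2 * f : ℕ) : ℝ) + 1) / (((n.choose 2 - 2 * f : ℕ) : ℝ) + 1 - mFloor p n) →
      (∀ i, (fib c i).card = v i) → (∀ i, (fib c0 i).card = v i) → (∀ i, v i ≤ a) →
      (∑ i, (v i).choose 2 = f) → ∀ Reg : Finset (Equiv.Perm (Fin n)),
      (∀ τ ∈ Reg, (bsum h c (c0 ∘ τ) : ℝ) ≤ dl * n) →
      ∑ τ ∈ Reg, B ^ (ov c (c0 ∘ τ)) ≤ (n.factorial : ℝ) * ((1 + ε) *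
        Real.exp ((f:ℝ) ^ 2 * ((mFloor p n:ℝ) / ((((n.choose 2 : ℕ):ℝ) - f - mFloor p n + 1) *
          (((n.choose 2 : ℕ):ℝ) - f + 1))))) := by
  have hq : 0 < 1 - p := by linarith
  set β := Real.log (1/(1-p)) with hβd
  have hb1 : 1 < 1/(1-p) := by rw [one_lt_div hq]; linarith
  have hβ : 0 < β := Real.log_pos hb1
  have hbe : (1 - p)⁻¹ = Real.exp β := by
    rw [hβd, Real.exp_log (by positivity), one_div]
  set ζ := Real.exp (β / 40) with hζ
  have hζ1 : 1 ≤ ζ := Real.one_le_exp (by positivity)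
  have hdp : 0 < 1 - dl := by linarith
  have h1dl : 1 ≤ 1 / (1 - dl) := by rw [le_div_iff₀ hdp]; linarith
  set D := ζ * Real.exp 1 / (1 - dl) with hD
  have hζD : ζ / (1 - dl) ≤ D := by
    rw [hD]; gcongr
    exact le_mul_of_one_le_right (by positivity) (Real.one_le_exp zero_le_one)
  have hζD1 : 1 ≤ ζ / (1 - dl) := by
    rw [le_div_iff₀ hdp]; linarith
  have hD1 : 1 ≤ D := hζD1.trans hζD
  have hζX : ζ / (1 - dl) ≤ Real.exp (β / 20) := by
    calc ζ / (1 - dl) = ζ * (1 / (1 - dl)) := by ring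
      _ ≤ ζ * ζ := by gcongr
      _ = _ := by rw [hζ, ← Real.exp_add]; congr 1; ring
  have hε50 : 0 < ε / 50 := by positivity
  filter_upwards [basic_ev hp hp1 hε50, high_ev hβ (le_refl (1:ℝ)) hε50, high_ev hβ hD1 one_pos,
    second_ev hβ (4 * (1-p)⁻¹ * D ^ 2) (half_pos hε), s0_ev hβ hε50, eventually_ge_atTop 1] with
    L hA hH1 hH2 hS hs0 hL n a k h f B c c0 v hn ha han hkn hh2 hhL hf hμ hB hc hc0 hva hfs Reg hReg
  obtain ⟨hN, hf4, hθ1, hθ2, hθ3, hT, _⟩ := hA n f hn hf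
  obtain ⟨hmf, hB1, hB2, _⟩ := B_facts hp hp1 hN hf4 hB
  have hT2 := T2_bound hp hp1 hN hf4 hB
  have hB0 : 0 ≤ B := by linarith
  have hn0 : (0:ℝ) < n := by rw [hn]; positivity
  have hNR : (0:ℝ) < (n.choose 2 : ℕ) := by exact_mod_cast hN
  have hθ0 : 0 ≤ 4 * (f:ℝ) / ((1 - p) * (n.choose 2 : ℕ)) := by positivity
  rw [hbe] at hB2
  have hBpow : ∀ t : ℕ, (t:ℝ) ≤ 4 * L ^ 2 → B ^ t ≤ 2 * Real.exp (β * t) := by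
    intro t ht
    have := B_pow (Real.exp_pos β) hθ0 hB0 hB2 hθ2 t ht
    rwa [← Real.exp_nat_mul, mul_comm (t:ℝ)] at this
  have hBle : B ≤ 2 * (1-p)⁻¹ := by
    have := hBpow 1 (by push_cast; nlinarith)
    rw [hbe]; simpa using this
  set s0 := ⌊Real.exp (0.3 * β * L)⌋₊ with hs0d
  obtain ⟨hs0n, hs0e⟩ := hs0 n s0 hn (Nat.floor_le (Real.exp_pos _).le)
  have hS' := hS s0 (Nat.lt_floor_add_one _).le
  have hμe := mu_eq hp1 n a
  rw [← hβd] at hμe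
  have hh1 := hH1 n a k B 1 (muExp (1-p) n a) (fun _ => 1) hn ha han hkn hB0 hBpow (fun _ => zero_le_one)
    (fun r => by simp) (fun r _ _ => le_rfl) zero_le_one hμe
  set y : ℕ → ℝ := fun r => if h < r then ((ζ / (1 - dl)) / n) ^ r else ((ζ * Real.exp 1 / (1 - dl)) / n) ^ r with hy
  set w : ℕ → ℝ := fun r => if h < r then (ζ / (1 - dl)) ^ r else D ^ r with hw
  have hyw : ∀ r, y r = w r * ((n:ℝ)⁻¹) ^ r := by
    intro r
    simp only [hy, hw, hD, div_eq_mul_inv _ (n:ℝ)]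
    split_ifs <;> rw [mul_pow]
  have hw0 : ∀ r, 0 ≤ w r := by
    intro r; simp only [hw]; split_ifs <;> positivity
  have hwD : ∀ r, w r ≤ D ^ r := by
    intro r; simp only [hw]; split_ifs
    · exact pow_le_pow_left₀ (by positivity) hζD r
    · exact le_rfl
  have hwX : ∀ r, r ≤ a → 1.5 * L < r → w r ≤ Real.exp (β * L / 10) := by
    intro r hra hr
    have hhr : h < r := by
      have : (h:ℝ) < r := by linarith
      exact_mod_cast this
    simp only [hw, if_pos hhr]
    calc (ζ / (1 - dl)) ^ r ≤ Real.exp (β / 20) ^ r := pow_le_pow_left₀ (by positivity) hζX r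
      _ = Real.exp (r * (β / 20)) := by rw [← Real.exp_nat_mul]
      _ ≤ _ := by
          refine Real.exp_le_exp.2 ?_
          have : (r:ℝ) ≤ 2 * L := by
            have : (r:ℝ) ≤ a := by exact_mod_cast hra
            linarith
          have := mul_le_mul_of_nonneg_right this (by positivity : 0 ≤ β / 20)
          linarith
  have hh2' := hH2 n a k B (Real.exp (β * L / 10)) (muExp (1-p) n a) w hn ha han hkn hB0 hBpow hw0
    hwD hwX (Real.exp_pos _).le hμe
  have hreg := regimeI c c0 v hc hc0 a f h s0 hva hfs hB1 dl (ε / 50) ζ hd0 hd1 hs0n hs0e hζ1 Reg hReg y hy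
  refine hreg.trans ?_
  refine mul_le_mul_of_nonneg_left ?_ (by positivity)
  set Rx : ℝ := (f:ℝ) ^ 2 * ((mFloor p n:ℝ) / ((((n.choose 2 : ℕ):ℝ) - f - mFloor p n + 1) *
          (((n.choose 2 : ℕ):ℝ) - f + 1))) with hRx
  have hRx0 : 0 ≤ Rx := by
    have hm : (mFloor p n : ℝ) + 2 * f ≤ (n.choose 2 : ℕ) := by exact_mod_cast hmf
    have h1 : (0:ℝ) ≤ ((n.choose 2 : ℕ):ℝ) - f - mFloor p n + 1 := by
      have : (0:ℝ) ≤ f := by positivity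
      linarith
    have h2 : (0:ℝ) ≤ ((n.choose 2 : ℕ):ℝ) - f + 1 := by
      have : (0:ℝ) ≤ mFloor p n := by positivity
      linarith
    positivity
  have hμ0 : 0 ≤ (k:ℝ) ^ 2 / muExp (1-p) n a := by rw [hμe]; positivity
  have hS1 : k ^ 2 * ∑ r ∈ Icc 3 a, (a.choose r : ℝ) * (a.descFactorial r : ℝ) * B ^ (r.choose 2) * ((n:ℝ)⁻¹) ^ r
      ≤ 2 * ε / 50 := by
    simp only [one_mul] at hh1
    refine hh1.trans ?_
    linarith
  have hS2 : k ^ 2 * ∑ r ∈ Icc 3 a, (a.choose r : ℝ) * (a.descFactorial r : ℝ) * B ^ (r.choose 2) * y r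
      ≤ 1 + 4 * Real.exp (β * L / 10) := by
    simp only [hyw]
    refine hh2'.trans ?_
    have : 4 * Real.exp (β * L / 10) * ((k:ℝ) ^ 2 / muExp (1-p) n a) ≤ 4 * Real.exp (β * L / 10) * 1 := by
      gcongr; linarith
    linarith
  have hy2 : (B - 1) * (2 * (f:ℝ) ^ 2) * y 2 ≤ 4 * (1-p)⁻¹ * D ^ 2 * L ^ 2 := by
    have e : y 2 = D ^ 2 * ((n:ℝ)⁻¹) ^ 2 := by
      rw [hyw]; simp only [hw, if_neg (by omega : ¬ h < 2)]
    rw [e]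
    have e1 : B - 1 ≤ 2 * (1-p)⁻¹ := by linarith
    calc (B - 1) * (2 * (f:ℝ) ^ 2) * (D ^ 2 * ((n:ℝ)⁻¹) ^ 2) ≤
        (2 * (1-p)⁻¹) * (2 * (n * L) ^ 2) * (D ^ 2 * ((n:ℝ)⁻¹) ^ 2) := by gcongr
      _ = _ := y2_num hn0.ne'
  have t1 : (1 + ε / 50) * Real.exp ((B - 1) * (2 * (f:ℝ) ^ 2) * ((n:ℝ)⁻¹) ^ 2 +
        k ^ 2 * ∑ r ∈ Icc 3 a, (a.choose r : ℝ) * (a.descFactorial r : ℝ) * B ^ (r.choose 2) * ((n:ℝ)⁻¹) ^ r) ≤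
      (1 + ε / 2) * Real.exp Rx := by
    calc _ ≤ (1 + ε / 50) * Real.exp (3 * ε / 50 + Rx) := by
          refine mul_le_mul_of_nonneg_left (Real.exp_le_exp.2 ?_) (by positivity)
          linarith
      _ = ((1 + ε / 50) * Real.exp (3 * ε / 50)) * Real.exp Rx := by rw [Real.exp_add]; ring
      _ ≤ _ := mul_le_mul_of_nonneg_right (first_num hε hε1 le_rfl) (Real.exp_pos _).le
  have t2 : (ζ ^ s0)⁻¹ * Real.exp ((B - 1) * (2 * (f:ℝ) ^ 2) * y 2 +
        k ^ 2 * ∑ r ∈ Icc 3 a, (a.choose r : ℝ) * (a.descFactorial r : ℝ) * B ^ (r.choose 2) * y r) ≤ ε / 2 := by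
    refine le_trans ?_ hS'
    have e : (ζ ^ s0)⁻¹ = Real.exp (-(β / 40 * s0)) := by
      rw [hζ, ← Real.exp_nat_mul, ← Real.exp_neg]; congr 1; ring
    rw [e]
    refine mul_le_mul_of_nonneg_left (Real.exp_le_exp.2 ?_) (Real.exp_pos _).le
    linarith
  have hR1 : ε / 2 * 1 ≤ ε / 2 * Real.exp Rx := mul_le_mul_of_nonneg_left (Real.one_le_exp hRx0) (half_pos hε).le
  have hR2 : (1 + ε) * Real.exp Rx = (1 + ε / 2) * Real.exp Rx + ε / 2 * Real.exp Rx := by ring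
  rw [hR2]
  exact add_le_add t1 (t2.trans (by linarith))

end TC

end PartI7

section PartI8

namespace TC
open Finset
variable {n k m : ℕ}

lemma Qp_all {p : ℝ} (hp : 0 < p) (hp1 : p < 1) {ξ C L δ : ℝ} (hξ : ξ ≤ 1) (hL : 0 < L) {a : ℕ} {P j : ℕ → ℕ} {w : ℕ → ℝ}
    (hSZ : SZ (Real.log (1/(1-p))) ξ C L n a P j w)
    (hZ : ∏ u ∈ Icc 1 n, (((P u).factorial : ℝ) * ((1/(1-p)) ^ (u.choose 2) * (u.factorial : ℝ)) ^ (P u)) ≤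
      2 * (n.factorial : ℝ)) {M0 : ℕ} (hM0 : 0 < M0) {T : ℝ} (hT : T ≤ M0) (hδ0 : 0 < δ)
    (hδ : 2 * (2 + 3/2 * Real.log (1/(1-p)) + Real.log (1/(1-p)) * C / 2) ≤ Real.log (1/δ))
    (hsub : ∀ l : ℕ → ℕ, (∀ u, l u ≤ P u) → δ ≤ (∑ u ∈ Icc 1 a, (u : ℝ) * l u) / n →
      (∑ u ∈ Icc 1 a, (u : ℝ) * l u) / n ≤ 1 - δ →
      Real.exp T * ∏ u ∈ Icc 1 a, ((P u).choose (l u) : ℝ) ^ 2 ≤ Ep n p fun G => Xbar G l)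
    (l : ℕ → ℕ) (hl : ∀ u, l u ≤ P u) (h1 : δ * n ≤ (∑ u ∈ Icc 1 n, u * l u : ℕ))
    (h2 : ∑ u ∈ Icc 1 n, u * l u + M0 ≤ n) :
    Qp n (1/(1-p)) P l ≤ 2 * (n.factorial : ℝ) * Real.exp (-T) := by
  have hq : 0 < 1 - p := by linarith
  have hb1 : 1 < 1/(1-p) := by rw [one_lt_div hq]; linarith
  have hβ : 0 < Real.log (1/(1-p)) := Real.log_pos hb1
  have hbe : Real.exp (Real.log (1/(1-p))) = 1/(1-p) := Real.exp_log (by positivity)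
  have hn0 : (0:ℝ) < n := by rw [hSZ.hn]; positivity
  have hPa : ∀ u, a < u → P u = 0 := by
    intro u hu
    by_contra hne
    have := (hSZ.hi u (Nat.pos_of_ne_zero hne)).2
    omega
  rcases le_or_gt ((1 - δ) * n) ((∑ u ∈ Icc 1 n, u * l u : ℕ) : ℝ) with hc | hc
  · have := Qp_near hβ hξ hL hSZ hl (by rw [hbe]; exact hZ) hM0 h2 hδ0 hδ hc
    rw [hbe] at this
    refine this.trans ?_
    refine mul_le_mul_of_nonneg_left (Real.exp_le_exp.2 (by linarith)) (by positivity)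
  · have hsum : ∑ u ∈ Icc 1 a, (u : ℝ) * l u = ((∑ u ∈ Icc 1 n, u * l u : ℕ) : ℝ) := by
      push_cast
      refine sum_subset (Icc_subset_Icc_right hSZ.han) fun u hu hu' => ?_
      have hu2 : a < u := by rw [mem_Icc] at hu hu'; omega
      have := hl u
      rw [hPa u hu2] at this
      rw [Nat.le_zero.1 this]; simp
    have h3 := hsub l hl (by rw [hsum, le_div_iff₀ hn0]; exact h1) (by rw [hsum, div_le_iff₀ hn0]; exact hc.le)
    have := Qp_mid hp hp1 hSZ.han hl hSZ.hPz hPa h3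
    refine this.trans ?_
    have : 0 ≤ (n.factorial : ℝ) * Real.exp (-T) := by positivity
    linarith

lemma prod_P_le {β L : ℝ} {a : ℕ} {P : ℕ → ℕ} (hβ : 0 < β) (hL : 0 ≤ L) (hn : (n:ℝ) = Real.exp (β * L)) (hn1 : 2 ≤ n) (ha : (a:ℝ) ≤ 2 * L) (han : a ≤ n)
    (hPa : ∀ u, a < u → P u = 0) (hPn : ∀ u ∈ Icc 1 n, P u ≤ n) :
    ∏ u ∈ Icc 1 n, ((P u : ℝ) + 1) ≤ Real.exp (4 * β * L ^ 2) := by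
  have e : ∏ u ∈ Icc 1 n, ((P u : ℝ) + 1) = ∏ u ∈ Icc 1 a, ((P u : ℝ) + 1) := by
    symm
    refine prod_subset (Icc_subset_Icc_right han) fun u hu hu' => ?_
    have hu2 : a < u := by rw [mem_Icc] at hu hu'; omega
    simp [hPa u hu2]
  rw [e]
  have hnR : (2:ℝ) ≤ n := by exact_mod_cast hn1
  calc ∏ u ∈ Icc 1 a, ((P u : ℝ) + 1) ≤ ∏ u ∈ Icc 1 a, Real.exp (2 * β * L) := by
        refine prod_le_prod (fun u _ => by positivity) fun u hu => ?_
        have h1 : (P u : ℝ) ≤ n := by exact_mod_cast hPn u (Icc_subset_Icc_right han hu)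
        have h2 : Real.exp (2 * β * L) = n * n := by rw [hn, ← Real.exp_add]; congr 1; ring
        rw [h2]; nlinarith
    _ = Real.exp (a * (2 * β * L)) := by rw [prod_const, ← Real.exp_nat_mul]; simp
    _ ≤ _ := by
        refine Real.exp_le_exp.2 ?_
        have := mul_le_mul_of_nonneg_right ha (by positivity : 0 ≤ 2 * β * L)
        nlinarith

lemma final_exp {β A1 A2 A3 A4 ε : ℝ} (hβ : 0 < β) (hε : 0 < ε) :
    ∀ᶠ L : ℝ in atTop, 2 * Real.exp (A1 * L ^ 5 + A2 * L ^ 4 + A3 * L ^ 2 + A4 * L ^ 2 - (β * L) ^ 6) ≤ ε := by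
  have h : ∀ᶠ L : ℝ in atTop, (|A1| + |A2| + |A3| + |A4| + |Real.log (ε / 2)|) ≤ β ^ 6 * L := by
    exact (tendsto_id.const_mul_atTop (by positivity)).eventually_ge_atTop _
  filter_upwards [h, eventually_ge_atTop 1] with L h hL
  have hL5 : 1 ≤ L ^ 5 := one_le_pow₀ hL
  have e : Real.exp (A1 * L ^ 5 + A2 * L ^ 4 + A3 * L ^ 2 + A4 * L ^ 2 - (β * L) ^ 6) ≤ ε / 2 := by
    rw [← Real.le_log_iff_exp_le (by positivity)]
    have f1 : A1 * L ^ 5 ≤ |A1| * L ^ 5 := by gcongr; exact le_abs_self _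
    have f2 : A2 * L ^ 4 ≤ |A2| * L ^ 5 :=
      mul_le_mul (le_abs_self _) (pow_le_pow_right₀ hL (by norm_num)) (by positivity) (abs_nonneg _)
    have f3 : A3 * L ^ 2 ≤ |A3| * L ^ 5 :=
      mul_le_mul (le_abs_self _) (pow_le_pow_right₀ hL (by norm_num)) (by positivity) (abs_nonneg _)
    have f4 : A4 * L ^ 2 ≤ |A4| * L ^ 5 :=
      mul_le_mul (le_abs_self _) (pow_le_pow_right₀ hL (by norm_num)) (by positivity) (abs_nonneg _)
    have f5 : -Real.log (ε / 2) ≤ |Real.log (ε / 2)| * L ^ 5 :=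
      (neg_le_abs _).trans (le_mul_of_one_le_right (abs_nonneg _) hL5)
    have f6 : (|A1| + |A2| + |A3| + |A4| + |Real.log (ε / 2)|) * L ^ 5 ≤ β ^ 6 * L * L ^ 5 := by gcongr
    have f7 : β ^ 6 * L * L ^ 5 = (β * L) ^ 6 := by ring
    linarith
  linarith

set_option maxHeartbeats 1000000 in
/-- regime II sum -/
lemma SII_ev {p : ℝ} (hp : 0 < p) (hp1 : p < 1) {C δ : ℝ} (hδ0 : 0 < δ)
    (hδ : 2 * (2 + 3/2 * Real.log (1/(1-p)) + Real.log (1/(1-p)) * C / 2) ≤ Real.log (1/δ))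
    {ε : ℝ} (hε : 0 < ε) :
    ∀ᶠ L : ℝ in atTop, ∀ (n a k h f s1 Λ : ℕ) (B ξ : ℝ) (P j : ℕ → ℕ) (w : ℕ → ℝ) (c c0 : Fin n → Fin k) (v : Fin k → ℕ),
      ξ ≤ 1 → SZ (Real.log (1/(1-p))) ξ C L n a P j w → 1 ≤ h → (h:ℝ) ≤ L / 8 →
      (f:ℝ) ≤ n * L → (∑ u ∈ Icc 1 n, P u * u.choose 2 = f) → Real.exp (Real.log (1/(1-p)) * L / 2) ≤ s1 + 1 →
      (Λ:ℝ) ≤ 4 * L ^ 3 →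
      B = (((n.choose 2 - 2 * f : ℕ) : ℝ) + 1) / (((n.choose 2 - 2 * f : ℕ) : ℝ) + 1 - mFloor p n) →
      (∀ i, (fib c i).card = v i) → (∀ i, (fib c0 i).card = v i) → (∀ i, v i ≤ a) → (∀ i, v i ∈ Icc 1 n) →
      (∀ u, (univ.filter fun i => v i = u).card = P u) → (∑ i, v i = n) →
      (∏ u ∈ Icc 1 n, (((P u).factorial : ℝ) * ((1/(1-p)) ^ (u.choose 2) * (u.factorial : ℝ)) ^ (P u)) ≤
        2 * (n.factorial : ℝ)) →
      (∀ l : ℕ → ℕ, (∀ u, l u ≤ P u) → δ ≤ (∑ u ∈ Icc 1 a, (u : ℝ) * l u) / n →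
        (∑ u ∈ Icc 1 a, (u : ℝ) * l u) / n ≤ 1 - δ →
        Real.exp ((Real.log n) ^ 6) * ∏ u ∈ Icc 1 a, ((P u).choose (l u) : ℝ) ^ 2 ≤ Ep n p fun G => Xbar G l) →
      ∀ Reg : Finset (Equiv.Perm (Fin n)), (∀ τ ∈ Reg, δ * n ≤ (sE v (exE c (c0 ∘ τ)) : ℝ) ∧
        sE v (exE c (c0 ∘ τ)) + s1 ≤ n ∧ (inx h c (c0 ∘ τ)).card ≤ Λ) →
      ∑ τ ∈ Reg, B ^ (ov c (c0 ∘ τ)) ≤ ε * (n.factorial : ℝ) := by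
  have hq : 0 < 1 - p := by linarith
  set β := Real.log (1/(1-p)) with hβd
  have hb1 : 1 < 1/(1-p) := by rw [one_lt_div hq]; linarith
  have hβ : 0 < β := Real.log_pos hb1
  have hbe : (1 - p)⁻¹ = Real.exp β := by
    rw [hβd, Real.exp_log (by positivity), one_div]
  have hb0 : 0 < (1-p)⁻¹ := by positivity
  have hc2 : 0 < β / 2 := by positivity
  have hc3 : 0 < β * 3 / 8 := by positivity
  filter_upwards [basic_ev hp hp1 one_pos, ev_lin hc2 (2 * β ^ 6) 6, ev_lin hc2 4 0, ev_lin hc3 (48 * Real.exp 1) 2,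
    final_exp (A1 := (Real.log 2 + β) * 16) (A2 := 64 * Real.exp 1 ^ 2 * (1-p)⁻¹) (A3 := 4 * β) (A4 := 16 / (1 - p)) hβ hε,
    eventually_ge_atTop 1] with
    L hA hs hs4 hx hfin hL n a k h f s1 Λ B ξ P j w c c0 v hξ hSZ hh1 hhL hf hfP hs1 hΛ hB hc hc0 hva hvn hvP hsum hZ hsub Reg hReg
  have hn := hSZ.hn
  obtain ⟨hN, hf4, hθ1, hθ2, hθ3, hT, _⟩ := hA n f hn hf
  obtain ⟨hmf, hB1, hB2, _⟩ := B_facts hp hp1 hN hf4 hB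
  have hB0 : 0 ≤ B := by linarith
  have hn0 : (0:ℝ) < n := by rw [hn]; positivity
  have hNR : (0:ℝ) < (n.choose 2 : ℕ) := by exact_mod_cast hN
  have hn2 : 2 ≤ n := by
    by_contra hlt
    push Not at hlt
    rw [Nat.choose_eq_zero_of_lt hlt] at hN
    exact lt_irrefl _ hN
  set θ := 4 * (f:ℝ) / ((1 - p) * (n.choose 2 : ℕ)) with hθ
  have hθ0 : 0 ≤ θ := by positivity
  have hBpow : ∀ t : ℕ, (t:ℝ) ≤ 4 * L ^ 2 → B ^ t ≤ 2 * Real.exp (β * t) := by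
    intro t ht
    have := B_pow hb0 hθ0 hB0 hB2 hθ2 t ht
    rwa [hbe, ← Real.exp_nat_mul, mul_comm (t:ℝ)] at this
  have hBle : B ≤ 2 * (1-p)⁻¹ := by
    have := hBpow 1 (by push_cast; nlinarith)
    rw [hbe]; simpa using this
  have ha := hSZ.ha
  have hlogn : Real.log n = β * L := by rw [hn, Real.log_exp]
  have eh : β / 2 * L = β * L / 2 := by ring
  rw [eh] at hs hs4
  rw [pow_zero, mul_one] at hs4
  set X := Real.exp (β * L / 2) with hX
  have hs1X : X / 2 ≤ s1 := by linarith
  have hs1p : 0 < s1 := by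
    have : (0:ℝ) < s1 := by linarith
    exact_mod_cast this
  have hTs : (Real.log n) ^ 6 ≤ s1 := by
    rw [hlogn]
    have : (β * L) ^ 6 = (2 * β ^ 6 * L ^ 6) / 2 := by ring
    linarith
  have hPa : ∀ u, a < u → P u = 0 := by
    intro u hu
    by_contra hne
    have := (hSZ.hi u (Nat.pos_of_ne_zero hne)).2
    omega
  have hPn : ∀ u ∈ Icc 1 n, P u ≤ n := by
    intro u hu
    have h1 : u * P u ≤ n := by
      conv_rhs => rw [← hSZ.hsum]
      exact single_le_sum (f := fun u => u * P u) (fun _ _ => Nat.zero_le _) hu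
    exact (Nat.le_mul_of_pos_left _ (mem_Icc.1 hu).1).trans h1
  set K : ℝ := Real.exp (16 / (1 - p) * L ^ 2) * (2 * (n.factorial : ℝ) * Real.exp (-(β * L) ^ 6)) with hK
  have hQ : ∀ l : ℕ → ℕ, (∀ u, l u ≤ P u) → δ * n ≤ (∑ u ∈ Icc 1 n, u * l u : ℕ) →
      ∑ u ∈ Icc 1 n, u * l u + s1 ≤ n → Qp n B P l ≤ K := by
    intro l hl g1 g2
    have h1 := Qp_all hp hp1 hξ (by linarith) hSZ hZ hs1p hTs hδ0 hδ hsub l hl g1 g2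
    rw [hlogn] at h1
    have h2 := Qp_change (n := n) (b := 1/(1-p)) (by positivity) hB0 hθ0 (by rw [one_div]; exact hB2) hl hfP
    refine h2.trans ?_
    rw [hK]
    refine mul_le_mul (Real.exp_le_exp.2 hθ3) h1 ?_ (Real.exp_pos _).le
    rw [Qp]; positivity
  have hhB : (a:ℝ) ^ 2 * Real.exp 1 * B ^ h ≤ (s1:ℝ) / 2 := by
    have g1 : B ^ h ≤ 2 * Real.exp (β * L / 8) := by
      refine (hBpow h (by nlinarith)).trans ?_
      refine mul_le_mul_of_nonneg_left (Real.exp_le_exp.2 ?_) zero_le_two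
      have := mul_le_mul_of_nonneg_left hhL hβ.le
      linarith
    have g2 : (48 * Real.exp 1 * L ^ 2) * Real.exp (β * L / 8) ≤ X := by
      have : X = Real.exp (β * 3 / 8 * L) * Real.exp (β * L / 8) := by
        rw [hX, ← Real.exp_add]; congr 1; ring
      rw [this]
      gcongr
    calc (a:ℝ) ^ 2 * Real.exp 1 * B ^ h ≤ (2 * L) ^ 2 * Real.exp 1 * (2 * Real.exp (β * L / 8)) := by gcongr
      _ = (48 * Real.exp 1 * L ^ 2) * Real.exp (β * L / 8) / 6 := by ring
      _ ≤ X / 6 := by gcongr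
      _ ≤ _ := by
          have : 0 < X := Real.exp_pos _
          linarith
  have hII := regimeII hB1 h a Λ c c0 v hc hc0 hva hvn hvP hsum hh1 s1 hs1p (δ * n) hhB K (by rw [hK]; positivity) hQ Reg hReg
  refine hII.trans ?_
  have k1 : B ^ (a * a * Λ) ≤ Real.exp ((Real.log 2 + β) * 16 * L ^ 5) := by
    calc B ^ (a * a * Λ) ≤ (2 * (1-p)⁻¹) ^ (a * a * Λ) := pow_le_pow_left₀ hB0 hBle _
      _ = Real.exp ((a * a * Λ : ℕ) * (Real.log 2 + β)) := by
          rw [Real.exp_nat_mul, Real.exp_add, Real.exp_log two_pos, hbe]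
      _ ≤ _ := by
          refine Real.exp_le_exp.2 ?_
          have hl2 : 0 ≤ Real.log 2 + β := by
            have := Real.log_pos (by norm_num : (1:ℝ) < 2)
            linarith
          push_cast
          calc (a:ℝ) * a * Λ * (Real.log 2 + β) ≤ (2 * L) * (2 * L) * (4 * L ^ 3) * (Real.log 2 + β) := by gcongr
            _ = _ := by ring
  have k2 : Real.exp (2 * ((a:ℝ) ^ 2 * Real.exp 1) ^ 2 * B) ≤ Real.exp (64 * Real.exp 1 ^ 2 * (1-p)⁻¹ * L ^ 4) := by
    refine Real.exp_le_exp.2 ?_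
    calc 2 * ((a:ℝ) ^ 2 * Real.exp 1) ^ 2 * B ≤ 2 * ((2 * L) ^ 2 * Real.exp 1) ^ 2 * (2 * (1-p)⁻¹) := by gcongr
      _ = _ := by ring
  have k3 := prod_P_le hβ (by linarith) hn hn2 ha hSZ.han hPa hPn
  have hK0 : 0 ≤ K := by rw [hK]; positivity
  have hfac : (0:ℝ) ≤ n.factorial := by positivity
  calc _ ≤ Real.exp ((Real.log 2 + β) * 16 * L ^ 5) * (Real.exp (64 * Real.exp 1 ^ 2 * (1-p)⁻¹ * L ^ 4) *
        (Real.exp (4 * β * L ^ 2) * K)) := by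
        refine mul_le_mul k1 ?_ ?_ (Real.exp_pos _).le
        · refine mul_le_mul k2 ?_ ?_ (Real.exp_pos _).le
          · exact mul_le_mul_of_nonneg_right k3 hK0
          · exact mul_nonneg (prod_nonneg fun u _ => by positivity) hK0
        · exact mul_nonneg (Real.exp_pos _).le (mul_nonneg (prod_nonneg fun u _ => by positivity) hK0)
    _ = (2 * Real.exp ((Real.log 2 + β) * 16 * L ^ 5 + 64 * Real.exp 1 ^ 2 * (1-p)⁻¹ * L ^ 4 + 4 * β * L ^ 2 +
          16 / (1 - p) * L ^ 2 - (β * L) ^ 6)) * n.factorial := by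
        rw [hK, Real.exp_sub, Real.exp_add, Real.exp_add, Real.exp_add, Real.exp_neg]; ring
    _ ≤ _ := mul_le_mul_of_nonneg_right hfin hfac

end TC

end PartI8

section PartI9

namespace TC
open Finset
variable {n k m : ℕ}

lemma good_X {P : ℕ → ℕ} (v : Fin (profileParts n P) → ℕ) (hv : Antitone v)
    (hvP : ∀ u, (univ.filter fun i => v i = u).card = P u) (c : Fin n → Fin (profileParts n P))
    (hc : ∀ i, (fib c i).card = v i) {ω : Finset (Sym2 (Fin n))} (hω : Disjoint ω (mono c)) :
    0 < Xprofile (toG ω) P := by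
  rw [Xprofile, Set.ncard_pos (Set.toFinite _)]
  refine ⟨fun i => fib c i, fun i j hij => fib_disj c hij, fun i j hij => ?_, fun u => ?_, fun i => ?_⟩
  · simp only [hc]; exact hv hij
  · simp only [hc]; exact hvP u
  · intro x hx y hy hadj
    obtain ⟨h1, h2⟩ := (toG_adj x y).1 hadj
    exact Finset.disjoint_left.1 hω h1 (mem_mono.2 ⟨by rw [mem_fib.1 hx, mem_fib.1 hy], h2⟩)

lemma Em_use {P : ℕ → ℕ} (v : Fin (profileParts n P) → ℕ) (hv : Antitone v)
    (hvP : ∀ u, (univ.filter fun i => v i = u).card = P u) (hs : ∑ i, v i = n) {f : ℕ}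
    (hf : ∑ i, (v i).choose 2 = f) (hMN : 0 < (n.choose 2).choose m) {T : ℝ}
    (hT : T ≤ Em n m (fun G => Xbar G P)) :
    T * ((n.choose 2).choose m : ℝ) * ((∏ i, ((v i).factorial : ℝ)) * ∏ u ∈ Icc 1 n, ((P u).factorial : ℝ)) ≤
      (n.factorial : ℝ) * ((n.choose 2 - f).choose m : ℝ) := by
  have h := hT.trans (Em_le v hv hvP)
  rw [hs, hf, Nat.sub_self, Nat.factorial_zero, Nat.cast_one, mul_one] at h
  have a1 : 0 < ∏ i, ((v i).factorial : ℝ) := prod_pos fun i _ => by positivity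
  have a2 : 0 < ∏ u ∈ Icc 1 n, ((P u).factorial : ℝ) := prod_pos fun i _ => by positivity
  have a3 : (0:ℝ) < ((n.choose 2).choose m : ℝ) := by exact_mod_cast hMN
  rw [le_div_iff₀ a2, le_div_iff₀ a3, div_mul_eq_mul_div, le_div_iff₀ a1] at h
  linarith

lemma hZ_of {p : ℝ} (hp : 0 < p) (hp1 : p < 1) {P : ℕ → ℕ} (hPz : ∀ u, u ∉ Icc 1 n → P u = 0)
    (v : Fin (profileParts n P) → ℕ) (hv : Antitone v)
    (hvP : ∀ u, (univ.filter fun i => v i = u).card = P u) (hs : ∑ i, v i = n) {f : ℕ}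
    (hf : ∑ i, (v i).choose 2 = f) (hN : 0 < n.choose 2) (hmN : mFloor p n ≤ n.choose 2)
    (hf4 : 4 * (f:ℝ) ≤ (1 - p) * (n.choose 2 : ℕ))
    (hT : 1 ≤ Em n (mFloor p n) (fun G => Xbar G P)) :
    ∏ u ∈ Icc 1 n, (((P u).factorial : ℝ) * ((1/(1-p)) ^ (u.choose 2) * (u.factorial : ℝ)) ^ (P u)) ≤
        2 * (n.factorial : ℝ) := by
  have hq : 0 < 1 - p := by linarith
  have hMN : 0 < (n.choose 2).choose (mFloor p n) := Nat.choose_pos hmN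
  have a3 : (0:ℝ) < ((n.choose 2).choose (mFloor p n) : ℝ) := by exact_mod_cast hMN
  have h1 := Em_use v hv hvP hs hf hMN hT
  have hfN : f ≤ n.choose 2 := by
    have hNR : (0:ℝ) < (n.choose 2 : ℕ) := by exact_mod_cast hN
    have : (f:ℝ) ≤ (n.choose 2 : ℕ) := by nlinarith [(Nat.cast_nonneg f : (0:ℝ) ≤ f)]
    exact_mod_cast this
  have h2 := choose_down (n.choose 2) (mFloor p n) hN hmN f (n.choose 2) le_rfl hfN
  have h3 := qhat_pow hp hp1 hN f (by linarith [(Nat.cast_nonneg f : (0:ℝ) ≤ f)])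
  set A := ∏ i, ((v i).factorial : ℝ)
  set D := ∏ u ∈ Icc 1 n, ((P u).factorial : ℝ)
  set CN := ((n.choose 2).choose (mFloor p n) : ℝ)
  have h4 : A * D ≤ 2 * n.factorial * (1 - p) ^ f := by
    have : CN * (A * D) ≤ CN * (2 * n.factorial * (1 - p) ^ f) := by
      calc CN * (A * D) = 1 * CN * (A * D) := by ring
        _ ≤ _ := h1
        _ ≤ n.factorial * (CN * (2 * (1 - p) ^ f)) := by
          refine mul_le_mul_of_nonneg_left (h2.trans ?_) (by positivity)
          exact mul_le_mul_of_nonneg_left h3 a3.le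
        _ = _ := by ring
    exact le_of_mul_le_mul_left this a3
  have e1 : ∏ u ∈ Icc 1 n, (((P u).factorial : ℝ) * ((1/(1-p)) ^ (u.choose 2) * (u.factorial : ℝ)) ^ (P u)) =
      D * ((1/(1-p)) ^ f * A) := by
    rw [prod_mul_distrib, ← prod_parts hPz v hvP (fun u => (1/(1-p)) ^ (u.choose 2) * (u.factorial : ℝ)),
      prod_mul_distrib, prod_pow_eq_pow_sum, hf]
  rw [e1]
  have e2 : (1/(1-p)) ^ f * (1 - p) ^ f = 1 := by
    rw [← mul_pow, one_div, inv_mul_cancel₀ hq.ne', one_pow]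
  calc D * ((1/(1-p)) ^ f * A) = (1/(1-p)) ^ f * (A * D) := by ring
    _ ≤ (1/(1-p)) ^ f * (2 * n.factorial * (1 - p) ^ f) := by
        refine mul_le_mul_of_nonneg_left h4 (by positivity)
    _ = 2 * n.factorial * ((1/(1-p)) ^ f * (1 - p) ^ f) := by ring
    _ = _ := by rw [e2, mul_one]

/-- the two first-moment bounds on lists -/
lemma e34 {p : ℝ} (hp : 0 < p) (hp1 : p < 1) {C η L : ℝ} (hC : 0 ≤ C) (hη : 0 < η) (hL : 1 ≤ L)
    (hLC : 6 * C / ((1 - p) * η) ≤ L) {a lam lam' : ℕ} (v : Fin k → ℕ) (hN : 0 < n.choose 2)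
    (ha4 : 4 * (a:ℝ) ≤ (1 - p) * (n.choose 2 : ℕ)) (hva : ∀ i, v i ≤ a) (hv1 : ∀ i, 1 ≤ v i)
    (ha : (a:ℝ) ≤ 2 * L) (hn0 : (0:ℝ) < n)
    (hsum : ∑ i, Real.exp (-(Real.log (1/(1-p)) * v i)) ≤ C * L / n)
    (hlam : 2 * C / η * L ≤ lam) (hlam' : L ^ 3 ≤ lam') :
    (n * ((a:ℝ) + 1) * ∑ i, (1 - (mFloor p n : ℝ) / (n.choose 2 : ℕ)) ^ (v i - 1)) / ((lam':ℝ) + 1) ≤ η ∧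
    (n * ∑ i, (1 - (mFloor p n : ℝ) / (n.choose 2 : ℕ)) ^ (v i)) / ((lam:ℝ) + 1) ≤ η := by
  have hq : 0 < 1 - p := by linarith
  set q := 1 - (mFloor p n : ℝ) / (n.choose 2 : ℕ) with hqd
  have hex : ∀ t : ℕ, (1 - p) ^ t = Real.exp (-(Real.log (1/(1-p)) * t)) := by
    intro t
    rw [one_div, Real.log_inv, neg_mul, neg_neg, mul_comm, Real.exp_nat_mul, Real.exp_log hq]
  have hb : ∀ i, ∀ t, t ≤ v i → q ^ t ≤ 2 * (1 - p) ^ t := by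
    intro i t ht
    refine qhat_pow hp hp1 hN t ?_
    have h1 : (t:ℝ) ≤ a := by exact_mod_cast ht.trans (hva i)
    linarith [(Nat.cast_nonneg a : (0:ℝ) ≤ a)]
  have s4 : ∑ i, q ^ (v i) ≤ 2 * (C * L / n) := by
    calc ∑ i, q ^ (v i) ≤ ∑ i, 2 * Real.exp (-(Real.log (1/(1-p)) * v i)) :=
          sum_le_sum fun i _ => by rw [← hex]; exact hb i _ le_rfl
      _ = 2 * ∑ i, Real.exp (-(Real.log (1/(1-p)) * v i)) := by rw [mul_sum]
      _ ≤ _ := by linarith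
  have s3 : ∑ i, q ^ (v i - 1) ≤ 2 / (1 - p) * (C * L / n) := by
    calc ∑ i, q ^ (v i - 1) ≤ ∑ i, 2 / (1 - p) * Real.exp (-(Real.log (1/(1-p)) * v i)) := by
          refine sum_le_sum fun i _ => ?_
          refine (hb i _ (Nat.sub_le _ _)).trans (le_of_eq ?_)
          rw [← hex]
          obtain ⟨t, ht⟩ := Nat.exists_eq_add_of_le (hv1 i)
          rw [ht, Nat.add_sub_cancel_left, pow_add, pow_one]
          field_simp
      _ = 2 / (1 - p) * ∑ i, Real.exp (-(Real.log (1/(1-p)) * v i)) := by rw [mul_sum]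
      _ ≤ _ := mul_le_mul_of_nonneg_left hsum (by positivity)
  constructor
  · rw [div_le_iff₀ (by positivity)]
    have h6 : 6 * C ≤ L * ((1 - p) * η) := (div_le_iff₀ (by positivity)).1 hLC
    calc n * ((a:ℝ) + 1) * ∑ i, q ^ (v i - 1) ≤ n * (3 * L) * (2 / (1 - p) * (C * L / n)) := by
          refine mul_le_mul ?_ s3 ?_ (by positivity)
          · exact mul_le_mul_of_nonneg_left (by linarith) hn0.le
          · exact sum_nonneg fun i _ => pow_nonneg (qhat_nonneg hp hp1 hN) _
      _ = (6 * C) * L ^ 2 / (1 - p) := by field_simp; ring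
      _ ≤ (L * ((1 - p) * η)) * L ^ 2 / (1 - p) := by gcongr
      _ = η * L ^ 3 := by field_simp
      _ ≤ _ := mul_le_mul_of_nonneg_left (by linarith) hη.le
  · rw [div_le_iff₀ (by positivity)]
    calc n * ∑ i, q ^ (v i) ≤ n * (2 * (C * L / n)) := mul_le_mul_of_nonneg_left s4 hn0.le
      _ = η * (2 * C / η * L) := by field_simp
      _ ≤ _ := mul_le_mul_of_nonneg_left (by linarith) hη.le

/-- numerical combination of the three contributions -/
lemma total_bound {N f m : ℕ} (hmf : m + 2 * f ≤ N) {F PV T ε : ℝ} {lam : ℕ} (hF : 0 ≤ F) (hε : 0 < ε)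
    (hPV : 0 ≤ PV) (hT : T * (N.choose m : ℝ) * PV ≤ F * ((N - f).choose m : ℝ)) (hlam : (2:ℝ) ^ lam ≤ ε * T) :
    ((N - 2 * f).choose m : ℝ) * (F * ((1 + ε) * Real.exp ((f:ℝ) ^ 2 * ((m:ℝ) / (((N:ℝ) - f - m + 1) *
      ((N:ℝ) - f + 1))))) + ε * F) + ((N - f).choose m : ℝ) * (2 ^ lam * PV) ≤
    (1 + 3 * ε) * F * ((N - f).choose m : ℝ) ^ 2 / (N.choose m : ℝ) := by
  have hC : (0:ℝ) < (N.choose m : ℝ) := by exact_mod_cast Nat.choose_pos (by omega : m ≤ N)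
  have h0 := R0_bound N f m hmf
  set x := (f:ℝ) ^ 2 * ((m:ℝ) / (((N:ℝ) - f - m + 1) * ((N:ℝ) - f + 1))) with hx
  have hx0 : 0 ≤ x := by
    have : (m:ℝ) + 2 * f ≤ N := by exact_mod_cast hmf
    have g1 : 0 ≤ (N:ℝ) - f - m + 1 := by linarith [(Nat.cast_nonneg f : (0:ℝ) ≤ f)]
    have g2 : 0 ≤ (N:ℝ) - f + 1 := by linarith [(Nat.cast_nonneg m : (0:ℝ) ≤ m)]
    positivity
  have hE : 1 ≤ Real.exp x := Real.one_le_exp hx0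
  set M := ((N - f).choose m : ℝ)
  set CN := (N.choose m : ℝ)
  set Q := ((N - 2 * f).choose m : ℝ)
  have hQ0 : 0 ≤ Q := by positivity
  have hM0 : 0 ≤ M := by positivity
  have h1 : Q * CN * Real.exp x ≤ M ^ 2 := by
    calc Q * CN * Real.exp x ≤ M ^ 2 * Real.exp (-x) * Real.exp x :=
          mul_le_mul_of_nonneg_right h0 (Real.exp_pos _).le
      _ = M ^ 2 := by rw [mul_assoc, ← Real.exp_add]; simp
  have h2 : Q * CN ≤ M ^ 2 := (le_mul_of_one_le_right (by positivity) hE).trans h1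
  rw [le_div_iff₀ hC]
  have h3 : (2:ℝ) ^ lam * (CN * PV) ≤ ε * (F * M) := by
    calc (2:ℝ) ^ lam * (CN * PV) ≤ ε * T * (CN * PV) := mul_le_mul_of_nonneg_right hlam (by positivity)
      _ = ε * (T * CN * PV) := by ring
      _ ≤ _ := mul_le_mul_of_nonneg_left hT hε.le
  calc (Q * (F * ((1 + ε) * Real.exp x) + ε * F) + M * (2 ^ lam * PV)) * CN
      = F * (1 + ε) * (Q * CN * Real.exp x) + ε * F * (Q * CN) + M * (2 ^ lam * (CN * PV)) := by ring
    _ ≤ F * (1 + ε) * M ^ 2 + ε * F * M ^ 2 + M * (ε * (F * M)) := by gcongr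
    _ = _ := by ring

lemma lam_ev {K ε : ℝ} (hK : 0 ≤ K) (hε : 0 < ε) :
    ∀ᶠ L : ℝ in atTop, (2:ℝ) ^ ⌈K * L⌉₊ ≤ ε * Real.exp ((K + 1) * L) := by
  filter_upwards [ev_lin one_pos (Real.exp 1 / ε) 0, eventually_ge_atTop 0] with L h hL
  have h1 : (⌈K * L⌉₊ : ℝ) ≤ K * L + 1 := (Nat.ceil_lt_add_one (by positivity)).le
  have h2 : Real.exp 1 ≤ ε * Real.exp L := by
    rw [pow_zero, mul_one, one_mul, div_le_iff₀ hε] at h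
    linarith
  calc (2:ℝ) ^ ⌈K * L⌉₊ ≤ (Real.exp 1) ^ ⌈K * L⌉₊ :=
        pow_le_pow_left₀ (by norm_num) (by linarith [Real.add_one_le_exp (1:ℝ)]) _
    _ = Real.exp (⌈K * L⌉₊ : ℝ) := by rw [← Real.exp_nat_mul, mul_one]
    _ ≤ Real.exp (K * L + 1) := Real.exp_le_exp.2 h1
    _ = Real.exp (K * L) * Real.exp 1 := Real.exp_add _ _
    _ ≤ Real.exp (K * L) * (ε * Real.exp L) := by gcongr
    _ = ε * Real.exp ((K + 1) * L) := by rw [add_mul, one_mul, Real.exp_add]; ring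

lemma exists_delta {β W : ℝ} (hβ : 0 < β) :
    ∃ δ : ℝ, 0 < δ ∧ 2 * δ < 1 ∧ 1 / (1 - 2 * δ) ≤ Real.exp (β / 40) ∧ W ≤ Real.log (1/δ) := by
  have h1 : Real.exp (-(β / 40)) < 1 := by rw [Real.exp_lt_one_iff]; linarith
  have h0 : 0 < Real.exp (-(β / 40)) := Real.exp_pos _
  have hpos : 0 < min ((1 - Real.exp (-(β / 40))) / 2) (Real.exp (-W)) :=
    lt_min (by linarith) (Real.exp_pos _)
  have hl := min_le_left ((1 - Real.exp (-(β / 40))) / 2) (Real.exp (-W))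
  have hr := min_le_right ((1 - Real.exp (-(β / 40))) / 2) (Real.exp (-W))
  refine ⟨_, hpos, by linarith, ?_, ?_⟩
  · rw [div_le_iff₀ (by linarith)]
    have : Real.exp (β / 40) * Real.exp (-(β / 40)) = 1 := by rw [← Real.exp_add]; simp
    calc 1 = Real.exp (β / 40) * Real.exp (-(β / 40)) := this.symm
      _ ≤ _ := mul_le_mul_of_nonneg_left (by linarith) (Real.exp_pos _).le
  · have := Real.log_le_log hpos hr
    rw [Real.log_exp] at this
    rw [one_div, Real.log_inv]
    linarith

lemma exists_xi {β : ℝ} (hβ : 0 < β) :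
    ∃ ξ : ℝ, 0 < ξ ∧ ξ ≤ 1/200 ∧ ξ * Real.log (100 / β + 1) ≤ 0.02 * β := by
  have hl : 0 ≤ Real.log (100 / β + 1) :=
    Real.log_nonneg (by linarith [show (0:ℝ) ≤ 100 / β by positivity])
  refine ⟨min (1/200) (0.02 * β / (Real.log (100 / β + 1) + 1)), lt_min (by norm_num) (by positivity), min_le_left _ _, ?_⟩
  calc _ ≤ 0.02 * β / (Real.log (100 / β + 1) + 1) * Real.log (100 / β + 1) :=
        mul_le_mul_of_nonneg_right (min_le_right _ _) hl
    _ ≤ 0.02 * β / (Real.log (100 / β + 1) + 1) * (Real.log (100 / β + 1) + 1) := by gcongr; linarith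
    _ = _ := div_mul_cancel₀ _ (by positivity)

lemma ratio_mu {β e L : ℝ} (hβ : 0 < β) (he : 0 < e) (hL : 0 < L) {n k μ : ℝ} (hn : 0 < n) (hk : 0 ≤ k)
    (hkL : k * L ≤ n) (h : 200 * β ^ 2 / e ≤ μ * (β * L) ^ 2 / n ^ 2) : k ^ 2 / μ ≤ e / 200 := by
  rw [div_le_div_iff₀ he (by positivity)] at h
  have h2 : 200 * n ^ 2 ≤ μ * L ^ 2 * e := by
    have : β ^ 2 * (200 * n ^ 2) ≤ β ^ 2 * (μ * L ^ 2 * e) := by linarith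
    exact le_of_mul_le_mul_left this (by positivity)
  have hμ : 0 < μ := by
    by_contra hneg
    push Not at hneg
    have : μ * (L ^ 2 * e) ≤ 0 := mul_nonpos_of_nonpos_of_nonneg hneg (by positivity)
    nlinarith [pow_pos hn 2]
  rw [div_le_div_iff₀ hμ (by norm_num)]
  have h3 : (k * L) ^ 2 ≤ n ^ 2 := pow_le_pow_left₀ (by positivity) hkL 2
  have : L ^ 2 * (k ^ 2 * 200) ≤ L ^ 2 * (e * μ) := by linarith
  exact le_of_mul_le_mul_left this (by positivity)

lemma final_ineq {e : ℝ} (he : 0 < e) (he1 : e ≤ 1/16) :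
    1 - 16 * e ≤ (1 - (e + e + e + e + e + e)) ^ 2 / (1 + 3 * e) := by
  rw [le_div_iff₀ (by positivity)]
  nlinarith

end TC

end PartI9

section PartJ

namespace TC
open Finset
variable {n k m : ℕ}

set_option maxHeartbeats 2000000 in
/-- lower bound on the success probability -/
lemma lower_ev (p : ℝ) (hp : 0 < p) (hp1 : p < 1)
    (a : ℕ → ℕ) (P : ℕ → ℕ → ℕ)
    (hmu2 : Tendsto (fun n : ℕ =>
      muExp (1-p) n (a n) * (Real.log n) ^ 2 / (n : ℝ) ^ 2) atTop atTop)
    (htame : IsTame p a P)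
    (hexp : ∀ C : ℝ, ∀ᶠ n : ℕ in atTop,
      Real.exp (C * Real.log n) ≤ Em n (mFloor p n) fun G => Xbar G (P n))
    (hsub : ∀ δ : ℝ, 0 < δ → ∀ᶠ n : ℕ in atTop, ∀ L : ℕ → ℕ,
      (∀ u, L u ≤ P n u) →
      δ ≤ (∑ u ∈ Finset.Icc 1 (a n), (u : ℝ) * L u) / n →
      (∑ u ∈ Finset.Icc 1 (a n), (u : ℝ) * L u) / n ≤ 1 - δ →
      Real.exp ((Real.log n) ^ 6) *
          ∏ u ∈ Finset.Icc 1 (a n), ((P n u).choose (L u) : ℝ) ^ 2 ≤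
        Ep n p fun G => Xbar G L) {e : ℝ} (he : 0 < e) (he1 : e ≤ 1/16) :
    ∀ᶠ n : ℕ in atTop, 1 - 16 * e ≤ Pm n (mFloor p n) fun G => 0 < Xprofile G (P n) := by
  have hq : 0 < 1 - p := by linarith
  have hb1 : 1 < 1/(1-p) := by rw [one_lt_div hq]; linarith
  have hβ : 0 < Real.log (1/(1-p)) := Real.log_pos hb1
  obtain ⟨C, hC0, hC⟩ := size_ev hp hp1 htame
  obtain ⟨δ, hδ0, hδ1, hδ2, hδ3⟩ := exists_delta
    (W := 2 * (2 + 3/2 * Real.log (1/(1-p)) + Real.log (1/(1-p)) * C / 2)) hβ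
  obtain ⟨ξ, hξ0, hξ1, hξ2⟩ := exists_xi hβ
  have hK : 0 ≤ 2 * C / e := by positivity
  have E1 := e1_ev hβ hξ0.le hξ1 hξ2 he
  have E2 := e2_ev hβ hξ0.le hξ1 he
  have E5 := e5_ev hβ hξ0.le hξ1 he
  have E6 := e6_ev hβ hξ0.le hξ1 he
  have EI := SI_ev hp hp1 (by positivity) hδ1 hδ2 he (by linarith)
  have EII := SII_ev hp hp1 (C := C) hδ0 hδ3 he
  have Eb := basic_ev hp hp1 one_pos
  have El := lam_ev hK he
  have Ed := ev_lin hβ (8 / δ) 4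
  have hall := ((((((((E1.and E2).and E5).and E6).and EI).and EII).and Eb).and El).and Ed).and
    ((eventually_ge_atTop 16).and (eventually_ge_atTop (6 * C / ((1 - p) * e))))
  have hall' := (tendsto_L hb1).eventually hall
  filter_upwards [hall', hC ξ hξ0, hmu2.eventually_ge_atTop (200 * Real.log (1/(1-p)) ^ 2 / e), hexp 0,
    hexp ((2 * C / e + 1) / Real.log (1/(1-p))), hsub δ hδ0] with n hE hSZ' hmu hexp0 hexpK hsubn
  set β := Real.log (1/(1-p)) with hβd
  set L := Real.logb (1/(1-p)) n with hLd
  obtain ⟨⟨⟨⟨⟨⟨⟨⟨⟨E1, E2⟩, E5⟩, E6⟩, EI⟩, EII⟩, Eb⟩, El⟩, Ed⟩, hL16, hLC⟩ := hE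
  obtain ⟨j, w, hSZ⟩ := hSZ'
  have hL1 : 1 ≤ L := by linarith
  have hn := hSZ.hn
  have ha := hSZ.ha
  have hn0 : (0:ℝ) < n := by rw [hn]; positivity
  have hlogn : Real.log n = β * L := by rw [hn, Real.log_exp]
  obtain ⟨v, hv, hvP⟩ := exists_sizes (P n) hSZ.hPz
  obtain ⟨hvn, hva, hvlo, hvs, hfL, hkL, hkn, hfP, hexs⟩ :=
    sizes_det (by linarith : ξ ≤ 1) hL1 hSZ v hvP (f := ∑ i, (v i).choose 2) rfl
  obtain ⟨f, hf⟩ : ∃ f, ∑ i, (v i).choose 2 = f := ⟨_, rfl⟩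
  rw [hf] at hfL hfP
  obtain ⟨hN, hf4, _, _, _, _, hqe⟩ := Eb n f hn hfL
  have ha4 : 4 * (a n : ℝ) ≤ (1 - p) * (n.choose 2 : ℕ) := by
    refine (Eb n (a n) hn (ha.trans ?_)).2.1
    have hn2 : (2:ℝ) ≤ n := by
      have h1 : 2 ≤ n := by
        by_contra hlt
        push Not at hlt
        rw [Nat.choose_eq_zero_of_lt hlt] at hN
        exact lt_irrefl _ hN
      exact_mod_cast h1
    exact mul_le_mul_of_nonneg_right hn2 (by linarith)
  set B : ℝ := (((n.choose 2 - 2 * f : ℕ) : ℝ) + 1) / (((n.choose 2 - 2 * f : ℕ) : ℝ) + 1 - mFloor p n) with hB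
  obtain ⟨hmf, _⟩ := B_facts hp hp1 hN hf4 hB
  have hmN : mFloor p n ≤ n.choose 2 := by omega
  have hMN : 0 < (n.choose 2).choose (mFloor p n) := Nat.choose_pos hmN
  have hM : (0:ℝ) < ((n.choose 2 - f).choose (mFloor p n) : ℝ) := by
    exact_mod_cast Nat.choose_pos (by omega)
  obtain ⟨c0, hc0⟩ := exists_c0 v hvs
  have hmu' : ((profileParts n (P n) : ℕ):ℝ) ^ 2 / muExp (1-p) n (a n) ≤ e / 200 := by
    rw [hlogn] at hmu
    exact ratio_mu hβ he (by linarith) hn0 (Nat.cast_nonneg _) hkL hmu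
  have hZ := hZ_of hp hp1 hSZ.hPz v hv hvP hvs hf hN hmN hf4 (by simpa using hexp0)
  have hT := Em_use v hv hvP hvs hf hMN hexpK
  have eT : (2 * C / e + 1) / β * Real.log n = (2 * C / e + 1) * L := by
    rw [hlogn]; field_simp
  rw [eT] at hT
  obtain ⟨h, hh⟩ : ∃ h, h = ⌊L / 8⌋₊ := ⟨_, rfl⟩
  obtain ⟨R, hR⟩ : ∃ R, R = ⌊1.4 * L⌋₊ := ⟨_, rfl⟩
  obtain ⟨s1, hs1⟩ : ∃ s1, s1 = ⌊Real.exp (β * L / 2)⌋₊ := ⟨_, rfl⟩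
  obtain ⟨umin, humin⟩ : ∃ umin, umin = ⌈(2 - ξ) * L⌉₊ := ⟨_, rfl⟩
  obtain ⟨lam, hlam⟩ : ∃ lam, lam = ⌈2 * C / e * L⌉₊ := ⟨_, rfl⟩
  obtain ⟨lam', hlam'⟩ : ∃ lam', lam' = ⌈L ^ 3⌉₊ := ⟨_, rfl⟩
  rw [← hlam] at El
  have hhL : (h:ℝ) ≤ L / 8 := by rw [hh]; exact Nat.floor_le (by linarith)
  have hhL' : L / 8 ≤ h + 1 := by rw [hh]; exact (Nat.lt_floor_add_one _).le
  have hh2 : 2 ≤ h := by rw [hh]; exact Nat.le_floor (by push_cast; linarith)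
  have hRL : (R:ℝ) ≤ 1.4 * L := by rw [hR]; exact Nat.floor_le (by linarith)
  have hRL' : 1.4 * L ≤ R + 1 := by rw [hR]; exact (Nat.lt_floor_add_one _).le
  have hsL : (s1:ℝ) ≤ Real.exp (β * L / 2) := by rw [hs1]; exact Nat.floor_le (Real.exp_pos _).le
  have hsL' : Real.exp (β * L / 2) ≤ s1 + 1 := by rw [hs1]; exact (Nat.lt_floor_add_one _).le
  have huL : (2 - ξ) * L ≤ umin := by rw [humin]; exact Nat.le_ceil _
  have huv : ∀ i, umin ≤ v i := fun i => by rw [humin]; exact Nat.ceil_le.2 (hvlo i)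
  have hhu : h < umin := by
    have : (h:ℝ) < umin := by nlinarith
    exact_mod_cast this
  have hua : umin ≤ a n := by
    have hnp : 0 < n := by exact_mod_cast hn0
    have hi : (univ : Finset (Fin (profileParts n (P n)))).Nonempty := by
      by_contra hne
      rw [not_nonempty_iff_eq_empty] at hne
      rw [hne, sum_empty] at hvs
      omega
    obtain ⟨i, _⟩ := hi
    exact (huv i).trans (hva i)
  have hl3 : L ^ 3 ≤ lam' := by rw [hlam']; exact Nat.le_ceil _
  have hl3' : (lam':ℝ) ≤ 2 * L ^ 3 := by
    have h1 : (lam':ℝ) ≤ L ^ 3 + 1 := by rw [hlam']; exact (Nat.ceil_lt_add_one (by positivity)).le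
    have h2 : 1 ≤ L ^ 3 := one_le_pow₀ hL1
    linarith
  have hll : 2 * C / e * L ≤ lam := by rw [hlam]; exact Nat.le_ceil _
  have hdl : (a n:ℝ) * (2 * lam') ≤ 2 * δ / 2 * n := by
    have h1 : 8 * L ^ 4 ≤ δ * n := by
      rw [← hn, div_mul_eq_mul_div, div_le_iff₀ hδ0] at Ed
      linarith
    calc (a n:ℝ) * (2 * lam') ≤ (2 * L) * (2 * (2 * L ^ 3)) := by gcongr
      _ = 8 * L ^ 4 := by ring
      _ ≤ δ * n := h1
      _ = _ := by ring
  have hq0 := qhat_nonneg hp hp1 hN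
  obtain ⟨he3, he4⟩ := e34 hp hp1 hC0 he hL1 hLC v hN ha4 hva (fun i => (mem_Icc.1 (hvn i)).1) ha hn0 hexs hll hl3
  rw [Pm_eq]
  refine (final_ineq he he1).trans ?_
  refine second_moment (fun ω => 0 < Xprofile (toG ω) (P n))
    (fun σ ω => Good h umin (a n) s1 lam lam' (c0 ∘ σ) ω) ?_
    ((n.choose 2 - f).choose (mFloor p n) : ℝ) hM hMN _ _ (by linarith) (by positivity) ?_ ?_
  · intro σ ω _ hg
    exact good_X v hv hvP (c0 ∘ σ) (fib_comp_card hc0 σ) hg.proper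
  · intro σ
    have hcσ := fib_comp_card hc0 σ
    have hmono : (mono (c0 ∘ σ)).card = f := by
      rw [card_mono, ← hf]
      exact sum_congr rfl fun i _ => by rw [hcσ i]
    have := F_good (c := c0 ∘ σ) (umin := umin) (a := a n) (h := h) hmN hN (by omega)
      (fun i => by rw [hcσ i]; exact huv i) (fun i => by rw [hcσ i]; exact hva i) R s1 lam lam'
      e e e e e e _ rfl
      (E1 n (a n) umin _ R _ hn hq0 hqe huL ha hkn hRL')
      (E2 n (a n) umin _ R h _ hn hq0 hqe huL ha hkn hRL hhL')
      (by simp only [hcσ]; exact he3) (by simp only [hcσ]; exact he4)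
      (E5 n (a n) umin _ _ hn hq0 hqe huL ha hkn)
      (E6 n (a n) umin _ h s1 _ hn hq0 hqe huL ha hua hkn hhL hsL)
    rw [hmono] at this
    exact this
  · intro σ
    have hcσ := fib_comp_card hc0 σ
    have hcomb := combine (m := mFloor p n) c0 v hc0 hvn hvP hvs h umin (a n) s1 lam lam' f (by omega) hhu huv hva hf hmf B hB
      (2 * δ) _ _ hdl σ
      (EI n (a n) _ h f B (c0 ∘ σ) c0 v hn ha hSZ.han hkn hh2 (by linarith) hfL hmu' hB hcσ hc0 hva hf)
      (by
        have := EII n (a n) _ h f s1 (2 * lam') B ξ (P n) j w (c0 ∘ σ) c0 v (by linarith) hSZ (by omega) hhL hfL hfP hsL'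
          (by push_cast; linarith) hB hcσ hc0 hva hvn hvP hvs hZ hsubn
        rw [show 2 * δ / 2 = δ by ring]
        exact this)
    refine hcomb.trans ?_
    have ht := total_bound (lam := lam) hmf (by positivity) he
      (mul_nonneg (prod_nonneg fun i _ => by positivity) (prod_nonneg fun i _ => by positivity)) hT El
    refine le_trans (le_of_eq ?_) ht
    ring

end TC

end PartJ

lemma TC.Pm_le_one {n m : ℕ} (E : SimpleGraph (Fin n) → Prop) : Pm n m E ≤ 1 := by
  rw [TC.Pm_eq]
  refine div_le_one_of_le₀ ?_ (by positivity)
  rw [← TC.card_Om]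
  exact Nat.cast_le.2 (Finset.card_le_card (Finset.filter_subset _ _))

/-- Theorem 2.5: under the conditions of Theorem 2.4, if additionally
`μ_a ≫ n²/ln² n`, then whp `G_{n,m}` has a colouring with profile `P`. -/
theorem whp_tame_colouring_exists
    (p ε : ℝ) (hp : p ∈ Set.Ioo (0:ℝ) 1) (hε : 0 < ε)
    (a : ℕ → ℕ) (P : ℕ → ℕ → ℕ)
    (ha : ∃ C : ℝ, ∀ᶠ n : ℕ in atTop, |alpha0 (1/(1-p)) n - (a n : ℝ)| ≤ C)
    (hmu : ∀ᶠ n : ℕ in atTop, (n : ℝ) ^ ((1:ℝ) + ε) ≤ muExp (1-p) n (a n))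
    (hmu2 : Tendsto (fun n : ℕ =>
      muExp (1-p) n (a n) * (Real.log n) ^ 2 / (n : ℝ) ^ 2) atTop atTop)
    (htame : IsTame p a P)
    (hexp : ∀ C : ℝ, ∀ᶠ n : ℕ in atTop,
      Real.exp (C * Real.log n) ≤ Em n (mFloor p n) fun G => Xbar G (P n))
    (hsub : ∀ δ : ℝ, 0 < δ → ∀ᶠ n : ℕ in atTop, ∀ L : ℕ → ℕ,
      (∀ u, L u ≤ P n u) →
      δ ≤ (∑ u ∈ Finset.Icc 1 (a n), (u : ℝ) * L u) / n →
      (∑ u ∈ Finset.Icc 1 (a n), (u : ℝ) * L u) / n ≤ 1 - δ →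
      Real.exp ((Real.log n) ^ 6) *
          ∏ u ∈ Finset.Icc 1 (a n), ((P n u).choose (L u) : ℝ) ^ 2 ≤
        Ep n p fun G => Xbar G L) :
    Tendsto (fun n : ℕ => Pm n (mFloor p n) fun G => 0 < Xprofile G (P n))
      atTop (nhds 1) := by
  obtain ⟨hp0, hp1⟩ := hp
  refine tendsto_order.2 ⟨fun x hx => ?_, fun x hx => ?_⟩
  · have h16 : 0 < min ((1 - x) / 32) (1 / 16) := lt_min (by linarith) (by norm_num)
    filter_upwards [TC.lower_ev p hp0 hp1 a P hmu2 htame hexp hsub h16 (min_le_right _ _)] with n hn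
    have := min_le_left ((1 - x) / 32) ((1:ℝ) / 16)
    linarith
  · refine Eventually.of_forall fun n => lt_of_le_of_lt ?_ hx
    exact TC.Pm_le_one _
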